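/- Let m₁ > 0 and m₂ = 2m₁. Let F₁, F₂ ∈ C^∞(ℝ²×ℝ^{2×3}; ℝ) vanish to second order at the origin (F_j(0,0)=0 and all first-order derivatives of F_j vanish at (0,0)), and let Q_j(v,w) = lim_{λ↓0} λ⁻² F_j(λv, λw) denote the quadratic homogeneous part of F_j. Suppose that either condition (a) or condition (b) holds for the functions Φ₁, Φ₂ associated with Q₁, Q₂, m₁, m₂. Then for any f₁, f₂, g₁, g₂ ∈ C₀^∞(ℝ²) there exist ε₀ > 0 and C > 0 such that for every ε ∈ (0, ε₀] the Cauchy problem ∂_t²u_j − (∂_{x₁}² + ∂_{x₂}²)u_j + m_j² u_j = F_j(u, ∂u) on ℝ×ℝ² (j = 1,2), with initial data u_j(0,x) = ε f_j(x), ∂_t u_j(0,x) = ε g_j(x), admits a unique global classical solution u = (u₁, u₂), and this solution satisfies Σ_{|I|≤1} ‖∂_{t,x}^I u(t,·)‖_{L^p(ℝ²)} ≤ C ε (1+|t|)^{−(1−2/p)} for every p ∈ [2, ∞] and all t ∈ ℝ, with C independent of ε. -/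

import Mathlib

open Real MeasureTheory Filter Set
open scoped ENNReal NNReal

noncomputable section

/-- The hyperboloid `ℍ = {ω ∈ ℝ³ : ω₀² − ω₁² − ω₂² = 1}`. -/
def Hyp : Set (Fin 3 → ℝ) := {ω | ω 0 ^ 2 - ω 1 ^ 2 - ω 2 ^ 2 = 1}

/-- `V(θ) = (cos 2πθ, cos 4πθ)`. -/
def Vprof (θ : ℝ) (k : Fin 2) : ℝ := Real.cos (2 * π * ((k.1 : ℝ) + 1) * θ)

/-- `W(ω,θ)_{k,a} = −ω_a m_k sin(2πkθ)` with `m_k = k·m₁` (`k = 1,2`). -/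
def Wprof (m₁ : ℝ) (ω : Fin 3 → ℝ) (θ : ℝ) (k : Fin 2) (a : Fin 3) : ℝ :=
  -(ω a) * (((k.1 : ℝ) + 1) * m₁) * Real.sin (2 * π * ((k.1 : ℝ) + 1) * θ)

/-- `Φ_j(ω) = ∫₀¹ Q(V(θ), W(ω,θ)) e^{−2πijθ} dθ`. -/
def Phi (m₁ : ℝ) (Q : (Fin 2 → ℝ) × (Fin 2 → Fin 3 → ℝ) → ℝ) (j : ℕ) (ω : Fin 3 → ℝ) : ℂ :=
  ∫ θ in (0:ℝ)..1,
    (Q (Vprof θ, Wprof m₁ ω θ) : ℂ) * Complex.exp (((-(2 * π * (j : ℝ) * θ) : ℝ) : ℂ) * Complex.I)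

/-- `Q` is a quadratic homogeneous polynomial on `ℝ²×ℝ^{2×3}`. -/
def IsQuad (Q : (Fin 2 → ℝ) × (Fin 2 → Fin 3 → ℝ) → ℝ) : Prop :=
  ∃ B : ((Fin 2 → ℝ) × (Fin 2 → Fin 3 → ℝ)) →ₗ[ℝ] ((Fin 2 → ℝ) × (Fin 2 → Fin 3 → ℝ)) →ₗ[ℝ] ℝ,
    ∀ x, Q x = B x x

/-- Partial derivative `∂_{x_k}` of a function on `ℝ²`. -/
def pd (k : Fin 2) (f : (Fin 2 → ℝ) → ℝ) (x : Fin 2 → ℝ) : ℝ :=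
  fderiv ℝ f x (Pi.single k 1)

/-- The masses `m₁, m₂ = 2m₁` (indices `0,1`). -/
def mass (m₁ : ℝ) (j : Fin 2) : ℝ := ((j.1 : ℝ) + 1) * m₁

/-- `u = (u₁,u₂)` is a global classical solution of the Cauchy problem
`∂_t²u_j − Δu_j + m_j²u_j = F_j(u, ∂u)`, `u_j(0) = εf_j`, `∂_t u_j(0) = εg_j`. -/
def IsSolution (m₁ ε : ℝ)
    (F : Fin 2 → (Fin 2 → ℝ) × (Fin 2 → Fin 3 → ℝ) → ℝ)
    (f g : Fin 2 → (Fin 2 → ℝ) → ℝ)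
    (u : Fin 2 → ℝ → (Fin 2 → ℝ) → ℝ) : Prop :=
  (∀ j, ContDiff ℝ 2 (fun p : ℝ × (Fin 2 → ℝ) => u j p.1 p.2))
  ∧ (∀ j : Fin 2, ∀ t : ℝ, ∀ x : Fin 2 → ℝ,
      iteratedDeriv 2 (fun s => u j s x) t
          - (pd 0 (pd 0 (u j t)) x + pd 1 (pd 1 (u j t)) x)
          + mass m₁ j ^ 2 * u j t x
        = F j (fun k => u k t x,
            fun k a =>
              if a = 0 then deriv (fun s => u k s x) t
              else if a = 1 then pd 0 (u k t) x
              else pd 1 (u k t) x))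
  ∧ (∀ j x, u j 0 x = ε * f j x ∧ deriv (fun s => u j s x) 0 = ε * g j x)

namespace KG

open Finset (sum_nonneg single_le_sum sum_congr sum_le_sum sum_le_card_nsmul mul_sum sum_mul sum_comm sum_add_distrib sum_le_sum_of_subset_of_nonneg sum_eq_zero abs_sum_le_sum_abs)
open Complex (I norm_real)

/-- Space-time points `(t, x, y)`. -/
abbrev Pt := ℝ × ℝ × ℝ

/-- The algebra of smooth functions on space-time, as a subalgebra. -/
def smoothAlg : Subalgebra ℝ (Pt → ℝ) where
  carrier := {f | ContDiff ℝ (⊤ : ℕ∞) f}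
  mul_mem' := fun hf hg => by rw [mem_ofPred_eq] at *; exact hf.mul hg
  add_mem' := fun hf hg => by rw [mem_ofPred_eq] at *; exact hf.add hg
  algebraMap_mem' c := by rw [mem_ofPred_eq]; exact contDiff_const (c := c)

theorem mem_smoothAlg {f : Pt → ℝ} : f ∈ smoothAlg ↔ ContDiff ℝ (⊤ : ℕ∞) f := Iff.rfl

/-- The algebra of smooth functions on space-time. -/
def SF : Type := smoothAlg

instance : CommRing SF := inferInstanceAs (CommRing smoothAlg)
instance : Algebra ℝ SF := inferInstanceAs (Algebra ℝ smoothAlg)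
/-- The underlying function. -/
@[coe] def SF.fn (f : SF) : Pt → ℝ := Subtype.val (p := fun f => f ∈ smoothAlg) f

instance : CoeFun SF (fun _ => Pt → ℝ) := ⟨SF.fn⟩

def SF.mk (f : Pt → ℝ) (h : ContDiff ℝ (⊤ : ℕ∞) f) : SF := ⟨f, mem_smoothAlg.2 h⟩
theorem SF.smooth (f : SF) : ContDiff ℝ (⊤ : ℕ∞) f := mem_smoothAlg.1 f.2
theorem SF.diff (f : SF) (p : Pt) : DifferentiableAt ℝ f p :=
  (f.smooth.differentiable (by simp)) p
@[fun_prop] theorem SF.cont (f : SF) : Continuous f := f.smooth.continuous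

@[ext] theorem SF.ext {f g : SF} (h : ∀ p, f p = g p) : f = g := Subtype.ext (funext h)
@[simp] theorem SF.mk_apply (f : Pt → ℝ) (h) (p : Pt) : (SF.mk f h) p = f p := rfl
@[simp] theorem SF.add_apply (f g : SF) (p : Pt) : (f + g) p = f p + g p := rfl
@[simp] theorem SF.mul_apply (f g : SF) (p : Pt) : (f * g) p = f p * g p := rfl
@[simp] theorem SF.sub_apply (f g : SF) (p : Pt) : (f - g) p = f p - g p := rfl
@[simp] theorem SF.neg_apply (f : SF) (p : Pt) : (-f) p = -f p := rfl
@[simp] theorem SF.smul_apply (c : ℝ) (f : SF) (p : Pt) : (c • f) p = c * f p := rfl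
@[simp] theorem SF.zero_apply (p : Pt) : (0 : SF) p = 0 := rfl
@[simp] theorem SF.one_apply (p : Pt) : (1 : SF) p = 1 := rfl
@[simp] theorem SF.pow_apply (f : SF) (n : ℕ) (p : Pt) : (f ^ n) p = f p ^ n := rfl
@[simp] theorem SF.sum_apply {κ : Type*} (s : Finset κ) (f : κ → SF) (p : Pt) :
    (∑ i ∈ s, f i) p = ∑ i ∈ s, f i p := by
  induction s using Finset.cons_induction with
  | empty => rfl
  | cons a s ha ih => rw [Finset.sum_cons, Finset.sum_cons, SF.add_apply, ih]

/-- The coordinate functions. -/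
def ct : SF := .mk (fun p => p.1) contDiff_fst
def cx : SF := .mk (fun p => p.2.1) (contDiff_fst.comp contDiff_snd)
def cy : SF := .mk (fun p => p.2.2) (contDiff_snd.comp contDiff_snd)
@[simp] theorem ct_apply (p : Pt) : ct p = p.1 := rfl
@[simp] theorem cx_apply (p : Pt) : cx p = p.2.1 := rfl
@[simp] theorem cy_apply (p : Pt) : cy p = p.2.2 := rfl

/-- Smooth functions of finitely many variables. -/
def GF (ι : Type) [Fintype ι] : Type := {G : (ι → ℝ) → ℝ // ContDiff ℝ (⊤ : ℕ∞) G}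

/-- The underlying function. -/
@[coe] def GF.fn {ι : Type} [Fintype ι] (G : GF ι) : (ι → ℝ) → ℝ :=
  Subtype.val (p := fun G => ContDiff ℝ (⊤ : ℕ∞) G) G

instance {ι : Type} [Fintype ι] : CoeFun (GF ι) (fun _ => (ι → ℝ) → ℝ) := ⟨GF.fn⟩
theorem GF.smooth {ι : Type} [Fintype ι] (G : GF ι) : ContDiff ℝ (⊤ : ℕ∞) G := G.2

/-- Partial derivative. -/
def GF.pd {ι : Type} [Fintype ι] [DecidableEq ι] (c : ι) (G : GF ι) : GF ι :=
  ⟨fun v => fderiv ℝ G.fn v (Pi.single c 1),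
    (G.smooth.fderiv_right (m := (⊤ : ℕ∞)) (by simp)).clm_apply contDiff_const⟩

/-- Iterated partial derivatives. -/
def GF.pdw {ι : Type} [Fintype ι] [DecidableEq ι] : List ι → GF ι → GF ι
  | [], G => G
  | c :: cs, G => (pdw cs G).pd c

/-- Composition of a smooth function of several variables with a tuple of smooth functions. -/
def comp {ι : Type} [Fintype ι] (G : GF ι) (U : ι → SF) : SF :=
  .mk (fun p => G (fun c => U c p)) (G.smooth.comp (contDiff_pi.2 fun c => (U c).smooth))
@[simp] theorem comp_apply {ι : Type} [Fintype ι] (G : GF ι) (U : ι → SF) (p : Pt) :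
    comp G U p = G (fun c => U c p) := rfl

/-- The derivation in a constant direction. -/
def dir (w : Pt) : Derivation ℝ SF SF :=
  Derivation.mk'
    { toFun := fun f => .mk (fun p => fderiv ℝ f p w)
          ((f.smooth.fderiv_right (m := (⊤ : ℕ∞)) (by simp)).clm_apply contDiff_const)
      map_add' := fun f g => by
        ext p; simp only [SF.add_apply, SF.mk_apply]
        rw [show ((f + g : SF) : Pt → ℝ) = f.fn + g.fn from rfl, fderiv_add (f.diff p) (g.diff p)]; rfl
      map_smul' := fun c f => by
        ext p; simp only [SF.smul_apply, SF.mk_apply, RingHom.id_apply]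
        rw [show ((c • f : SF) : Pt → ℝ) = c • f.fn from rfl, fderiv_const_smul (f.diff p)]; rfl }
    (fun f g => by
      ext p
      change fderiv ℝ (f.fn * g.fn) p w = f p * fderiv ℝ g p w + g p * fderiv ℝ f p w
      rw [fderiv_mul (f.diff p) (g.diff p)]; simp)

theorem dir_apply (w : Pt) (f : SF) (p : Pt) : dir w f p = fderiv ℝ f p w := rfl

/-- `∂_t`, `∂_x`, `∂_y`. -/
def T : Derivation ℝ SF SF := dir (1, 0, 0)
def X : Derivation ℝ SF SF := dir (0, 1, 0)
def Y : Derivation ℝ SF SF := dir (0, 0, 1)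

theorem two_le_top : (2 : WithTop ℕ∞) ≤ ((⊤ : ℕ∞) : WithTop ℕ∞) :=
  WithTop.coe_le_coe.2 (le_top : (2 : ℕ∞) ≤ ⊤)

theorem dir_comm (v w : Pt) (f : SF) : dir v (dir w f) = dir w (dir v f) := by
  ext p
  have h2 : ∀ a b : Pt, dir a (dir b f) p = fderiv ℝ (fderiv ℝ f) p a b := by
    intro a b
    rw [dir_apply]
    have hd : DifferentiableAt ℝ (fderiv ℝ f.fn) p :=
      ((f.smooth.fderiv_right (m := (⊤ : ℕ∞)) (by simp)).differentiable (by simp)) p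
    have : ((dir b f : SF) : Pt → ℝ) = fun q => fderiv ℝ f.fn q b := rfl
    rw [this, fderiv_clm_apply hd (by fun_prop)]
    simp
  rw [h2, h2]
  have := f.smooth.contDiffAt (x := p) |>.isSymmSndFDerivAt
    (by simp; exact two_le_top)
  exact this _ _

theorem fderiv_eq (f : SF) (p w : Pt) :
    fderiv ℝ f p w = w.1 * T f p + w.2.1 * X f p + w.2.2 * Y f p := by
  have : w = w.1 • ((1, 0, 0) : Pt) + w.2.1 • ((0, 1, 0) : Pt) + w.2.2 • ((0, 0, 1) : Pt) := by
    ext <;> simp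
  conv_lhs => rw [this]
  simp only [map_add, map_smul, smul_eq_mul]; rfl

theorem XT (f : SF) : X (T f) = T (X f) := dir_comm _ _ f
theorem YT (f : SF) : Y (T f) = T (Y f) := dir_comm _ _ f
theorem YX (f : SF) : Y (X f) = X (Y f) := dir_comm _ _ f

theorem dir_ct (w : Pt) : dir w ct = algebraMap ℝ SF w.1 := by
  ext p; rw [dir_apply]
  have : (ct : Pt → ℝ) = (ContinuousLinearMap.fst ℝ ℝ (ℝ × ℝ)) := rfl
  rw [this, ContinuousLinearMap.fderiv]; rfl
theorem dir_cx (w : Pt) : dir w cx = algebraMap ℝ SF w.2.1 := by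
  ext p; rw [dir_apply]
  have : (cx : Pt → ℝ) =
    ((ContinuousLinearMap.fst ℝ ℝ ℝ).comp (ContinuousLinearMap.snd ℝ ℝ (ℝ × ℝ))) := rfl
  rw [this, ContinuousLinearMap.fderiv]; rfl
theorem dir_cy (w : Pt) : dir w cy = algebraMap ℝ SF w.2.2 := by
  ext p; rw [dir_apply]
  have : (cy : Pt → ℝ) =
    ((ContinuousLinearMap.snd ℝ ℝ ℝ).comp (ContinuousLinearMap.snd ℝ ℝ (ℝ × ℝ))) := rfl
  rw [this, ContinuousLinearMap.fderiv]; rfl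

@[simp] theorem T_ct : T ct = 1 := by simp [T, dir_ct]
@[simp] theorem T_cx : T cx = 0 := by simp [T, dir_cx]
@[simp] theorem T_cy : T cy = 0 := by simp [T, dir_cy]
@[simp] theorem X_ct : X ct = 0 := by simp [X, dir_ct]
@[simp] theorem X_cx : X cx = 1 := by simp [X, dir_cx]
@[simp] theorem X_cy : X cy = 0 := by simp [X, dir_cy]
@[simp] theorem Y_ct : Y ct = 0 := by simp [Y, dir_ct]
@[simp] theorem Y_cx : Y cx = 0 := by simp [Y, dir_cx]
@[simp] theorem Y_cy : Y cy = 1 := by simp [Y, dir_cy]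

/-- Lorentz boosts, rotation and scaling. -/
def L1 : Derivation ℝ SF SF := cx • T + ct • X
def L2 : Derivation ℝ SF SF := cy • T + ct • Y
def Om : Derivation ℝ SF SF := cx • Y - cy • X
def Sc : Derivation ℝ SF SF := ct • T + cx • X + cy • Y

theorem L1_eq (f : SF) : L1 f = cx * T f + ct * X f := rfl
theorem L2_eq (f : SF) : L2 f = cy * T f + ct * Y f := rfl
theorem Om_eq (f : SF) : Om f = cx * Y f - cy * X f := rfl
theorem Sc_eq (f : SF) : Sc f = ct * T f + cx * X f + cy * Y f := rfl

/-- The five vector fields commuting with the Klein-Gordon operator, `0..2` being translations. -/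
def Z : Fin 5 → Derivation ℝ SF SF := ![T, X, Y, L1, L2]
def dd : Fin 3 → Derivation ℝ SF SF := ![T, X, Y]

/-- The wave operator. -/
def box (f : SF) : SF := T (T f) - X (X f) - Y (Y f)

theorem box_T (f : SF) : box (T f) = T (box f) := by
  simp only [box, map_sub, XT, YT]
theorem box_X (f : SF) : box (X f) = X (box f) := by
  simp only [box, map_sub, XT, YX]
theorem box_Y (f : SF) : box (Y f) = Y (box f) := by
  simp only [box, map_sub, YT, YX]
theorem box_L1 (f : SF) : box (L1 f) = L1 (box f) := by
  simp only [box, L1_eq, map_sub, map_add, Derivation.leibniz, XT, YT, YX, smul_eq_mul,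
    T_ct, T_cx, X_ct, X_cx, Y_ct, Y_cx, map_zero, Derivation.map_one_eq_zero]
  ring
theorem box_L2 (f : SF) : box (L2 f) = L2 (box f) := by
  simp only [box, L2_eq, map_sub, map_add, Derivation.leibniz, XT, YT, YX, smul_eq_mul,
    T_ct, T_cy, X_ct, X_cy, Y_ct, Y_cy, map_zero, Derivation.map_one_eq_zero]
  ring

theorem box_Z (i : Fin 5) (f : SF) : box (Z i f) = Z i (box f) := by
  fin_cases i
  exacts [box_T f, box_X f, box_Y f, box_L1 f, box_L2 f]

theorem box_add (f g : SF) : box (f + g) = box f + box g := by simp only [box, map_add]; ring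
theorem box_smul (c : ℝ) (f : SF) : box (c • f) = c • box f := by
  simp only [box, Derivation.map_smul, smul_sub]

/-- Words of derivations: `word Z [i, j, k] f = Z i (Z j (Z k f))`. -/
def word {κ : Type} (D : κ → Derivation ℝ SF SF) : List κ → SF →ₗ[ℝ] SF
  | [] => LinearMap.id
  | i :: I => (D i).toLinearMap ∘ₗ word D I

@[simp] theorem word_nil {κ : Type} (D : κ → Derivation ℝ SF SF) (f : SF) : word D [] f = f := rfl
@[simp] theorem word_cons {κ : Type} (D : κ → Derivation ℝ SF SF) (i : κ) (I : List κ) (f : SF) :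
    word D (i :: I) f = D i (word D I f) := rfl
theorem word_append {κ : Type} (D : κ → Derivation ℝ SF SF) (I J : List κ) (f : SF) :
    word D (I ++ J) f = word D I (word D J f) := by
  induction I with
  | nil => rfl
  | cons i I ih => simp [ih]

theorem box_word (I : List (Fin 5)) (f : SF) : box (word Z I f) = word Z I (box f) := by
  induction I with
  | nil => rfl
  | cons i I ih => simp [box_Z, ih]

/-- Chain rule. -/
theorem dir_comp {ι : Type} [Fintype ι] [DecidableEq ι] (w : Pt) (G : GF ι) (U : ι → SF) :
    dir w (comp G U) = ∑ c, comp (G.pd c) U * dir w (U c) := by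
  ext p
  rw [dir_apply]
  have h1 : HasFDerivAt (fun q => (fun c => U c q : ι → ℝ))
      (ContinuousLinearMap.pi fun c => fderiv ℝ (U c) p) p :=
    hasFDerivAt_pi.2 fun c => ((U c).diff p).hasFDerivAt
  have h2 : HasFDerivAt G.fn (fderiv ℝ G.fn (fun c => U c p)) (fun c => U c p) :=
    ((G.smooth.differentiable (by simp)) _).hasFDerivAt
  have h3 := (h2.comp p h1).fderiv
  have : ((comp G U : SF) : Pt → ℝ) = G.fn ∘ (fun q => (fun c => U c q : ι → ℝ)) := rfl
  rw [this, h3, ContinuousLinearMap.comp_apply]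
  set v := (ContinuousLinearMap.pi fun c => fderiv ℝ (U c) p) w
  have hv : v = ∑ c, dir w (U c) p • (Pi.single c (1 : ℝ) : ι → ℝ) := by
    ext d
    simp [Pi.single_apply, v, dir_apply]
  rw [hv, map_sum, SF.sum_apply]
  refine sum_congr rfl fun c _ => ?_
  rw [map_smul, smul_eq_mul, mul_comm]
  rfl

/-- The finite set of words of length at most `k`. -/
def words (κ : Type) [Fintype κ] [DecidableEq κ] : ℕ → Finset (List κ)
  | 0 => {[]}
  | k + 1 => insert [] ((Finset.univ ×ˢ words κ k).image fun e => e.1 :: e.2)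

theorem mem_words {κ : Type} [Fintype κ] [DecidableEq κ] {k : ℕ} {I : List κ} :
    I ∈ words κ k ↔ I.length ≤ k := by
  induction k generalizing I with
  | zero => simp [words]
  | succ k ih =>
    cases I with
    | nil => simp [words]
    | cons i I => simp [words, ih]

theorem words_mono {κ : Type} [Fintype κ] [DecidableEq κ] {k l : ℕ} (h : k ≤ l) :
    words κ k ⊆ words κ l := fun _ hI => mem_words.2 ((mem_words.1 hI).trans h)

/-- Pointwise size of all derivatives of order at most `k`. -/
def hk {κ : Type} [Fintype κ] [DecidableEq κ] (D : κ → Derivation ℝ SF SF) (k : ℕ) (f : SF)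
    (p : Pt) : ℝ := ∑ J ∈ words κ k, |word D J f p|

section
variable {κ : Type} [Fintype κ] [DecidableEq κ] (D : κ → Derivation ℝ SF SF)

theorem hk_nonneg (k : ℕ) (f : SF) (p : Pt) : 0 ≤ hk D k f p :=
  sum_nonneg fun _ _ => abs_nonneg _

theorem hk_mono {k l : ℕ} (h : k ≤ l) (f : SF) (p : Pt) : hk D k f p ≤ hk D l f p :=
  sum_le_sum_of_subset_of_nonneg (words_mono h) fun _ _ _ => abs_nonneg _

theorem le_hk {k : ℕ} {J : List κ} (h : J.length ≤ k) (f : SF) (p : Pt) :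
    |word D J f p| ≤ hk D k f p :=
  single_le_sum (f := fun J => |word D J f p|) (fun _ _ => abs_nonneg _) (mem_words.2 h)

end

/-- Structure constants of the commutators `[Z i, ∂_b]`. -/
def kap (i : Fin 5) (b b' : Fin 3) : ℝ :=
  match i, b, b' with
  | 3, 0, 1 => -1
  | 3, 1, 0 => -1
  | 4, 0, 2 => -1
  | 4, 2, 0 => -1
  | _, _, _ => 0

theorem Z_dd (i : Fin 5) (b : Fin 3) (f : SF) :
    Z i (dd b f) = dd b (Z i f) + ∑ b', kap i b b' • dd b' f := by
  rw [Fin.sum_univ_three]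
  fin_cases i <;> fin_cases b <;>
  simp only [Z, dd, kap, Matrix.cons_val_zero, Matrix.cons_val_one, Matrix.cons_val,
    Fin.zero_eta, Fin.mk_one, Fin.reduceFinMk, XT, YT, YX, L1_eq, L2_eq, map_add,
    Derivation.leibniz, smul_eq_mul, T_ct, T_cx, X_ct, X_cx, Y_ct, Y_cx, T_cy, X_cy, Y_cy,
    zero_smul, neg_smul, one_smul] <;> ring

theorem word_dd_expand (I : List (Fin 5)) (a : Fin 3) :
    ∃ l : List (ℝ × Fin 3 × List (Fin 5)), (∀ e ∈ l, e.2.2.length ≤ I.length) ∧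
      ∀ f : SF, word Z I (dd a f) = (l.map fun e => e.1 • dd e.2.1 (word Z e.2.2 f)).sum := by
  induction I with
  | nil => exact ⟨[(1, a, [])], by simp, by simp⟩
  | cons i I ih =>
    obtain ⟨l, h1, h2⟩ := ih
    refine ⟨l.flatMap fun e => (e.1, e.2.1, i :: e.2.2) ::
      (List.finRange 3).map fun b' => (e.1 * kap i e.2.1 b', b', e.2.2), ?_, fun f => ?_⟩
    · grind
    · rw [word_cons, h2]
      clear h1 h2
      induction l with
      | nil => simp
      | cons e l ih =>
        simp only [List.map_cons, List.sum_cons, map_add, List.flatMap_cons, List.map_append,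
          List.sum_append, ih, List.cons_append, Derivation.map_smul, Z_dd, word_cons]
        rw [← add_assoc]
        congr 1
        simp only [Fin.sum_univ_three, smul_add, smul_smul, List.map_map]
        simp [List.finRange_succ, add_assoc]

theorem abs_list_sum_le {α : Type} (l : List α) (f : α → SF) (p : Pt) :
    |(l.map f).sum p| ≤ (l.map fun e => |f e p|).sum := by
  induction l with
  | nil => simp
  | cons e l ih =>
    simp
    grind

theorem list_map_sum_nonneg {α : Type} (l : List α) (f : α → ℝ) (h : ∀ e ∈ l, 0 ≤ f e) :
    0 ≤ (l.map f).sum := by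
  refine List.sum_nonneg fun x hx => ?_
  grind

theorem list_sum_le_of_forall {α : Type} (l : List α) (f c : α → ℝ) (A : ℝ)
    (h : ∀ e ∈ l, f e ≤ c e * A) : (l.map f).sum ≤ (l.map c).sum * A := by
  induction l with
  | nil => simp
  | cons e l ih =>
    simp
    grind

/-- Commuting a coordinate derivative to the outside. -/
theorem word_dd_le (k : ℕ) : ∃ C, 0 ≤ C ∧ ∀ (a : Fin 3) (f : SF) (p : Pt),
    hk Z k (dd a f) p ≤ C * ∑ J ∈ words (Fin 5) k, ∑ b, |dd b (word Z J f) p| := by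
  choose l h1 h2 using word_dd_expand
  refine ⟨∑ I ∈ words (Fin 5) k, ∑ a, ((l I a).map fun e => |e.1|).sum, ?_, fun a f p => ?_⟩
  · refine sum_nonneg fun I _ => sum_nonneg fun a _ => list_map_sum_nonneg _ _ fun e _ => abs_nonneg _
  rw [hk, sum_mul]
  set A := ∑ J ∈ words (Fin 5) k, ∑ b, |dd b (word Z J f) p|
  have hA : 0 ≤ A := by positivity
  refine sum_le_sum fun I hI => ?_
  have h3 : |word Z I (dd a f) p| ≤ ((l I a).map fun e => |e.1|).sum * A := by
    rw [h2]
    refine (abs_list_sum_le _ _ _).trans (list_sum_le_of_forall _ _ _ _ fun e he => ?_)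
    rw [SF.smul_apply, abs_mul]
    gcongr
    have hJ : e.2.2 ∈ words (Fin 5) k :=
      mem_words.2 ((h1 _ _ e he).trans (mem_words.1 hI))
    refine le_trans ?_ (single_le_sum (f := fun J => ∑ b, |dd b (word Z J f) p|)
      (fun _ _ => sum_nonneg fun _ _ => abs_nonneg _) hJ)
    exact single_le_sum (f := fun b => |dd b (word Z e.2.2 f) p|)
      (fun _ _ => abs_nonneg _) (Finset.mem_univ _)
  refine h3.trans (mul_le_mul_of_nonneg_right ?_ hA)
  refine single_le_sum (f := fun a => ((l I a).map fun e => |e.1|).sum)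
    (fun _ _ => list_map_sum_nonneg _ _ fun e _ => abs_nonneg _) (Finset.mem_univ a)

theorem Z_eq_dd (i : Fin 5) : ∃ c : Fin 3 → SF, ∀ f, Z i f = ∑ b, c b * dd b f := by
  fin_cases i
  · exact ⟨![1, 0, 0], fun f => by simp [Z, dd, Fin.sum_univ_three]⟩
  · exact ⟨![0, 1, 0], fun f => by simp [Z, dd, Fin.sum_univ_three]⟩
  · exact ⟨![0, 0, 1], fun f => by simp [Z, dd, Fin.sum_univ_three]⟩
  · exact ⟨![cx, ct, 0], fun f => by simp [Z, dd, Fin.sum_univ_three, L1_eq]⟩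
  · exact ⟨![cy, 0, ct], fun f => by simp [Z, dd, Fin.sum_univ_three, L2_eq]⟩

theorem word_Z_flat (I : List (Fin 5)) :
    ∃ l : List (SF × List (Fin 3)), (∀ e ∈ l, e.2.length ≤ I.length) ∧
      ∀ f : SF, word Z I f = (l.map fun e => e.1 * word dd e.2 f).sum := by
  induction I with
  | nil => exact ⟨[(1, [])], by simp, by simp⟩
  | cons i I ih =>
    obtain ⟨l, h1, h2⟩ := ih
    obtain ⟨c, hc⟩ := Z_eq_dd i
    refine ⟨l.flatMap fun e => (Z i e.1, e.2) ::
      (List.finRange 3).map fun b => (e.1 * c b, b :: e.2), ?_, fun f => ?_⟩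
    · grind
    · rw [word_cons, h2]
      clear h1 h2
      induction l with
      | nil => simp
      | cons e l ih =>
        simp only [List.map_cons, List.sum_cons, map_add, List.flatMap_cons, List.map_append,
          List.sum_append, ih, List.cons_append, Derivation.leibniz, hc (word _ _ _)]
        rw [← add_assoc]
        congr 1
        simp [List.finRange_succ, Fin.sum_univ_three]
        ring

/-- Hyperbolic derivatives are controlled by flat ones on compact sets. -/
theorem hk_Z_le_flat (K : Set Pt) (hK : IsCompact K) (k : ℕ) :
    ∃ C, 0 ≤ C ∧ ∀ f : SF, ∀ p ∈ K, hk Z k f p ≤ C * hk dd k f p := by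
  choose l h1 h2 using word_Z_flat
  have hb : ∀ g : SF, ∃ B, 0 ≤ B ∧ ∀ p ∈ K, |g p| ≤ B := fun g => by
    obtain ⟨B, hB⟩ := hK.exists_bound_of_continuousOn g.cont.continuousOn
    exact ⟨max B 0, le_max_right _ _, fun p hp => (hB p hp).trans (le_max_left _ _)⟩
  choose B hB0 hB using hb
  refine ⟨∑ I ∈ words (Fin 5) k, ((l I).map fun e => B e.1).sum, ?_, fun f p hp => ?_⟩
  · exact sum_nonneg fun I _ => list_map_sum_nonneg _ _ fun e _ => hB0 _
  rw [hk, sum_mul]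
  refine sum_le_sum fun I hI => ?_
  rw [h2]
  refine (abs_list_sum_le _ _ _).trans (list_sum_le_of_forall _ _ _ _ fun e he => ?_)
  rw [SF.mul_apply, abs_mul]
  exact mul_le_mul (hB _ _ hp) (le_hk _ ((h1 _ e he).trans (mem_words.1 hI)) _ _)
    (abs_nonneg _) (hB0 _)

section
variable {ι κ : Type} [Fintype ι] [DecidableEq ι]

/-- Derivations obeying the chain rule. -/
def IsChain (D : Derivation ℝ SF SF) : Prop :=
  ∀ (G : GF ι) (U : ι → SF), D (comp G U) = ∑ c, comp (G.pd c) U * D (U c)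

theorem isChain_dd (i : Fin 3) : IsChain (ι := ι) (dd i) := by
  fin_cases i <;> exact fun G U => dir_comp _ G U

theorem isChain_Z (i : Fin 5) : IsChain (ι := ι) (Z i) := by
  intro G U
  obtain ⟨c, hc⟩ := Z_eq_dd i
  simp only [hc, isChain_dd _ G U, mul_sum]
  rw [sum_comm]
  grind

/-- Apply one more derivation to one of the factors. -/
def mods (i : κ) : List (List κ × ι) → List (List (List κ × ι))
  | [] => []
  | e :: t => ((i :: e.1, e.2) :: t) :: (mods i t).map (e :: ·)

/-- The terms in the expansion of an iterated derivative of a composition. -/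
def expand (ι : Type) {κ : Type} [Fintype ι] : List κ → List (List (List κ × ι))
  | [] => [[]]
  | i :: I => (expand ι I).flatMap fun t =>
      ((Finset.univ : Finset ι).toList.map fun c => ([i], c) :: t) ++ mods i t

variable (D : κ → Derivation ℝ SF SF)

def factors (U : ι → SF) (t : List (List κ × ι)) : SF := (t.map fun e => word D e.1 (U e.2)).prod

def term (G : GF ι) (U : ι → SF) (t : List (List κ × ι)) : SF :=
  comp (G.pdw (t.map (·.2))) U * factors D U t

theorem D_factors (i : κ) (U : ι → SF) (t : List (List κ × ι)) :
    D i (factors D U t) = ((mods i t).map (factors D U)).sum := by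
  induction t with
  | nil => simp [mods, factors]
  | cons e t ih =>
    have : ∀ e : List κ × ι, ∀ t, factors D U (e :: t) = word D e.1 (U e.2) * factors D U t :=
      fun e t => by simp [factors]
    simp only [this, Derivation.leibniz, ih, mods, List.map_cons, List.map_map, List.sum_cons,
      word_cons, smul_eq_mul]
    have h2 : (List.map (factors D U ∘ fun x => e :: x) (mods i t)).sum =
        word D e.1 (U e.2) * ((mods i t).map (factors D U)).sum := by
      rw [← List.sum_map_mul_left]
      simp [Function.comp_def, this]
    rw [h2]; ring

theorem mods_snd (i : κ) (t s : List (List κ × ι)) (h : s ∈ mods i t) :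
    s.map (·.2) = t.map (·.2) := by
  induction t generalizing s with
  | nil => simp [mods] at h
  | cons e t ih =>
    simp only [mods, List.mem_cons, List.mem_map] at h
    grind

theorem word_comp (hD : ∀ i, IsChain (ι := ι) (D i)) (G : GF ι) (U : ι → SF) (I : List κ) :
    word D I (comp G U) = ((expand ι I).map (term D G U)).sum := by
  induction I with
  | nil => simp [expand, term, factors, GF.pdw]
  | cons i I ih =>
    rw [word_cons, ih, expand]
    generalize expand ι I = l
    induction l with
    | nil => simp
    | cons t l ih =>
      simp only [List.map_cons, List.sum_cons, map_add, ih, List.flatMap_cons, List.map_append,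
        List.sum_append, List.map_map]
      congr 1
      simp only [term, Derivation.leibniz, hD i _ U, D_factors, smul_eq_mul]
      rw [add_comm]
      congr 1
      · rw [← Finset.sum_map_toList, mul_comm, ← List.sum_map_mul_right]
        congr 2
        ext1 c
        simp only [Function.comp, term, factors, List.map_cons, GF.pdw, word_cons, word_nil,
          List.prod_cons]
        ring
      · rw [← List.sum_map_mul_left]
        congr 1
        refine List.map_congr_left fun s hs => ?_
        rw [term, mods_snd i t s hs]

theorem mem_mods (i : κ) (t s : List (List κ × ι)) (h : s ∈ mods i t)
    (h1 : ∀ e ∈ t, e.1 ≠ []) :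
    (∀ e ∈ s, e.1 ≠ []) ∧
      (s.map fun e => e.1.length).sum = (t.map fun e => e.1.length).sum + 1 := by
  induction t generalizing s with
  | nil => simp [mods] at h
  | cons e t ih =>
    simp only [mods, List.mem_cons, List.mem_map] at h
    grind

theorem mem_expand (I : List κ) (t : List (List κ × ι)) (h : t ∈ expand ι I) :
    (∀ e ∈ t, e.1 ≠ []) ∧ (t.map fun e => e.1.length).sum = I.length := by
  induction I generalizing t with
  | nil => simp [expand] at h; simp [h]
  | cons i I ih =>
    obtain ⟨r, hr, h⟩ := List.mem_flatMap.1 h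
    obtain ⟨h1, h2⟩ := ih r hr
    rcases List.mem_append.1 h with h | h
    · grind
    · obtain ⟨h3, h4⟩ := mem_mods i r t h h1
      grind

end

theorem SF.list_prod_apply {α : Type} (l : List α) (f : α → SF) (p : Pt) :
    (l.map f).prod p = (l.map fun e => f e p).prod := by
  induction l with
  | nil => rfl
  | cons e l ih => simp [ih]

theorem abs_list_prod {α : Type} (l : List α) (f : α → ℝ) :
    |(l.map f).prod| = (l.map fun e => |f e|).prod := by
  induction l with
  | nil => simp
  | cons e l ih => simp [ih]

theorem list_prod_nonneg {α : Type} (l : List α) (f : α → ℝ) (h : ∀ e ∈ l, 0 ≤ f e) :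
    0 ≤ (l.map f).prod := by
  induction l with
  | nil => simp
  | cons e l ih =>
    exact mul_nonneg (h e (by simp)) (ih fun e' he' => h e' (by simp [he']))

theorem list_prod_le_prod {α : Type} (l : List α) (f g : α → ℝ) (h0 : ∀ e ∈ l, 0 ≤ f e)
    (h : ∀ e ∈ l, f e ≤ g e) : (l.map f).prod ≤ (l.map g).prod := by
  induction l with
  | nil => simp
  | cons e l ih =>
    have h0' := list_prod_nonneg l f fun e' he' => h0 e' (by simp [he'])
    exact mul_le_mul (h e (by simp)) (ih (fun e' he' => h0 e' (by simp [he']))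
      fun e' he' => h e' (by simp [he'])) h0' ((h0 e (by simp)).trans (h e (by simp)))

theorem list_prod_le_one {α : Type} (l : List α) (f : α → ℝ) (h0 : ∀ e ∈ l, 0 ≤ f e)
    (h : ∀ e ∈ l, f e ≤ 1) : (l.map f).prod ≤ 1 := by
  simpa using list_prod_le_prod l f (fun _ => 1) h0 h

/-- A product of at least two factors of total order `k` is bounded by a product of two. -/
theorem list_prod_le_two {α : Type} (l : List α) (len : α → ℕ) (n : ℕ → ℝ) (M k : ℕ)
    (hn : Monotone n) (h0 : ∀ a, 0 ≤ n a) (h1 : ∀ a ≤ M, n a ≤ 1) (hk : k ≤ 2 * M)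
    (hs : (l.map len).sum = k) (hl : 2 ≤ l.length) :
    ∃ a b, a + b = k ∧ (l.map fun e => n (len e)).prod ≤ n a * n b := by
  classical
  obtain ⟨m, hm, hmax⟩ : ∃ m ∈ l, ∀ e ∈ l, len e ≤ len m := by
    have hne : l.toFinset.Nonempty := by
      rw [List.toFinset_nonempty_iff]; rintro rfl; simp at hl
    obtain ⟨m, hm, h⟩ := l.toFinset.exists_max_image len hne
    exact ⟨m, List.mem_toFinset.1 hm, fun e he => h e (List.mem_toFinset.2 he)⟩
  have hp := List.perm_cons_erase hm
  set r := l.erase m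
  have hlen : r.length + 1 = l.length := by grind
  have hsum : len m + (r.map len).sum = k := by
    rw [← hs, (hp.map len).sum_eq]; simp
  refine ⟨len m, (r.map len).sum, hsum, ?_⟩
  rw [(hp.map _).prod_eq, List.map_cons, List.prod_cons]
  refine mul_le_mul_of_nonneg_left ?_ (h0 _)
  have hr : ∀ e ∈ r, len e ≤ M := fun e he => by
    have h2 := hmax e (List.mem_of_mem_erase he)
    have h3 := List.single_le_sum (l := r.map len) (by simp) _ (List.mem_map_of_mem he)
    omega
  cases hr' : r with
  | nil => rw [hr'] at hlen; simp at hlen; omega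
  | cons e s =>
    rw [hr'] at hr
    simp
    calc n (len e) * (s.map fun e => n (len e)).prod ≤ n (len e) * 1 :=
          mul_le_mul_of_nonneg_left (list_prod_le_one _ _ (fun _ _ => h0 _)
            fun e' he' => h1 _ (hr e' (by simp [he']))) (h0 _)
      _ ≤ _ := by rw [mul_one]; exact hn (by omega)

/-- Integral over a time slice. -/
def II (g : Pt → ℝ) (s : ℝ) : ℝ := ∫ z : ℝ × ℝ, g (s, z)

/-- Spatially compact support, locally uniformly in time. -/
def SC (g : Pt → ℝ) : Prop :=
  ∀ A : ℝ, ∃ R : ℝ, ∀ p : Pt, |p.1| ≤ A → (R < |p.2.1| ∨ R < |p.2.2|) → g p = 0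

theorem SC.dir {f : SF} (hf : SC f) (w : Pt) : SC (dir w f) := by
  intro A
  obtain ⟨R, hR⟩ := hf (A + 1)
  refine ⟨R, fun p hp hp2 => ?_⟩
  have h : (f : Pt → ℝ) =ᶠ[nhds p] fun _ => 0 := by
    have h1 : ∀ᶠ q in nhds p, |q.1| < A + 1 :=
      (continuous_abs.comp continuous_fst).continuousAt.eventually_lt continuousAt_const
        (by grind)
    have h2 : ∀ᶠ q in nhds p, (R < |q.2.1| ∨ R < |q.2.2|) := by
      rcases hp2 with h | h
      · exact (ContinuousAt.eventually_lt (f := fun _ : Pt => R) (g := fun q : Pt => |q.2.1|)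
          (by fun_prop) (by fun_prop) h).mono fun _ h => Or.inl h
      · exact (ContinuousAt.eventually_lt (f := fun _ : Pt => R) (g := fun q : Pt => |q.2.2|)
          (by fun_prop) (by fun_prop) h).mono fun _ h => Or.inr h
    filter_upwards [h1, h2] with q hq1 hq2 using hR q hq1.le hq2
  rw [dir_apply, h.fderiv_eq]; simp

theorem SC.add {f g : Pt → ℝ} (hf : SC f) (hg : SC g) : SC (fun p => f p + g p) := by
  intro A
  obtain ⟨R, hR⟩ := hf A
  obtain ⟨S, hS⟩ := hg A
  refine ⟨max R S, fun p hp hp2 => ?_⟩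
  grind

theorem SC.of_zero {f g : Pt → ℝ} (hf : SC f) (h : ∀ p, f p = 0 → g p = 0) : SC g := fun A => by
  obtain ⟨R, hR⟩ := hf A
  exact ⟨R, fun p hp hp2 => h p (hR p hp hp2)⟩

theorem SC.T {f : SF} (hf : SC f) : SC (T f) := hf.dir _
theorem SC.X {f : SF} (hf : SC f) : SC (X f) := hf.dir _
theorem SC.Y {f : SF} (hf : SC f) : SC (Y f) := hf.dir _
theorem SC.mul_left {f : Pt → ℝ} (hf : SC f) (g : Pt → ℝ) : SC (fun p => g p * f p) :=
  hf.of_zero fun p h => by simp [h]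
theorem SC.mul_right {f : Pt → ℝ} (hf : SC f) (g : Pt → ℝ) : SC (fun p => f p * g p) :=
  hf.of_zero fun p h => by simp [h]
theorem SC.zero : SC (fun _ => 0) := fun _ => ⟨0, fun _ _ _ => rfl⟩
theorem SC.sum {α : Type} (s : Finset α) (f : α → Pt → ℝ) (h : ∀ a ∈ s, SC (f a)) :
    SC (fun p => ∑ a ∈ s, f a p) := by
  classical
  induction s using Finset.induction_on with
  | empty => simpa using SC.zero
  | insert a s ha ih =>
    simp only [Finset.sum_insert ha]
    exact (h a (by simp)).add (ih fun b hb => h b (by simp [hb]))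

theorem SC.hcs {g : Pt → ℝ} (hg : SC g) (s : ℝ) : HasCompactSupport fun z : ℝ × ℝ => g (s, z) := by
  obtain ⟨R, hR⟩ := hg |s|
  refine HasCompactSupport.intro (K := Icc (-R) R ×ˢ Icc (-R) R) (isCompact_Icc.prod isCompact_Icc)
    fun z hz => hR (s, z) le_rfl ?_
  grind

theorem SC.int {g : Pt → ℝ} (hg : SC g) (hc : Continuous g) (s : ℝ) :
    Integrable fun z : ℝ × ℝ => g (s, z) :=
  (hc.comp (by fun_prop)).integrable_of_hasCompactSupport (hg.hcs s)

theorem II_nonneg {g : Pt → ℝ} {s : ℝ} (h : ∀ z, 0 ≤ g (s, z)) : 0 ≤ II g s :=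
  integral_nonneg fun z => h z

theorem II_mono {f g : Pt → ℝ} {s : ℝ} (hf : SC f) (hcf : Continuous f) (hg : SC g)
    (hcg : Continuous g) (h : ∀ z, f (s, z) ≤ g (s, z)) : II f s ≤ II g s :=
  integral_mono (hf.int hcf s) (hg.int hcg s) h

theorem II_add {f g : Pt → ℝ} {s : ℝ} (hf : SC f) (hcf : Continuous f) (hg : SC g)
    (hcg : Continuous g) : II (fun p => f p + g p) s = II f s + II g s :=
  integral_add (hf.int hcf s) (hg.int hcg s)

theorem II_const_mul (c : ℝ) (f : Pt → ℝ) (s : ℝ) : II (fun p => c * f p) s = c * II f s :=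
  integral_const_mul _ _

/-- Cauchy-Schwarz. -/
theorem II_mul_le {f g : Pt → ℝ} {s : ℝ} (hf : SC f) (hcf : Continuous f) (hg : SC g)
    (hcg : Continuous g) :
    II (fun p => f p * g p) s ≤ √(II (fun p => f p ^ 2) s) * √(II (fun p => g p ^ 2) s) := by
  have hf2 : SC fun p => f p ^ 2 := hf.of_zero fun p h => by simp [h]
  have hg2 : SC fun p => g p ^ 2 := hg.of_zero fun p h => by simp [h]
  have hfg : SC fun p => f p * g p := hf.mul_right g
  have i1 := hf2.int (hcf.pow 2) s
  have i2 := hg2.int (hcg.pow 2) s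
  have i3 := hfg.int (hcf.mul hcg) s
  have key : ∀ x : ℝ, 0 ≤ II (fun p => f p ^ 2) s * (x * x) + (2 * II (fun p => f p * g p) s) * x
      + II (fun p => g p ^ 2) s := by
    intro x
    have : II (fun p => f p ^ 2) s * (x * x) + (2 * II (fun p => f p * g p) s) * x
      + II (fun p => g p ^ 2) s = ∫ z : ℝ × ℝ, (x * f (s, z) + g (s, z)) ^ 2 := by
      have e : (fun z : ℝ × ℝ => (x * f (s, z) + g (s, z)) ^ 2) = fun z =>
        ((x * x) * f (s, z) ^ 2 + (2 * x) * (f (s, z) * g (s, z))) + g (s, z) ^ 2 := by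
        ext z; ring
      have j1 := i1.const_mul (x * x)
      have j3 := i3.const_mul (2 * x)
      have h2 := integral_add (j1.add j3) i2
      simp at h2
      rw [e, h2, integral_add j1 j3, integral_const_mul, integral_const_mul]
      simp only [II]; ring
    rw [this]
    positivity
  have hd := discrim_le_zero key
  rw [discrim] at hd
  rw [← sqrt_mul (II_nonneg fun z => sq_nonneg _)]
  refine le_sqrt_of_sq_le ?_
  nlinarith

/-- Partial derivatives of differentiable functions. -/
def Dd (w : Pt) (g : Pt → ℝ) (p : Pt) : ℝ := fderiv ℝ g p w

theorem hasDerivAt_Dd_t {g : Pt → ℝ} (s : ℝ) (z : ℝ × ℝ) (hg : DifferentiableAt ℝ g (s, z)) :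
    HasDerivAt (fun s => g (s, z)) (Dd (1, 0, 0) g (s, z)) s :=
  hg.hasFDerivAt.comp_hasDerivAt s ((hasDerivAt_id s).prodMk (hasDerivAt_const s z))

theorem hasDerivAt_Dd_x {g : Pt → ℝ} (s x y : ℝ) (hg : DifferentiableAt ℝ g (s, x, y)) :
    HasDerivAt (fun x => g (s, x, y)) (Dd (0, 1, 0) g (s, x, y)) x :=
  hg.hasFDerivAt.comp_hasDerivAt x
    ((hasDerivAt_const x s).prodMk ((hasDerivAt_id x).prodMk (hasDerivAt_const x y)))

theorem hasDerivAt_Dd_y {g : Pt → ℝ} (s x y : ℝ) (hg : DifferentiableAt ℝ g (s, x, y)) :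
    HasDerivAt (fun y => g (s, x, y)) (Dd (0, 0, 1) g (s, x, y)) y :=
  hg.hasFDerivAt.comp_hasDerivAt y
    ((hasDerivAt_const y s).prodMk ((hasDerivAt_const y x).prodMk (hasDerivAt_id y)))

theorem hasDerivAt_t (g : SF) (s x y : ℝ) :
    HasDerivAt (fun s => g (s, x, y)) (T g (s, x, y)) s := hasDerivAt_Dd_t s _ (g.diff _)

theorem hasDerivAt_x (g : SF) (s x y : ℝ) :
    HasDerivAt (fun x => g (s, x, y)) (X g (s, x, y)) x := hasDerivAt_Dd_x s x y (g.diff _)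

theorem hasDerivAt_y (g : SF) (s x y : ℝ) :
    HasDerivAt (fun y => g (s, x, y)) (Y g (s, x, y)) y := hasDerivAt_Dd_y s x y (g.diff _)

/-- Differentiation under the slice integral. -/
theorem hasDerivAt_II_of {g g' : Pt → ℝ} (hg : SC g) (hc : Continuous g) (hg' : SC g')
    (hc' : Continuous g') (h : ∀ s z, HasDerivAt (fun s => g (s, z)) (g' (s, z)) s) (s : ℝ) :
    HasDerivAt (II g) (II g' s) s := by
  obtain ⟨R, hR⟩ := hg' (|s| + 1)
  have hK : IsCompact (Icc (s - 1) (s + 1) ×ˢ (Icc (-R) R ×ˢ Icc (-R) R) : Set Pt) :=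
    isCompact_Icc.prod (isCompact_Icc.prod isCompact_Icc)
  obtain ⟨B, hB⟩ := hK.exists_bound_of_continuousOn hc'.continuousOn
  refine (hasDerivAt_integral_of_dominated_loc_of_deriv_le
    (F := fun s (z : ℝ × ℝ) => g (s, z)) (F' := fun s (z : ℝ × ℝ) => g' (s, z))
    (s := Metric.ball s 1)
    (bound := (Icc (-R) R ×ˢ Icc (-R) R).indicator fun _ => B) (Metric.ball_mem_nhds s one_pos) ?_
    (hg.int hc s) ?_ ?_ ?_ ?_).2
  · exact Eventually.of_forall fun s => (hg.int hc s).aestronglyMeasurable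
  · fun_prop
  · refine Eventually.of_forall fun z x hx => ?_
    rw [Metric.mem_ball, dist_eq] at hx
    by_cases hz : z ∈ (Icc (-R) R ×ˢ Icc (-R) R : Set (ℝ × ℝ))
    · rw [indicator_of_mem hz]
      grind
    · rw [indicator_of_notMem hz, hR (x, z), norm_zero]
      · grind
      · grind
  · refine (integrable_indicator_iff (measurableSet_Icc.prod measurableSet_Icc)).2 ?_
    exact integrableOn_const (isCompact_Icc.prod isCompact_Icc).measure_lt_top.ne (by simp)
  · exact Eventually.of_forall fun z x _ => h x z

theorem hasDerivAt_II {g : SF} (hg : SC g) (s : ℝ) : HasDerivAt (II g) (II (T g) s) s :=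
  hasDerivAt_II_of hg g.cont hg.T (T g).cont (fun s z => hasDerivAt_t g s z.1 z.2) s

theorem SC.hcs_x {g : Pt → ℝ} (hg : SC g) (s y : ℝ) : HasCompactSupport fun x => g (s, x, y) := by
  obtain ⟨R, hR⟩ := hg |s|
  refine HasCompactSupport.intro (K := Icc (-R) R) isCompact_Icc
    fun x hx => hR (s, x, y) le_rfl (Or.inl ?_)
  grind

theorem SC.hcs_y {g : Pt → ℝ} (hg : SC g) (s x : ℝ) : HasCompactSupport fun y => g (s, x, y) := by
  obtain ⟨R, hR⟩ := hg |s|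
  refine HasCompactSupport.intro (K := Icc (-R) R) isCompact_Icc
    fun y hy => hR (s, x, y) le_rfl (Or.inr ?_)
  grind

theorem SC.int_x {g : Pt → ℝ} (hg : SC g) (hc : Continuous g) (s y : ℝ) :
    Integrable fun x : ℝ => g (s, x, y) :=
  (hc.comp (by fun_prop)).integrable_of_hasCompactSupport (hg.hcs_x s y)

theorem SC.int_y {g : Pt → ℝ} (hg : SC g) (hc : Continuous g) (s x : ℝ) :
    Integrable fun y : ℝ => g (s, x, y) :=
  (hc.comp (by fun_prop)).integrable_of_hasCompactSupport (hg.hcs_y s x)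

theorem II_Dx {g g' : Pt → ℝ} (hg : SC g) (hc : Continuous g) (hg' : SC g') (hc' : Continuous g')
    (hd : ∀ s x y, HasDerivAt (fun x => g (s, x, y)) (g' (s, x, y)) x) (s : ℝ) : II g' s = 0 := by
  have h : ∀ y, ∫ x, g' (s, x, y) = 0 := fun y =>
    integral_eq_zero_of_hasDerivAt_of_integrable (fun x => hd s x y)
      (hg'.int_x hc' s y) (hg.int_x hc s y)
  rw [II, Measure.volume_eq_prod, integral_prod_symm _ (hg'.int hc' s)]
  simp [h]

theorem II_Dy {g g' : Pt → ℝ} (hg : SC g) (hc : Continuous g) (hg' : SC g') (hc' : Continuous g')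
    (hd : ∀ s x y, HasDerivAt (fun y => g (s, x, y)) (g' (s, x, y)) y) (s : ℝ) : II g' s = 0 := by
  have h : ∀ x, ∫ y, g' (s, x, y) = 0 := fun x =>
    integral_eq_zero_of_hasDerivAt_of_integrable (fun y => hd s x y)
      (hg'.int_y hc' s x) (hg.int_y hc s x)
  rw [II, Measure.volume_eq_prod, integral_prod _ (hg'.int hc' s)]
  simp [h]

theorem II_X {g : SF} (hg : SC g) (s : ℝ) : II (X g) s = 0 :=
  II_Dx hg g.cont hg.X (X g).cont (hasDerivAt_x g) s

theorem II_Y {g : SF} (hg : SC g) (s : ℝ) : II (Y g) s = 0 :=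
  II_Dy hg g.cont hg.Y (Y g).cont (hasDerivAt_y g) s

theorem SC.abs {g : Pt → ℝ} (hg : SC g) : SC fun p => |g p| := hg.of_zero fun p h => by simp [h]

theorem abs_le_int_deriv {φ φ' : ℝ → ℝ} (h : ∀ x, HasDerivAt φ (φ' x) x)
    (hs : HasCompactSupport φ) (hi : Integrable φ') (x : ℝ) : |φ x| ≤ ∫ x, |φ' x| := by
  have hlim : Tendsto φ atBot (nhds 0) := hs.is_zero_at_infty.mono_left atBot_le_cocompact
  have h1 : ∫ y in Iic x, φ' y = φ x - 0 :=
    integral_Iic_of_hasDerivAt_of_tendsto' (fun y _ => h y) hi.integrableOn hlim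
  rw [sub_zero] at h1
  rw [← h1]
  refine (abs_integral_le_integral_abs).trans ?_
  exact setIntegral_le_integral hi.abs (Eventually.of_forall fun _ => abs_nonneg _)

theorem abs_le_int_X {g : SF} (hg : SC g) (s x y : ℝ) :
    |g (s, x, y)| ≤ ∫ x, |X g (s, x, y)| :=
  abs_le_int_deriv (fun x => hasDerivAt_x g s x y) (hg.hcs_x s y) (hg.X.int_x (X g).cont s y) x

theorem abs_le_int_Y {g : SF} (hg : SC g) (s x y : ℝ) :
    |g (s, x, y)| ≤ ∫ y, |Y g (s, x, y)| :=
  abs_le_int_deriv (fun y => hasDerivAt_y g s x y) (hg.hcs_y s x) (hg.Y.int_y (Y g).cont s x) y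

theorem abs_le_II {g : SF} (hg : SC g) (p : Pt) : |g p| ≤ II (fun p => |Y (X g) p|) p.1 := by
  obtain ⟨s, x, y⟩ := p
  refine (abs_le_int_X hg s x y).trans ?_
  have hi := hg.X.Y.abs.int (Y (X g)).cont.abs s
  rw [II, Measure.volume_eq_prod, integral_prod _ hi]
  exact integral_mono (hg.X.abs.int_x (X g).cont.abs s y) hi.integral_prod_left
    fun x => abs_le_int_Y hg.X s x y

/-- Sobolev inequality on slices. -/
theorem sobolev {f : SF} (hf : SC f) (p : Pt) :
    f p ^ 2 ≤ II (fun p => f p ^ 2 + X f p ^ 2 + Y f p ^ 2 + Y (X f) p ^ 2) p.1 := by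
  have hff : SC (f * f : SF) := hf.mul_left f
  have h := abs_le_II hff p
  rw [SF.mul_apply, abs_mul_self, ← pow_two] at h
  refine h.trans (II_mono hff.X.Y.abs (Y (X (f * f))).cont.abs ?_ ?_ fun z => ?_)
  · refine SC.add (SC.add (SC.add ?_ ?_) ?_) ?_
    exacts [hf.of_zero fun p h => by simp [h], hf.X.of_zero fun p h => by simp [h],
      hf.Y.of_zero fun p h => by simp [h], hf.X.Y.of_zero fun p h => by simp [h]]
  · fun_prop
  · simp
    rw [abs_le]
    constructor <;>
    nlinarith [sq_nonneg (f (p.1, z) - Y (X f) (p.1, z)), sq_nonneg (f (p.1, z) + Y (X f) (p.1, z)), sq_nonneg (X f (p.1, z) - Y f (p.1, z)), sq_nonneg (X f (p.1, z) + Y f (p.1, z))]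

theorem SC.sq {g : Pt → ℝ} (hg : SC g) : SC fun p => g p ^ 2 := hg.of_zero fun p h => by simp [h]

theorem II_abs_dir_sq_le {f : SF} (hf : SC f) (w : Pt) (s : ℝ) : II (fun p => |dir w (f * f) p|) s ≤
    2 * (√(II (fun p => f p ^ 2) s) * √(II (fun p => dir w f p ^ 2) s)) := by
  have e : (fun p => |dir w (f * f) p|) = fun p => 2 * (|f p| * |dir w f p|) := by
    ext p
    simp
    rw [← two_mul, abs_mul, abs_mul, abs_two]
  rw [e, II_const_mul]
  have := II_mul_le (s := s) hf.abs f.cont.abs (hf.dir w).abs (dir w f).cont.abs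
  simp at this
  linarith

/-- Ladyzhenskaya's inequality for products. -/
theorem ladyzhenskaya {f g : SF} (hf : SC f) (hg : SC g) (s : ℝ) :
    II (fun p => (f p * g p) ^ 2) s ≤
      2 * (√(II (fun p => f p ^ 2) s) * √(II (fun p => X f p ^ 2) s)) *
      (2 * (√(II (fun p => g p ^ 2) s) * √(II (fun p => Y g p ^ 2) s))) := by
  have hff : SC (f * f : SF) := hf.mul_left f
  have hgg : SC (g * g : SF) := hg.mul_left g
  have hi := hff.X.abs.int (X (f * f)).cont.abs s
  have hj := hgg.Y.abs.int (Y (g * g)).cont.abs s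
  have hA := hi.integral_prod_right
  have hB := hj.integral_prod_left
  have h1 : II (fun p => (f p * g p) ^ 2) s ≤ ∫ z : ℝ × ℝ,
      (∫ y, |Y (g * g) (s, z.1, y)|) * (∫ x, |X (f * f) (s, x, z.2)|) := by
    refine integral_mono (SC.int (hf.mul_right g).sq (by fun_prop) s) (hB.mul_prod hA) fun z => ?_
    have h2 := abs_le_int_X hff s z.1 z.2
    have h3 := abs_le_int_Y hgg s z.1 z.2
    simp only [SF.mul_apply, abs_mul_self] at h2 h3
    nlinarith
  refine h1.trans ?_
  rw [Measure.volume_eq_prod, integral_prod_mul (fun x => ∫ y, |Y (g * g) (s, x, y)|)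
    (fun y => ∫ x, |X (f * f) (s, x, y)|), mul_comm, ← integral_prod_symm _ hi,
    ← integral_prod _ hj]
  exact mul_le_mul (II_abs_dir_sq_le hf _ s) (II_abs_dir_sq_le hg _ s)
    (integral_nonneg fun _ => abs_nonneg _) (by positivity)

/-- Energy density on flat slices. -/
def dens (m : ℝ) (f : SF) : SF := T f * T f + X f * X f + Y f * Y f + (m ^ 2) • (f * f)

theorem dens_apply (m : ℝ) (f : SF) (p : Pt) :
    dens m f p = T f p ^ 2 + X f p ^ 2 + Y f p ^ 2 + m ^ 2 * f p ^ 2 := by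
  simp [dens, pow_two]

theorem SC.dens {f : SF} (hf : SC f) (m : ℝ) : SC (dens m f) := by
  have := ((hf.T.sq.add hf.X.sq).add hf.Y.sq).add (hf.sq.mul_left fun _ => m ^ 2)
  convert this using 2
  rw [dens_apply]

theorem T_dens (m : ℝ) (f : SF) : T (dens m f) =
    (2 : ℝ) • (T f * (box f + (m ^ 2) • f)) + X ((2 : ℝ) • (T f * X f))
      + Y ((2 : ℝ) • (T f * Y f)) := by
  simp only [dens, box, map_add, Derivation.map_smul, Derivation.leibniz, smul_eq_mul, XT, YT]
  simp only [Algebra.smul_def]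
  simp only [map_ofNat]
  ring

theorem hasDerivAt_energy (m : ℝ) {f : SF} (hf : SC f) (s : ℝ) :
    HasDerivAt (II (dens m f)) (II (fun p => 2 * (T f p * (box f p + m ^ 2 * f p))) s) s := by
  have h := hasDerivAt_II (hf.dens m) s
  have h1 : SC ((2 : ℝ) • (T f * X f) : SF) := hf.T.of_zero fun p hp => by simp [hp]
  have h2 : SC ((2 : ℝ) • (T f * Y f) : SF) := hf.T.of_zero fun p hp => by simp [hp]
  have h0' : SC (fun p => 2 * (T f p * (box f p + m ^ 2 * f p))) :=
    hf.T.of_zero fun p hp => by simp [hp]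
  have e : II (T (dens m f)) s = II (fun p => 2 * (T f p * (box f p + m ^ 2 * f p))) s := by
    have : (T (dens m f) : Pt → ℝ) = fun p => (2 * (T f p * (box f p + m ^ 2 * f p))
        + X ((2 : ℝ) • (T f * X f)) p) + Y ((2 : ℝ) • (T f * Y f)) p := by
      ext p; rw [T_dens]; simp
    rw [this, II_add (h0'.add h1.X) (by fun_prop) h2.Y (by fun_prop),
      II_add h0' (by fun_prop) h1.X (by fun_prop), II_X h1, II_Y h2, add_zero, add_zero]
  rwa [e] at h

@[simp] theorem SF.two_apply (p : Pt) : (2 : SF) p = 2 := rfl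

/-- Pull-back along `(s, z) ↦ (φ (s, z), z)`. -/
def pull (φ : SF) : SF →ₐ[ℝ] SF where
  toFun f := .mk (fun p => f (φ p, p.2)) (f.smooth.comp (φ.smooth.prodMk contDiff_snd))
  map_one' := rfl
  map_mul' _ _ := rfl
  map_zero' := rfl
  map_add' _ _ := rfl
  commutes' _ := rfl

@[simp] theorem pull_apply (φ f : SF) (p : Pt) : pull φ f p = f (φ p, p.2) := rfl

theorem dir_pull (w : Pt) (φ f : SF) (p : Pt) : dir w (pull φ f) p
    = dir w φ p * T f (φ p, p.2) + w.2.1 * X f (φ p, p.2) + w.2.2 * Y f (φ p, p.2) := by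
  rw [dir_apply]
  have h1 : HasFDerivAt (fun q : Pt => ((φ q, q.2) : Pt))
      ((fderiv ℝ φ p).prod (ContinuousLinearMap.snd ℝ ℝ (ℝ × ℝ))) p :=
    (φ.diff p).hasFDerivAt.prodMk hasFDerivAt_snd
  have h2 : HasFDerivAt f.fn (fderiv ℝ f.fn (φ p, p.2)) (φ p, p.2) := (f.diff _).hasFDerivAt
  have h3 := (h2.comp p h1).fderiv
  have : ((pull φ f : SF) : Pt → ℝ) = f.fn ∘ fun q : Pt => ((φ q, q.2) : Pt) := rfl
  rw [this, h3, ContinuousLinearMap.comp_apply, fderiv_eq]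
  rfl

theorem T_pull (φ f : SF) : T (pull φ f) = T φ * pull φ (T f) := by
  ext p; rw [T, dir_pull]; simp [T]
theorem X_pull (φ f : SF) : X (pull φ f) = pull φ (X f) + X φ * pull φ (T f) := by
  ext p; rw [X, dir_pull]; simp [X]; ring
theorem Y_pull (φ f : SF) : Y (pull φ f) = pull φ (Y f) + Y φ * pull φ (T f) := by
  ext p; rw [Y, dir_pull]; simp [Y]; ring

/-- `τ² = exp (2σ)` as a function of the logarithmic hyperbolic time. -/
def tau2 : SF := .mk (fun p => exp (2 * p.1)) (by fun_prop)

theorem hyp_pos (p : Pt) : 0 < exp (2 * p.1) + p.2.1 ^ 2 + p.2.2 ^ 2 := by positivity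

/-- The time function on hyperboloids. -/
def hy : SF := .mk (fun p => √(exp (2 * p.1) + p.2.1 ^ 2 + p.2.2 ^ 2))
  (ContDiff.sqrt (by fun_prop) fun p => (hyp_pos p).ne')

theorem hy_pos (p : Pt) : 0 < hy p := sqrt_pos.2 (hyp_pos p)

/-- The reciprocal time function on hyperboloids. -/
def tinv : SF := .mk (fun p => (hy p)⁻¹) (hy.smooth.inv fun p => (hy_pos p).ne')

theorem tinv_apply (p : Pt) : tinv p = (hy p)⁻¹ := rfl
theorem tau2_apply (p : Pt) : tau2 p = exp (2 * p.1) := rfl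

theorem tinv_hy : tinv * hy = 1 := by
  ext p; exact inv_mul_cancel₀ (hy_pos p).ne'

theorem hy_sq : hy * hy = tau2 + cx * cx + cy * cy := by
  ext p
  change √_ * √_ = exp (2 * p.1) + p.2.1 * p.2.1 + p.2.2 * p.2.2
  rw [mul_self_sqrt (hyp_pos p).le]; ring

theorem T_tau2 : T tau2 = 2 * tau2 := by
  ext ⟨s, x, y⟩
  have h := hasDerivAt_t tau2 s x y
  have h2 : HasDerivAt (fun s => tau2 (s, x, y)) (exp (2 * s) * 2) s := by
    have := ((hasDerivAt_id s).const_mul 2).exp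
    simpa [tau2] using this
  rw [h.unique h2]; simp [tau2]; ring
theorem X_tau2 : X tau2 = 0 := by
  ext ⟨s, x, y⟩
  exact (hasDerivAt_x tau2 s x y).unique (hasDerivAt_const x (exp (2 * s)))
theorem Y_tau2 : Y tau2 = 0 := by
  ext ⟨s, x, y⟩
  exact (hasDerivAt_y tau2 s x y).unique (hasDerivAt_const y (exp (2 * s)))

theorem T_hy : T hy = tau2 * tinv := by
  have h := congrArg (fun f => (1 / 2 : ℝ) • (tinv * T f)) hy_sq
  simp only [Derivation.leibniz, map_add, smul_eq_mul, T_tau2, T_cx, T_cy] at h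
  have e := tinv_hy
  have a1 : tinv * (hy * T hy + hy * T hy) = 2 * T hy := by grind
  rw [a1] at h
  have a2 : ∀ a : SF, (1 / 2 : ℝ) • (2 * a) = a := fun a => by ext p; simp
  rw [a2] at h
  rw [h]; ext p; simp; try ring
theorem X_hy : X hy = cx * tinv := by
  have h := congrArg (fun f => (1 / 2 : ℝ) • (tinv * X f)) hy_sq
  simp only [Derivation.leibniz, map_add, smul_eq_mul, X_tau2, X_cx, X_cy] at h
  have e := tinv_hy
  have a1 : tinv * (hy * X hy + hy * X hy) = 2 * X hy := by grind
  rw [a1] at h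
  have a2 : ∀ a : SF, (1 / 2 : ℝ) • (2 * a) = a := fun a => by ext p; simp
  rw [a2] at h
  rw [h]; ext p; simp; try ring
theorem Y_hy : Y hy = cy * tinv := by
  have h := congrArg (fun f => (1 / 2 : ℝ) • (tinv * Y f)) hy_sq
  simp only [Derivation.leibniz, map_add, smul_eq_mul, Y_tau2, Y_cx, Y_cy] at h
  have e := tinv_hy
  have a1 : tinv * (hy * Y hy + hy * Y hy) = 2 * Y hy := by grind
  rw [a1] at h
  have a2 : ∀ a : SF, (1 / 2 : ℝ) • (2 * a) = a := fun a => by ext p; simp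
  rw [a2] at h
  rw [h]; ext p; simp; try ring

theorem derivation_tinv (D : Derivation ℝ SF SF) : D tinv = - (tinv * tinv * D hy) := by
  have h := congrArg (fun f => tinv * D f) tinv_hy
  simp at h
  linear_combination h - (D tinv) * tinv_hy

/-- Pull-back to hyperboloids. -/
abbrev P : SF →ₐ[ℝ] SF := pull hy

@[simp] theorem P_ct : P ct = hy := by ext p; simp
@[simp] theorem P_cx : P cx = cx := by ext p; simp
@[simp] theorem P_cy : P cy = cy := by ext p; simp

theorem X_P (f : SF) : X (P f) = tinv * P (L1 f) := by
  rw [X_pull, L1_eq, map_add, map_mul, map_mul, X_hy, P_cx, P_ct]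
  linear_combination -(P (X f)) * tinv_hy
theorem Y_P (f : SF) : Y (P f) = tinv * P (L2 f) := by
  rw [Y_pull, L2_eq, map_add, map_mul, map_mul, Y_hy, P_cy, P_ct]
  linear_combination -(P (Y f)) * tinv_hy

/-- Energy density on hyperboloids. -/
def hdens (m : ℝ) (f : SF) : SF :=
  P (T f * T f + X f * X f + Y f * Y f + (m ^ 2) • (f * f))
    + (2 : ℝ) • (P (T f) * tinv * (cx * P (X f) + cy * P (Y f)))

theorem hdens_eq (m : ℝ) (f : SF) : hdens m f = (tinv * P (L1 f)) ^ 2 + (tinv * P (L2 f)) ^ 2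
    + tau2 * (tinv * P (T f)) ^ 2 + (m ^ 2) • (P f) ^ 2 := by
  simp only [hdens, L1_eq, L2_eq, map_add, map_mul, P_cx, P_cy, P_ct, Algebra.smul_def,
    AlgHom.commutes]
  have h1 := hy_sq
  have h2 := tinv_hy
  have h3 : tinv * tinv * tau2 = 1 - tinv * tinv * (cx * cx + cy * cy) := by
    linear_combination (-(tinv * tinv)) * h1 + (tinv * hy + 1) * h2
  simp only [map_ofNat, map_pow]
  linear_combination (-(P (T f)) ^ 2) * h3 - (tinv * hy + 1) * ((P (X f)) ^ 2 + (P (Y f)) ^ 2) * h2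
    - 2 * tinv * P (T f) * (cx * P (X f) + cy * P (Y f)) * h2

theorem T_hdens (m : ℝ) (f : SF) : T (hdens m f) =
    (2 : ℝ) • (tau2 * tinv * P (T f * (box f + (m ^ 2) • f)))
      + X ((2 : ℝ) • (tau2 * tinv * P (T f * X f)))
      + Y ((2 : ℝ) • (tau2 * tinv * P (T f * Y f))) := by
  simp only [hdens, box, map_add, map_sub, map_mul, Derivation.map_smul, Derivation.leibniz,
    smul_eq_mul, XT, YT, T_pull, X_pull, Y_pull, derivation_tinv, T_hy, X_hy, Y_hy, X_tau2, Y_tau2, T_cx,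
    T_cy]
  simp only [Algebra.smul_def, map_add, map_mul, AlgHom.commutes]
  simp only [map_ofNat]
  ring

/-- Support inside the cone `r ≤ t - 1`. -/
def CS (f : Pt → ℝ) : Prop := ∀ p, f p ≠ 0 → 1 ≤ p.1 ∧ p.2.1 ^ 2 + p.2.2 ^ 2 ≤ (p.1 - 1) ^ 2

theorem dir_ne_zero {f : SF} {S : Set Pt} (hS : IsClosed S) (h : ∀ p, f p ≠ 0 → p ∈ S) (w : Pt)
    (p : Pt) (hp : dir w f p ≠ 0) : p ∈ S := by
  by_contra hps
  have : (f : Pt → ℝ) =ᶠ[nhds p] fun _ => 0 := by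
    filter_upwards [hS.isOpen_compl.mem_nhds hps] with q hq
    grind
  rw [dir_apply, this.fderiv_eq] at hp
  simp at hp

theorem CS.dir {f : SF} (hf : CS f) (w : Pt) : CS (dir w f) := by
  refine fun p hp => dir_ne_zero
    (S := {p : Pt | 1 ≤ p.1 ∧ p.2.1 ^ 2 + p.2.2 ^ 2 ≤ (p.1 - 1) ^ 2}) ?_ hf w p hp
  have h1 : IsClosed {p : Pt | 1 ≤ p.1} := isClosed_le (by fun_prop) (by fun_prop)
  have h2 : IsClosed {p : Pt | p.2.1 ^ 2 + p.2.2 ^ 2 ≤ (p.1 - 1) ^ 2} :=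
    isClosed_le (by fun_prop) (by fun_prop)
  exact h1.inter h2

theorem CS.of_zero {f g : Pt → ℝ} (hf : CS f) (h : ∀ p, f p = 0 → g p = 0) : CS g :=
  fun p hp => hf p fun h0 => hp (h p h0)

theorem CS.add {f g : Pt → ℝ} (hf : CS f) (hg : CS g) : CS (fun p => f p + g p) := by
  intro p hp
  by_cases h : f p = 0
  · exact hg p fun h' => hp (by simp [h, h'])
  · exact hf p h

theorem CS.Z {f : SF} (hf : CS f) (i : Fin 5) : CS (Z i f) := by
  fin_cases i
  · exact hf.dir _
  · exact hf.dir _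
  · exact hf.dir _
  · exact CS.add ((hf.dir (1, 0, 0)).of_zero (g := (cx * T f : SF)) fun p h => by simp [T, h])
      ((hf.dir (0, 1, 0)).of_zero (g := (ct * X f : SF)) fun p h => by simp [X, h])
  · exact CS.add ((hf.dir (1, 0, 0)).of_zero (g := (cy * T f : SF)) fun p h => by simp [T, h])
      ((hf.dir (0, 0, 1)).of_zero (g := (ct * Y f : SF)) fun p h => by simp [Y, h])

theorem CS.word {f : SF} (hf : CS f) (I : List (Fin 5)) : CS (KG.word KG.Z I f) := by
  induction I with
  | nil => exact hf
  | cons i I ih => exact ih.Z i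

/-- Points of hyperboloids inside the cone. -/
theorem cone_bounds {t x y s : ℝ} (ht : 1 ≤ t) (hr : x ^ 2 + y ^ 2 ≤ (t - 1) ^ 2)
    (hs : t ^ 2 = s + x ^ 2 + y ^ 2) : t ≤ (s + 1) / 2 := by nlinarith

theorem hy_sq' (p : Pt) : hy p ^ 2 = exp (2 * p.1) + p.2.1 ^ 2 + p.2.2 ^ 2 := by
  have := congrArg (fun f : SF => f p) hy_sq
  simp [tau2_apply] at this
  grind

theorem CS.pull {f : Pt → ℝ} (hf : CS f) : SC (fun p => f (hy p, p.2)) := by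
  intro A
  refine ⟨exp (2 * A) / 2, fun p hp hR => ?_⟩
  by_contra h0
  obtain ⟨h1, h2⟩ := hf _ h0
  have h3 := cone_bounds h1 h2 (hy_sq' p)
  have h4 : exp (2 * p.1) ≤ exp (2 * A) := exp_le_exp.2 (by grind)
  have h5 : 0 ≤ hy p - 1 := by linarith
  rcases hR with h | h
  · have := abs_le_of_sq_le_sq (a := p.2.1) (b := hy p - 1) (by nlinarith) h5
    linarith
  · have := abs_le_of_sq_le_sq (a := p.2.2) (b := hy p - 1) (by nlinarith) h5
    linarith

theorem CS.P {f : SF} (hf : CS f) : SC (P f) := hf.pull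

/-- The hyperboloidal energy identity. -/
theorem hasDerivAt_henergy (m : ℝ) {f : SF} (hf : CS f) (s : ℝ) :
    HasDerivAt (II (hdens m f))
      (II (fun p => 2 * (tau2 p * tinv p * P (T f * (box f + (m ^ 2) • f)) p)) s) s := by
  have hT : CS (T f) := hf.dir _
  have sT := hT.P
  have hd : SC (hdens m f) := by
    have h1 := (((hf.Z 3).P.sq.add (hf.Z 4).P.sq).add sT.sq).add hf.P.sq
    refine h1.of_zero fun p hp => ?_
    have a1 := sq_nonneg (KG.P (KG.Z 3 f) p)
    have a2 := sq_nonneg (KG.P (KG.Z 4 f) p)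
    have a3 := sq_nonneg (KG.P (T f) p)
    have a4 := sq_nonneg (KG.P f p)
    have b1 : KG.P (L1 f) p = 0 := pow_eq_zero_iff two_ne_zero |>.1 (show KG.P (KG.Z 3 f) p ^ 2 = 0 by linarith)
    have b2 : KG.P (L2 f) p = 0 := pow_eq_zero_iff two_ne_zero |>.1 (show KG.P (KG.Z 4 f) p ^ 2 = 0 by linarith)
    have b3 : KG.P (T f) p = 0 := by nlinarith
    have b4 : KG.P f p = 0 := by nlinarith
    rw [hdens_eq]
    simp only [SF.add_apply, SF.pow_apply, SF.mul_apply, SF.smul_apply, b1, b2, b3, b4]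
    simp
  have h := hasDerivAt_II hd s
  have h0' : SC (fun p => 2 * (tau2 p * tinv p * KG.P (T f * (box f + (m ^ 2) • f)) p)) :=
    sT.of_zero fun p hp => by rw [map_mul, SF.mul_apply, hp]; ring
  have h1 : SC ((2 : ℝ) • (tau2 * tinv * KG.P (T f * X f)) : SF) :=
    sT.of_zero fun p hp => by rw [map_mul]; simp only [SF.smul_apply, SF.mul_apply, hp]; ring
  have h2 : SC ((2 : ℝ) • (tau2 * tinv * KG.P (T f * Y f)) : SF) :=
    sT.of_zero fun p hp => by rw [map_mul]; simp only [SF.smul_apply, SF.mul_apply, hp]; ring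
  have e : II (T (hdens m f)) s
      = II (fun p => 2 * (tau2 p * tinv p * KG.P (T f * (box f + (m ^ 2) • f)) p)) s := by
    have : (T (hdens m f) : Pt → ℝ) = fun p =>
        ((2 * (tau2 p * tinv p * KG.P (T f * (box f + (m ^ 2) • f)) p))
        + X ((2 : ℝ) • (tau2 * tinv * KG.P (T f * X f))) p)
        + Y ((2 : ℝ) • (tau2 * tinv * KG.P (T f * Y f))) p := by
      ext p; rw [T_hdens]; simp
    rw [this, II_add (h0'.add h1.X) (by fun_prop) h2.Y (by fun_prop),
      II_add h0' (by fun_prop) h1.X (by fun_prop), II_X h1, II_Y h2, add_zero, add_zero]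
  rwa [e] at h

/-- The hyperboloidal Sobolev inequality. -/
theorem hsobolev {f : SF} (hf : CS f) (p : Pt) : (hy p * P f p) ^ 2 ≤ 8 *
    II (fun p => P f p ^ 2 + P (L1 f) p ^ 2 + P (L2 f) p ^ 2 + P (L2 (L1 f)) p ^ 2) p.1 := by
  have h1 : CS (L1 f) := hf.Z 3
  have h2 : CS (L2 f) := hf.Z 4
  have h3 : CS (L2 (L1 f)) := h1.Z 4
  have hg : SC (hy * P f : SF) := hf.P.of_zero fun p h => by rw [SF.mul_apply, h, mul_zero]
  have hgg : SC ((hy * P f) * (hy * P f) : SF) := hg.mul_left (hy * P f : SF)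
  have h := abs_le_II hgg p
  rw [SF.mul_apply, abs_mul_self, ← pow_two, SF.mul_apply] at h
  rw [← II_const_mul]
  have eX : X (hy * P f) = tinv * cx * P f + P (L1 f) := by
    rw [Derivation.leibniz, X_P, X_hy, smul_eq_mul, smul_eq_mul]
    linear_combination (P (L1 f)) * tinv_hy
  have eY : Y (hy * P f) = tinv * cy * P f + P (L2 f) := by
    rw [Derivation.leibniz, Y_P, Y_hy, smul_eq_mul, smul_eq_mul]
    linear_combination (P (L2 f)) * tinv_hy
  have eYX : Y (X (hy * P f)) = tinv * (-(tinv * cx) * (tinv * cy) * P f + tinv * cx * P (L2 f)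
      + P (L2 (L1 f))) := by
    rw [eX]
    simp only [map_add, Derivation.leibniz, Y_P, smul_eq_mul, derivation_tinv, Y_hy, Y_cx]
    ring
  have key : Y (X ((hy * P f) * (hy * P f))) = (2 : SF) * (P f * (-(tinv * cx) * (tinv * cy) * P f
      + tinv * cx * P (L2 f) + P (L2 (L1 f))) + (tinv * cx * P f + P (L1 f)) *
        (tinv * cy * P f + P (L2 f))) := by
    have : Y (X ((hy * P f) * (hy * P f))) = (2 : SF) * (hy * P f * Y (X (hy * P f))
        + X (hy * P f) * Y (hy * P f)) := by
      generalize hy * P f = g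
      simp
      ring
    rw [this, eYX, eX, eY]
    linear_combination (2 * (P f * (-(tinv * cx) * (tinv * cy) * P f
      + tinv * cx * P (L2 f) + P (L2 (L1 f))))) * tinv_hy
  refine h.trans (II_mono hgg.X.Y.abs (by fun_prop) ?_ (by fun_prop) fun z => ?_)
  · exact SC.mul_left (((hf.P.sq.add h1.P.sq).add h2.P.sq).add h3.P.sq) fun _ => 8
  · rw [key]
    simp only [SF.mul_apply, SF.add_apply, SF.neg_apply, SF.two_apply]
    have ha : (tinv (p.1, z) * cx (p.1, z)) ^ 2 ≤ 1 := by
      rw [tinv_apply, mul_pow, inv_pow, inv_mul_le_one₀ (pow_pos (hy_pos _) 2), hy_sq']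
      simp; nlinarith [exp_pos (2 * p.1), sq_nonneg z.2]
    have hb : (tinv (p.1, z) * cy (p.1, z)) ^ 2 ≤ 1 := by
      rw [tinv_apply, mul_pow, inv_pow, inv_mul_le_one₀ (pow_pos (hy_pos _) 2), hy_sq']
      simp; nlinarith [exp_pos (2 * p.1), sq_nonneg z.1]
    rw [sq_le_one_iff_abs_le_one] at ha hb
    generalize tinv (p.1, z) * cx (p.1, z) = a at *
    generalize tinv (p.1, z) * cy (p.1, z) = b at *
    generalize P f (p.1, z) = u at *
    generalize P (L1 f) (p.1, z) = u1 at *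
    generalize P (L2 f) (p.1, z) = u2 at *
    generalize P (L2 (L1 f)) (p.1, z) = u3 at *
    have e : 2 * (u * (-a * b * u + a * u2 + u3) + (a * u + u1) * (b * u + u2))
      = 2 * (a * (2 * (u * u2)) + u * u3 + b * (u * u1) + u1 * u2) := by ring
    have f1 : |a * (2 * (u * u2))| ≤ u ^ 2 + u2 ^ 2 := by
      rw [abs_mul]
      refine (mul_le_of_le_one_left (abs_nonneg _) ha).trans ?_
      rw [abs_le]; constructor <;> nlinarith [sq_nonneg (u + u2), sq_nonneg (u - u2)]
    have f2 : |b * (u * u1)| ≤ u ^ 2 + u1 ^ 2 := by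
      rw [abs_mul]
      refine (mul_le_of_le_one_left (abs_nonneg _) hb).trans ?_
      rw [abs_le]; constructor <;> nlinarith
    rw [abs_le] at *
    constructor <;> nlinarith [sq_nonneg (u + u3), sq_nonneg (u - u3), sq_nonneg (u1 + u2),
      sq_nonneg (u1 - u2)]

/-- A comparison principle for energies. -/
theorem energy_le {e e' : ℝ → ℝ} {s₀ s₁ K δ : ℝ} (hd : ∀ s ∈ Icc s₀ s₁, HasDerivAt e (e' s) s)
    (h0 : e s₀ ≤ (K * exp (δ * s₀)) ^ 2)
    (h : ∀ s ∈ Ico s₀ s₁, e s = (K * exp (δ * s)) ^ 2 →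
      e' s < 2 * δ * (K * exp (δ * s)) ^ 2) :
    ∀ s ∈ Icc s₀ s₁, e s ≤ (K * exp (δ * s)) ^ 2 := by
  have hB : ∀ s, HasDerivAt (fun s => (K * exp (δ * s)) ^ 2)
      (2 * δ * (K * exp (δ * s)) ^ 2) s := by
    intro s
    have h1 := ((((hasDerivAt_id s).const_mul δ).exp).const_mul K).pow 2
    refine h1.congr_deriv ?_
    simp; ring
  exact fun s hs => image_le_of_deriv_right_lt_deriv_boundary'
    (fun s hs => (hd s hs).continuousAt.continuousWithinAt)
    (fun s hs => (hd s (Ico_subset_Icc_self hs)).hasDerivWithinAt) h0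
    (fun s _ => (hB s).continuousAt.continuousWithinAt) (fun s _ => (hB s).hasDerivWithinAt) h hs

/-- Functions whose slices have good integrability. -/
def OK (g : Pt → ℝ) : Prop := SC g ∧ Continuous g

theorem OK.of_le {f g : Pt → ℝ} (hf : OK f) (hg : Continuous g) (h : ∀ p, |g p| ≤ |f p|) : OK g :=
  ⟨hf.1.of_zero fun p hp => by simpa [hp] using h p, hg⟩
theorem OK.add {f g : Pt → ℝ} (hf : OK f) (hg : OK g) : OK fun p => f p + g p :=
  ⟨hf.1.add hg.1, hf.2.add hg.2⟩
theorem OK.sum {α : Type} (s : Finset α) (f : α → Pt → ℝ) (h : ∀ a ∈ s, OK (f a)) :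
    OK (fun p => ∑ a ∈ s, f a p) :=
  ⟨SC.sum s f fun a ha => (h a ha).1, continuous_finsetSum s fun a ha => (h a ha).2⟩
theorem OK.abs {g : Pt → ℝ} (hg : OK g) : OK fun p => |g p| := ⟨hg.1.abs, hg.2.abs⟩
theorem OK.sq {g : Pt → ℝ} (hg : OK g) : OK fun p => g p ^ 2 := ⟨hg.1.sq, hg.2.pow 2⟩
theorem OK.mul_left {f g : Pt → ℝ} (hf : OK f) (hg : Continuous g) : OK fun p => g p * f p :=
  ⟨hf.1.mul_left g, hg.mul hf.2⟩
theorem OK.mul_right {f g : Pt → ℝ} (hf : OK f) (hg : Continuous g) : OK fun p => f p * g p :=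
  ⟨hf.1.mul_right g, hf.2.mul hg⟩
theorem OK.const_mul {f : Pt → ℝ} (hf : OK f) (c : ℝ) : OK fun p => c * f p :=
  hf.mul_left continuous_const

/-- The `L²` norm on a slice. -/
def nrm (g : Pt → ℝ) (s : ℝ) : ℝ := √(II (fun p => g p ^ 2) s)

theorem nrm_nonneg (g : Pt → ℝ) (s : ℝ) : 0 ≤ nrm g s := sqrt_nonneg _
theorem nrm_sq (g : Pt → ℝ) (s : ℝ) : nrm g s ^ 2 = II (fun p => g p ^ 2) s :=
  sq_sqrt (II_nonneg fun _ => sq_nonneg _)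

theorem II_mul_le_nrm {f g : Pt → ℝ} (hf : OK f) (hg : OK g) (s : ℝ) :
    II (fun p => f p * g p) s ≤ nrm f s * nrm g s := II_mul_le hf.1 hf.2 hg.1 hg.2

theorem nrm_le_of_II {g : Pt → ℝ} {s A : ℝ} (hA : 0 ≤ A) (h : II (fun p => g p ^ 2) s ≤ A ^ 2) :
    nrm g s ≤ A := sqrt_le_iff.2 ⟨hA, h⟩

theorem nrm_mono {f g : Pt → ℝ} {s : ℝ} (hf : OK f) (hg : OK g) (h : ∀ z, |f (s, z)| ≤ |g (s, z)|) :
    nrm f s ≤ nrm g s :=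
  sqrt_le_sqrt (II_mono hf.1.sq (hf.2.pow 2) hg.1.sq (hg.2.pow 2) fun z => sq_le_sq.2 (h z))

theorem nrm_const_mul (c : ℝ) (g : Pt → ℝ) (s : ℝ) : nrm (fun p => c * g p) s = |c| * nrm g s := by
  simp only [nrm, mul_pow]
  rw [II_const_mul, sqrt_mul (sq_nonneg c), sqrt_sq_eq_abs]

theorem nrm_add {f g : Pt → ℝ} (hf : OK f) (hg : OK g) (s : ℝ) :
    nrm (fun p => f p + g p) s ≤ nrm f s + nrm g s := by
  refine nrm_le_of_II (add_nonneg (nrm_nonneg _ _) (nrm_nonneg _ _)) ?_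
  have e : (fun p => (f p + g p) ^ 2) = fun p => (f p ^ 2 + 2 * (f p * g p)) + g p ^ 2 := by
    ext p; ring
  have h1 : OK fun p => 2 * (f p * g p) := (hf.mul_right hg.2).const_mul 2
  rw [e, II_add (hf.sq.add h1).1 (hf.sq.add h1).2 hg.sq.1 hg.sq.2,
    II_add hf.sq.1 hf.sq.2 h1.1 h1.2, II_const_mul, ← nrm_sq, ← nrm_sq]
  nlinarith [II_mul_le_nrm hf hg s]

theorem nrm_sum {α : Type} (S : Finset α) (f : α → Pt → ℝ) (h : ∀ a ∈ S, OK (f a)) (s : ℝ) :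
    nrm (fun p => ∑ a ∈ S, f a p) s ≤ ∑ a ∈ S, nrm (f a) s := by
  classical
  induction S using Finset.induction_on with
  | empty => simp [nrm, II]
  | insert a S ha ih =>
    simp only [Finset.sum_insert ha]
    refine (nrm_add (h a (by simp)) (OK.sum S f fun b hb => h b (by simp [hb])) s).trans ?_
    grind

theorem nrm_mul_le {f g : Pt → ℝ} {s A : ℝ} (hA : 0 ≤ A) (hf : Continuous f) (hg : OK g)
    (h : ∀ z, |f (s, z)| ≤ A) : nrm (fun p => f p * g p) s ≤ A * nrm g s := by
  rw [← abs_of_nonneg hA, ← nrm_const_mul]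
  refine nrm_mono (hg.mul_left hf) (hg.const_mul A) fun z => ?_
  rw [abs_mul, abs_mul, abs_of_nonneg hA]
  exact mul_le_mul_of_nonneg_right (h z) (abs_nonneg _)

section
variable {ι : Type} [Fintype ι] [DecidableEq ι]

theorem norm_fderiv_le (G : GF ι) (v : ι → ℝ) : ‖fderiv ℝ G.fn v‖ ≤ ∑ c, |G.pd c v| := by
  refine ContinuousLinearMap.opNorm_le_bound _ (sum_nonneg fun _ _ => abs_nonneg _) fun w => ?_
  have hw : w = ∑ c, w c • (Pi.single c (1 : ℝ) : ι → ℝ) := by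
    ext d; simp [Pi.single_apply]
  conv_lhs => rw [hw]
  rw [map_sum, sum_mul]
  refine (norm_sum_le _ _).trans (sum_le_sum fun c _ => ?_)
  rw [map_smul, norm_smul, mul_comm]
  exact mul_le_mul_of_nonneg_left (norm_le_pi_norm w c) (abs_nonneg _)

/-- All derivatives are bounded. -/
def GF.Bdd (G : GF ι) : Prop := ∀ cs : List ι, ∃ B, ∀ v, |G.pdw cs v| ≤ B

theorem GF.pdw_append (G : GF ι) (cs ds : List ι) : (G.pdw ds).pdw cs = G.pdw (cs ++ ds) := by
  induction cs with
  | nil => rfl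
  | cons c cs ih => simp [GF.pdw, ih]

theorem GF.Bdd.pd {G : GF ι} (h : G.Bdd) (c : ι) : (G.pd c).Bdd := by
  intro cs
  obtain ⟨B, hB⟩ := h (cs ++ [c])
  refine ⟨B, fun v => ?_⟩
  rw [← GF.pdw_append] at hB
  exact hB v

/-- Lipschitz bound. -/
theorem GF.abs_sub_le (G : GF ι) {r B : ℝ} (hB : ∀ v, ‖v‖ ≤ r → ∀ c, |G.pd c v| ≤ B) {v w : ι → ℝ}
    (hv : ‖v‖ ≤ r) (hw : ‖w‖ ≤ r) : |G v - G w| ≤ Fintype.card ι * B * ‖v - w‖ := by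
  refine Convex.norm_image_sub_le_of_norm_fderiv_le (𝕜 := ℝ) (f := G.fn) (s := Metric.closedBall 0 r)
    (fun x _ => G.smooth.differentiable (by simp) x) (fun x hx => ?_) (convex_closedBall 0 r)
    (by simpa using hw) (by simpa using hv)
  refine (norm_fderiv_le G x).trans ?_
  refine (sum_le_card_nsmul _ _ B fun c _ => hB x (by simpa using hx) c).trans ?_
  simp

theorem GF.Bdd.lip {G : GF ι} (h : G.Bdd) : ∃ B, 0 ≤ B ∧ ∀ v w, |G v - G w| ≤ B * ‖v - w‖ := by
  choose B hB using fun c => h [c]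
  refine ⟨Fintype.card ι * ∑ c, |B c|, by positivity, fun v w => ?_⟩
  refine G.abs_sub_le (r := max ‖v‖ ‖w‖) (fun v _ c => ?_) (le_max_left _ _) (le_max_right _ _)
  exact ((hB c v).trans (le_abs_self _)).trans
    (single_le_sum (f := fun c => |B c|) (fun _ _ => abs_nonneg _) (Finset.mem_univ c))

/-- Vanishing to second order at the origin. -/
def GF.Quad (G : GF ι) : Prop := G 0 = 0 ∧ ∀ c, G.pd c 0 = 0

theorem GF.Bdd.quad {G : GF ι} (h : G.Bdd) (hG : G.Quad) : ∃ B, 0 ≤ B ∧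
    (∀ v, |G v| ≤ B * ‖v‖ ^ 2) ∧ ∀ c v, |G.pd c v| ≤ B * ‖v‖ := by
  choose B hB0 hB using fun c => (h.pd c).lip
  have h1 : ∀ c v, |G.pd c v| ≤ (∑ c, B c) * ‖v‖ := fun c v => by
    have := hB c v 0
    rw [hG.2 c, sub_zero, sub_zero] at this
    refine this.trans (mul_le_mul_of_nonneg_right ?_ (norm_nonneg _))
    exact single_le_sum (f := B) (fun _ _ => hB0 _) (Finset.mem_univ c)
  have hS : 0 ≤ ∑ c, B c := sum_nonneg fun _ _ => hB0 _
  refine ⟨(1 + Fintype.card ι) * ∑ c, B c, by positivity, fun v => ?_, fun c v => ?_⟩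
  · have := G.abs_sub_le (r := ‖v‖) (B := (∑ c, B c) * ‖v‖) (v := v) (w := 0) (fun w hw c =>
      (h1 c w).trans (mul_le_mul_of_nonneg_left hw hS)) le_rfl (by simp)
    rw [hG.1, sub_zero, sub_zero] at this
    nlinarith
  · refine (h1 c v).trans (mul_le_mul_of_nonneg_right ?_ (norm_nonneg _))
    nlinarith

section
variable {κ : Type} [Fintype κ] [DecidableEq κ] (D : κ → Derivation ℝ SF SF)

/-- Pointwise size of a tuple. -/
def nn (U : ι → SF) (k : ℕ) (p : Pt) : ℝ := ∑ c, hk D k (U c) p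

theorem nn_nonneg (U : ι → SF) (k : ℕ) (p : Pt) : 0 ≤ nn D U k p :=
  sum_nonneg fun _ _ => hk_nonneg _ _ _ _
theorem nn_mono (U : ι → SF) (p : Pt) : Monotone fun k => nn D U k p := fun _ _ h =>
  sum_le_sum fun _ _ => hk_mono _ h _ _
theorem le_nn {k : ℕ} {J : List κ} (h : J.length ≤ k) (U : ι → SF) (c : ι) (p : Pt) :
    |word D J (U c) p| ≤ nn D U k p :=
  (le_hk D h (U c) p).trans (single_le_sum (f := fun c => hk D k (U c) p)
    (fun _ _ => hk_nonneg _ _ _ _) (Finset.mem_univ c))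
theorem norm_le_nn (U : ι → SF) (p : Pt) : ‖fun c => U c p‖ ≤ nn D U 0 p :=
  (pi_norm_le_iff_of_nonneg (nn_nonneg D U 0 p)).2 fun c => le_nn D (J := []) (by simp) U c p

theorem hk_cont (k : ℕ) (f : SF) : Continuous (hk D k f) :=
  continuous_finsetSum _ fun _ _ => (SF.cont _).abs
theorem nn_cont (U : ι → SF) (k : ℕ) : Continuous (nn D U k) :=
  continuous_finsetSum _ fun _ _ => hk_cont _ _ _

theorem abs_factors_le (U : ι → SF) (t : List (List κ × ι)) (p : Pt) :
    |factors D U t p| ≤ (t.map fun e => nn D U e.1.length p).prod := by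
  rw [factors, SF.list_prod_apply, abs_list_prod]
  exact list_prod_le_prod _ _ _ (fun _ _ => abs_nonneg _) fun e _ => le_nn D le_rfl U e.2 p

/-- Pointwise bounds for the derivatives of a quadratic nonlinearity. -/
theorem word_comp_le (hD : ∀ i, IsChain (ι := ι) (D i)) {G : GF ι} (hb : G.Bdd) (hq : G.Quad)
    (M k : ℕ) (hk : k ≤ 2 * M) : ∃ C, 0 ≤ C ∧ ∀ (U : ι → SF) (p : Pt), nn D U M p ≤ 1 →
      ∀ I : List κ, I.length ≤ k →
        |word D I (comp G U) p| ≤ C * ∑ a ∈ Finset.range (k + 1), nn D U a p * nn D U (k - a) p := by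
  obtain ⟨B0, hB0, hB1, hB2⟩ := hb.quad hq
  choose B hB using hb
  have hterm : ∀ t : List (List κ × ι), (∀ e ∈ t, e.1 ≠ []) →
      (t.map fun e => e.1.length).sum ≤ k → ∀ (U : ι → SF) (p : Pt), nn D U M p ≤ 1 →
      |term D G U t p| ≤ (B0 + |B (t.map (·.2))|) *
        ∑ a ∈ Finset.range (k + 1), nn D U a p * nn D U (k - a) p := by
    intro t ht hs U p h1
    have hn := nn_nonneg D U
    have key : ∀ a b, a + b ≤ k → nn D U a p * nn D U b p ≤
        ∑ a ∈ Finset.range (k + 1), nn D U a p * nn D U (k - a) p := by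
      intro a b hab
      refine le_trans ?_ (single_le_sum (f := fun a => nn D U a p * nn D U (k - a) p)
        (fun _ _ => mul_nonneg (hn _ _) (hn _ _)) (Finset.mem_range.2 (by omega : a < k + 1)))
      exact mul_le_mul_of_nonneg_left (nn_mono D U p (by omega)) (hn _ _)
    have hS : 0 ≤ ∑ a ∈ Finset.range (k + 1), nn D U a p * nn D U (k - a) p :=
      sum_nonneg fun _ _ => mul_nonneg (hn _ _) (hn _ _)
    have hN := norm_le_nn D U p
    rw [term, SF.mul_apply, abs_mul]
    match t with
    | [] =>
      simp only [List.map_nil, GF.pdw, factors, List.prod_nil, SF.one_apply, abs_one, mul_one,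
        comp_apply]
      refine (hB1 _).trans ?_
      calc B0 * ‖fun c => U c p‖ ^ 2 ≤ B0 * (nn D U 0 p * nn D U 0 p) := by
            rw [pow_two]
            exact mul_le_mul_of_nonneg_left (mul_self_le_mul_self (norm_nonneg _) hN) hB0
        _ ≤ B0 * _ := mul_le_mul_of_nonneg_left (key 0 0 (by omega)) hB0
        _ ≤ _ := mul_le_mul_of_nonneg_right (by linarith [abs_nonneg (B [])]) hS
    | [e] =>
      have h2 := abs_factors_le D U [e] p
      simp only [List.map_cons, List.map_nil, List.prod_cons, List.prod_nil, mul_one, List.sum_cons,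
        List.sum_nil, add_zero] at h2 hs ⊢
      calc _ ≤ (B0 * nn D U 0 p) * nn D U e.1.length p := by
            refine mul_le_mul ((hB2 e.2 _).trans (mul_le_mul_of_nonneg_left hN hB0)) h2
              (abs_nonneg _) (mul_nonneg hB0 (hn _ _))
        _ ≤ B0 * _ := by
          rw [mul_assoc]; exact mul_le_mul_of_nonneg_left (key _ _ (by omega)) hB0
        _ ≤ _ := mul_le_mul_of_nonneg_right (by linarith [abs_nonneg (B [e.2])]) hS
    | e :: e' :: t' =>
      have h2 := abs_factors_le D U (e :: e' :: t') p
      obtain ⟨a, b, hab, h3⟩ := list_prod_le_two (e :: e' :: t') (fun e => e.1.length)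
        (fun k => nn D U k p) M _ (nn_mono D U p) (fun _ => hn _ _)
        (fun a ha => (nn_mono D U p ha).trans h1) (hs.trans hk) rfl (by simp)
      calc _ ≤ |B ((e :: e' :: t').map (·.2))| * (nn D U a p * nn D U b p) :=
            mul_le_mul ((hB _ _).trans (le_abs_self _)) (h2.trans h3) (abs_nonneg _) (abs_nonneg _)
        _ ≤ |B ((e :: e' :: t').map (·.2))| * _ :=
          mul_le_mul_of_nonneg_left (key _ _ (by omega)) (abs_nonneg _)
        _ ≤ _ := by nlinarith
  refine ⟨∑ I ∈ words κ k, ((expand ι I).map fun t => B0 + |B (t.map (·.2))|).sum,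
    sum_nonneg fun I _ => list_map_sum_nonneg _ _ fun e _ => by positivity,
    fun U p h1 I hI => ?_⟩
  have hS : 0 ≤ ∑ a ∈ Finset.range (k + 1), nn D U a p * nn D U (k - a) p :=
      sum_nonneg fun _ _ => mul_nonneg (nn_nonneg D U _ _) (nn_nonneg D U _ _)
  rw [word_comp D hD]
  refine (abs_list_sum_le _ _ _).trans ((list_sum_le_of_forall _ _ _ _ fun t ht => ?_).trans
    (mul_le_mul_of_nonneg_right (single_le_sum
      (f := fun I => ((expand ι I).map fun t => B0 + |B (t.map (·.2))|).sum)
      (fun I _ => list_map_sum_nonneg _ _ fun e _ => by positivity) (mem_words.2 hI)) hS))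
  obtain ⟨h3, h4⟩ := mem_expand I t ht
  grind
end
end

abbrev Ix := Fin 2 × Option (Fin 3)

/-- The unknowns together with their first derivatives. -/
def UU (w : Fin 2 → SF) (c : Ix) : SF := c.2.elim (w c.1) fun a => dd a (w c.1)

/-- Global solutions of the system above the hyperboloid `s = s0`, supported in a cone. -/
structure Sol (m : Fin 2 → ℝ) (G : Fin 2 → GF Ix) (s0 : ℝ) (w : Fin 2 → SF) : Prop where
  cs : ∀ j, CS (w j)
  eq : ∀ j p, exp s0 - 1 < p.1 → (box (w j) + (m j ^ 2) • w j) p = comp (G j) (UU w) p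

def hp (p : Pt) : Pt := (hy p, p.2)
theorem P_hp (f : SF) (p : Pt) : P f p = f (hp p) := rfl
theorem hp_cont : Continuous hp := (hy.cont.prodMk continuous_snd)

theorem exp_le_hy (p : Pt) : exp p.1 ≤ hy p := by
  have h := hy_sq' p
  refine le_of_sq_le_sq ?_ (hy_pos p).le |>.trans le_rfl
  rw [h, ← exp_nat_mul]
  push_cast
  nlinarith

/-- The quotient `τ/t`. -/
def rho (p : Pt) : ℝ := exp p.1 * tinv p
theorem rho_cont : Continuous rho := by unfold rho; fun_prop
theorem rho_nonneg (p : Pt) : 0 ≤ rho p := by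
  unfold rho; rw [tinv_apply]; have := hy_pos p; positivity
theorem rho_le_one (p : Pt) : rho p ≤ 1 := by
  unfold rho; rw [tinv_apply, ← div_eq_mul_inv, div_le_one (hy_pos p)]; exact exp_le_hy p

theorem CS.okp {g : Pt → ℝ} (hg : CS g) (hc : Continuous g) : OK fun p => g (hp p) :=
  ⟨hg.pull, hc.comp hp_cont⟩

theorem CS.sum {α : Type} (s : Finset α) (f : α → Pt → ℝ) (h : ∀ a ∈ s, CS (f a)) :
    CS (fun p => ∑ a ∈ s, f a p) := by
  intro p hp
  obtain ⟨a, ha, h2⟩ := Finset.exists_ne_zero_of_sum_ne_zero hp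
  exact h a ha p h2

theorem CS_hk {f : SF} (hf : CS f) (k : ℕ) : CS (hk Z k f) :=
  CS.sum _ _ fun I _ => (hf.word I).of_zero fun p h => by simp [h]

theorem Sol.csU {m G s0 w} (h : Sol m G s0 w) (c : Ix) : CS (UU w c) := by
  rcases c with ⟨j, _ | a⟩
  · exact h.cs j
  · fin_cases a <;> exact (h.cs j).dir _

theorem Sol.csn {m G s0 w} (h : Sol m G s0 w) (k : ℕ) : CS (nn Z (UU w) k) :=
  CS.sum _ _ fun c _ => CS_hk (h.csU c) k

theorem Sol.okn {m G s0 w} (h : Sol m G s0 w) (k : ℕ) : OK fun p => nn Z (UU w) k (hp p) :=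
  (h.csn k).okp (nn_cont _ _ _)

theorem Sol.okw {m G s0 w} (h : Sol m G s0 w) (I j) : OK fun p => word Z I (w j) (hp p) :=
  ((h.cs j).word I).okp (SF.cont _)

theorem hdens_apply (m : ℝ) (f : SF) (p : Pt) : hdens m f p = (tinv p * L1 f (hp p)) ^ 2 +
    (tinv p * L2 f (hp p)) ^ 2 + (rho p * T f (hp p)) ^ 2 + m ^ 2 * f (hp p) ^ 2 := by
  rw [hdens_eq]
  simp only [SF.add_apply, SF.pow_apply, SF.mul_apply, SF.smul_apply, P_hp, rho, tau2_apply]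
  rw [two_mul, exp_add]; ring

theorem hdens_nonneg (m : ℝ) (f : SF) (p : Pt) : 0 ≤ hdens m f p := by
  rw [hdens_apply]; positivity

theorem abs_cx_tinv (p : Pt) : |p.2.1 * tinv p| ≤ 1 ∧ |p.2.2 * tinv p| ≤ 1 := by
  have h := hy_sq' p
  have h0 := hy_pos p
  have h1 := exp_pos (2 * p.1)
  constructor <;>
  · rw [tinv_apply, ← div_eq_mul_inv, abs_div, abs_of_pos h0, div_le_one h0]
    refine abs_le_of_sq_le_sq ?_ h0.le
    nlinarith

theorem rho_dd_sq_le (m : ℝ) (b : Fin 3) (f : SF) (p : Pt) :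
    (rho p * dd b f (hp p)) ^ 2 ≤ 2 * hdens m f p := by
  have hd := hdens_apply m f p
  have hT : hy p * tinv p = 1 := by rw [tinv_apply]; exact mul_inv_cancel₀ (hy_pos p).ne'
  have h0 := rho_nonneg p
  have h1 := rho_le_one p
  obtain ⟨hx, hy'⟩ := abs_cx_tinv p
  have key : ∀ c L A : ℝ, |c| ≤ 1 → (rho p * L - c * A) ^ 2 ≤ 2 * (L ^ 2 + A ^ 2) := by
    intro c L A hc
    have h2 : (rho p * L) ^ 2 ≤ L ^ 2 := by
      rw [mul_pow]; exact mul_le_of_le_one_left (sq_nonneg _) (pow_le_one₀ h0 h1)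
    have h3 : (c * A) ^ 2 ≤ A ^ 2 := by
      rw [mul_pow, ← sq_abs c]
      exact mul_le_of_le_one_left (sq_nonneg _) (pow_le_one₀ (abs_nonneg c) hc)
    nlinarith [sq_nonneg (rho p * L + c * A)]
  fin_cases b
  · change (rho p * T f (hp p)) ^ 2 ≤ _
    nlinarith
  · change (rho p * X f (hp p)) ^ 2 ≤ _
    have e : rho p * X f (hp p) = rho p * (tinv p * L1 f (hp p)) -
        (p.2.1 * tinv p) * (rho p * T f (hp p)) := by
      have : rho p * X f (hp p) = (hy p * tinv p) * (rho p * X f (hp p)) := by grind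
      rw [this]
      change _ = rho p * (tinv p * (p.2.1 * T f (hp p) + hy p * X f (hp p))) - _
      ring
    rw [e]
    have := key _ (tinv p * L1 f (hp p)) (rho p * T f (hp p)) hx
    nlinarith
  · change (rho p * Y f (hp p)) ^ 2 ≤ _
    have e : rho p * Y f (hp p) = rho p * (tinv p * L2 f (hp p)) -
        (p.2.2 * tinv p) * (rho p * T f (hp p)) := by
      have : rho p * Y f (hp p) = (hy p * tinv p) * (rho p * Y f (hp p)) := by grind
      rw [this]
      change _ = rho p * (tinv p * (p.2.2 * T f (hp p) + hy p * Y f (hp p))) - _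
      ring
    rw [e]
    have := key _ (tinv p * L2 f (hp p)) (rho p * T f (hp p)) hy'
    nlinarith

theorem CS_hdens {f : SF} (hf : CS f) (m : ℝ) : OK (hdens m f) := by
  refine ⟨?_, SF.cont _⟩
  have e : (hdens m f : Pt → ℝ) = fun p => (tinv p ^ 2 * P (L1 f) p) * P (L1 f) p +
    (tinv p ^ 2 * P (L2 f) p) * P (L2 f) p + (rho p ^ 2 * P (T f) p) * P (T f) p +
    (m ^ 2 * P f p) * P f p := by
    ext p; rw [hdens_apply]; simp only [P_hp]; ring
  rw [e]
  exact (((CS.P (hf.Z 3)).mul_left _).add ((CS.P (hf.Z 4)).mul_left _)).add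
    ((CS.P (hf.dir _)).mul_left _) |>.add (hf.P.mul_left _)

/-- Total energy of order `k`. -/
def En (m : Fin 2 → ℝ) (w : Fin 2 → SF) (k : ℕ) (s : ℝ) : ℝ :=
  ∑ j, ∑ I ∈ words (Fin 5) k, II (hdens (m j) (word Z I (w j))) s

theorem En_nonneg (m w k s) : 0 ≤ En m w k s :=
  sum_nonneg fun _ _ => sum_nonneg fun _ _ => II_nonneg fun _ => hdens_nonneg _ _ _
theorem II_le_En (m w j s) {k : ℕ} {I : List (Fin 5)} (h : I.length ≤ k) :
    II (hdens (m j) (word Z I (w j))) s ≤ En m w k s := by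
  refine le_trans ?_ (single_le_sum (f := fun j => ∑ I ∈ words (Fin 5) k,
    II (hdens (m j) (word Z I (w j))) s) (fun _ _ => sum_nonneg fun _ _ => II_nonneg
      fun _ => hdens_nonneg _ _ _) (Finset.mem_univ j))
  exact single_le_sum (f := fun I => II (hdens (m j) (word Z I (w j))) s)
    (fun _ _ => II_nonneg fun _ => hdens_nonneg _ _ _) (mem_words.2 h)
theorem En_mono (m w s) {k l : ℕ} (h : k ≤ l) : En m w k s ≤ En m w l s :=
  sum_le_sum fun _ _ => sum_le_sum_of_subset_of_nonneg (words_mono h)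
    fun _ _ _ => II_nonneg fun _ => hdens_nonneg _ _ _

section
variable {m : Fin 2 → ℝ} {G : Fin 2 → GF Ix} {s0 : ℝ} {w : Fin 2 → SF}

theorem Sol.nrm_dd_le (h : Sol m G s0 w) (b : Fin 3) (j s) {k : ℕ} {I : List (Fin 5)}
    (hI : I.length ≤ k) :
    nrm (fun p => rho p * dd b (word Z I (w j)) (hp p)) s ≤ 2 * √(En m w k s) := by
  refine nrm_le_of_II (by positivity) ?_
  have h1 : CS (dd b (word Z I (w j))) := by
    fin_cases b <;> exact ((h.cs j).word I).dir _
  have h2 : OK fun p => rho p * dd b (word Z I (w j)) (hp p) :=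
    (h1.okp (SF.cont _)).mul_left rho_cont
  have h3 := CS_hdens ((h.cs j).word I) (m j)
  calc _ ≤ II (fun p => 2 * hdens (m j) (word Z I (w j)) p) s :=
        II_mono h2.sq.1 h2.sq.2 (h3.const_mul 2).1 (h3.const_mul 2).2
          fun z => rho_dd_sq_le (m j) b _ _
    _ ≤ 2 * En m w k s := by
      rw [II_const_mul]; exact mul_le_mul_of_nonneg_left (II_le_En m w j s hI) (by norm_num)
    _ ≤ _ := by grind

theorem Sol.nrm_w_le (h : Sol m G s0 w) (hm : ∀ j, 0 < m j) (j s) {k : ℕ} {I : List (Fin 5)}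
    (hI : I.length ≤ k) :
    nrm (fun p => word Z I (w j) (hp p)) s ≤ (m j)⁻¹ * √(En m w k s) := by
  have hj := hm j
  refine nrm_le_of_II (by positivity) ?_
  have h3 := CS_hdens ((h.cs j).word I) (m j)
  have h2 := h.okw I j
  calc _ ≤ II (fun p => ((m j)⁻¹ ^ 2) * hdens (m j) (word Z I (w j)) p) s := by
        refine II_mono h2.sq.1 h2.sq.2 (h3.const_mul _).1 (h3.const_mul _).2 fun z => ?_
        rw [hdens_apply]
        rw [inv_pow, ← div_eq_inv_mul, le_div_iff₀ (by positivity)]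
        nlinarith
    _ ≤ (m j)⁻¹ ^ 2 * En m w k s := by
      rw [II_const_mul]; exact mul_le_mul_of_nonneg_left (II_le_En m w j s hI) (by positivity)
    _ = _ := by rw [mul_pow, sq_sqrt (En_nonneg _ _ _ _)]

theorem nn_UU_le (k : ℕ) : ∃ C, 0 ≤ C ∧ ∀ (w : Fin 2 → SF) (p : Pt), nn Z (UU w) k p ≤
    C * ∑ j, ∑ J ∈ words (Fin 5) k, (|word Z J (w j) p| + ∑ b, |dd b (word Z J (w j)) p|) := by
  obtain ⟨C, hC, h⟩ := word_dd_le k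
  refine ⟨1 + 3 * C, by positivity, fun w p => ?_⟩
  rw [nn, Fintype.sum_prod_type, mul_sum]
  refine sum_le_sum fun j _ => ?_
  rw [Fintype.sum_option, sum_add_distrib]
  have h1 : 0 ≤ ∑ J ∈ words (Fin 5) k, |word Z J (w j) p| :=
    sum_nonneg fun _ _ => abs_nonneg _
  have h2 : 0 ≤ ∑ J ∈ words (Fin 5) k, ∑ b, |dd b (word Z J (w j)) p| :=
    sum_nonneg fun _ _ => sum_nonneg fun _ _ => abs_nonneg _
  have h3 : ∑ a, hk Z k (UU w (j, some a)) p ≤ 3 * (C * ∑ J ∈ words (Fin 5) k, ∑ b,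
      |dd b (word Z J (w j)) p|) := by
    refine (sum_le_card_nsmul Finset.univ _ _ fun a _ => h a (w j) p).trans ?_
    simp
  have h4 : hk Z k (UU w (j, none)) p = ∑ J ∈ words (Fin 5) k, |word Z J (w j) p| := rfl
  nlinarith

theorem Sol.nrm_nn_le (hm : ∀ j, 0 < m j) (k : ℕ) : ∃ C, 0 ≤ C ∧ ∀ {G s0 w}, Sol m G s0 w →
    ∀ s, nrm (fun p => rho p * nn Z (UU w) k (hp p)) s ≤ C * √(En m w k s) := by
  obtain ⟨C, hC, hC'⟩ := nn_UU_le k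
  refine ⟨C * ∑ j, ∑ J ∈ words (Fin 5) k, ((m j)⁻¹ + 6), mul_nonneg hC (sum_nonneg fun j _ =>
    sum_nonneg fun _ _ => by have := hm j; positivity), fun {G s0 w} h s => ?_⟩
  have ha : ∀ j J, OK fun p => |rho p * word Z J (w j) (hp p)| := fun j J =>
    ((h.okw J j).mul_left rho_cont).abs
  have hb : ∀ j J b, OK fun p => |rho p * dd b (word Z J (w j)) (hp p)| := fun j J b => by
    have h1 : CS (dd b (word Z J (w j))) := by
      fin_cases b <;> exact ((h.cs j).word J).dir _
    exact ((h1.okp (SF.cont _)).mul_left rho_cont).abs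
  have hab : ∀ j J, OK fun p => |rho p * word Z J (w j) (hp p)| +
      ∑ b, |rho p * dd b (word Z J (w j)) (hp p)| := fun j J =>
    (ha j J).add (OK.sum _ _ fun b _ => hb j J b)
  have hS : ∀ j, OK fun p => ∑ J ∈ words (Fin 5) k, (|rho p * word Z J (w j) (hp p)| +
      ∑ b, |rho p * dd b (word Z J (w j)) (hp p)|) := fun j => OK.sum _ _ fun J _ => hab j J
  have hSS := OK.sum Finset.univ _ fun j _ => hS j
  calc _ ≤ nrm (fun p => C * ∑ j, ∑ J ∈ words (Fin 5) k, (|rho p * word Z J (w j) (hp p)| +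
        ∑ b, |rho p * dd b (word Z J (w j)) (hp p)|)) s := by
        refine nrm_mono ((h.okn k).mul_left rho_cont) (hSS.const_mul C) fun z => ?_
        rw [abs_of_nonneg (mul_nonneg (rho_nonneg _) (nn_nonneg _ _ _ _))]
        refine le_trans ?_ (le_abs_self _)
        refine (mul_le_mul_of_nonneg_left (hC' w (hp (s, z))) (rho_nonneg (s, z))).trans (le_of_eq ?_)
        simp only [abs_mul, abs_of_nonneg (rho_nonneg (s, z)), mul_sum, mul_add]
        grind
    _ ≤ C * ∑ j, ∑ J ∈ words (Fin 5) k, ((m j)⁻¹ + 6) * √(En m w k s) := by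
      rw [nrm_const_mul, abs_of_nonneg hC]
      refine mul_le_mul_of_nonneg_left ?_ hC
      refine (nrm_sum _ _ (fun j _ => hS j) s).trans (sum_le_sum fun j _ => ?_)
      refine (nrm_sum _ _ (fun J _ => hab j J) s).trans (sum_le_sum fun J hJ => ?_)
      refine (nrm_add (ha j J) (OK.sum _ _ fun b _ => hb j J b) s).trans ?_
      rw [add_mul]
      refine add_le_add ?_ ?_
      · refine le_trans ?_ (h.nrm_w_le hm j s (mem_words.1 hJ))
        refine nrm_mono (ha j J) (h.okw J j) fun z => ?_
        rw [abs_abs, abs_mul, abs_of_nonneg (rho_nonneg _)]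
        exact mul_le_of_le_one_left (abs_nonneg _) (rho_le_one _)
      · refine (nrm_sum _ _ (fun b _ => hb j J b) s).trans ?_
        refine (sum_le_card_nsmul Finset.univ _ (2 * √(En m w k s)) fun b _ => ?_).trans ?_
        · simpa only [nrm, sq_abs] using h.nrm_dd_le b j s (mem_words.1 hJ)
        · simp; linarith
    _ = _ := by simp only [mul_assoc, sum_mul]
end

theorem word_ne_zero {f : SF} {S : Set Pt} (hS : IsClosed S) (h : ∀ p, f p ≠ 0 → p ∈ S)
    (I : List (Fin 5)) : ∀ p, word Z I f p ≠ 0 → p ∈ S := by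
  induction I with
  | nil => exact h
  | cons i I ih =>
    intro p hp
    obtain ⟨c, hc⟩ := Z_eq_dd i
    rw [word_cons, hc, SF.sum_apply] at hp
    obtain ⟨b, -, hb⟩ := Finset.exists_ne_zero_of_sum_ne_zero hp
    have hb' := right_ne_zero_of_mul hb
    fin_cases b <;> exact dir_ne_zero hS ih _ p hb'

/-- The decay bootstrap assumption. -/
def Boot (w : Fin 2 → SF) (A δ s0 s1 : ℝ) : Prop := ∀ p : Pt, p.1 ∈ Icc s0 s1 → ∀ a ≤ 15,
  hy p * nn Z (UU w) a (hp p) ≤ A * exp (a * δ * p.1)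

section
variable {m : Fin 2 → ℝ} {G : Fin 2 → GF Ix} {s0 : ℝ} {w : Fin 2 → SF}

theorem Sol.src (h : Sol m G s0 w) (I : List (Fin 5)) (j : Fin 2) {p : Pt}
    (hp : exp s0 - 1 < p.1) :
    (box (word Z I (w j)) + (m j ^ 2) • word Z I (w j)) p = word Z I (comp (G j) (UU w)) p := by
  have h1 := word_ne_zero (f := box (w j) + (m j ^ 2) • w j - comp (G j) (UU w))
    (S := {p | p.1 ≤ exp s0 - 1}) (isClosed_le continuous_fst continuous_const)
    (fun p hp => by
      by_contra hc
      refine hp ?_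
      rw [SF.sub_apply, h.eq j p (not_le.1 hc), sub_self]) I p
  have h2 : word Z I (box (w j) + (m j ^ 2) • w j - comp (G j) (UU w)) p = 0 := by grind
  rw [map_sub, map_add, map_smul, ← box_word, SF.sub_apply] at h2
  linarith

theorem Sol.src_hp (h : Sol m G s0 w) (I : List (Fin 5)) (j : Fin 2) {p : Pt}
    (hs : s0 ≤ p.1) :
    (box (word Z I (w j)) + (m j ^ 2) • word Z I (w j)) (hp p) =
      word Z I (comp (G j) (UU w)) (hp p) := by
  refine h.src I j ?_
  have h1 := exp_le_hy p
  have h2 := exp_le_exp.2 hs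
  change _ < hy p
  linarith

theorem Boot.small {A δ s1 : ℝ} (hB : Boot w A δ s0 s1) (h0 : 0 ≤ s0) (hA : A ≤ 1)
    (hδ : 15 * δ ≤ 1) {p : Pt} (hp : p.1 ∈ Icc s0 s1) : nn Z (UU w) 15 (KG.hp p) ≤ 1 := by
  have h1 := hB p hp 15 le_rfl
  have h2 : exp ((15 : ℕ) * δ * p.1) ≤ exp p.1 := by
    refine exp_le_exp.2 ?_
    push_cast
    nlinarith [hp.1]
  have h3 := exp_le_hy p
  by_contra hc
  push Not at hc
  nlinarith [exp_pos ((15 : ℕ) * δ * p.1)]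

theorem CS_boxm {f : SF} (hf : CS f) (c : ℝ) : CS (box f + c • f : SF) := by
  intro p hp
  by_contra hc
  have e : ∀ v v', KG.dir v (KG.dir v' f) p = 0 := fun v v' => by
    by_contra h'; exact hc ((hf.dir v').dir v p h')
  have e0 : f p = 0 := by by_contra h'; exact hc (hf p h')
  refine hp ?_
  simp only [box, SF.add_apply, SF.sub_apply, SF.smul_apply, T, X, Y, e]
  rw [e0]; simp

theorem Sol.nrm_src_le (hm : ∀ j, 0 < m j) (hb : ∀ j, (G j).Bdd) (hq : ∀ j, (G j).Quad) (k : ℕ)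
    (hk : k ≤ 30) {δ : ℝ} (hδ : 0 ≤ δ) (hδ' : 15 * δ ≤ 1) : ∃ C, 0 ≤ C ∧
    ∀ {s0 w}, 0 ≤ s0 → Sol m G s0 w → ∀ s1 A, 0 ≤ A → A ≤ 1 → Boot w A δ s0 s1 →
    ∀ s ∈ Icc s0 s1, ∀ (I : List (Fin 5)) j, I.length ≤ k →
      nrm (fun p => exp p.1 * (box (word Z I (w j)) + (m j ^ 2) • word Z I (w j)) (hp p)) s ≤
      C * A * ∑ a ∈ Finset.range (k + 1), exp ((min a (k - a) : ℕ) * δ * s) *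
        √(En m w (max a (k - a)) s) := by
  choose C1 hC1 h1 using fun j => word_comp_le (ι := Ix) Z (fun i => isChain_Z i) (hb j) (hq j) 15 k hk
  choose C2 hC2 h2 using fun k => Sol.nrm_nn_le (m := m) hm k
  have hS2 : ∀ a ∈ Finset.range (k + 1), C2 (max a (k - a)) ≤
      ∑ a ∈ Finset.range (k + 1), C2 (max a (k - a)) := fun a ha =>
    single_le_sum (f := fun a => C2 (max a (k - a))) (fun _ _ => hC2 _) ha
  refine ⟨(∑ j, C1 j) * ∑ a ∈ Finset.range (k + 1), C2 (max a (k - a)),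
    mul_nonneg (sum_nonneg fun _ _ => hC1 _) (sum_nonneg fun _ _ => hC2 _),
    fun {s0 w} h0 h s1 A hA hA1 hB s hs I j hI => ?_⟩
  have hcs : CS (box (word Z I (w j)) + (m j ^ 2) • word Z I (w j) : SF) :=
    CS_boxm ((h.cs j).word I) _
  have hl : OK fun p => exp p.1 *
      (box (word Z I (w j)) + (m j ^ 2) • word Z I (w j)) (hp p) :=
    (hcs.okp (SF.cont _)).mul_left (by fun_prop)
  set g : ℕ → Pt → ℝ := fun a p => (hy p * nn Z (UU w) (min a (k - a)) (hp p)) *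
    (rho p * nn Z (UU w) (max a (k - a)) (hp p)) with hg
  have hgc : ∀ a, Continuous fun p => hy p * nn Z (UU w) a (hp p) := fun a =>
    hy.cont.mul ((nn_cont _ _ _).comp hp_cont)
  have hr : ∀ a, OK fun p => rho p * nn Z (UU w) a (hp p) := fun a => (h.okn a).mul_left rho_cont
  have hgo : ∀ a, OK (g a) := fun a => (hr _).mul_left (hgc _)
  have hgs : OK fun p => ∑ a ∈ Finset.range (k + 1), g a p := OK.sum _ _ fun a _ => hgo a
  have hn := fun k p => nn_nonneg Z (UU w) k p
  calc _ ≤ nrm (fun p => C1 j * ∑ a ∈ Finset.range (k + 1), g a p) s := by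
        refine nrm_mono hl (hgs.const_mul _) fun z => ?_
        rw [h.src_hp I j hs.1]
        refine le_trans ?_ (le_abs_self _)
        rw [abs_mul, abs_of_pos (exp_pos _)]
        refine (mul_le_mul_of_nonneg_left (h1 j (UU w) (hp (s, z)) (hB.small h0 hA1 hδ' hs) I hI)
          (exp_pos _).le).trans (le_of_eq ?_)
        rw [mul_left_comm, mul_sum]
        congr 1
        refine sum_congr rfl fun a _ => ?_
        have e1 : nn Z (UU w) a (hp (s, z)) * nn Z (UU w) (k - a) (hp (s, z)) =
          nn Z (UU w) (min a (k - a)) (hp (s, z)) * nn Z (UU w) (max a (k - a)) (hp (s, z)) := by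
          grind
        have hT : hy (s, z) * tinv (s, z) = 1 := by
          rw [tinv_apply]; exact mul_inv_cancel₀ (hy_pos _).ne'
        rw [e1, hg]
        simp only [rho]
        linear_combination (-(exp s) * (nn Z (UU w) (min a (k - a)) (hp (s, z)) *
          nn Z (UU w) (max a (k - a)) (hp (s, z)))) * hT
    _ ≤ C1 j * ∑ a ∈ Finset.range (k + 1), (A * exp ((min a (k - a) : ℕ) * δ * s)) *
        (C2 (max a (k - a)) * √(En m w (max a (k - a)) s)) := by
      rw [nrm_const_mul, abs_of_nonneg (hC1 j)]
      refine mul_le_mul_of_nonneg_left ?_ (hC1 j)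
      refine (nrm_sum _ _ (fun a _ => hgo a) s).trans (sum_le_sum fun a ha => ?_)
      refine (nrm_mul_le (A := A * exp ((min a (k - a) : ℕ) * δ * s)) (by positivity) (hgc _) (hr _)
        fun z => ?_).trans (mul_le_mul_of_nonneg_left (h2 _ h s) (by positivity))
      rw [abs_of_nonneg (mul_nonneg (hy_pos _).le (hn _ _))]
      exact hB (s, z) hs (min a (k - a)) (by omega)
    _ ≤ (∑ j, C1 j) * ∑ a ∈ Finset.range (k + 1), (A * exp ((min a (k - a) : ℕ) * δ * s)) *
        ((∑ a ∈ Finset.range (k + 1), C2 (max a (k - a))) * √(En m w (max a (k - a)) s)) := by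
      refine mul_le_mul (single_le_sum (f := C1) (fun _ _ => hC1 _) (Finset.mem_univ j))
        (sum_le_sum fun a ha => mul_le_mul_of_nonneg_left (mul_le_mul_of_nonneg_right
          (hS2 a ha) (sqrt_nonneg _)) (by positivity)) (sum_nonneg fun a _ => ?_)
        (sum_nonneg fun _ _ => hC1 _)
      have := hC2 (max a (k - a))
      positivity
    _ = _ := by
      rw [mul_assoc, mul_assoc]
      generalize (∑ a ∈ Finset.range (k + 1), C2 (max a (k - a)) : ℝ) = S
      congr 1
      simp only [mul_sum]
      grind

theorem exists_bound (f : ℕ → ℝ) (n : ℕ) : ∃ S, 0 ≤ S ∧ ∀ k ≤ n, f k ≤ S :=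
  ⟨∑ k ∈ Finset.range (n + 1), |f k|, sum_nonneg fun _ _ => abs_nonneg _, fun k hk =>
    (le_abs_self _).trans (single_le_sum (f := fun k => |f k|) (fun _ _ => abs_nonneg _)
      (Finset.mem_range.2 (by omega)))⟩

theorem Sol.hasDerivAt_En (h : Sol m G s0 w) (k : ℕ) (s : ℝ) : HasDerivAt (En m w k)
    (∑ j, ∑ I ∈ words (Fin 5) k, II (fun p => 2 * (tau2 p * tinv p * P (T (word Z I (w j)) *
      (box (word Z I (w j)) + (m j ^ 2) • word Z I (w j))) p)) s) s :=
  HasDerivAt.fun_sum fun j _ => HasDerivAt.fun_sum fun I _ =>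
    hasDerivAt_henergy (m j) ((h.cs j).word I) s

theorem energy_growth (hm : ∀ j, 0 < m j) (hb : ∀ j, (G j).Bdd) (hq : ∀ j, (G j).Quad)
    {δ : ℝ} (hδ : 0 < δ) (hδ' : 15 * δ ≤ 1) : ∃ A0 > 0, ∀ {s0 w}, 0 ≤ s0 → Sol m G s0 w →
    ∀ s1 A K, 0 ≤ A → A ≤ A0 → 0 < K → Boot w A δ s0 s1 → En m w 30 s0 ≤ K ^ 2 →
    ∀ k ≤ 30, ∀ s ∈ Icc s0 s1, En m w k s ≤ (K * exp ((k + 1) * δ * s)) ^ 2 := by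
  choose! C hC0 hC using fun k (hk : k ≤ 30) => Sol.nrm_src_le hm hb hq k hk hδ.le hδ'
  obtain ⟨S, hS1, hS⟩ : ∃ S, 0 ≤ S ∧ ∀ k ≤ 30, 4 * (words (Fin 5) k).card * C k ≤ S :=
    exists_bound (fun k => 4 * (words (Fin 5) k).card * C k) 30
  refine ⟨min 1 (δ / (1 + S)), by positivity, fun {s0 w} h0 h s1 A K hA hA0 hK hB hE k => ?_⟩
  have hA1 := hA0.trans (min_le_left _ _)
  have hAS : S * A < δ := by
    have := hA0.trans (min_le_right _ _)
    rw [le_div_iff₀ (by positivity)] at this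
    nlinarith
  induction k using Nat.strong_induction_on with
  | _ k ih =>
  intro hk
  refine energy_le (fun s _ => h.hasDerivAt_En k s) ?_ fun s hs hE' => ?_
  · refine (En_mono _ _ _ hk).trans (hE.trans ?_)
    refine pow_le_pow_left₀ hK.le (le_mul_of_one_le_right hK.le (one_le_exp ?_)) 2
    positivity
  · set Yk := K * exp ((k + 1) * δ * s) with hY
    have hY0 : 0 < Yk := by positivity
    have hs' : s ∈ Icc s0 s1 := ⟨hs.1, hs.2.le⟩
    have hsq : √(En m w k s) = Yk := by rw [hE', sqrt_sq hY0.le]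
    have hsum : ∑ a ∈ Finset.range (k + 1), exp ((min a (k - a) : ℕ) * δ * s) *
        √(En m w (max a (k - a)) s) ≤ (k + 1) * Yk := by
      refine (sum_le_card_nsmul _ _ Yk fun a ha => ?_).trans (by simp)
      have hak : a ≤ k := by grind
      have h1 : √(En m w (max a (k - a)) s) ≤ K * exp (((max a (k - a) : ℕ) + 1) * δ * s) := by
        rcases (show max a (k - a) ≤ k by omega).eq_or_lt with h' | h'
        · rw [h', hsq]
        · exact sqrt_le_iff.2 ⟨by positivity, ih _ h' (by omega) s hs'⟩
      refine (mul_le_mul_of_nonneg_left h1 (exp_pos _).le).trans (le_of_eq ?_)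
      rw [mul_left_comm, ← exp_add, hY]
      congr 2
      have h2 : ((min a (k - a) : ℕ) : ℝ) + (max a (k - a) : ℕ) = k := by
        rw [← Nat.cast_add]; congr 1; omega
      grind
    have hterm : ∀ j, ∀ I ∈ words (Fin 5) k, II (fun p => 2 * (tau2 p * tinv p *
        P (T (word Z I (w j)) * (box (word Z I (w j)) + (m j ^ 2) • word Z I (w j))) p)) s ≤
        4 * (C k * A * ((k + 1) * Yk)) * Yk := by
      intro j I hI
      have hI' := mem_words.1 hI
      have e : (fun p => 2 * (tau2 p * tinv p *
          P (T (word Z I (w j)) * (box (word Z I (w j)) + (m j ^ 2) • word Z I (w j))) p)) =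
          fun p => 2 * ((rho p * dd 0 (word Z I (w j)) (hp p)) * (exp p.1 *
          (box (word Z I (w j)) + (m j ^ 2) • word Z I (w j)) (hp p))) := by
        ext p
        rw [P_hp, SF.mul_apply, tau2_apply, two_mul p.1, exp_add, rho]
        change _ = 2 * ((_ * T (word Z I (w j)) (hp p)) * _)
        ring
      have hf := (h.cs j).word I
      have o1 : OK fun p => rho p * dd 0 (word Z I (w j)) (hp p) :=
        (CS.okp (g := T (word Z I (w j))) (hf.dir _) (SF.cont _)).mul_left rho_cont
      have o2 : OK fun p => exp p.1 *
          (box (word Z I (w j)) + (m j ^ 2) • word Z I (w j)) (hp p) :=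
        ((CS_boxm hf _).okp (SF.cont _)).mul_left (by fun_prop)
      rw [e, II_const_mul]
      have h1 := II_mul_le_nrm o1 o2 s
      have h2 := h.nrm_dd_le 0 j s hI'
      have h3 := (hC k hk h0 h s1 A hA hA1 hB s hs' I j hI').trans
        (mul_le_mul_of_nonneg_left hsum (mul_nonneg (hC0 k hk) hA))
      rw [hsq] at h2
      have h4 := mul_le_mul h2 h3 (nrm_nonneg _ _) (by positivity)
      linarith
    calc _ ≤ ∑ j : Fin 2, ∑ I ∈ words (Fin 5) k, 4 * (C k * A * ((k + 1) * Yk)) * Yk :=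
          sum_le_sum fun j _ => sum_le_sum fun I hI => hterm j I hI
      _ = 2 * (k + 1) * ((4 * (words (Fin 5) k).card * C k) * A) * Yk ^ 2 := by simp; ring
      _ ≤ 2 * (k + 1) * (S * A) * Yk ^ 2 := by
        have := hS k hk
        gcongr
      _ < _ := by
        have : 2 * (k + 1) * (S * A) < 2 * ((k + 1) * δ) := by nlinarith
        gcongr
end

/-- Pointwise size of the solution. -/
def hs (w : Fin 2 → SF) (k : ℕ) (p : Pt) : ℝ := ∑ j, hk Z k (w j) p

theorem hs_nonneg (w k p) : 0 ≤ hs w k p := sum_nonneg fun _ _ => hk_nonneg _ _ _ _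
theorem hs_mono (w p) {k l : ℕ} (h : k ≤ l) : hs w k p ≤ hs w l p :=
  sum_le_sum fun _ _ => hk_mono _ h _ _
theorem le_hs (w p j) {k : ℕ} {I : List (Fin 5)} (h : I.length ≤ k) :
    |word Z I (w j) p| ≤ hs w k p :=
  (le_hk Z h (w j) p).trans (single_le_sum (f := fun j => hk Z k (w j) p)
    (fun _ _ => hk_nonneg _ _ _ _) (Finset.mem_univ j))
theorem hs_le (w p) {k : ℕ} {A : ℝ} (h : ∀ j, ∀ I : List (Fin 5), I.length ≤ k → |word Z I (w j) p| ≤ A) :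
    hs w k p ≤ 2 * ((words (Fin 5) k).card * A) := by
  refine (sum_le_card_nsmul _ _ ((words (Fin 5) k).card * A) fun j _ => ?_).trans (by simp)
  refine (sum_le_card_nsmul _ _ A fun I hI => h j I (mem_words.1 hI)).trans (by simp)

theorem nn_le_hs (k : ℕ) : ∃ C, 0 ≤ C ∧ ∀ w p, nn Z (UU w) k p ≤ C * hs w (k + 1) p := by
  refine ⟨Fintype.card Ix * (words (Fin 5) k).card, by positivity, fun w p => ?_⟩
  have key : ∀ c, ∀ I ∈ words (Fin 5) k, |word Z I (UU w c) p| ≤ hs w (k + 1) p := by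
    rintro ⟨j, _ | a⟩ I hI
    · exact le_hs w p j ((mem_words.1 hI).trans (by omega))
    · have e : ∃ i : Fin 5, dd a (w j) = Z i (w j) := by
        fin_cases a
        · exact ⟨0, rfl⟩
        · exact ⟨1, rfl⟩
        · exact ⟨2, rfl⟩
      obtain ⟨i, hi⟩ := e
      have := le_hs w p j (k := k + 1) (I := I ++ [i]) (by simpa using mem_words.1 hI)
      rwa [word_append, word_cons, word_nil, ← hi] at this
  refine (sum_le_card_nsmul _ _ ((words (Fin 5) k).card * hs w (k + 1) p) fun c _ => ?_).trans ?_
  · refine (sum_le_card_nsmul _ _ (hs w (k + 1) p) fun I hI => key c I hI).trans (by simp)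
  · simp [mul_assoc]

/-- The quotient `t/τ`. -/
def om (p : Pt) : ℝ := hy p * exp (-p.1)
theorem om_pos (p : Pt) : 0 < om p := mul_pos (hy_pos p) (exp_pos _)
/-- Geometry of the support. -/
theorem CS.geom {f : Pt → ℝ} (hf : CS f) {p : Pt} (h : f (hp p) ≠ 0) :
    1 ≤ hy p ∧ hy p ≤ exp (2 * p.1) ∧ om p ^ 2 ≤ hy p := by
  obtain ⟨h1, h2⟩ := hf _ h
  change 1 ≤ hy p at h1
  change p.2.1 ^ 2 + p.2.2 ^ 2 ≤ (hy p - 1) ^ 2 at h2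
  have h3 := hy_sq' p
  have h4 : hy p ≤ exp (2 * p.1) := by nlinarith
  refine ⟨h1, h4, ?_⟩
  have e : om p ^ 2 = hy p ^ 2 / exp (2 * p.1) := by
    rw [om, mul_pow, ← exp_nat_mul, div_eq_mul_inv, ← exp_neg]
    simp
  rw [e, div_le_iff₀ (exp_pos _), pow_two]
  gcongr

theorem gain_box {f : SF} (hf : CS f) (p : Pt) (h : f (hp p) ≠ 0) :
    om p ^ 2 * |box f (hp p)| ≤ |T (T f) (hp p)| + |L1 (X f) (hp p)| + |L2 (Y f) (hp p)| +
      |L1 (T f) (hp p)| + |L2 (T f) (hp p)| := by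
  obtain ⟨h1, h2, -⟩ := hf.geom h
  have h3 := hy_sq' p
  have hE := exp_pos (2 * p.1)
  set E := exp (2 * p.1) with hEd
  have e : om p ^ 2 = hy p ^ 2 / E := by
    rw [om, mul_pow, ← exp_nat_mul, div_eq_mul_inv, hEd, ← exp_neg]
    simp
  have hx : |p.2.1| ≤ hy p := abs_le_of_sq_le_sq (by nlinarith) (hy_pos p).le
  have hy' : |p.2.2| ≤ hy p := abs_le_of_sq_le_sq (by nlinarith) (hy_pos p).le
  have key : om p ^ 2 * box f (hp p) = T (T f) (hp p) - (hy p / E) * L1 (X f) (hp p) -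
      (hy p / E) * L2 (Y f) (hp p) + (p.2.1 / E) * L1 (T f) (hp p) +
      (p.2.2 / E) * L2 (T f) (hp p) := by
    simp only [box, L1_eq, L2_eq, XT, YT, SF.add_apply, SF.sub_apply, SF.mul_apply]
    have c1 : (ct (hp p) : ℝ) = hy p := rfl
    have c2 : (cx (hp p) : ℝ) = p.2.1 := rfl
    have c3 : (cy (hp p) : ℝ) = p.2.2 := rfl
    grind
  have e2 : om p ^ 2 * |box f (hp p)| = |om p ^ 2 * box f (hp p)| := by simp
  have b : ∀ c v : ℝ, |c| ≤ hy p → |(c / E) * v| ≤ |v| := fun c v hc => by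
    rw [abs_mul, abs_div, abs_of_pos hE]
    exact mul_le_of_le_one_left (abs_nonneg _) ((div_le_one hE).2 (hc.trans h2))
  have b0 := le_of_eq (abs_of_pos (hy_pos p))
  rw [e2, key]
  have b1 := b (hy p) (L1 (X f) (hp p)) b0
  have b2 := b (hy p) (L2 (Y f) (hp p)) b0
  have b3 := b p.2.1 (L1 (T f) (hp p)) hx
  have b4 := b p.2.2 (L2 (T f) (hp p)) hy'
  refine (abs_add_le _ _).trans ((add_le_add ((abs_add_le _ _).trans (add_le_add ((abs_sub _ _).trans
    (add_le_add ((abs_sub _ _).trans (add_le_add le_rfl b1)) b2)) b3)) b4).trans (le_of_eq ?_))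
  ring

section
variable {m : Fin 2 → ℝ} {G : Fin 2 → GF Ix} {s0 : ℝ} {w : Fin 2 → SF}

theorem Sol.sob (hm : ∀ j, 0 < m j) (k : ℕ) : ∃ C, 0 ≤ C ∧ ∀ {G s0 w}, Sol m G s0 w →
    ∀ p : Pt, hy p * hs w k (hp p) ≤ C * √(En m w (k + 2) p.1) := by
  refine ⟨2 * ((words (Fin 5) k).card * ∑ j, 6 * (m j)⁻¹), mul_nonneg (by norm_num) (mul_nonneg
    (by positivity) (sum_nonneg fun j _ => by have := hm j; positivity)), fun {G s0 w} h p => ?_⟩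
  have hM : ∀ j ∈ Finset.univ, 0 ≤ 6 * (m j)⁻¹ := fun j _ => by have := hm j; positivity
  have hh := hy_pos p
  have key : ∀ j, ∀ I : List (Fin 5), I.length ≤ k →
      |word Z I (w j) (hp p)| ≤ (hy p)⁻¹ * ((∑ j, 6 * (m j)⁻¹) * √(En m w (k + 2) p.1)) := by
    intro j I hI
    set f := word Z I (w j) with hf
    have hcs : CS f := (h.cs j).word I
    have h1 := hsobolev hcs p
    have o : ∀ J : List (Fin 5), J.length ≤ 2 → ∃ g : SF, g = word Z J f ∧
        OK (fun p => P g p ^ 2) ∧ II (fun p => P g p ^ 2) p.1 ≤ ((m j)⁻¹) ^ 2 * En m w (k + 2) p.1 := by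
      intro J hJ
      refine ⟨_, rfl, ((hcs.word J).okp (SF.cont _)).sq, ?_⟩
      rw [hf, ← word_append]
      have := h.nrm_w_le hm j p.1 (k := k + 2) (I := J ++ I) (by simp; omega)
      have h2 := pow_le_pow_left₀ (nrm_nonneg _ _) this 2
      rw [nrm_sq, mul_pow, sq_sqrt (En_nonneg _ _ _ _)] at h2
      exact h2
    obtain ⟨g0, e0, o0, b0⟩ := o [] (by simp)
    obtain ⟨g1, e1, o1, b1⟩ := o [3] (by simp)
    obtain ⟨g2, e2, o2, b2⟩ := o [4] (by simp)
    obtain ⟨g3, e3, o3, b3⟩ := o [4, 3] (by simp)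
    have d0 : f = g0 := by rw [e0]; rfl
    have d1 : L1 f = g1 := by rw [e1]; rfl
    have d2 : L2 f = g2 := by rw [e2]; rfl
    have d3 : L2 (L1 f) = g3 := by rw [e3]; rfl
    rw [d3, d2, d1, d0] at h1
    rw [II_add ((o0.add o1).add o2).1 ((o0.add o1).add o2).2 o3.1 o3.2,
      II_add (o0.add o1).1 (o0.add o1).2 o2.1 o2.2, II_add o0.1 o0.2 o1.1 o1.2] at h1
    have h3 : (hy p * P g0 p) ^ 2 ≤ (6 * (m j)⁻¹ * √(En m w (k + 2) p.1)) ^ 2 := by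
      rw [mul_pow _ (√_), sq_sqrt (En_nonneg _ _ _ _), mul_pow]
      nlinarith
    have h4 := abs_le_of_sq_le_sq h3 (mul_nonneg (hM j (Finset.mem_univ _)) (sqrt_nonneg _))
    rw [abs_mul, abs_of_pos hh] at h4
    rw [d0, ← div_eq_inv_mul, le_div_iff₀ hh, mul_comm]
    exact h4.trans (mul_le_mul_of_nonneg_right (single_le_sum (f := fun j => 6 * (m j)⁻¹) hM
      (Finset.mem_univ j)) (sqrt_nonneg _))
  have := mul_le_mul_of_nonneg_left (hs_le w (hp p) key) hh.le
  refine this.trans (le_of_eq ?_)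
  field_simp

theorem Sol.gain (hm : ∀ j, 0 < m j) (hb : ∀ j, (G j).Bdd) (hq : ∀ j, (G j).Quad) {δ : ℝ}
    (hδ : 0 ≤ δ) (hδ' : 15 * δ ≤ 1) (k : ℕ) (hk : k ≤ 30) : ∃ C, 0 ≤ C ∧ ∀ {s0 w}, 0 ≤ s0 →
    Sol m G s0 w → ∀ s1 A, 0 ≤ A → A ≤ 1 → Boot w A δ s0 s1 → ∀ p : Pt, p.1 ∈ Icc s0 s1 →
    om p ^ 2 * hs w k (hp p) ≤ C * exp (15 * δ * p.1) * hs w (k + 2) (hp p) := by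
  choose C1 hC1 h1 using fun j => word_comp_le (ι := Ix) Z (fun i => isChain_Z i) (hb j) (hq j) 15 k hk
  obtain ⟨C2, hC2, h2⟩ := nn_le_hs k
  have hB : ∀ j ∈ Finset.univ, 0 ≤ (m j ^ 2)⁻¹ * (5 + C1 j * (k + 1) * C2) := fun j _ => by
    have := hC1 j; positivity
  refine ⟨2 * ((words (Fin 5) k).card * ∑ j, (m j ^ 2)⁻¹ * (5 + C1 j * (k + 1) * C2)),
    mul_nonneg (by norm_num) (mul_nonneg (by positivity) (sum_nonneg hB)),
    fun {s0 w} h0 h s1 A hA hA1 hBt p hp' => ?_⟩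
  have hh := hs_nonneg w (k + 2) (hp p)
  have hom := om_pos p
  have hE : 1 ≤ exp (15 * δ * p.1) := one_le_exp (by
    have := h0.trans hp'.1; positivity)
  set E := exp (15 * δ * p.1) with hEd
  have key : ∀ j, ∀ I : List (Fin 5), I.length ≤ k → |word Z I (w j) (hp p)| ≤
      (om p ^ 2)⁻¹ * ((∑ j, (m j ^ 2)⁻¹ * (5 + C1 j * (k + 1) * C2)) * (E * hs w (k + 2) (hp p))) := by
    intro j I hI
    set f := word Z I (w j) with hf
    have hcs : CS f := (h.cs j).word I
    rw [← div_eq_inv_mul, le_div_iff₀ (by positivity)]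
    have hmj := hm j
    by_cases hz : f (hp p) = 0
    · rw [hz, abs_zero, zero_mul]
      exact mul_nonneg (sum_nonneg hB) (by positivity)
    obtain ⟨t1, t2, t3⟩ := hcs.geom hz
    have g1 := gain_box hcs p hz
    have o : ∀ J : List (Fin 5), J.length ≤ 2 → |word Z J f (hp p)| ≤ hs w (k + 2) (hp p) := by
      intro J hJ
      rw [hf, ← word_append]
      exact le_hs w _ j (by simp; omega)
    have o1 := o [0, 0] (by simp)
    have o2 := o [3, 1] (by simp)
    have o3 := o [4, 2] (by simp)
    have o4 := o [3, 0] (by simp)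
    have o5 := o [4, 0] (by simp)
    have g2 : om p ^ 2 * |box f (hp p)| ≤ 5 * hs w (k + 2) (hp p) := by
      refine g1.trans ?_
      change |T (T f) (hp p)| ≤ _ at o1
      change |L1 (X f) (hp p)| ≤ _ at o2
      change |L2 (Y f) (hp p)| ≤ _ at o3
      change |L1 (T f) (hp p)| ≤ _ at o4
      change |L2 (T f) (hp p)| ≤ _ at o5
      linarith
    have g3 : om p ^ 2 * |word Z I (comp (G j) (UU w)) (hp p)| ≤
        C1 j * (k + 1) * C2 * (E * hs w (k + 2) (hp p)) := by
      have b1 := h1 j (UU w) (hp p) (hBt.small h0 hA1 hδ' hp') I hI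
      have hn := fun k => nn_nonneg Z (UU w) k (hp p)
      have b2 : ∑ a ∈ Finset.range (k + 1), nn Z (UU w) a (hp p) * nn Z (UU w) (k - a) (hp p) ≤
          (k + 1) * (nn Z (UU w) 15 (hp p) * nn Z (UU w) k (hp p)) := by
        refine (sum_le_card_nsmul _ _ (nn Z (UU w) 15 (hp p) * nn Z (UU w) k (hp p))
          fun a ha => ?_).trans (by simp)
        have hmo := nn_mono Z (UU w) (hp p)
        have hak : a ≤ k := by grind
        rcases le_total a 15 with h' | h'
        · exact mul_le_mul (hmo h') (hmo (by omega)) (hn _) (hn _)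
        · rw [mul_comm]
          exact mul_le_mul (hmo (by omega)) (hmo hak) (hn _) (hn _)
      have b3 : om p ^ 2 * nn Z (UU w) 15 (hp p) ≤ E := by
        have := hBt p hp' 15 le_rfl
        refine (mul_le_mul_of_nonneg_right t3 (hn _)).trans (this.trans ?_)
        exact mul_le_of_le_one_left (by positivity) hA1
      have b4 := (h2 w (hp p)).trans (mul_le_mul_of_nonneg_left
        (hs_mono w (hp p) (by omega : k + 1 ≤ k + 2)) hC2)
      calc _ ≤ om p ^ 2 * (C1 j * ((k + 1) * (nn Z (UU w) 15 (hp p) * nn Z (UU w) k (hp p)))) :=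
            mul_le_mul_of_nonneg_left (b1.trans (mul_le_mul_of_nonneg_left b2 (hC1 j))) (sq_nonneg _)
        _ = C1 j * (k + 1) * ((om p ^ 2 * nn Z (UU w) 15 (hp p)) * nn Z (UU w) k (hp p)) := by ring
        _ ≤ C1 j * (k + 1) * (E * (C2 * hs w (k + 2) (hp p))) := by
          have := hC1 j
          exact mul_le_mul_of_nonneg_left (mul_le_mul b3 b4 (hn _) (by positivity)) (by positivity)
        _ = _ := by ring
    have g4 : m j ^ 2 * f (hp p) = word Z I (comp (G j) (UU w)) (hp p) - box f (hp p) := by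
      have := h.src_hp I j hp'.1
      rw [SF.add_apply, SF.smul_apply] at this
      linarith
    have g5 : |f (hp p)| * om p ^ 2 ≤ ((m j ^ 2)⁻¹ * (5 + C1 j * (k + 1) * C2)) *
        (E * hs w (k + 2) (hp p)) := by
      rw [mul_assoc, ← div_eq_inv_mul, le_div_iff₀ (by positivity)]
      have e : |f (hp p)| * om p ^ 2 * m j ^ 2 =
          om p ^ 2 * |word Z I (comp (G j) (UU w)) (hp p) - box f (hp p)| := by
        grind
      have := mul_le_mul_of_nonneg_left (abs_sub (word Z I (comp (G j) (UU w)) (hp p)) (box f (hp p)))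
        (sq_nonneg (om p))
      have h6 : hs w (k + 2) (hp p) ≤ E * hs w (k + 2) (hp p) := le_mul_of_one_le_left hh hE
      linarith
    exact g5.trans (mul_le_mul_of_nonneg_right (single_le_sum hB (Finset.mem_univ j))
      (by positivity))
  have := mul_le_mul_of_nonneg_left (hs_le w (hp p) key) (sq_nonneg (om p))
  generalize (∑ j, (m j ^ 2)⁻¹ * (5 + C1 j * (k + 1) * C2) : ℝ) = S at this ⊢
  refine this.trans (le_of_eq ?_)
  field_simp
end

/-- The bootstrap situation on `[s0, s1]`. -/
structure BS (m : Fin 2 → ℝ) (G : Fin 2 → GF Ix) (δ s0 s1 A K : ℝ) (w : Fin 2 → SF) : Prop where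
  s0_nonneg : 0 ≤ s0
  sol : Sol m G s0 w
  A_nonneg : 0 ≤ A
  A_le : A ≤ 1
  K_nonneg : 0 ≤ K
  boot : Boot w A δ s0 s1
  en : ∀ k ≤ 30, ∀ s ∈ Icc s0 s1, √(En m w k s) ≤ K * exp ((k + 1) * δ * s)

section
variable {m : Fin 2 → ℝ} {G : Fin 2 → GF Ix}

theorem decay_gain (hm : ∀ j, 0 < m j) (hb : ∀ j, (G j).Bdd) (hq : ∀ j, (G j).Quad) {δ : ℝ}
    (hδ : 0 ≤ δ) (hδ' : 15 * δ ≤ 1) (q : ℕ) : ∀ k, k + 2 * q + 2 ≤ 30 → ∃ C, 0 ≤ C ∧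
    ∀ {s0 s1 A K w}, BS m G δ s0 s1 A K w → ∀ p : Pt, p.1 ∈ Icc s0 s1 →
    hy p * om p ^ (2 * q) * hs w k (hp p) ≤ C * K * exp ((31 + 15 * q) * δ * p.1) := by
  induction q with
  | zero =>
    intro k hk
    obtain ⟨C, hC, h⟩ := Sol.sob hm k
    refine ⟨C, hC, fun {s0 s1 A K w} B p hp' => ?_⟩
    rw [mul_zero, pow_zero, mul_one, mul_assoc]
    refine (h B.sol p).trans (mul_le_mul_of_nonneg_left ((B.en _ (by omega) _ hp').trans ?_) hC)
    refine mul_le_mul_of_nonneg_left (exp_le_exp.2 ?_) B.K_nonneg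
    have h0 := B.s0_nonneg.trans hp'.1
    have hk' : (((k + 2 : ℕ) : ℝ) + 1) ≤ 31 + 15 * ((0 : ℕ) : ℝ) := by
      have : ((k + 2 : ℕ) : ℝ) ≤ 30 := by exact_mod_cast (by omega : k + 2 ≤ 30)
      grind
    gcongr
  | succ q ih =>
    intro k hk
    obtain ⟨C, hC, h⟩ := ih (k + 2) (by omega)
    obtain ⟨C', hC', h'⟩ := Sol.gain hm hb hq hδ hδ' k (by omega)
    refine ⟨C' * C, mul_nonneg hC' hC, fun {s0 s1 A K w} B p hp' => ?_⟩
    have h1 := h B p hp'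
    have h2 := h' B.s0_nonneg B.sol s1 A B.A_nonneg B.A_le B.boot p hp'
    have h3 := hy_pos p
    have h4 := om_pos p
    calc _ = (hy p * om p ^ (2 * q)) * (om p ^ 2 * hs w k (hp p)) := by ring
      _ ≤ (hy p * om p ^ (2 * q)) * (C' * exp (15 * δ * p.1) * hs w (k + 2) (hp p)) :=
        mul_le_mul_of_nonneg_left h2 (by positivity)
      _ = C' * exp (15 * δ * p.1) * (hy p * om p ^ (2 * q) * hs w (k + 2) (hp p)) := by ring
      _ ≤ C' * exp (15 * δ * p.1) * (C * K * exp ((31 + 15 * q) * δ * p.1)) :=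
        mul_le_mul_of_nonneg_left h1 (by positivity)
      _ = C' * C * K * (exp (15 * δ * p.1) * exp ((31 + 15 * q) * δ * p.1)) := by ring
      _ = _ := by rw [← exp_add]; push_cast; ring_nf

/-- Decay with the loss `τ^{1/10}`. -/
theorem decay_tenth (hm : ∀ j, 0 < m j) (hb : ∀ j, (G j).Bdd) (hq : ∀ j, (G j).Quad) (q k : ℕ)
    (hk : k + 2 * q + 2 ≤ 30) : ∃ C, 0 ≤ C ∧ ∀ {s0 s1 A K w}, BS m G (1 / 4000) s0 s1 A K w →
    ∀ p : Pt, p.1 ∈ Icc s0 s1 →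
    hy p * om p ^ (2 * q) * hs w k (hp p) ≤ C * K * exp (p.1 / 10) := by
  obtain ⟨C, hC, h⟩ := decay_gain hm hb hq (by norm_num : (0 : ℝ) ≤ 1 / 4000) (by norm_num) q k hk
  refine ⟨C, hC, fun {s0 s1 A K w} B p hp' => (h B p hp').trans ?_⟩
  refine mul_le_mul_of_nonneg_left (exp_le_exp.2 ?_) (mul_nonneg hC B.K_nonneg)
  have h0 := B.s0_nonneg.trans hp'.1
  have hq : (q : ℝ) ≤ 14 := by exact_mod_cast (by omega : q ≤ 14)
  nlinarith
end

/-- Rays in the hyperbolic picture. -/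
def rpt (y : ℝ × ℝ) (τ : ℝ) : Pt := (log τ, τ * y.1, τ * y.2)
def w0 (y : ℝ × ℝ) : ℝ := √(1 + y.1 ^ 2 + y.2 ^ 2)
def ry (y : ℝ × ℝ) (τ : ℝ) : Pt := (τ * w0 y, τ * y.1, τ * y.2)

theorem w0_sq (y : ℝ × ℝ) : w0 y ^ 2 = 1 + y.1 ^ 2 + y.2 ^ 2 := sq_sqrt (by positivity)
theorem w0_pos (y : ℝ × ℝ) : 0 < w0 y := sqrt_pos.2 (by positivity)
theorem one_le_w0 (y : ℝ × ℝ) : 1 ≤ w0 y := one_le_sqrt.2 (by nlinarith)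

theorem hy_rpt (y : ℝ × ℝ) {τ : ℝ} (hτ : 0 < τ) : hy (rpt y τ) = τ * w0 y := by
  have h1 := hy_sq' (rpt y τ)
  have h2 := hy_pos (rpt y τ)
  have h3 := w0_pos y
  have h4 := w0_sq y
  have e : exp (2 * log τ) = τ ^ 2 := by
    rw [two_mul, exp_add, exp_log hτ, pow_two]
  refine (pow_left_inj₀ h2.le (by positivity) two_ne_zero).1 ?_
  rw [h1, mul_pow, h4]
  simp only [rpt, e]; ring

theorem hp_rpt (y : ℝ × ℝ) {τ : ℝ} (hτ : 0 < τ) : hp (rpt y τ) = ry y τ := by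
  rw [hp, hy_rpt y hτ]; rfl

theorem om_rpt (y : ℝ × ℝ) {τ : ℝ} (hτ : 0 < τ) : om (rpt y τ) = w0 y := by
  rw [om, hy_rpt y hτ]
  simp only [rpt, exp_neg, exp_log hτ]; field_simp

theorem exists_rpt (p : Pt) : ∃ y : ℝ × ℝ, p = rpt y (exp p.1) := by
  refine ⟨(p.2.1 / exp p.1, p.2.2 / exp p.1), ?_⟩
  ext <;> simp [rpt] <;> field_simp

theorem hasDerivAt_ry (f : SF) (y : ℝ × ℝ) {τ : ℝ} (hτ : 0 < τ) :
    HasDerivAt (fun τ => f (ry y τ)) (Sc f (ry y τ) / τ) τ := by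
  have h1 : HasDerivAt (ry y) (w0 y, y.1, y.2) τ := by
    have h := fun c : ℝ => (hasDerivAt_id τ).mul_const c
    simp at h
    exact (h _).prodMk ((h _).prodMk (h _))
  have h2 := (f.diff (ry y τ)).hasFDerivAt.comp_hasDerivAt τ h1
  refine h2.congr_deriv ?_
  rw [fderiv_eq, Sc_eq]
  simp
  change _ = (τ * w0 y * _ + τ * y.1 * _ + τ * y.2 * _) / τ
  field_simp

/-- The rescaled solution along a ray. -/
def vr (f : SF) (y : ℝ × ℝ) (τ : ℝ) : ℝ := τ * f (ry y τ)
def vr' (f : SF) (y : ℝ × ℝ) (τ : ℝ) : ℝ := (f + Sc f) (ry y τ)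

theorem hasDerivAt_vr (f : SF) (y : ℝ × ℝ) {τ : ℝ} (hτ : 0 < τ) :
    HasDerivAt (vr f y) (vr' f y τ) τ := by
  refine ((hasDerivAt_id τ).mul (hasDerivAt_ry f y hτ)).congr_deriv ?_
  simp only [vr', SF.add_apply, id]; field_simp

theorem Om_eq' (f : SF) : Om f = L1 (L2 f) - L2 (L1 f) := by
  simp only [Om_eq, L1_eq, L2_eq, map_add, Derivation.leibniz, smul_eq_mul, XT, YT, YX]
  simp; ring

/-- The angular operator. -/
def Cas (f : SF) : SF := L1 (L1 f) + L2 (L2 f) - Om (Om f)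

theorem box_polar (f : SF) : (ct * ct - cx * cx - cy * cy) * box f = Sc (Sc f) + Sc f - Cas f := by
  simp only [Cas, box, Om_eq, L1_eq, L2_eq, Sc_eq, map_add, map_sub, Derivation.leibniz, smul_eq_mul, XT, YT, YX]
  simp; ring

theorem hasDerivAt_vr' (m : ℝ) (f : SF) (y : ℝ × ℝ) {τ : ℝ} (hτ : 0 < τ) :
    HasDerivAt (vr' f y) ((τ * (box f + (m ^ 2) • f) (ry y τ) + Cas f (ry y τ) / τ)
      - m ^ 2 * vr f y τ) τ := by
  refine (hasDerivAt_ry (f + Sc f) y hτ).congr_deriv ?_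
  have h := congrArg (fun g : SF => g (ry y τ)) (box_polar f)
  have h2 := w0_sq y
  simp at h
  change (τ * w0 y * (τ * w0 y) - τ * y.1 * (τ * y.1) - τ * y.2 * (τ * y.2)) * _ = _ at h
  have h3 : τ * w0 y * (τ * w0 y) - τ * y.1 * (τ * y.1) - τ * y.2 * (τ * y.2) = τ ^ 2 := by
    linear_combination τ ^ 2 * h2
  rw [map_add, vr]
  simp
  grind

theorem abs_Cas_le (w : Fin 2 → SF) (I : List (Fin 5)) (j p) {k : ℕ} (hI : I.length ≤ k) :
    |Cas (word Z I (w j)) p| ≤ 6 * hs w (k + 4) p := by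
  set f := word Z I (w j) with hf
  have o : ∀ J : List (Fin 5), J.length ≤ 4 → |word Z J f p| ≤ hs w (k + 4) p := by
    intro J hJ
    rw [hf, ← word_append]
    exact le_hs w _ j (by simp; omega)
  have o1 : |L1 (L1 f) p| ≤ _ := o [3, 3] (by simp)
  have o2 : |L2 (L2 f) p| ≤ _ := o [4, 4] (by simp)
  have o3 : |L1 (L2 (L1 (L2 f))) p| ≤ _ := o [3, 4, 3, 4] (by simp)
  have o4 : |L1 (L2 (L2 (L1 f))) p| ≤ _ := o [3, 4, 4, 3] (by simp)
  have o5 : |L2 (L1 (L1 (L2 f))) p| ≤ _ := o [4, 3, 3, 4] (by simp)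
  have o6 : |L2 (L1 (L2 (L1 f))) p| ≤ _ := o [4, 3, 4, 3] (by simp)
  rw [Cas, Om_eq', Om_eq']
  simp
  rw [abs_le] at *
  constructor <;> linarith

/-- Growth of the amplitude of a forced oscillator. -/
theorem oscillator_le {m : ℝ} (hm : 0 < m) {v v' r β β' : ℝ → ℝ} {a b : ℝ}
    (hv : ∀ τ ∈ Icc a b, HasDerivAt v (v' τ) τ)
    (hv' : ∀ τ ∈ Icc a b, HasDerivAt v' (r τ - m ^ 2 * v τ) τ)
    (hβ : ∀ τ ∈ Icc a b, HasDerivAt β (β' τ) τ)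
    (hr : ∀ τ ∈ Icc a b, |r τ| ≤ β' τ) (h0 : m * |v a| + |v' a| ≤ β a) :
    ∀ τ ∈ Icc a b, |v' τ| ≤ β τ ∧ m * |v τ| ≤ β τ := by
  set α : ℝ → ℂ := fun τ => Complex.exp (-(I * m * τ)) * (m * v τ - I * v' τ) with hα
  have hn : ∀ τ, ‖α τ‖ = ‖((m * v τ - I * v' τ : ℂ))‖ := fun τ => by
    rw [hα]
    simp
    have : -(I * m * τ) = ((-(m * τ) : ℝ) : ℂ) * I := by push_cast; ring
    rw [this, Complex.norm_exp_ofReal_mul_I, one_mul]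
  have hd : ∀ τ ∈ Icc a b, HasDerivAt α (Complex.exp (-(I * m * τ)) *
      (-(I * r τ))) τ := by
    intro τ hτ
    have h1 := (hv τ hτ).ofReal_comp
    have h2 := (hv' τ hτ).ofReal_comp
    have h3 : HasDerivAt (fun τ : ℝ => Complex.exp (-(I * m * τ)))
        (Complex.exp (-(I * m * τ)) * (-(I * m))) τ := by
      have : HasDerivAt (fun τ : ℝ => -(I * m * (τ : ℂ))) (-(I * m * 1)) τ :=
        ((hasDerivAt_id τ).ofReal_comp.const_mul _).neg
      simpa using this.cexp
    refine (h3.mul ((h1.const_mul (m : ℂ)).fun_sub (h2.const_mul I))).congr_deriv ?_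
    push_cast
    linear_combination (Complex.exp (-(I * m * τ)) * m * v' τ) * Complex.I_sq
  have key : ∀ τ ∈ Icc a b, ‖α τ‖ ≤ β τ := by
    intro τ hτ
    refine image_norm_le_of_norm_deriv_right_le_deriv_boundary' (f := α) (B := β) (B' := β')
      (fun x hx => (hd x hx).continuousAt.continuousWithinAt)
      (fun x hx => (hd x ⟨hx.1, hx.2.le⟩).hasDerivWithinAt) ?_
      (fun x hx => (hβ x hx).continuousAt.continuousWithinAt)
      (fun x hx => (hβ x ⟨hx.1, hx.2.le⟩).hasDerivWithinAt) (fun x hx => ?_) hτ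
    · rw [hn]
      refine (norm_sub_le _ _).trans ?_
      simpa [abs_of_pos hm] using h0
    · rw [norm_mul]
      have : -(I * m * x) = ((-(m * x) : ℝ) : ℂ) * I := by push_cast; ring
      rw [this, Complex.norm_exp_ofReal_mul_I, one_mul]
      simpa using hr x ⟨hx.1, hx.2.le⟩
  intro τ hτ
  have h1 := key τ hτ
  have h2 := Complex.abs_re_le_norm ((m * v τ - I * v' τ : ℂ))
  have h3 := Complex.abs_im_le_norm ((m * v τ - I * v' τ : ℂ))
  simp at h2 h3
  grind

section
variable {m : Fin 2 → ℝ} {G : Fin 2 → GF Ix} {δ s0 s1 A K : ℝ} {w : Fin 2 → SF}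

theorem rpt_mem (y : ℝ × ℝ) {τ : ℝ} (hτ : τ ∈ Icc (exp s0) (exp s1)) :
    (rpt y τ).1 ∈ Icc s0 s1 := by
  have h0 : 0 < τ := (exp_pos _).trans_le hτ.1
  exact ⟨(le_log_iff_exp_le h0).2 hτ.1, (log_le_iff_le_exp h0).2 hτ.2⟩

/-- Decay along rays. -/
theorem ray_decay (hm : ∀ j, 0 < m j) (hb : ∀ j, (G j).Bdd) (hq : ∀ j, (G j).Quad) (q k : ℕ)
    (hk : k + 2 * q + 2 ≤ 30) : ∃ C, 0 ≤ C ∧ ∀ {s0 s1 A K w}, BS m G (1 / 4000) s0 s1 A K w →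
    ∀ y τ, τ ∈ Icc (exp s0) (exp s1) →
    w0 y ^ (2 * q + 1) * (τ * hs w k (ry y τ)) ≤ C * K * τ ^ (1 / 10 : ℝ) := by
  obtain ⟨C, hC, h⟩ := decay_tenth hm hb hq q k hk
  refine ⟨C, hC, fun {s0 s1 A K w} B y τ hτ => ?_⟩
  have h0 : 0 < τ := (exp_pos _).trans_le hτ.1
  have h1 := h B (rpt y τ) (rpt_mem y hτ)
  rw [hp_rpt y h0, hy_rpt y h0, om_rpt y h0] at h1
  rw [rpow_def_of_pos h0]
  change _ ≤ C * K * exp (log τ / 10) at h1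
  refine le_trans (le_of_eq (by ring)) (h1.trans (le_of_eq ?_))
  ring_nf

theorem one_le_ray (B : BS m G δ s0 s1 A K w) {τ : ℝ} (hτ : exp s0 ≤ τ) : 1 ≤ τ :=
  (one_le_exp B.s0_nonneg).trans hτ

theorem ray_boot (B : BS m G δ s0 s1 A K w) {a : ℕ} (ha : a ≤ 15) (y : ℝ × ℝ) {τ : ℝ}
    (hτ : τ ∈ Icc (exp s0) (exp s1)) :
    τ * w0 y * nn Z (UU w) a (ry y τ) ≤ A * τ ^ (a * δ) := by
  have h0 : 0 < τ := (exp_pos _).trans_le hτ.1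
  have h1 := B.boot (rpt y τ) (rpt_mem y hτ) a ha
  rw [hp_rpt y h0, hy_rpt y h0] at h1
  rw [rpow_def_of_pos h0]
  refine h1.trans (le_of_eq ?_)
  change _ * exp (a * δ * log τ) = _
  ring_nf

theorem ray_src (B : BS m G δ s0 s1 A K w) (I : List (Fin 5)) (j : Fin 2) (y : ℝ × ℝ) {τ : ℝ}
    (hτ : τ ∈ Icc (exp s0) (exp s1)) :
    (box (word Z I (w j)) + (m j ^ 2) • word Z I (w j)) (ry y τ) =
      word Z I (comp (G j) (UU w)) (ry y τ) := by
  have h0 : 0 < τ := (exp_pos _).trans_le hτ.1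
  rw [← hp_rpt y h0]
  exact B.sol.src_hp I j (rpt_mem y hτ).1

theorem ray_small (B : BS m G δ s0 s1 A K w) (hδ : 15 * δ ≤ 1) (y : ℝ × ℝ) {τ : ℝ}
    (hτ : τ ∈ Icc (exp s0) (exp s1)) : nn Z (UU w) 15 (ry y τ) ≤ 1 := by
  have h0 : 0 < τ := (exp_pos _).trans_le hτ.1
  rw [← hp_rpt y h0]
  exact B.boot.small B.s0_nonneg B.A_le hδ (rpt_mem y hτ)

theorem ray_word_le (hb : ∀ j, (G j).Bdd) (hq : ∀ j, (G j).Quad) (k : ℕ) (hk : k ≤ 15) :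
    ∃ C, 0 ≤ C ∧ ∀ {δ s0 s1 A K w}, BS m G δ s0 s1 A K w → 15 * δ ≤ 1 →
    ∀ (I : List (Fin 5)), I.length ≤ k → ∀ j y τ, τ ∈ Icc (exp s0) (exp s1) →
    w0 y ^ 2 * (τ * |word Z I (comp (G j) (UU w)) (ry y τ)|) ≤ C * A ^ 2 * τ ^ (k * δ - 1) := by
  have h := fun j => word_comp_le (D := Z) isChain_Z (hb j) (hq j) 15 k (by omega)
  choose c hc h using h
  refine ⟨(c 0 + c 1) * (k + 1), mul_nonneg (add_nonneg (hc 0) (hc 1)) (by positivity), ?_⟩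
  intro δ s0 s1 A K w B hδ I hI j y τ hτ
  have h0 : 0 < τ := (exp_pos _).trans_le hτ.1
  have hw := w0_pos y
  have h1 := h j (UU w) (ry y τ) (ray_small B hδ y hτ) I hI
  have h2 : ∀ a ∈ Finset.range (k + 1), (τ * w0 y) ^ 2 *
      (nn Z (UU w) a (ry y τ) * nn Z (UU w) (k - a) (ry y τ)) ≤ A ^ 2 * τ ^ (k * δ) := by
    intro a ha
    have ha' : a ≤ k := by grind
    have b1 := ray_boot B (a := a) (by omega) y hτ
    have b2 := ray_boot B (a := k - a) (by omega) y hτ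
    have b3 := mul_le_mul b1 b2 (mul_nonneg (by positivity) (nn_nonneg _ _ _ _))
      (mul_nonneg B.A_nonneg (rpow_nonneg h0.le _))
    have e : τ ^ (k * δ) = τ ^ (a * δ) * τ ^ (((k - a : ℕ) : ℝ) * δ) := by
      rw [← rpow_add h0]; congr 1; push_cast [ha']; ring
    nlinarith
  have h3 : (τ * w0 y) ^ 2 * ∑ a ∈ Finset.range (k + 1), nn Z (UU w) a (ry y τ) * nn Z (UU w) (k - a) (ry y τ)
      ≤ (k + 1) * (A ^ 2 * τ ^ (k * δ)) := by
    rw [mul_sum]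
    refine (sum_le_card_nsmul _ _ _ h2).trans (le_of_eq ?_)
    simp
  have hcj : c j ≤ c 0 + c 1 := by fin_cases j <;> simp [hc]
  have e : τ ^ (k * δ - 1) = τ ^ (k * δ) / τ := by rw [rpow_sub h0, rpow_one]
  rw [e]
  generalize hS : ∑ a ∈ Finset.range (k + 1), nn Z (UU w) a (ry y τ) * nn Z (UU w) (k - a) (ry y τ) = S at *
  have hS0 : 0 ≤ S := hS ▸ sum_nonneg fun _ _ => mul_nonneg (nn_nonneg _ _ _ _) (nn_nonneg _ _ _ _)
  rw [mul_div_assoc', le_div_iff₀ h0]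
  calc _ = (τ * w0 y) ^ 2 * |word Z I (comp (G j) (UU w)) (ry y τ)| := by ring
    _ ≤ (τ * w0 y) ^ 2 * (c j * S) := by gcongr
    _ ≤ (τ * w0 y) ^ 2 * ((c 0 + c 1) * S) := by gcongr
    _ = (c 0 + c 1) * ((τ * w0 y) ^ 2 * S) := by ring
    _ ≤ (c 0 + c 1) * ((k + 1) * (A ^ 2 * τ ^ (k * δ))) :=
      mul_le_mul_of_nonneg_left h3 (add_nonneg (hc 0) (hc 1))
    _ = _ := by ring

theorem L1_ray (f : SF) (y : ℝ × ℝ) (τ : ℝ) :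
    L1 f (ry y τ) = τ * y.1 * T f (ry y τ) + τ * w0 y * X f (ry y τ) := by rw [L1_eq]; rfl

theorem L2_ray (f : SF) (y : ℝ × ℝ) (τ : ℝ) :
    L2 f (ry y τ) = τ * y.2 * T f (ry y τ) + τ * w0 y * Y f (ry y τ) := by rw [L2_eq]; rfl

theorem Sc_ray (f : SF) (y : ℝ × ℝ) (τ : ℝ) : Sc f (ry y τ) =
    τ * w0 y * T f (ry y τ) + τ * y.1 * X f (ry y τ) + τ * y.2 * Y f (ry y τ) := by rw [Sc_eq]; rfl

theorem ry_abs_le (y : ℝ × ℝ) {τ : ℝ} (h0 : 0 < τ) : |τ * y.1| ≤ τ * w0 y ∧ |τ * y.2| ≤ τ * w0 y := by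
  have h := w0_sq y
  have hw := w0_pos y
  rw [abs_mul, abs_mul, abs_of_pos h0]
  exact ⟨mul_le_mul_of_nonneg_left (abs_le_of_sq_le_sq (by nlinarith) hw.le) h0.le,
    mul_le_mul_of_nonneg_left (abs_le_of_sq_le_sq (by nlinarith) hw.le) h0.le⟩

/-- Recovering derivatives from the rescaled profile. -/
theorem ray_recover (w : Fin 2 → SF) {k : ℕ} {y : ℝ × ℝ} {τ D E : ℝ} (hτ : 1 ≤ τ)
    {I : List (Fin 5)} (hI : I.length ≤ k) (j : Fin 2)
    (hD : w0 y ^ 2 * (|vr (word Z I (w j)) y τ| + |vr' (word Z I (w j)) y τ|) ≤ D)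
    (hE : w0 y ^ 2 * hs w (k + 1) (ry y τ) ≤ E) :
    τ * w0 y * (|word Z I (w j) (ry y τ)| + ∑ b, |dd b (word Z I (w j)) (ry y τ)|) ≤
      4 * D + 8 * E := by
  set f := word Z I (w j) with hf
  have h0 : 0 < τ := by linarith
  have hw := w0_pos y
  have hw1 := one_le_w0 y
  have hL1 : |L1 f (ry y τ)| ≤ hs w (k + 1) (ry y τ) := le_hs w _ j (I := 3 :: I) (by grind)
  have hL2 : |L2 f (ry y τ)| ≤ hs w (k + 1) (ry y τ) := le_hs w _ j (I := 4 :: I) (by grind)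
  set p := ry y τ with hp
  set H := hs w (k + 1) p
  obtain ⟨hx, hy⟩ := ry_abs_le y h0
  have hwsq := w0_sq y
  have e1 := L1_ray f y τ
  have e2 := L2_ray f y τ
  have eS := Sc_ray f y τ
  have eT : τ * T f p = w0 y * Sc f p - y.1 * L1 f p - y.2 * L2 f p := by grind
  have hv : vr f y τ = τ * f p := rfl
  have hv' : vr' f y τ = f p + Sc f p := rfl
  have hfp : |f p| ≤ |vr f y τ| := by
    rw [hv, abs_mul, abs_of_pos h0]; exact le_mul_of_one_le_left (abs_nonneg _) hτ
  have hSc : |Sc f p| ≤ |vr f y τ| + |vr' f y τ| := by grind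
  have hy1 : |y.1| ≤ w0 y := abs_le_of_sq_le_sq (by nlinarith) hw.le
  have hy2 : |y.2| ≤ w0 y := abs_le_of_sq_le_sq (by nlinarith) hw.le
  have hT : τ * |T f p| ≤ w0 y * (|vr f y τ| + |vr' f y τ| + 2 * H) := by
    have : τ * |T f p| = |τ * T f p| := by grind
    have a1 : |w0 y * Sc f p| ≤ w0 y * (|vr f y τ| + |vr' f y τ|) := by
      rw [abs_mul, abs_of_pos hw]; gcongr
    have a2 : |y.1 * L1 f p| ≤ w0 y * H := by rw [abs_mul]; gcongr
    have a3 : |y.2 * L2 f p| ≤ w0 y * H := by rw [abs_mul]; gcongr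
    grind
  have hT' : τ * w0 y * |T f p| ≤ D + 2 * E := by
    have h5 := mul_le_mul_of_nonneg_left hT hw.le
    grind
  have hHE : H ≤ E := by
    have h5 : 0 ≤ H := hs_nonneg _ _ _
    exact (le_mul_of_one_le_left h5 (one_le_pow₀ hw1)).trans hE
  have hX : ∀ (u c : ℝ) (l : ℝ), |c| ≤ τ * w0 y → l = c * T f p + τ * w0 y * u → |l| ≤ H →
      τ * w0 y * |u| ≤ D + 3 * E := by
    intro u c l hc hl hl'
    have : τ * w0 y * |u| = |l - c * T f p| := by
      rw [hl, add_sub_cancel_left, abs_mul, abs_of_pos (by positivity : 0 < τ * w0 y)]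
    rw [this]
    refine (abs_sub _ _).trans ?_
    rw [abs_mul]
    have := mul_le_mul_of_nonneg_right hc (abs_nonneg (T f p))
    linarith
  have hX1 := hX _ _ _ hx e1 hL1
  have hX2 := hX _ _ _ hy e2 hL2
  have hf0 : τ * w0 y * |f p| ≤ D := by
    have : τ * |f p| = |vr f y τ| := by rw [hv, abs_mul, abs_of_pos h0]
    have h5 : w0 y * |vr f y τ| ≤ w0 y ^ 2 * |vr f y τ| :=
      mul_le_mul_of_nonneg_right (by nlinarith) (abs_nonneg _)
    have h6 : w0 y ^ 2 * |vr f y τ| ≤ w0 y ^ 2 * (|vr f y τ| + |vr' f y τ|) :=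
      mul_le_mul_of_nonneg_left (by simp) (by positivity)
    calc τ * w0 y * |f p| = w0 y * (τ * |f p|) := by ring
      _ = w0 y * |vr f y τ| := by rw [this]
      _ ≤ D := by linarith
  rw [Fin.sum_univ_three]
  change τ * w0 y * (|f p| + (|T f p| + |X f p| + |Y f p|)) ≤ _
  linarith

/-- Initial bound of the rescaled profile. -/
theorem ray_init (w : Fin 2 → SF) {k : ℕ} {y : ℝ × ℝ} {τ : ℝ} (hτ : 1 ≤ τ)
    {I : List (Fin 5)} (hI : I.length ≤ k) (j : Fin 2) :
    |vr (word Z I (w j)) y τ| + |vr' (word Z I (w j)) y τ| ≤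
      5 * w0 y * (τ * hs w (k + 1) (ry y τ)) := by
  set f := word Z I (w j) with hf
  have h0 : 0 < τ := by linarith
  have hw1 := one_le_w0 y
  have o : ∀ i : Fin 5, |Z i f (ry y τ)| ≤ hs w (k + 1) (ry y τ) := fun i =>
    le_hs w _ j (I := i :: I) (by grind)
  have o0 : |f (ry y τ)| ≤ hs w (k + 1) (ry y τ) := le_hs w _ j (I := I) (by omega)
  set p := ry y τ with hp
  set H := hs w (k + 1) p
  obtain ⟨hx, hy⟩ := ry_abs_le y h0
  have eS := Sc_ray f y τ
  have hv : |vr f y τ| = τ * |f p| := by rw [vr, abs_mul, abs_of_pos h0]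
  have hv' : vr' f y τ = f p + Sc f p := rfl
  have hH : 0 ≤ H := hs_nonneg _ _ _
  have b : ∀ c u : ℝ, |c| ≤ τ * w0 y → |u| ≤ H → |c * u| ≤ τ * w0 y * H := fun c u hc hu => by
    rw [abs_mul]; gcongr
  have b1 := b (τ * w0 y) (T f p) (le_of_eq (abs_of_pos (by positivity))) (o 0)
  have b2 := b _ (X f p) hx (o 1)
  have b3 := b _ (Y f p) hy (o 2)
  have b4 : τ * |f p| ≤ τ * w0 y * H := by
    have := mul_le_mul_of_nonneg_left o0 h0.le
    have h6 : τ * H ≤ τ * w0 y * H := by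
      rw [mul_assoc]; exact mul_le_mul_of_nonneg_left (le_mul_of_one_le_left hH hw1) h0.le
    linarith
  have b5 : |f p| ≤ τ * |f p| := le_mul_of_one_le_left (abs_nonneg _) hτ
  rw [hv, hv', eS]
  have b6 := abs_add_le (f p) (τ * w0 y * T f p + τ * y.1 * X f p + τ * y.2 * Y f p)
  have b7 := abs_add_le (τ * w0 y * T f p + τ * y.1 * X f p) (τ * y.2 * Y f p)
  have b8 := abs_add_le (τ * w0 y * T f p) (τ * y.1 * X f p)
  linarith
end

section
variable {m : Fin 2 → ℝ} {G : Fin 2 → GF Ix} {δ s0 s1 A K : ℝ} {w : Fin 2 → SF}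

theorem hs_ray_le (hm : ∀ j, 0 < m j) (hb : ∀ j, (G j).Bdd) (hq : ∀ j, (G j).Quad) (k : ℕ)
    (hk : k + 5 ≤ 30) : ∃ C, 0 ≤ C ∧ ∀ {s0 s1 A K w}, BS m G (1 / 4000) s0 s1 A K w →
    ∀ y τ, τ ∈ Icc (exp s0) (exp s1) →
    w0 y ^ 2 * hs w (k + 1) (ry y τ) ≤ C * K := by
  obtain ⟨C, hC, h⟩ := ray_decay hm hb hq 1 (k + 1) (by omega)
  refine ⟨C, hC, fun {s0 s1 A K w} B y τ hτ => ?_⟩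
  have h1 := h B y τ hτ
  have h2 := one_le_ray B hτ.1
  have h3 := one_le_w0 y
  have hH := hs_nonneg w (k + 1) (ry y τ)
  have h4 : τ ^ (1 / 10 : ℝ) ≤ τ := by
    simpa using rpow_le_rpow_of_exponent_le h2 (by norm_num : (1 / 10 : ℝ) ≤ 1)
  have h0 : 0 < τ := by linarith
  have h5 : C * K * τ ^ (1 / 10 : ℝ) ≤ C * K * τ :=
    mul_le_mul_of_nonneg_left h4 (mul_nonneg hC B.K_nonneg)
  have h6 : w0 y ^ 2 * hs w (k + 1) (ry y τ) ≤ w0 y ^ (2 * 1 + 1) * hs w (k + 1) (ry y τ) :=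
    mul_le_mul_of_nonneg_right (pow_le_pow_right₀ h3 (by norm_num)) hH
  refine le_of_mul_le_mul_right ?_ h0
  calc _ ≤ w0 y ^ (2 * 1 + 1) * hs w (k + 1) (ry y τ) * τ := mul_le_mul_of_nonneg_right h6 h0.le
    _ = w0 y ^ (2 * 1 + 1) * (τ * hs w (k + 1) (ry y τ)) := by ring
    _ ≤ _ := h1.trans h5

theorem ray_Cas_le (hm : ∀ j, 0 < m j) (hb : ∀ j, (G j).Bdd) (hq : ∀ j, (G j).Quad) (q k : ℕ)
    (hk : k + 2 * q + 6 ≤ 30) : ∃ C, 0 ≤ C ∧ ∀ {s0 s1 A K w}, BS m G (1 / 4000) s0 s1 A K w →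
    ∀ (I : List (Fin 5)), I.length ≤ k → ∀ j y τ, τ ∈ Icc (exp s0) (exp s1) →
    w0 y ^ (2 * q) * |Cas (word Z I (w j)) (ry y τ) / τ| ≤ C * K * τ ^ (-3 / 2 : ℝ) := by
  obtain ⟨C, hC, h⟩ := ray_decay hm hb hq q (k + 4) (by omega)
  refine ⟨6 * C, by positivity, fun {s0 s1 A K w} B I hI j y τ hτ => ?_⟩
  have h1 := h B y τ hτ
  have h2 := one_le_ray B hτ.1
  have h0 : 0 < τ := by linarith
  have h3 := one_le_w0 y
  have h4 := abs_Cas_le w I j (ry y τ) hI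
  have h6 : w0 y ^ (2 * q) ≤ w0 y ^ (2 * q + 1) := pow_le_pow_right₀ h3 (by norm_num)
  have h7 : τ ^ (1 / 10 : ℝ) ≤ τ ^ (2 + -3 / 2 : ℝ) :=
    rpow_le_rpow_of_exponent_le h2 (by norm_num)
  rw [rpow_add h0, rpow_ofNat] at h7
  rw [abs_div, abs_of_pos h0, ← mul_div_assoc, div_le_iff₀ h0]
  refine le_of_mul_le_mul_right ?_ h0
  calc _ ≤ w0 y ^ (2 * q + 1) * (6 * hs w (k + 4) (ry y τ)) * τ := by gcongr
    _ = 6 * (w0 y ^ (2 * q + 1) * (τ * hs w (k + 4) (ry y τ))) := by ring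
    _ ≤ 6 * (C * K * (τ ^ 2 * τ ^ (-3 / 2 : ℝ))) := by
      refine mul_le_mul_of_nonneg_left (h1.trans ?_) (by norm_num)
      exact mul_le_mul_of_nonneg_left h7 (mul_nonneg hC B.K_nonneg)
    _ = _ := by ring

theorem ray_init_le (hm : ∀ j, 0 < m j) (hb : ∀ j, (G j).Bdd) (hq : ∀ j, (G j).Quad) (q k : ℕ)
    (hk : k + 2 * q + 3 ≤ 30) (s0 : ℝ) : ∃ C, 0 ≤ C ∧ ∀ {s1 A K w}, BS m G (1 / 4000) s0 s1 A K w →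
    s0 ≤ s1 → ∀ (I : List (Fin 5)), I.length ≤ k → ∀ j y,
    w0 y ^ (2 * q) * (|vr (word Z I (w j)) y (exp s0)| + |vr' (word Z I (w j)) y (exp s0)|) ≤ C * K := by
  obtain ⟨C, hC, h⟩ := ray_decay hm hb hq q (k + 1) (by omega)
  refine ⟨5 * C * exp s0 ^ (1 / 10 : ℝ), by positivity, fun {s1 A K w} B hs I hI j y => ?_⟩
  have hτ : exp s0 ∈ Icc (exp s0) (exp s1) := ⟨le_rfl, exp_le_exp.2 hs⟩
  have h1 := h B y _ hτ
  have h2 := ray_init w (y := y) (one_le_ray B hτ.1) hI j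
  have hw := w0_pos y
  refine (mul_le_mul_of_nonneg_left h2 (by positivity)).trans ?_
  grind

/-- The bootstrap bounds with loss, improved. -/
theorem ray_weak (hm : ∀ j, 0 < m j) (hb : ∀ j, (G j).Bdd) (hq : ∀ j, (G j).Quad) (k : ℕ)
    (hk : 1 ≤ k) (hk' : k ≤ 15) (s0 : ℝ) : ∃ C, 0 ≤ C ∧ ∀ {s1 A K w}, BS m G (1 / 4000) s0 s1 A K w →
    ∀ y τ, τ ∈ Icc (exp s0) (exp s1) →
    τ * w0 y * nn Z (UU w) k (ry y τ) ≤ C * (K + A ^ 2) * τ ^ (k * (1 / 4000) : ℝ) := by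
  obtain ⟨C1, hC1, h1⟩ := ray_word_le (G := G) (m := m) hb hq k hk'
  obtain ⟨C2, hC2, h2⟩ := ray_Cas_le (G := G) hm hb hq 1 k (by omega)
  obtain ⟨C3, hC3, h3⟩ := ray_init_le (G := G) hm hb hq 1 k (by omega) s0
  obtain ⟨C4, hC4, h4⟩ := hs_ray_le (G := G) hm hb hq k (by omega)
  obtain ⟨C5, hC5, h5⟩ := nn_UU_le k
  set γ : ℝ := k * (1 / 4000) with hγ
  have hγ0 : 0 < γ := by positivity
  set D : ℝ := 2 * C2 + (1 + ∑ j, m j) * C3 with hD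
  have hM0 : 0 ≤ ∑ j, m j := sum_nonneg fun j _ => (hm j).le
  have hMi : 0 ≤ ∑ j, (m j)⁻¹ := sum_nonneg fun j _ => by have := hm j; positivity
  set D' : ℝ := 4 * ((1 + ∑ j, (m j)⁻¹) * (C1 / γ + D)) + 8 * C4 with hD'
  refine ⟨C5 * (2 * ((words (Fin 5) k).card * D')), by positivity, fun {s1 A K w} B y τ hτ => ?_⟩
  have hs01 : s0 ≤ s1 := exp_le_exp.1 (hτ.1.trans hτ.2)
  have hw := w0_pos y
  have hτ1 := one_le_ray B hτ.1
  have hK := B.K_nonneg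
  have hE0 : 1 ≤ τ ^ γ := one_le_rpow hτ1 hγ0.le
  have key : ∀ j (I : List (Fin 5)), I ∈ words (Fin 5) k → τ * w0 y * (|word Z I (w j) (ry y τ)| +
      ∑ b, |dd b (word Z I (w j)) (ry y τ)|) ≤ D' * (K + A ^ 2) * τ ^ γ := by
    intro j I hI
    rw [mem_words] at hI
    set f := word Z I (w j) with hf
    have osc := oscillator_le (hm j) (v := vr f y) (v' := vr' f y)
      (r := fun σ => σ * (box f + (m j ^ 2) • f) (ry y σ) + Cas f (ry y σ) / σ)
      (β := fun σ => (w0 y ^ 2)⁻¹ * (C1 * A ^ 2 / γ * σ ^ γ - 2 * C2 * K * σ ^ (-1 / 2 : ℝ) + D * K))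
      (β' := fun σ => (w0 y ^ 2)⁻¹ * (C1 * A ^ 2 * σ ^ (γ - 1) + C2 * K * σ ^ (-3 / 2 : ℝ)))
      (a := exp s0) (b := exp s1)
      (fun σ hσ => hasDerivAt_vr f y ((exp_pos _).trans_le hσ.1))
      (fun σ hσ => hasDerivAt_vr' (m j) f y ((exp_pos _).trans_le hσ.1)) ?_ ?_ ?_ τ hτ
    · obtain ⟨o1, o2⟩ := osc
      have hmj := hm j
      have o3 : |vr f y τ| ≤ (m j)⁻¹ * ((w0 y ^ 2)⁻¹ * (C1 * A ^ 2 / γ * τ ^ γ - 2 * C2 * K * τ ^ (-1 / 2 : ℝ) + D * K)) := by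
        rw [inv_mul_eq_div, le_div_iff₀ hmj, mul_comm]; exact o2
      set β := (w0 y ^ 2)⁻¹ * (C1 * A ^ 2 / γ * τ ^ γ - 2 * C2 * K * τ ^ (-1 / 2 : ℝ) + D * K) with hβ
      have hβ0 : 0 ≤ β := by grind
      have o4 : (m j)⁻¹ ≤ ∑ j, (m j)⁻¹ := single_le_sum (f := fun j => (m j)⁻¹)
        (fun j _ => by have := hm j; positivity) (Finset.mem_univ j)
      have o5 : w0 y ^ 2 * β ≤ (C1 / γ + D) * (K + A ^ 2) * τ ^ γ := by
        rw [hβ, mul_inv_cancel_left₀ (by positivity)]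
        have t1 : 0 ≤ 2 * C2 * K * τ ^ (-1 / 2 : ℝ) := by positivity
        have t2 : D * K ≤ D * K * τ ^ γ := le_mul_of_one_le_right (by positivity) hE0
        have t3 : (C1 / γ + D) * (K + A ^ 2) * τ ^ γ = C1 * A ^ 2 / γ * τ ^ γ + D * K * τ ^ γ +
          (C1 / γ * K * τ ^ γ + D * A ^ 2 * τ ^ γ) := by ring
        have t4 : 0 ≤ C1 / γ * K * τ ^ γ + D * A ^ 2 * τ ^ γ := by positivity
        linarith
      have o6 : w0 y ^ 2 * (|vr f y τ| + |vr' f y τ|) ≤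
          (1 + ∑ j, (m j)⁻¹) * ((C1 / γ + D) * (K + A ^ 2) * τ ^ γ) := by
        calc _ ≤ w0 y ^ 2 * ((∑ j, (m j)⁻¹) * β + β) := by
              refine mul_le_mul_of_nonneg_left (add_le_add (o3.trans ?_) o1) (by positivity)
              gcongr
          _ = (1 + ∑ j, (m j)⁻¹) * (w0 y ^ 2 * β) := by ring
          _ ≤ _ := by gcongr
      refine (ray_recover w hτ1 hI j o6 (h4 B y τ hτ)).trans ?_
      have t5 : 8 * (C4 * K) ≤ 8 * C4 * (K + A ^ 2) * τ ^ γ := by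
        have : 8 * (C4 * K) ≤ 8 * C4 * (K + A ^ 2) := by nlinarith
        exact this.trans (le_mul_of_one_le_right (by positivity) hE0)
      grind
    · intro σ hσ
      have hσ0 : 0 < σ := (exp_pos _).trans_le hσ.1
      have d1 := (hasDerivAt_rpow_const (x := σ) (p := γ) (Or.inl hσ0.ne')).const_mul (C1 * A ^ 2 / γ)
      have d2 := (hasDerivAt_rpow_const (x := σ) (p := -1 / 2) (Or.inl hσ0.ne')).const_mul (2 * C2 * K)
      refine (((d1.fun_sub d2).add_const (D * K)).const_mul _).congr_deriv ?_
      grind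
    · intro σ hσ
      have r1 := h1 B (by norm_num) I hI j y σ hσ
      have r2 := h2 B I hI j y σ hσ
      have hσ0 : 0 < σ := (exp_pos _).trans_le hσ.1
      rw [inv_mul_eq_div, le_div_iff₀ (by positivity), mul_comm]
      rw [← ray_src B I j y hσ] at r1
      calc _ ≤ w0 y ^ 2 * (σ * |(box f + (m j ^ 2) • f) (ry y σ)| + |Cas f (ry y σ) / σ|) := by
            refine mul_le_mul_of_nonneg_left ((abs_add_le _ _).trans ?_) (by positivity)
            rw [abs_mul, abs_of_pos hσ0]
        _ ≤ _ := by grind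
    · have r3 := h3 B hs01 I hI j y
      have hmj : m j ≤ ∑ j, m j := single_le_sum (f := fun j => m j)
        (fun j _ => (hm j).le) (Finset.mem_univ j)
      rw [inv_mul_eq_div, le_div_iff₀ (by positivity), mul_comm]
      have he : 1 ≤ exp s0 := one_le_exp B.s0_nonneg
      have t1 : exp s0 ^ (-1 / 2 : ℝ) ≤ 1 := rpow_le_one_of_one_le_of_nonpos he (by norm_num)
      have t2 : 0 ≤ C1 * A ^ 2 / γ * exp s0 ^ γ := by positivity
      have t3 : 2 * C2 * K * exp s0 ^ (-1 / 2 : ℝ) ≤ 2 * C2 * K := mul_le_of_le_one_right (by positivity) t1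
      have t4 : w0 y ^ 2 * (m j * |vr f y (exp s0)| + |vr' f y (exp s0)|) ≤ (1 + ∑ j, m j) * (C3 * K) := by
        calc _ ≤ w0 y ^ 2 * ((1 + ∑ j, m j) * (|vr f y (exp s0)| + |vr' f y (exp s0)|)) := by
              refine mul_le_mul_of_nonneg_left ?_ (by positivity)
              have a1 := mul_le_mul_of_nonneg_right hmj (abs_nonneg (vr f y (exp s0)))
              have a2 := mul_nonneg hM0 (abs_nonneg (vr' f y (exp s0)))
              grind
          _ = (1 + ∑ j, m j) * (w0 y ^ 2 * (|vr f y (exp s0)| + |vr' f y (exp s0)|)) := by ring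
          _ ≤ _ := mul_le_mul_of_nonneg_left r3 (by positivity)
      grind
  refine (mul_le_mul_of_nonneg_left (h5 w (ry y τ)) (by positivity)).trans ?_
  rw [mul_left_comm, mul_assoc C5, mul_assoc C5]
  refine mul_le_mul_of_nonneg_left ?_ hC5
  rw [mul_sum]
  refine (sum_le_card_nsmul _ _ ((words (Fin 5) k).card * (D' * (K + A ^ 2) * τ ^ γ)) fun j _ => ?_).trans
    (le_of_eq ?_)
  · rw [mul_sum]
    refine (sum_le_card_nsmul _ _ _ fun I hI => key j I hI).trans (by simp)
  · simp; ring
end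

/-- Complex amplitudes of the plane-wave profiles. -/
def eta (m₁ : ℝ) (ω : Fin 3 → ℝ) (k : Fin 2) (c : Ix) : ℂ :=
  if c.1 = k then c.2.elim 1 fun a => I * (((k.1 : ℝ) + 1) * m₁ * ω a : ℝ) else 0
def hvec (m₁ : ℝ) (ω : Fin 3 → ℝ) (s : Fin 4) (c : Ix) : ℂ :=
  ![eta m₁ ω 0 c, star (eta m₁ ω 0 c), eta m₁ ω 1 c, star (eta m₁ ω 1 c)] s
def dg : Fin 4 → ℤ := ![1, -1, 2, -2]
/-- The quadruple `(z₁, z̄₁, z₂, z̄₂)`. -/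
def quadr (z : Fin 2 → ℂ) : Fin 4 → ℂ := ![z 0, star (z 0), z 1, star (z 1)]
def qf (b : Ix → Ix → ℝ) (x : Ix → ℝ) : ℝ := ∑ c, ∑ d, b c d * x c * x d
def cf (m₁ : ℝ) (b : Ix → Ix → ℝ) (ω : Fin 3 → ℝ) (s t : Fin 4) : ℂ :=
  ∑ c, ∑ d, (b c d : ℂ) * (hvec m₁ ω s c / 2) * (hvec m₁ ω t d / 2)
def prof (ω : Fin 3 → ℝ) (v v' : Fin 2 → ℝ) (c : Ix) : ℝ :=
  c.2.elim (v c.1) fun a => ω a * v' c.1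

theorem qf_expand (m₁ : ℝ) (b : Ix → Ix → ℝ) (ω : Fin 3 → ℝ) (z : Fin 4 → ℂ) (x : Ix → ℝ)
    (hx : ∀ c, (x c : ℂ) = ∑ s, z s * (hvec m₁ ω s c / 2)) :
    (qf b x : ℂ) = ∑ s, ∑ t, cf m₁ b ω s t * (z s * z t) := by
  have e : (qf b x : ℂ) = ∑ c, ∑ d, ∑ s, ∑ t,
      ((b c d : ℂ) * (hvec m₁ ω s c / 2) * (hvec m₁ ω t d / 2)) * (z s * z t) := by
    simp only [qf, Complex.ofReal_sum, Complex.ofReal_mul, hx]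
    refine sum_congr rfl fun c _ => sum_congr rfl fun d _ => ?_
    rw [mul_assoc, Finset.sum_mul_sum, mul_sum]
    refine sum_congr rfl fun s _ => ?_
    rw [mul_sum]
    grind
  have e2 : ∀ c, ∑ d, ∑ s, ∑ t,
      ((b c d : ℂ) * (hvec m₁ ω s c / 2) * (hvec m₁ ω t d / 2)) * (z s * z t) =
      ∑ s, ∑ t, ∑ d, ((b c d : ℂ) * (hvec m₁ ω s c / 2) * (hvec m₁ ω t d / 2)) * (z s * z t) :=
    fun c => by
      rw [sum_comm]
      exact sum_congr rfl fun s _ => sum_comm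
  rw [e]
  simp only [e2]
  rw [sum_comm]
  refine sum_congr rfl fun s _ => ?_
  rw [sum_comm]
  refine sum_congr rfl fun t _ => ?_
  rw [cf, sum_mul]
  exact sum_congr rfl fun c _ => by rw [sum_mul]

theorem prof_expand {m₁ : ℝ} (hm : 0 < m₁) (ω : Fin 3 → ℝ) (v v' : Fin 2 → ℝ) (c : Ix) :
    (prof ω v v' c : ℂ) = ∑ s, quadr (fun k => (v k : ℂ) - I * (v' k : ℂ) / (((k.1 : ℝ) + 1) * m₁ : ℝ)) s *
      (hvec m₁ ω s c / 2) := by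
  have h1 : (m₁ : ℂ) ≠ 0 := by exact_mod_cast hm.ne'
  obtain ⟨k, c⟩ := c
  fin_cases k <;> rcases c with _ | a <;>
    simp [Fin.sum_univ_four, quadr, hvec, prof, eta] <;> field_simp <;>
    (try simp) <;> ring_nf <;> simp [Complex.I_sq]

theorem norm_eta_le {m₁ : ℝ} (hm : 0 < m₁) (ω : Fin 3 → ℝ) {W : ℝ} (hW : 1 ≤ W)
    (hω : ∀ a, |ω a| ≤ W) (k c) : ‖eta m₁ ω k c‖ ≤ (1 + 2 * m₁) * W := by
  rw [eta]
  split_ifs with h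
  · rcases c with ⟨j, _ | a⟩
    · simp; nlinarith
    · simp only [Option.elim, norm_mul, Complex.norm_I, one_mul, norm_real, norm_eq_abs]
      have h2 : |((k.1 : ℝ) + 1)| ≤ 2 := by fin_cases k <;> simp <;> norm_num
      rw [abs_of_pos hm]
      have := hω a
      calc _ ≤ 2 * m₁ * W := by gcongr
        _ ≤ _ := by nlinarith
  · simp; positivity

theorem norm_cf_le {m₁ : ℝ} (hm : 0 < m₁) (b : Ix → Ix → ℝ) : ∃ C, 0 ≤ C ∧ ∀ ω W, 1 ≤ W →
    (∀ a, |ω a| ≤ W) → ∀ s t, ‖cf m₁ b ω s t‖ ≤ C * W ^ 2 := by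
  refine ⟨∑ c, ∑ d, |b c d| * ((1 + 2 * m₁) ^ 2), by positivity, fun ω W hW hω s t => ?_⟩
  have hh : ∀ s c, ‖hvec m₁ ω s c / 2‖ ≤ (1 + 2 * m₁) * W := by
    intro s c
    have e : ∀ k, ‖eta m₁ ω k c / 2‖ ≤ (1 + 2 * m₁) * W := fun k => by
      have := norm_eta_le hm ω hW hω k c
      simp; linarith [norm_nonneg (eta m₁ ω k c)]
    have e' : ∀ k, ‖star (eta m₁ ω k c) / 2‖ ≤ (1 + 2 * m₁) * W := fun k => by
      rw [norm_div, norm_star, ← norm_div]; exact e k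
    fin_cases s
    exacts [e 0, e' 0, e 1, e' 1]
  rw [cf, sum_mul]
  refine (norm_sum_le _ _).trans (sum_le_sum fun c _ => ?_)
  rw [sum_mul]
  refine (norm_sum_le _ _).trans (sum_le_sum fun d _ => ?_)
  rw [norm_mul, norm_mul, norm_real, norm_eq_abs]
  have h1 := hh s c
  have h2 := hh t d
  calc _ ≤ |b c d| * ((1 + 2 * m₁) * W) * ((1 + 2 * m₁) * W) := by gcongr
    _ = _ := by ring

/-- The resonant coefficient. -/
def res (m₁ : ℝ) (b : Ix → Ix → ℝ) (ω : Fin 3 → ℝ) (j : ℤ) : ℂ :=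
  ∑ s, ∑ t, if dg s + dg t = j then cf m₁ b ω s t else 0

theorem integral_character (n : ℤ) :
    ∫ θ in (0:ℝ)..1, Complex.exp (((2 * π * n * θ : ℝ) : ℂ) * I) = if n = 0 then 1 else 0 := by
  split_ifs with h
  · simp [h]
  · have hc : (2 * π * n * I : ℂ) ≠ 0 := by
      simp [h]
    have e : ∀ θ : ℝ, (((2 * π * n * θ : ℝ) : ℂ) * I) = (2 * π * n * I : ℂ) * θ :=
      fun θ => by push_cast; ring
    simp only [e]
    rw [integral_exp_mul_complex hc]
    have : (2 * π * n * I : ℂ) * (1 : ℝ) = n * (2 * π * I) := by push_cast; ring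
    rw [this, Complex.exp_int_mul_two_pi_mul_I]
    simp

theorem phi_eq_res {m₁ : ℝ} (hm : 0 < m₁) (b : Ix → Ix → ℝ) (ω : Fin 3 → ℝ) (j : ℤ) :
    ∫ θ in (0:ℝ)..1, (qf b (prof ω (fun k => cos (2 * π * ((k.1 : ℝ) + 1) * θ))
      (fun k => -(((k.1 : ℝ) + 1) * m₁) * sin (2 * π * ((k.1 : ℝ) + 1) * θ))) : ℂ) *
      Complex.exp (((-(2 * π * (j : ℝ) * θ) : ℝ) : ℂ) * I) = res m₁ b ω j := by
  have key : ∀ θ : ℝ, (qf b (prof ω (fun k => cos (2 * π * ((k.1 : ℝ) + 1) * θ))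
      (fun k => -(((k.1 : ℝ) + 1) * m₁) * sin (2 * π * ((k.1 : ℝ) + 1) * θ))) : ℂ) *
      Complex.exp (((-(2 * π * (j : ℝ) * θ) : ℝ) : ℂ) * I) =
      ∑ s, ∑ t, cf m₁ b ω s t * Complex.exp (((2 * π * ((dg s + dg t - j : ℤ) : ℝ) * θ : ℝ) : ℂ) * I) := by
    intro θ
    rw [qf_expand m₁ b ω _ _ (prof_expand hm ω _ _)]
    have hz : quadr (fun k : Fin 2 => ((cos (2 * π * ((k.1 : ℝ) + 1) * θ) : ℝ) : ℂ) - I *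
        ((-(((k.1 : ℝ) + 1) * m₁) * sin (2 * π * ((k.1 : ℝ) + 1) * θ) : ℝ) : ℂ) / (((k.1 : ℝ) + 1) * m₁ : ℝ)) =
        fun s => Complex.exp (((2 * π * ((dg s : ℤ) : ℝ) * θ : ℝ) : ℂ) * I) := by
      have e : ∀ k : Fin 2, ((cos (2 * π * ((k.1 : ℝ) + 1) * θ) : ℝ) : ℂ) - I *
        ((-(((k.1 : ℝ) + 1) * m₁) * sin (2 * π * ((k.1 : ℝ) + 1) * θ) : ℝ) : ℂ) / (((k.1 : ℝ) + 1) * m₁ : ℝ) =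
        Complex.exp (((2 * π * ((k.1 : ℝ) + 1) * θ : ℝ) : ℂ) * I) := by
        intro k
        rw [Complex.exp_mul_I, ← Complex.ofReal_cos, ← Complex.ofReal_sin]
        have : ((((k.1 : ℝ) + 1) * m₁ : ℝ) : ℂ) ≠ 0 := by
          have : (0:ℝ) < ((k.1 : ℝ) + 1) * m₁ := by positivity
          exact_mod_cast this.ne'
        rw [neg_mul, Complex.ofReal_neg, Complex.ofReal_mul (((k.1 : ℝ) + 1) * m₁)]
        grind
      have e' : ∀ x : ℝ, star (Complex.exp ((x : ℂ) * I)) = Complex.exp (((-x : ℝ) : ℂ) * I) := by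
        intro x
        change (starRingEnd ℂ) _ = _
        rw [← Complex.exp_conj]; simp
      funext s
      simp only [e]
      fin_cases s
      · change Complex.exp _ = Complex.exp _
        congr 3; simp [dg]
      · change star (Complex.exp _) = Complex.exp _
        rw [e']; congr 3; simp [dg]
      · change Complex.exp _ = Complex.exp _
        congr 3; simp [dg]; norm_num
      · change star (Complex.exp _) = Complex.exp _
        rw [e']; congr 3; simp [dg]; norm_num
    rw [hz, sum_mul]
    refine sum_congr rfl fun s _ => ?_
    rw [sum_mul]
    refine sum_congr rfl fun t _ => ?_
    rw [← Complex.exp_add, mul_assoc, ← Complex.exp_add]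
    congr 2; push_cast; ring
  simp only [key]
  rw [intervalIntegral.integral_finsetSum fun s _ => Continuous.intervalIntegrable (by fun_prop) _ _]
  refine sum_congr rfl fun s _ => ?_
  rw [intervalIntegral.integral_finsetSum fun s _ => Continuous.intervalIntegrable (by fun_prop) _ _]
  refine sum_congr rfl fun t _ => ?_
  rw [intervalIntegral.integral_const_mul, integral_character]
  grind

/-- Oscillating factors. -/
def ee (m₁ : ℝ) (n : ℤ) (τ : ℝ) : ℂ := Complex.exp (((m₁ * n * τ : ℝ) : ℂ) * I)
theorem norm_ee (m₁ n τ) : ‖ee m₁ n τ‖ = 1 := Complex.norm_exp_ofReal_mul_I _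
theorem ee_zero (m₁ τ) : ee m₁ 0 τ = 1 := by simp [ee]
theorem ee_add (m₁ n k τ) : ee m₁ (n + k) τ = ee m₁ n τ * ee m₁ k τ := by
  rw [ee, ee, ee, ← Complex.exp_add]; congr 1; push_cast; ring
theorem star_ee (m₁ n τ) : star (ee m₁ n τ) = ee m₁ (-n) τ := by
  change (starRingEnd ℂ) _ = _
  rw [ee, ← Complex.exp_conj, ee]; congr 1; simp
theorem hasDerivAt_ee (m₁ : ℝ) (n : ℤ) (τ : ℝ) :
    HasDerivAt (ee m₁ n) ((I * m₁ * n) * ee m₁ n τ) τ := by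
  have h : HasDerivAt (fun τ : ℝ => ((m₁ * n * τ : ℝ) : ℂ) * I) ((m₁ * n * 1 : ℝ) * I) τ :=
    (((hasDerivAt_id τ).const_mul _).ofReal_comp).mul_const _
  refine h.cexp.congr_deriv ?_
  rw [ee]; push_cast; ring

/-- The masses. -/
def mm (m₁ : ℝ) (k : Fin 2) : ℝ := ((k.1 : ℝ) + 1) * m₁
def ix (k : Fin 2) : ℤ := (k.1 : ℤ) + 1
theorem mm_pos {m₁ : ℝ} (h : 0 < m₁) (k) : 0 < mm m₁ k := by unfold mm; positivity
theorem mm_eq (m₁ k) : mm m₁ k = m₁ * (ix k : ℤ) := by simp [mm, ix]; ring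
theorem le_mm {m₁ : ℝ} (h : 0 < m₁) (k) : m₁ ≤ mm m₁ k := by unfold mm; nlinarith [Nat.cast_nonneg (α := ℝ) k.1]

/-- Slowly varying amplitudes. -/
def al (m₁ : ℝ) (v v' : Fin 2 → ℝ → ℝ) (k : Fin 2) (τ : ℝ) : ℂ :=
  ee m₁ (-ix k) τ * ((v k τ : ℂ) - I * (v' k τ : ℂ) / (mm m₁ k : ℝ))

/-- A resonant system of oscillators. -/
structure RayODE (m₁ : ℝ) (b : Fin 2 → Ix → Ix → ℝ) (ω : Fin 3 → ℝ) (W κ t0 t1 : ℝ)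
    (v v' r : Fin 2 → ℝ → ℝ) : Prop where
  one_le : 1 ≤ t0
  one_le_W : 1 ≤ W
  hω : ∀ a, |ω a| ≤ W
  hκ : 0 ≤ κ
  hWκ : W ^ 20 * κ ≤ 1
  hv : ∀ k, ∀ τ ∈ Icc t0 t1, HasDerivAt (v k) (v' k τ) τ
  hv' : ∀ k, ∀ τ ∈ Icc t0 t1, HasDerivAt (v' k)
    ((τ⁻¹ * qf (b k) (prof ω (fun k => v k τ) (fun k => v' k τ)) + r k τ) - mm m₁ k ^ 2 * v k τ) τ
  hb : ∀ k, ∀ τ ∈ Icc t0 t1, |v k τ| + |v' k τ| ≤ κ * τ ^ (1 / 10 : ℝ)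
  hr : ∀ k, ∀ τ ∈ Icc t0 t1, |r k τ| ≤ κ * τ ^ (-3 / 2 : ℝ)

section
variable {m₁ : ℝ} {b : Fin 2 → Ix → Ix → ℝ} {ω : Fin 3 → ℝ} {W κ t0 t1 : ℝ} {v v' r : Fin 2 → ℝ → ℝ}

theorem norm_al_le (hm : 0 < m₁) (k τ) : ‖al m₁ v v' k τ‖ ≤ (1 + m₁⁻¹) * (|v k τ| + |v' k τ|) := by
  rw [al, norm_mul, norm_ee, one_mul]
  refine (norm_sub_le _ _).trans ?_
  have h1 := mm_pos hm k
  simp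
  have h2 : |v' k τ| / mm m₁ k ≤ m₁⁻¹ * |v' k τ| := by
    rw [div_eq_inv_mul]
    exact mul_le_mul_of_nonneg_right (inv_anti₀ hm (le_mm hm k)) (abs_nonneg _)
  have := mul_nonneg (inv_pos.2 hm).le (abs_nonneg (v k τ))
  grind

theorem le_norm_al (hm : 0 < m₁) (k τ) : |v k τ| + |v' k τ| ≤ (1 + 2 * m₁) * ‖al m₁ v v' k τ‖ := by
  rw [al, norm_mul, norm_ee, one_mul]
  have h1 := mm_pos hm k
  have h2 := Complex.abs_re_le_norm ((v k τ : ℂ) - I * (v' k τ : ℂ) / (mm m₁ k : ℝ))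
  have h3 := Complex.abs_im_le_norm ((v k τ : ℂ) - I * (v' k τ : ℂ) / (mm m₁ k : ℝ))
  set N := ‖((v k τ : ℂ) - I * (v' k τ : ℂ) / (mm m₁ k : ℝ))‖
  simp [abs_div, abs_of_pos h1] at h2 h3
  rw [div_le_iff₀ h1] at h3
  have h4 : mm m₁ k ≤ 2 * m₁ := by fin_cases k <;> simp [mm] <;> linarith
  have : 0 ≤ N := norm_nonneg _
  nlinarith

theorem RayODE.pos (H : RayODE m₁ b ω W κ t0 t1 v v' r) {τ : ℝ} (hτ : τ ∈ Icc t0 t1) : 0 < τ := by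
  linarith [H.one_le, hτ.1]

/-- The forcing of the amplitudes. -/
def al' (m₁ : ℝ) (b : Fin 2 → Ix → Ix → ℝ) (ω : Fin 3 → ℝ) (v v' r : Fin 2 → ℝ → ℝ) (k : Fin 2) (τ : ℝ) : ℂ :=
  -(I / (mm m₁ k : ℝ)) * (ee m₁ (-ix k) τ *
    ((τ⁻¹ * qf (b k) (prof ω (fun k => v k τ) (fun k => v' k τ)) + r k τ : ℝ) : ℂ))

theorem RayODE.hasDerivAt_al (hm : 0 < m₁) (H : RayODE m₁ b ω W κ t0 t1 v v' r) (k) {τ : ℝ} (hτ : τ ∈ Icc t0 t1) :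
    HasDerivAt (al m₁ v v' k) (al' m₁ b ω v v' r k τ) τ := by
  have h1 := (H.hv k τ hτ).ofReal_comp
  have h2 := (H.hv' k τ hτ).ofReal_comp
  have h3 := hasDerivAt_ee m₁ (-ix k) τ
  refine (h3.mul (h1.fun_sub ((h2.const_mul I).div_const ((mm m₁ k : ℝ) : ℂ)))).congr_deriv ?_
  have h4 : ((mm m₁ k : ℝ) : ℂ) ≠ 0 := by exact_mod_cast (mm_pos hm k).ne'
  have h5 : (m₁ : ℂ) * (ix k : ℤ) = (mm m₁ k : ℝ) := by rw [mm_eq]; push_cast; ring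
  have h6 : I * m₁ * ((-ix k : ℤ) : ℂ) = -(I * (mm m₁ k : ℝ)) := by grind
  rw [h6, al']
  generalize ee m₁ (-ix k) τ = e
  push_cast
  generalize ((mm m₁ k : ℝ) : ℂ) = M at *
  generalize ((qf (b k) (prof ω (fun k => v k τ) (fun k => v' k τ)) : ℝ) : ℂ) = q
  field_simp
  linear_combination (e * v' k τ * M) * Complex.I_sq

/-- The resonant monomials. -/
def Mon (k : Fin 2) (z : Fin 2 → ℂ) : ℂ := ![star (z 0) * z 1, z 0 ^ 2] k

theorem res_sum (m₁ : ℝ) (b : Ix → Ix → ℝ) (ω : Fin 3 → ℝ) (k : Fin 2) (z : Fin 2 → ℂ) :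
    (∑ s, ∑ t, if dg s + dg t = ix k then cf m₁ b ω s t * (quadr z s * quadr z t) else 0) =
      res m₁ b ω (ix k) * Mon k z := by
  fin_cases k <;> simp [res, Fin.sum_univ_four, dg, ix, quadr, Mon] <;> ring_nf <;> simp

theorem quadr_al (m₁ : ℝ) (v v' : Fin 2 → ℝ → ℝ) (τ : ℝ) (s : Fin 4) :
    quadr (fun k => (v k τ : ℂ) - I * (v' k τ : ℂ) / (mm m₁ k : ℝ)) s =
      quadr (fun k => al m₁ v v' k τ) s * ee m₁ (dg s) τ := by
  have e : ∀ k, (v k τ : ℂ) - I * (v' k τ : ℂ) / (mm m₁ k : ℝ) = al m₁ v v' k τ * ee m₁ (ix k) τ := by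
    intro k
    rw [al, mul_right_comm, ← ee_add, neg_add_cancel, ee_zero, one_mul]
  have e' : ∀ k, star ((v k τ : ℂ) - I * (v' k τ : ℂ) / (mm m₁ k : ℝ)) =
      star (al m₁ v v' k τ) * ee m₁ (-ix k) τ := by
    intro k
    rw [e, star_mul, star_ee, mul_comm]
  fin_cases s
  exacts [e 0, e' 0, e 1, e' 1]

theorem qf_al (hm : 0 < m₁) (b : Ix → Ix → ℝ) (ω : Fin 3 → ℝ) (v v' : Fin 2 → ℝ → ℝ) (k : Fin 2) (τ : ℝ) :
    ee m₁ (-ix k) τ * (qf b (prof ω (fun k => v k τ) (fun k => v' k τ)) : ℂ) =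
      res m₁ b ω (ix k) * Mon k (fun k => al m₁ v v' k τ) +
      ∑ s, ∑ t, if dg s + dg t = ix k then 0 else cf m₁ b ω s t *
        (quadr (fun k => al m₁ v v' k τ) s * quadr (fun k => al m₁ v v' k τ) t) * ee m₁ (dg s + dg t - ix k) τ := by
  have h := qf_expand m₁ b ω _ _ (prof_expand hm ω (fun k => v k τ) (fun k => v' k τ))
  have q := quadr_al m₁ v v' τ
  simp only [mm] at q
  rw [h, ← res_sum, ← sum_add_distrib, mul_sum]
  refine sum_congr rfl fun s _ => ?_
  rw [← sum_add_distrib, mul_sum]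
  refine sum_congr rfl fun t _ => ?_
  have e : ee m₁ (dg s + dg t - ix k) τ = ee m₁ (-ix k) τ * (ee m₁ (dg s) τ * ee m₁ (dg t) τ) := by
    rw [← ee_add, ← ee_add]; congr 1; ring
  split_ifs with hr
  · have e1 : ee m₁ (-ix k) τ * (ee m₁ (dg s) τ * ee m₁ (dg t) τ) = 1 := by
      rw [← e, hr, sub_self, ee_zero]
    grind
  · grind

/-- The correction removing nonresonant terms. -/
def cor (m₁ : ℝ) (b : Ix → Ix → ℝ) (ω : Fin 3 → ℝ) (k : Fin 2) (A : Fin 4 → ℝ → ℂ) (τ : ℝ) : ℂ :=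
  ∑ s, ∑ t, (if dg s + dg t = ix k then 0 else cf m₁ b ω s t / (I * m₁ * (dg s + dg t - ix k : ℤ))) *
    (A s τ * A t τ) * ee m₁ (dg s + dg t - ix k) τ

def rem (m₁ : ℝ) (b : Ix → Ix → ℝ) (ω : Fin 3 → ℝ) (k : Fin 2) (A A' : Fin 4 → ℝ → ℂ) (τ : ℝ) : ℂ :=
  ∑ s, ∑ t, (if dg s + dg t = ix k then 0 else cf m₁ b ω s t / (I * m₁ * (dg s + dg t - ix k : ℤ))) *
    (A' s τ * A t τ + A s τ * A' t τ) * ee m₁ (dg s + dg t - ix k) τ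

theorem hasDerivAt_cor (hm : 0 < m₁) (b : Ix → Ix → ℝ) (ω : Fin 3 → ℝ) (k : Fin 2) {A A' : Fin 4 → ℝ → ℂ} {τ : ℝ}
    (h : ∀ s, HasDerivAt (A s) (A' s τ) τ) : HasDerivAt (cor m₁ b ω k A)
    ((∑ s, ∑ t, if dg s + dg t = ix k then 0 else cf m₁ b ω s t * (A s τ * A t τ) * ee m₁ (dg s + dg t - ix k) τ) +
      rem m₁ b ω k A A' τ) τ := by
  rw [rem, ← sum_add_distrib]
  refine HasDerivAt.fun_sum fun s _ => ?_
  rw [← sum_add_distrib]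
  refine HasDerivAt.fun_sum fun t _ => ?_
  refine ((((h s).mul (h t)).const_mul _).mul (hasDerivAt_ee m₁ _ τ)).congr_deriv ?_
  split_ifs with hr
  · simp
  · have h1 : (m₁ : ℂ) ≠ 0 := by exact_mod_cast hm.ne'
    have h2 : ((dg s + dg t - ix k : ℤ) : ℂ) ≠ 0 := by positivity
    have h3 : I * m₁ * ((dg s + dg t - ix k : ℤ) : ℂ) ≠ 0 := by
      simp only [ne_eq, mul_eq_zero, Complex.I_ne_zero, h1, h2, or_self, not_false_eq_true]
    generalize I * m₁ * ((dg s + dg t - ix k : ℤ) : ℂ) = N at h3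
    simp
    grind

theorem norm_coef_le (hm : 0 < m₁) (b : Ix → Ix → ℝ) (ω : Fin 3 → ℝ) (k : Fin 2) (s t : Fin 4) {B : ℝ} (hB : 0 ≤ B)
    (h : ‖cf m₁ b ω s t‖ ≤ B) :
    ‖(if dg s + dg t = ix k then 0 else cf m₁ b ω s t / (I * m₁ * (dg s + dg t - ix k : ℤ)) : ℂ)‖ ≤ B * m₁⁻¹ := by
  split_ifs with hr
  · rw [norm_zero]; positivity
  · rw [norm_div, norm_mul, norm_mul, Complex.norm_I, norm_real, one_mul, norm_eq_abs, abs_of_pos hm]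
    have h2 : (1 : ℝ) ≤ ‖((dg s + dg t - ix k : ℤ) : ℂ)‖ := by
      exact_mod_cast Int.one_le_abs (sub_ne_zero.2 hr)
    refine mul_le_mul h (inv_anti₀ hm (le_mul_of_one_le_right hm.le h2)) (by positivity) hB

theorem norm_cor_le (hm : 0 < m₁) (b : Ix → Ix → ℝ) (ω : Fin 3 → ℝ) (k : Fin 2) {A : Fin 4 → ℝ → ℂ} {τ B a : ℝ}
    (hB : 0 ≤ B) (h : ∀ s t, ‖cf m₁ b ω s t‖ ≤ B) (hA : ∀ s, ‖A s τ‖ ≤ a) :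
    ‖cor m₁ b ω k A τ‖ ≤ 16 * (B * m₁⁻¹ * a ^ 2) := by
  have ha : 0 ≤ a := (norm_nonneg _).trans (hA 0)
  have key : ∀ s t, ‖(if dg s + dg t = ix k then 0 else cf m₁ b ω s t / (I * m₁ * (dg s + dg t - ix k : ℤ)) : ℂ) *
    (A s τ * A t τ) * ee m₁ (dg s + dg t - ix k) τ‖ ≤ B * m₁⁻¹ * a ^ 2 := fun s t => by
    rw [norm_mul, norm_ee, mul_one, norm_mul, norm_mul, pow_two]
    exact mul_le_mul (norm_coef_le hm b ω k s t hB (h s t)) (mul_le_mul (hA s) (hA t) (norm_nonneg _) ha)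
      (by positivity) (by positivity)
  refine (norm_sum_le_of_le _ fun s _ => norm_sum_le_of_le _ fun t _ => key s t).trans (le_of_eq ?_)
  simp; ring

theorem norm_rem_le (hm : 0 < m₁) (b : Ix → Ix → ℝ) (ω : Fin 3 → ℝ) (k : Fin 2) {A A' : Fin 4 → ℝ → ℂ} {τ B a a' : ℝ}
    (hB : 0 ≤ B) (h : ∀ s t, ‖cf m₁ b ω s t‖ ≤ B) (hA : ∀ s, ‖A s τ‖ ≤ a) (hA' : ∀ s, ‖A' s τ‖ ≤ a') :
    ‖rem m₁ b ω k A A' τ‖ ≤ 32 * (B * m₁⁻¹ * (a * a')) := by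
  have ha : 0 ≤ a := (norm_nonneg _).trans (hA 0)
  have ha' : 0 ≤ a' := (norm_nonneg _).trans (hA' 0)
  have key : ∀ s t, ‖(if dg s + dg t = ix k then 0 else cf m₁ b ω s t / (I * m₁ * (dg s + dg t - ix k : ℤ)) : ℂ) *
    (A' s τ * A t τ + A s τ * A' t τ) * ee m₁ (dg s + dg t - ix k) τ‖ ≤ B * m₁⁻¹ * (2 * (a * a')) := fun s t => by
    rw [norm_mul, norm_ee, mul_one, norm_mul]
    refine mul_le_mul (norm_coef_le hm b ω k s t hB (h s t)) ((norm_add_le _ _).trans ?_)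
      (by positivity) (by positivity)
    rw [norm_mul, norm_mul, two_mul]
    refine add_le_add ?_ (mul_le_mul (hA s) (hA' t) (norm_nonneg _) ha)
    rw [mul_comm a]
    exact mul_le_mul (hA' s) (hA t) (norm_nonneg _) ha'
  refine (norm_sum_le_of_le _ fun s _ => norm_sum_le_of_le _ fun t _ => key s t).trans (le_of_eq ?_)
  simp; ring
end

section
variable {m₁ : ℝ} {b : Fin 2 → Ix → Ix → ℝ} {ω : Fin 3 → ℝ} {W κ t0 t1 : ℝ} {v v' r : Fin 2 → ℝ → ℝ}

/-- The corrected amplitudes. -/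
def at' (m₁ : ℝ) (b : Fin 2 → Ix → Ix → ℝ) (ω : Fin 3 → ℝ) (v v' : Fin 2 → ℝ → ℝ) (k : Fin 2) (τ : ℝ) : ℂ :=
  al m₁ v v' k τ + (I / (mm m₁ k : ℝ)) * ((τ⁻¹ : ℝ) * cor m₁ (b k) ω k (fun s τ => quadr (fun k => al m₁ v v' k τ) s) τ)

theorem hasDerivAt_quadr {z : Fin 2 → ℝ → ℂ} {z' : Fin 2 → ℂ} {τ : ℝ} (h : ∀ k, HasDerivAt (z k) (z' k) τ) (s : Fin 4) :
    HasDerivAt (fun τ => quadr (fun k => z k τ) s) (quadr z' s) τ := by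
  fin_cases s
  exacts [h 0, (h 0).star, h 1, (h 1).star]

theorem norm_quadr_le {z : Fin 2 → ℂ} {a : ℝ} (h : ∀ k, ‖z k‖ ≤ a) (s : Fin 4) : ‖quadr z s‖ ≤ a := by
  fin_cases s
  exacts [h 0, (norm_star (z 0)).trans_le (h 0), h 1, (norm_star (z 1)).trans_le (h 1)]

theorem norm_Mon_sub_le {z u : Fin 2 → ℂ} {a d : ℝ} (hz : ∀ k, ‖z k‖ ≤ a) (hu : ∀ k, ‖u k‖ ≤ a)
    (hd : ∀ k, ‖z k - u k‖ ≤ d) (k : Fin 2) : ‖Mon k z - Mon k u‖ ≤ 2 * (a * d) := by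
  have ha : 0 ≤ a := (norm_nonneg _).trans (hz 0)
  have key : ∀ p q p' q' : ℂ, ‖p‖ ≤ a → ‖q'‖ ≤ a → ‖p - p'‖ ≤ d → ‖q - q'‖ ≤ d →
      ‖p * q - p' * q'‖ ≤ 2 * (a * d) := by
    intro p q p' q' h1 h2 h3 h4
    have e : p * q - p' * q' = p * (q - q') + (p - p') * q' := by ring
    have hd0 : 0 ≤ d := (norm_nonneg _).trans h3
    rw [e]
    refine (norm_add_le _ _).trans ?_
    rw [norm_mul, norm_mul]
    have h5 := mul_le_mul h1 h4 (norm_nonneg _) ha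
    have h6 := mul_le_mul h3 h2 (norm_nonneg _) hd0
    linarith
  fin_cases k
  · refine key _ _ _ _ ((norm_star _).trans_le (hz 0)) (hu 1) ?_ (hd 1)
    rw [← star_sub, norm_star]; exact hd 0
  · change ‖z 0 ^ 2 - u 0 ^ 2‖ ≤ _
    rw [pow_two, pow_two]
    grind

theorem norm_qf_le (hm : 0 < m₁) (b : Ix → Ix → ℝ) (ω : Fin 3 → ℝ) (v v' : Fin 2 → ℝ → ℝ) (τ : ℝ) {B a : ℝ} (hB : 0 ≤ B)
    (h : ∀ s t, ‖cf m₁ b ω s t‖ ≤ B) (hA : ∀ k, ‖al m₁ v v' k τ‖ ≤ a) :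
    |qf b (prof ω (fun k => v k τ) (fun k => v' k τ))| ≤ 16 * (B * a ^ 2) := by
  have ha : 0 ≤ a := (norm_nonneg _).trans (hA 0)
  have h1 := qf_expand m₁ b ω _ _ (prof_expand hm ω (fun k => v k τ) (fun k => v' k τ))
  have q := quadr_al m₁ v v' τ
  simp only [mm] at q
  simp only [q] at h1
  rw [← norm_eq_abs, ← norm_real, h1]
  have h2 := norm_quadr_le hA
  have key : ∀ s t, ‖cf m₁ b ω s t * (quadr (fun k => al m₁ v v' k τ) s * ee m₁ (dg s) τ *
      (quadr (fun k => al m₁ v v' k τ) t * ee m₁ (dg t) τ))‖ ≤ B * a ^ 2 := fun s t => by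
    rw [norm_mul, norm_mul, norm_mul, norm_mul, norm_ee, norm_ee, mul_one, mul_one, pow_two]
    exact mul_le_mul (h s t) (mul_le_mul (h2 s) (h2 t) (norm_nonneg _) ha) (by positivity) hB
  refine (norm_sum_le_of_le _ fun s _ => norm_sum_le_of_le _ fun t _ => key s t).trans (le_of_eq ?_)
  simp; ring

set_option maxHeartbeats 1000000 in
theorem normal_form (hm : 0 < m₁) (b : Fin 2 → Ix → Ix → ℝ) : ∃ C, 0 ≤ C ∧
    ∀ {ω W κ t0 t1 v v' r}, RayODE m₁ b ω W κ t0 t1 v v' r → ∃ z' : Fin 2 → ℝ → ℂ, ∀ τ ∈ Icc t0 t1, ∀ k,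
      HasDerivAt (at' m₁ b ω v v' k) (z' k τ) τ ∧
      ‖z' k τ + (I / (mm m₁ k : ℝ)) * ((τ⁻¹ : ℝ) * (res m₁ (b k) ω (ix k) *
        Mon k (fun k => at' m₁ b ω v v' k τ)))‖ ≤ C * κ * τ ^ (-3 / 2 : ℝ) ∧
      ‖al m₁ v v' k τ - at' m₁ b ω v v' k τ‖ ≤ C * κ ∧
      ‖at' m₁ b ω v v' k τ‖ ≤ C * κ * τ ^ (1 / 10 : ℝ) := by
  have hc := fun k => norm_cf_le hm (b k)
  choose c hc0 hc using hc
  set Cc := c 0 + c 1 with hCc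
  have hCc0 : 0 ≤ Cc := by grind
  have hck : ∀ k, c k ≤ Cc := fun k => by fin_cases k <;> simp [hCc, hc0]
  set μ := m₁⁻¹ with hμ
  have hμ0 : 0 < μ := inv_pos.2 hm
  set C0 := 1 + μ with hC0
  have hC00 : 1 ≤ C0 := by linarith
  set C1 := μ * (16 * (Cc * C0 ^ 2) + 1) with hC1
  set C2 := 16 * (Cc * μ * C0 ^ 2) with hC2
  set C3 := 32 * (Cc * μ * (C0 * C1)) with hC3
  set C4 := C0 + μ * C2 with hC4
  set C5 := 16 * Cc * (2 * (C4 * (μ * C2))) with hC5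
  refine ⟨C4 + μ * (1 + C2 + C3 + C5), by positivity, fun {ω W κ t0 t1 v v' r} H => ?_⟩
  have hB : ∀ k s t, ‖cf m₁ (b k) ω s t‖ ≤ Cc * W ^ 2 := fun k s t =>
    (hc k ω W H.one_le_W H.hω s t).trans (mul_le_mul_of_nonneg_right (hck k) (by positivity))
  have hW := H.one_le_W
  have hκ := H.hκ
  have hWκ : W ^ 2 * κ ≤ 1 :=
    (mul_le_mul_of_nonneg_right (pow_le_pow_right₀ hW (by norm_num)) hκ).trans H.hWκ
  have hB0 : 0 ≤ Cc * W ^ 2 := by positivity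
  set A : Fin 4 → ℝ → ℂ := fun s τ => quadr (fun k => al m₁ v v' k τ) s with hA
  set A' : Fin 4 → ℝ → ℂ := fun s τ => quadr (fun k => al' m₁ b ω v v' r k τ) s with hA'
  refine ⟨fun k τ => al' m₁ b ω v v' r k τ + (I / (mm m₁ k : ℝ)) * (((-(τ ^ 2)⁻¹ : ℝ) : ℂ) * cor m₁ (b k) ω k A τ +
    (τ⁻¹ : ℝ) * ((∑ s, ∑ t, if dg s + dg t = ix k then 0 else cf m₁ (b k) ω s t * (A s τ * A t τ) * ee m₁ (dg s + dg t - ix k) τ) +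
      rem m₁ (b k) ω k A A' τ)), fun τ hτ k => ?_⟩
  have hτ0 := H.pos hτ
  have hτ1 : 1 ≤ τ := H.one_le.trans hτ.1
  set X := τ ^ (1 / 10 : ℝ) with hX
  set Yy := τ ^ (-3 / 2 : ℝ) with hY
  have hX1 : 1 ≤ X := one_le_rpow hτ1 (by norm_num)
  have hY0 : 0 < Yy := by positivity
  have hXY : τ⁻¹ * τ⁻¹ * X ^ 4 ≤ Yy := by
    have e1 : τ⁻¹ = τ ^ (-1 : ℝ) := (rpow_neg_one τ).symm
    have e2 : X ^ 4 = τ ^ (4 / 10 : ℝ) := by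
      rw [hX, ← rpow_natCast, ← rpow_mul hτ0.le]; norm_num
    rw [e1, e2, ← rpow_add hτ0, ← rpow_add hτ0]
    exact rpow_le_rpow_of_exponent_le hτ1 (by norm_num)
  have hYt : Yy ≤ τ⁻¹ := by
    rw [← rpow_neg_one]
    exact rpow_le_rpow_of_exponent_le hτ1 (by norm_num)
  have hti : 0 < τ⁻¹ := inv_pos.2 hτ0
  have hti1 : τ⁻¹ ≤ 1 := inv_le_one_of_one_le₀ hτ1
  have hX2 : τ⁻¹ * X ^ 2 ≤ 1 := by
    have e1 : τ⁻¹ = τ ^ (-1 : ℝ) := (rpow_neg_one τ).symm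
    have e2 : X ^ 2 = τ ^ (2 / 10 : ℝ) := by
      rw [hX, ← rpow_natCast, ← rpow_mul hτ0.le]; norm_num
    rw [e1, e2, ← rpow_add hτ0]
    exact rpow_le_one_of_one_le_of_nonpos hτ1 (by norm_num)
  have hXp2 : X ^ 2 ≤ X ^ 4 := pow_le_pow_right₀ hX1 (by norm_num)
  have hXp3 : X ^ 3 ≤ X ^ 4 := pow_le_pow_right₀ hX1 (by norm_num)
  have a1 : ∀ k, ‖al m₁ v v' k τ‖ ≤ C0 * (κ * X) := fun k =>
    (norm_al_le hm k τ).trans (mul_le_mul_of_nonneg_left (H.hb k τ hτ) (by positivity))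
  have hmk : ∀ k : Fin 2, ‖I / ((mm m₁ k : ℝ) : ℂ)‖ ≤ μ := fun k => by
    rw [norm_div, Complex.norm_I, norm_real, norm_eq_abs, abs_of_pos (mm_pos hm k), one_div]
    exact inv_anti₀ hm (le_mm hm k)
  have hWk2 : W ^ 2 * κ ^ 2 ≤ κ := by
    calc _ = W ^ 2 * κ * κ := by ring
      _ ≤ 1 * κ := by gcongr
      _ = κ := one_mul _
  have q1 : ∀ k, |qf (b k) (prof ω (fun k => v k τ) (fun k => v' k τ))| ≤ 16 * (Cc * C0 ^ 2) * (κ * X ^ 2) := fun k => by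
    refine (norm_qf_le hm (b k) ω v v' τ hB0 (hB k) a1).trans ?_
    calc _ = 16 * (Cc * C0 ^ 2) * (W ^ 2 * κ ^ 2 * X ^ 2) := by ring
      _ ≤ _ := by gcongr
  have a2 : ∀ k, ‖al' m₁ b ω v v' r k τ‖ ≤ C1 * (κ * (τ⁻¹ * X ^ 2)) := fun k => by
    rw [al', norm_mul, norm_mul, norm_ee, one_mul, norm_neg, norm_real, norm_eq_abs]
    have hr := H.hr k τ hτ
    rw [hC1, mul_assoc]
    refine mul_le_mul (hmk k) ((abs_add_le _ _).trans ?_) (abs_nonneg _) hμ0.le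
    rw [abs_mul, abs_of_pos hti]
    have h1 := mul_le_mul_of_nonneg_left (q1 k) hti.le
    have h2 : κ * Yy ≤ κ * (τ⁻¹ * X ^ 2) := by
      refine mul_le_mul_of_nonneg_left (hYt.trans ?_) hκ
      exact le_mul_of_one_le_right hti.le (one_le_pow₀ hX1)
    grind
  have cor1 : ∀ k, ‖cor m₁ (b k) ω k A τ‖ ≤ C2 * (κ * X ^ 2) := fun k => by
    refine (norm_cor_le hm (b k) ω k hB0 (hB k) (norm_quadr_le a1)).trans ?_
    calc _ = C2 * (W ^ 2 * κ ^ 2 * X ^ 2) := by rw [hC2]; ring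
      _ ≤ _ := by gcongr
  have rem1 : ‖rem m₁ (b k) ω k A A' τ‖ ≤ C3 * (κ * (τ⁻¹ * X ^ 3)) := by
    refine (norm_rem_le hm (b k) ω k hB0 (hB k) (norm_quadr_le a1) (norm_quadr_le a2)).trans ?_
    calc _ = C3 * (W ^ 2 * κ ^ 2 * (τ⁻¹ * X ^ 3)) := by rw [hC3]; ring
      _ ≤ _ := by gcongr
  have diff1 : ∀ k, ‖al m₁ v v' k τ - at' m₁ b ω v v' k τ‖ ≤ μ * C2 * (κ * (τ⁻¹ * X ^ 2)) := fun k => by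
    rw [at', sub_add_cancel_left, norm_neg, norm_mul, norm_mul, norm_real, norm_eq_abs, abs_of_pos hti]
    calc _ ≤ μ * (τ⁻¹ * (C2 * (κ * X ^ 2))) := by
          have := hmk k
          have := cor1 k
          gcongr
      _ = _ := by ring
  have at1 : ∀ k, ‖at' m₁ b ω v v' k τ‖ ≤ C4 * (κ * X) := fun k => by
    have h1 := norm_sub_norm_le (at' m₁ b ω v v' k τ) (al m₁ v v' k τ)
    rw [norm_sub_rev] at h1
    have h2 := diff1 k
    have h3 := a1 k
    have h4 : κ * (τ⁻¹ * X ^ 2) ≤ κ * X := mul_le_mul_of_nonneg_left (hX2.trans hX1) hκ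
    have h5 := mul_le_mul_of_nonneg_left h4 (by positivity : 0 ≤ μ * C2)
    grind
  have dq : ∀ s, HasDerivAt (A s) (A' s τ) τ := hasDerivAt_quadr fun k => H.hasDerivAt_al hm k hτ
  refine ⟨?_, ?_, ?_, ?_⟩
  · have h1 := (hasDerivAt_inv hτ0.ne').ofReal_comp
    have h2 := hasDerivAt_cor hm (b k) ω k dq
    refine ((H.hasDerivAt_al hm k hτ).add ((h1.mul h2).const_mul _)).congr_deriv ?_
    gcongr
  · have e := qf_al hm (b k) ω v v' k τ
    have e2 : al' m₁ b ω v v' r k τ + (I / (mm m₁ k : ℝ)) * (((-(τ ^ 2)⁻¹ : ℝ) : ℂ) * cor m₁ (b k) ω k A τ +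
        (τ⁻¹ : ℝ) * ((∑ s, ∑ t, if dg s + dg t = ix k then 0 else cf m₁ (b k) ω s t * (A s τ * A t τ) * ee m₁ (dg s + dg t - ix k) τ) +
        rem m₁ (b k) ω k A A' τ)) + (I / (mm m₁ k : ℝ)) * ((τ⁻¹ : ℝ) * (res m₁ (b k) ω (ix k) *
        Mon k (fun k => at' m₁ b ω v v' k τ))) =
        (I / (mm m₁ k : ℝ)) * (-(ee m₁ (-ix k) τ * (r k τ : ℂ)) + ((-(τ ^ 2)⁻¹ : ℝ) : ℂ) * cor m₁ (b k) ω k A τ +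
          (τ⁻¹ : ℝ) * rem m₁ (b k) ω k A A' τ - (τ⁻¹ : ℝ) * (res m₁ (b k) ω (ix k) *
            (Mon k (fun k => al m₁ v v' k τ) - Mon k (fun k => at' m₁ b ω v v' k τ)))) := by
      rw [al']
      push_cast
      grind
    rw [e2, norm_mul]
    have n1 : ‖-(ee m₁ (-ix k) τ * (r k τ : ℂ))‖ ≤ κ * Yy := by
      rw [norm_neg, norm_mul, norm_ee, one_mul, norm_real]; exact H.hr k τ hτ
    have n2 : ‖((-(τ ^ 2)⁻¹ : ℝ) : ℂ) * cor m₁ (b k) ω k A τ‖ ≤ C2 * (κ * Yy) := by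
      rw [norm_mul, norm_real, norm_neg, norm_eq_abs, abs_of_pos (by positivity)]
      calc _ ≤ (τ ^ 2)⁻¹ * (C2 * (κ * X ^ 2)) := by have := cor1 k; gcongr
        _ = C2 * (κ * (τ⁻¹ * τ⁻¹ * X ^ 2)) := by grind
        _ ≤ _ := by
          refine mul_le_mul_of_nonneg_left (mul_le_mul_of_nonneg_left (le_trans ?_ hXY) hκ) (by positivity)
          gcongr
    have n3 : ‖((τ⁻¹ : ℝ) : ℂ) * rem m₁ (b k) ω k A A' τ‖ ≤ C3 * (κ * Yy) := by
      rw [norm_mul, norm_real, norm_eq_abs, abs_of_pos hti]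
      calc _ ≤ τ⁻¹ * (C3 * (κ * (τ⁻¹ * X ^ 3))) := by gcongr
        _ = C3 * (κ * (τ⁻¹ * τ⁻¹ * X ^ 3)) := by ring
        _ ≤ _ := by
          refine mul_le_mul_of_nonneg_left (mul_le_mul_of_nonneg_left (le_trans ?_ hXY) hκ) (by positivity)
          gcongr
    have n4 : ‖((τ⁻¹ : ℝ) : ℂ) * (res m₁ (b k) ω (ix k) *
            (Mon k (fun k => al m₁ v v' k τ) - Mon k (fun k => at' m₁ b ω v v' k τ)))‖ ≤ C5 * (κ * Yy) := by
      have h1 := norm_Mon_sub_le (z := fun k => al m₁ v v' k τ) (u := fun k => at' m₁ b ω v v' k τ) (a := C4 * (κ * X))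
        (d := μ * C2 * (κ * (τ⁻¹ * X ^ 2)))
        (fun k => (a1 k).trans (mul_le_mul_of_nonneg_right (by rw [hC4]; linarith [mul_nonneg hμ0.le (by positivity : 0 ≤ C2)]) (by positivity)))
        at1 diff1 k
      have h2 : ‖res m₁ (b k) ω (ix k)‖ ≤ 16 * (Cc * W ^ 2) := by
        have h3 : ∀ s t, ‖(if dg s + dg t = ix k then cf m₁ (b k) ω s t else 0 : ℂ)‖ ≤ Cc * W ^ 2 := fun s t => by
          split_ifs
          · exact hB k s t
          · simpa using hB0
        refine (norm_sum_le_of_le _ fun s _ => norm_sum_le_of_le _ fun t _ => h3 s t).trans (le_of_eq ?_)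
        simp; ring
      rw [norm_mul, norm_mul, norm_real, norm_eq_abs, abs_of_pos hti]
      calc _ ≤ τ⁻¹ * ((16 * (Cc * W ^ 2)) * (2 * (C4 * (κ * X) * (μ * C2 * (κ * (τ⁻¹ * X ^ 2)))))) := by gcongr
        _ = C5 * (W ^ 2 * κ ^ 2 * (τ⁻¹ * τ⁻¹ * X ^ 3)) := by rw [hC5]; ring
        _ ≤ C5 * (κ * Yy) := by
          refine mul_le_mul_of_nonneg_left (mul_le_mul hWk2 (le_trans ?_ hXY) (by positivity) hκ) (by positivity)
          gcongr
    have n5 := (norm_sub_le_of_le (norm_add_le_of_le (norm_add_le_of_le n1 n2) n3) n4)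
    refine (mul_le_mul (hmk k) n5 (norm_nonneg _) hμ0.le).trans ?_
    have h4 : 0 ≤ C4 * (κ * Yy) := by positivity
    grind
  · refine (diff1 k).trans ?_
    have h4 : κ * (τ⁻¹ * X ^ 2) ≤ κ * 1 := by gcongr
    have h5 := mul_le_mul_of_nonneg_left h4 (by positivity : 0 ≤ μ * C2)
    refine h5.trans ?_
    have h6 : μ * C2 ≤ C4 + μ * (1 + C2 + C3 + C5) := by
      have : 0 ≤ C4 + μ * (1 + C3 + C5) := by positivity
      linarith
    rw [mul_one]
    gcongr
  · refine (at1 k).trans ?_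
    rw [mul_assoc]
    refine mul_le_mul_of_nonneg_right ?_ (by positivity)
    have : 0 ≤ μ * (1 + C2 + C3 + C5) := by positivity
    linarith
end

theorem norm_le_of_rpow_deriv {E : Type*} [NormedAddCommGroup E] [NormedSpace ℝ E] {f f' : ℝ → E} {t0 t1 B a : ℝ}
    (ht : 1 ≤ t0) (ha : 0 < a) (hB : 0 ≤ B) (hf : ∀ τ ∈ Icc t0 t1, HasDerivAt f (f' τ) τ)
    (hb : ∀ τ ∈ Icc t0 t1, ‖f' τ‖ ≤ B * τ ^ (-a - 1)) : ∀ τ ∈ Icc t0 t1, ‖f τ‖ ≤ ‖f t0‖ + B / a := by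
  intro τ hτ
  have key := image_norm_le_of_norm_deriv_right_le_deriv_boundary' (f := f)
    (B := fun τ => ‖f t0‖ + B / a * (1 - τ ^ (-a))) (B' := fun τ => B * τ ^ (-a - 1))
    (fun x hx => (hf x hx).continuousAt.continuousWithinAt)
    (fun x hx => (hf x ⟨hx.1, hx.2.le⟩).hasDerivWithinAt) ?_ ?_ ?_
    (fun x hx => hb x ⟨hx.1, hx.2.le⟩) hτ
  · refine key.trans ?_
    have h1 : 0 ≤ τ ^ (-a) := rpow_nonneg (by grind) _
    have h2 : 0 ≤ B / a := by positivity
    nlinarith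
  · have h1 : t0 ^ (-a) ≤ 1 := rpow_le_one_of_one_le_of_nonpos ht (by linarith)
    have h2 : 0 ≤ B / a := by positivity
    nlinarith
  · intro x hx
    have : 0 < x := by linarith [hx.1]
    exact (continuousAt_const.add (continuousAt_const.mul (continuousAt_const.sub
      (continuousAt_id.rpow_const (Or.inl this.ne'))))).continuousWithinAt
  · intro x hx
    have hx0 : x ≠ 0 := by linarith [hx.1]
    have h1 := (((hasDerivAt_rpow_const (p := -a) (Or.inl hx0)).const_sub 1).const_mul (B / a)).const_add ‖f t0‖
    refine (h1.congr_deriv ?_).hasDerivWithinAt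
    field_simp

section
variable {m₁ : ℝ}

theorem resonant_identity (hm : 0 < m₁) (R z : Fin 2 → ℂ) (s : ℝ) (h : (R 0 * R 1).im = 0) :
    (R 0 * R 1).re * (star (z 0) * ((I / (mm m₁ 0 : ℝ)) * ((s : ℂ) * (R 0 * Mon 0 z)))).re +
      2 * ‖R 0‖ ^ 2 * (star (z 1) * ((I / (mm m₁ 1 : ℝ)) * ((s : ℂ) * (R 1 * Mon 1 z)))).re = 0 := by
  have e : ∀ k, I / (mm m₁ k : ℝ) = ((mm m₁ k)⁻¹ : ℝ) * I := fun k => by push_cast; ring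
  have e1 : (mm m₁ 1)⁻¹ = (mm m₁ 0)⁻¹ / 2 := by
    simp only [mm]; norm_num; ring
  rw [e, e, e1, ← Complex.normSq_eq_norm_sq, Complex.normSq_apply]
  generalize (mm m₁ 0)⁻¹ = q
  obtain ⟨a0, b0, h0⟩ : ∃ a b : ℝ, R 0 = ⟨a, b⟩ := ⟨_, _, rfl⟩
  obtain ⟨a1, b1, h1⟩ : ∃ a b : ℝ, R 1 = ⟨a, b⟩ := ⟨_, _, rfl⟩
  obtain ⟨x0, y0, h2⟩ : ∃ a b : ℝ, z 0 = ⟨a, b⟩ := ⟨_, _, rfl⟩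
  obtain ⟨x1, y1, h3⟩ : ∃ a b : ℝ, z 1 = ⟨a, b⟩ := ⟨_, _, rfl⟩
  simp only [Mon, h0, h1, h2, h3] at h ⊢
  simp only [Matrix.cons_val_zero, Matrix.cons_val_one, Complex.mul_re, Complex.mul_im, Complex.ofReal_re, Complex.ofReal_im,
    Complex.I_re, Complex.I_im, Complex.star_def, Complex.conj_re, Complex.conj_im, pow_two] at h ⊢
  linear_combination (-s * q * (x1 * (x0 ^ 2 - y0 ^ 2) * a0 + y1 * (2 * x0 * y0) * a0 + x1 * (2 * x0 * y0) * b0 - y1 * (x0 ^ 2 - y0 ^ 2) * b0)) * h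

theorem resonant_bound (hm : 0 < m₁) {c : ℝ} (hc : 0 < c) : ∃ C, 0 ≤ C ∧ ∀ {R : Fin 2 → ℂ} {z z' : Fin 2 → ℝ → ℂ} {t0 t1 B D : ℝ},
    1 ≤ t0 → 1 ≤ B → 0 ≤ D → (∀ k, ‖R k‖ ≤ B) → (∀ k, ‖z k t0‖ ≤ D) →
    (∀ τ ∈ Icc t0 t1, ∀ k, HasDerivAt (z k) (z' k τ) τ ∧
      ‖z' k τ + (I / (mm m₁ k : ℝ)) * ((τ⁻¹ : ℝ) * (R k * Mon k (fun k => z k τ)))‖ ≤ D * τ ^ (-3 / 2 : ℝ) ∧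
      ‖z k τ‖ ≤ D * τ ^ (1 / 10 : ℝ)) →
    ((R 0 = 0 ∧ R 1 = 0) ∨ (c ≤ (R 0 * R 1).re ∧ (R 0 * R 1).im = 0)) →
    ∀ τ ∈ Icc t0 t1, ∀ k, ‖z k τ‖ ≤ C * B ^ 2 * D := by
  refine ⟨3 + √(18 / c + 9 / c ^ 2), by positivity, ?_⟩
  intro R z z' t0 t1 B D ht hB hD hR h0 hz hcase τ hτ k
  have hB2 : 1 ≤ B ^ 2 := one_le_pow₀ hB
  rcases hcase with ⟨r0, r1⟩ | ⟨hP, hI⟩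
  · have hR0 : ∀ k, R k = 0 := fun k => by fin_cases k; exacts [r0, r1]
    have h1 := norm_le_of_rpow_deriv (f := z k) (f' := z' k) (a := 1 / 2) ht (by norm_num) hD (fun τ hτ => (hz τ hτ k).1)
      (fun τ hτ => by have := (hz τ hτ k).2.1; rw [hR0 k] at this; simp only [zero_mul, mul_zero, add_zero] at this; norm_num at this ⊢; exact this) τ hτ
    have h2 := h0 k
    have h3 : ‖z k τ‖ ≤ 3 * D := by linarith
    refine h3.trans ?_
    refine mul_le_mul_of_nonneg_right ?_ hD
    have h4 : 0 ≤ √(18 / c + 9 / c ^ 2) := sqrt_nonneg _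
    nlinarith
  · set P := (R 0 * R 1).re with hPd
    set e : Fin 2 → ℝ → ℂ := fun k τ => z' k τ + (I / (mm m₁ k : ℝ)) * ((τ⁻¹ : ℝ) * (R k * Mon k (fun k => z k τ))) with he
    have hP0 : 0 < P := hc.trans_le hP
    have hPB : P ≤ B ^ 2 := by
      refine (Complex.re_le_norm _).trans ?_
      rw [norm_mul, pow_two]
      exact mul_le_mul (hR 0) (hR 1) (norm_nonneg _) (by linarith)
    have hRB : ‖R 0‖ ^ 2 ≤ B ^ 2 := pow_le_pow_left₀ (norm_nonneg _) (hR 0) 2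
    have hd : ∀ τ ∈ Icc t0 t1, HasDerivAt (fun τ => P * ‖z 0 τ‖ ^ 2 + 2 * ‖R 0‖ ^ 2 * ‖z 1 τ‖ ^ 2)
        (2 * (P * (star (z 0 τ) * e 0 τ).re + 2 * ‖R 0‖ ^ 2 * (star (z 1 τ) * e 1 τ).re)) τ := by
      intro τ hτ
      have i1 := ((hz τ hτ 0).1.norm_sq.const_mul P).fun_add ((hz τ hτ 1).1.norm_sq.const_mul (2 * ‖R 0‖ ^ 2))
      refine i1.congr_deriv ?_
      have i2 := resonant_identity hm R (fun k => z k τ) τ⁻¹ hI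
      rw [Complex.inner, Complex.inner, mul_comm (z' 0 τ), mul_comm (z' 1 τ)]
      simp only [he, mul_add, Complex.add_re, ← Complex.star_def] at i2 ⊢
      linear_combination -2 * i2
    have hb : ∀ τ ∈ Icc t0 t1, ‖2 * (P * (star (z 0 τ) * e 0 τ).re + 2 * ‖R 0‖ ^ 2 * (star (z 1 τ) * e 1 τ).re)‖ ≤
        6 * B ^ 2 * D ^ 2 * τ ^ (-(2 / 5) - 1 : ℝ) := by
      intro τ hτ
      have hτ0 : 0 < τ := by grind
      have j : ∀ k, |(star (z k τ) * e k τ).re| ≤ D ^ 2 * τ ^ (-(2 / 5) - 1 : ℝ) := fun k => by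
        refine (Complex.abs_re_le_norm _).trans ?_
        rw [norm_mul, norm_star]
        refine (mul_le_mul (hz τ hτ k).2.2 (hz τ hτ k).2.1 (norm_nonneg _) (by positivity)).trans (le_of_eq ?_)
        have : τ ^ (-(2 / 5) - 1 : ℝ) = τ ^ (1 / 10 : ℝ) * τ ^ (-3 / 2 : ℝ) := by
          rw [← rpow_add hτ0]; norm_num
        rw [this]; ring
      rw [norm_eq_abs, abs_mul, abs_two]
      set N := D ^ 2 * τ ^ (-(2 / 5) - 1 : ℝ)
      have hN : 0 ≤ N := by positivity
      calc _ ≤ 2 * (B ^ 2 * N + 2 * B ^ 2 * N) := by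
            refine mul_le_mul_of_nonneg_left ((abs_add_le _ _).trans (add_le_add ?_ ?_)) zero_le_two
            · rw [abs_mul, abs_of_pos hP0]
              exact mul_le_mul hPB (j 0) (abs_nonneg _) (by positivity)
            · rw [abs_mul, abs_of_nonneg (by positivity)]
              exact mul_le_mul (by linarith) (j 1) (abs_nonneg _) (by positivity)
        _ = _ := by ring
    have h1 := norm_le_of_rpow_deriv ht (by norm_num : (0:ℝ) < 2 / 5) (by positivity) hd hb τ hτ
    have nn : ∀ τ, 0 ≤ P * ‖z 0 τ‖ ^ 2 + 2 * ‖R 0‖ ^ 2 * ‖z 1 τ‖ ^ 2 := fun τ => by positivity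
    rw [norm_of_nonneg (nn _), norm_of_nonneg (nn _)] at h1
    have q : ∀ k, ‖z k t0‖ ^ 2 ≤ D ^ 2 := fun k => pow_le_pow_left₀ (norm_nonneg _) (h0 k) 2
    have h2 : P * ‖z 0 t0‖ ^ 2 ≤ B ^ 2 * D ^ 2 := mul_le_mul hPB (q 0) (by positivity) (by positivity)
    have h3 : ‖R 0‖ ^ 2 * ‖z 1 t0‖ ^ 2 ≤ B ^ 2 * D ^ 2 := mul_le_mul hRB (q 1) (by positivity) (by positivity)
    have h4 : P * ‖z 0 τ‖ ^ 2 + 2 * ‖R 0‖ ^ 2 * ‖z 1 τ‖ ^ 2 ≤ 18 * (B ^ 2 * D ^ 2) := by linarith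
    have hBB : B ^ 2 ≤ B ^ 4 := by nlinarith
    have k0 : ‖z 0 τ‖ ^ 2 ≤ 18 / c * (B ^ 4 * D ^ 2) := by
      have i1 : c * ‖z 0 τ‖ ^ 2 ≤ 18 * (B ^ 2 * D ^ 2) :=
        (mul_le_mul_of_nonneg_right hP (by positivity)).trans (by linarith [(by positivity : 0 ≤ 2 * ‖R 0‖ ^ 2 * ‖z 1 τ‖ ^ 2)])
      have i2 : B ^ 2 * D ^ 2 ≤ B ^ 4 * D ^ 2 := by gcongr
      rw [div_mul_eq_mul_div, le_div_iff₀ hc]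
      linarith
    have k1 : ‖z 1 τ‖ ^ 2 ≤ 9 / c ^ 2 * (B ^ 4 * D ^ 2) := by
      have i0 : c ≤ ‖R 0‖ * B := by
        refine (hP.trans (Complex.re_le_norm _)).trans ?_
        rw [norm_mul]
        exact mul_le_mul_of_nonneg_left (hR 1) (norm_nonneg _)
      have i1 : c ^ 2 ≤ ‖R 0‖ ^ 2 * B ^ 2 := by nlinarith
      have i2 : ‖R 0‖ ^ 2 * ‖z 1 τ‖ ^ 2 ≤ 9 * (B ^ 2 * D ^ 2) := by nlinarith
      rw [div_mul_eq_mul_div, le_div_iff₀ (by positivity)]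
      calc _ ≤ ‖z 1 τ‖ ^ 2 * (‖R 0‖ ^ 2 * B ^ 2) := by gcongr
        _ = B ^ 2 * (‖R 0‖ ^ 2 * ‖z 1 τ‖ ^ 2) := by ring
        _ ≤ B ^ 2 * (9 * (B ^ 2 * D ^ 2)) := by gcongr
        _ = _ := by ring
    have kk : ‖z k τ‖ ^ 2 ≤ (18 / c + 9 / c ^ 2) * (B ^ 4 * D ^ 2) := by
      rw [add_mul]
      have n0 : 0 ≤ 18 / c * (B ^ 4 * D ^ 2) := by positivity
      have n1 : 0 ≤ 9 / c ^ 2 * (B ^ 4 * D ^ 2) := by positivity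
      fin_cases k
      · grind
      · grind
    refine le_of_sq_le_sq (kk.trans ?_) (by positivity)
    have n2 : 0 ≤ 18 / c + 9 / c ^ 2 := by positivity
    calc _ = √(18 / c + 9 / c ^ 2) ^ 2 * (B ^ 4 * D ^ 2) := by rw [sq_sqrt n2]
      _ ≤ (3 + √(18 / c + 9 / c ^ 2)) ^ 2 * (B ^ 4 * D ^ 2) := by
        gcongr
        linarith
      _ = _ := by ring

/-- Sharp bound for solutions of the resonant system. -/
theorem RayODE.sharp (hm : 0 < m₁) (b : Fin 2 → Ix → Ix → ℝ) {c : ℝ} (hc : 0 < c) : ∃ C, 0 ≤ C ∧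
    ∀ {ω W κ t0 t1 v v' r}, RayODE m₁ b ω W κ t0 t1 v v' r → (∀ k, |v k t0| + |v' k t0| ≤ κ) →
    ((res m₁ (b 0) ω 1 = 0 ∧ res m₁ (b 1) ω 2 = 0) ∨
      (c ≤ (res m₁ (b 0) ω 1 * res m₁ (b 1) ω 2).re ∧ (res m₁ (b 0) ω 1 * res m₁ (b 1) ω 2).im = 0)) →
    ∀ τ ∈ Icc t0 t1, ∀ k, |v k τ| + |v' k τ| ≤ C * W ^ 4 * κ := by
  obtain ⟨C1, hC1, hn⟩ := normal_form hm b
  obtain ⟨C2, hC2, hr⟩ := resonant_bound hm hc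
  have hcf := fun k => norm_cf_le hm (b k)
  choose Cf hCf hcf using hcf
  set Bc := 1 + 16 * (Cf 0 + Cf 1) with hBc
  have hBc1 : 1 ≤ Bc := by grind
  set D0 := 1 + m₁⁻¹ + C1 with hD0
  have hmi : 0 < m₁⁻¹ := inv_pos.2 hm
  have hD1 : 0 ≤ D0 := by positivity
  refine ⟨(1 + 2 * m₁) * (C2 * Bc ^ 2 * D0 + C1), by positivity, ?_⟩
  intro ω W κ t0 t1 v v' r H hini hcase τ hτ k
  obtain ⟨z', hz⟩ := hn H
  have hW := H.one_le_W
  have hW4 : 1 ≤ W ^ 4 := one_le_pow₀ hW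
  have hW2 : 1 ≤ W ^ 2 := one_le_pow₀ hW
  have hκ := H.hκ
  have ht01 : t0 ≤ t1 := hτ.1.trans hτ.2
  have hR : ∀ k, ‖res m₁ (b k) ω (ix k)‖ ≤ Bc * W ^ 2 := fun k => by
    have h3 : ∀ s t, ‖(if dg s + dg t = ix k then cf m₁ (b k) ω s t else 0 : ℂ)‖ ≤ Cf k * W ^ 2 := fun s t => by
      split_ifs
      · exact hcf k ω W hW H.hω s t
      · simpa using mul_nonneg (hCf k) (by positivity)
    refine (norm_sum_le_of_le _ fun s _ => norm_sum_le_of_le _ fun t _ => h3 s t).trans ?_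
    have h4 : Cf k ≤ Cf 0 + Cf 1 := by
      fin_cases k
      · grind
      · grind
    calc _ = (16 * Cf k) * W ^ 2 := by simp; ring
      _ ≤ _ := by nlinarith
  have key := hr (R := fun k => res m₁ (b k) ω (ix k)) (z := at' m₁ b ω v v') (z' := z') (t0 := t0) (t1 := t1)
    (B := Bc * W ^ 2) (D := D0 * κ) H.one_le (one_le_mul_of_one_le_of_one_le hBc1 hW2) (by positivity) hR
    (fun k => by
      have h1 := (hz t0 ⟨le_rfl, ht01⟩ k).2.2.1
      have h2 := (norm_al_le (v := v) (v' := v') hm k t0).trans (mul_le_mul_of_nonneg_left (hini k) (by positivity))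
      have h3 := norm_sub_norm_le (at' m₁ b ω v v' k t0) (al m₁ v v' k t0)
      rw [norm_sub_rev] at h3
      rw [hD0, add_mul]; linarith)
    (fun τ hτ k => by
      obtain ⟨g1, g2, g3, g4⟩ := hz τ hτ k
      have hτ0 := H.pos hτ
      have hCD : C1 * κ ≤ D0 * κ := mul_le_mul_of_nonneg_right (by linarith) hκ
      exact ⟨g1, g2.trans (mul_le_mul_of_nonneg_right hCD (by positivity)), g4.trans (mul_le_mul_of_nonneg_right hCD (by positivity))⟩)
    hcase τ hτ k
  have h1 := (hz τ hτ k).2.2.1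
  have h2 : ‖al m₁ v v' k τ‖ ≤ C2 * (Bc * W ^ 2) ^ 2 * (D0 * κ) + C1 * κ := by
    have h3 := norm_sub_norm_le (al m₁ v v' k τ) (at' m₁ b ω v v' k τ)
    linarith
  refine (le_norm_al hm k τ).trans ((mul_le_mul_of_nonneg_left h2 (by positivity)).trans ?_)
  have h5 : C1 * κ ≤ C1 * κ * W ^ 4 := le_mul_of_one_le_right (by positivity) hW4
  calc _ ≤ (1 + 2 * m₁) * (C2 * (Bc * W ^ 2) ^ 2 * (D0 * κ) + C1 * κ * W ^ 4) := by gcongr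
    _ = _ := by ring
end

/-- The unit covector dual to the ray through `y`. -/
def oy (y : ℝ × ℝ) : Fin 3 → ℝ := ![w0 y, -y.1, -y.2]

theorem abs_oy_le (y : ℝ × ℝ) (a) : |oy y a| ≤ w0 y := by
  have hw := w0_pos y
  have hwsq := w0_sq y
  fin_cases a
  · exact (abs_of_pos hw).le
  · change |-y.1| ≤ _
    rw [abs_neg]; exact abs_le_of_sq_le_sq (by nlinarith) hw.le
  · change |-y.2| ≤ _
    rw [abs_neg]; exact abs_le_of_sq_le_sq (by nlinarith) hw.le

theorem oy_hyp (y : ℝ × ℝ) : oy y 0 ^ 2 - oy y 1 ^ 2 - oy y 2 ^ 2 = 1 := by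
  change w0 y ^ 2 - (-y.1) ^ 2 - (-y.2) ^ 2 = 1
  rw [w0_sq]; ring

theorem abs_prof_le (y : ℝ × ℝ) {v v' : Fin 2 → ℝ} {D : ℝ} (h : ∀ k, |v k| + |v' k| ≤ D) (c : Ix) :
    |prof (oy y) v v' c| ≤ w0 y * D := by
  have hw := one_le_w0 y
  obtain ⟨k, _ | a⟩ := c
  · change |v k| ≤ _
    have h1 := h k
    have h2 := abs_nonneg (v' k)
    have h3 := abs_nonneg (v k)
    nlinarith
  · change |oy y a * v' k| ≤ _
    rw [abs_mul]
    exact mul_le_mul (abs_oy_le y a) (by grind) (abs_nonneg _) (by linarith)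

theorem ray_prof (w : Fin 2 → SF) {y : ℝ × ℝ} {τ : ℝ} (h0 : 0 < τ) (c : Ix) :
    |τ * UU w c (ry y τ) - prof (oy y) (fun k => vr (w k) y τ) (fun k => vr' (w k) y τ) c| ≤
      4 * w0 y * hs w 1 (ry y τ) := by
  have hw := w0_pos y
  have hw1 := one_le_w0 y
  obtain ⟨j, c⟩ := c
  set f := w j with hf
  have hf0 : |f (ry y τ)| ≤ hs w 1 (ry y τ) := le_hs w _ j (I := []) (by simp)
  have hL1 : |L1 f (ry y τ)| ≤ hs w 1 (ry y τ) := le_hs w _ j (I := [3]) (by simp)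
  have hL2 : |L2 f (ry y τ)| ≤ hs w 1 (ry y τ) := le_hs w _ j (I := [4]) (by simp)
  set p := ry y τ with hp
  set H := hs w 1 p
  have hH : 0 ≤ H := by grind
  have hwsq := w0_sq y
  have e1 := L1_ray f y τ
  have e2 := L2_ray f y τ
  have eS := Sc_ray f y τ
  have hv' : vr' f y τ = f p + Sc f p := rfl
  have hy1 : |y.1| ≤ w0 y := abs_le_of_sq_le_sq (by nlinarith) hw.le
  have hy2 : |y.2| ≤ w0 y := abs_le_of_sq_le_sq (by nlinarith) hw.le
  have mb : ∀ {a b : ℝ}, |a| ≤ w0 y → |b| ≤ H → |a * b| ≤ w0 y * H := fun ha hb => by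
    rw [abs_mul]; exact mul_le_mul ha hb (abs_nonneg _) hw.le
  have mq : ∀ {a b : ℝ}, |a| ≤ w0 y → |b| ≤ w0 y → |a * b / w0 y| ≤ w0 y := fun ha hb => by
    rw [abs_div, abs_of_pos hw, div_le_iff₀ hw, abs_mul]; gcongr
  have hi : |(w0 y)⁻¹| ≤ w0 y := by
    rw [abs_of_pos (inv_pos.2 hw)]; exact (inv_le_one_of_one_le₀ hw1).trans hw1
  have n4 : ∀ {a b c d : ℝ}, |a| ≤ w0 y * H → |b| ≤ w0 y * H → |c| ≤ w0 y * H → |d| ≤ w0 y * H →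
      |a + b + c + d| ≤ 4 * w0 y * H := fun ha hb hc hd => by
    rw [abs_le] at *; constructor <;> linarith [ha.1, ha.2, hb.1, hb.2, hc.1, hc.2, hd.1, hd.2]
  have z0 : |(0 : ℝ)| ≤ w0 y * H := by rw [abs_zero]; positivity
  rcases c with _ | a
  · change |τ * f p - τ * f p| ≤ _
    rw [sub_self, abs_zero]; positivity
  · fin_cases a
    · change |τ * T f p - w0 y * vr' f y τ| ≤ _
      have : τ * T f p - w0 y * vr' f y τ = w0 y * (-f p) + y.1 * (-L1 f p) + y.2 * (-L2 f p) + 0 := by grind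
      rw [this]
      exact n4 (mb (abs_of_pos hw).le (by rwa [abs_neg])) (mb hy1 (by rwa [abs_neg])) (mb hy2 (by rwa [abs_neg])) z0
    · change |τ * X f p - -y.1 * vr' f y τ| ≤ _
      have : τ * X f p - -y.1 * vr' f y τ = (w0 y)⁻¹ * L1 f p + y.1 * y.1 / w0 y * L1 f p + y.1 * y.2 / w0 y * L2 f p + y.1 * f p := by
        rw [hv', e1, e2, eS]; field_simp; linear_combination (τ * y.1 * T f p) * hwsq
      rw [this]
      exact n4 (mb hi hL1) (mb (mq hy1 hy1) hL1) (mb (mq hy1 hy2) hL2) (mb hy1 hf0)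
    · change |τ * Y f p - -y.2 * vr' f y τ| ≤ _
      have : τ * Y f p - -y.2 * vr' f y τ = (w0 y)⁻¹ * L2 f p + y.2 * y.2 / w0 y * L2 f p + y.1 * y.2 / w0 y * L1 f p + y.2 * f p := by
        rw [hv', e1, e2, eS]; field_simp; linear_combination (τ * y.2 * T f p) * hwsq
      rw [this]
      exact n4 (mb hi hL2) (mb (mq hy2 hy2) hL2) (mb (mq hy1 hy2) hL1) (mb hy2 hf0)

theorem qf_smul (b : Ix → Ix → ℝ) (s : ℝ) (x : Ix → ℝ) : qf b (fun c => s * x c) = s ^ 2 * qf b x := by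
  simp only [qf, mul_sum]
  grind

theorem qf_sub_le (b : Ix → Ix → ℝ) {x z : Ix → ℝ} {a d : ℝ} (hx : ∀ c, |x c| ≤ a) (hz : ∀ c, |z c| ≤ a)
    (hd : ∀ c, |x c - z c| ≤ d) : |qf b x - qf b z| ≤ (∑ c, ∑ e, |b c e|) * (2 * a * d) := by
  rw [qf, qf, ← Finset.sum_sub_distrib, sum_mul]
  refine (abs_sum_le_sum_abs _ _).trans (sum_le_sum fun c _ => ?_)
  rw [← Finset.sum_sub_distrib, sum_mul]
  refine (abs_sum_le_sum_abs _ _).trans (sum_le_sum fun e _ => ?_)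
  have : b c e * x c * x e - b c e * z c * z e = b c e * (x c * (x e - z e) + (x c - z c) * z e) := by ring
  rw [this, abs_mul]
  refine mul_le_mul_of_nonneg_left ((abs_add_le _ _).trans ?_) (abs_nonneg _)
  have ha : 0 ≤ a := by grind
  have hd0 : 0 ≤ d := by grind
  have h1 : |x c * (x e - z e)| ≤ a * d := by rw [abs_mul]; exact mul_le_mul (hx c) (hd e) (abs_nonneg _) ha
  have h2 : |(x c - z c) * z e| ≤ d * a := by rw [abs_mul]; exact mul_le_mul (hd c) (hz e) (abs_nonneg _) hd0
  linarith

theorem cubic_est {τ X M q C D E : ℝ} (hτ : 0 < τ) (hX : 1 ≤ X) (hq0 : 0 ≤ q) (hq1 : q ≤ 1) (hC : 0 ≤ C) (hD : 0 ≤ D)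
    (hM0 : 0 ≤ M) (hM : M ≤ C * q * X) (hE : (τ ^ 2)⁻¹ * X ^ 5 = E) :
    τ * (D * (9 * M / τ) ^ 3) ≤ 1000 * D * C ^ 3 * q * E := by
  calc _ = 729 * D * (M ^ 3 * (τ ^ 2)⁻¹) := by field_simp; ring
    _ ≤ 1000 * D * ((C * q * X) ^ 3 * (τ ^ 2)⁻¹) := by gcongr; norm_num
    _ = 1000 * D * C ^ 3 * (q * q ^ 2) * ((τ ^ 2)⁻¹ * X ^ 3) := by ring
    _ ≤ 1000 * D * C ^ 3 * (q * 1) * ((τ ^ 2)⁻¹ * X ^ 5) := by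
        gcongr
        · nlinarith
        · norm_num
    _ = _ := by grind

theorem quadratic_est {τ X N w q C D E : ℝ} (hτ : 0 < τ) (hX : 1 ≤ X) (hq0 : 0 ≤ q) (hq1 : q ≤ 1) (hC : 0 ≤ C) (hD : 0 ≤ D)
    (hN0 : 0 ≤ N) (hw : 1 ≤ w) (hM : w ^ 3 * N ≤ C * q * X) (hE : (τ ^ 2)⁻¹ * X ^ 5 = E) :
    τ⁻¹ * (D * (2 * (9 * w ^ 2 * N) * (4 * w * N / τ))) ≤ 100 * D * C ^ 2 * q * E := by
  have hN : N ≤ C * q * X := le_trans (le_mul_of_one_le_left hN0 (one_le_pow₀ hw)) hM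
  calc _ = 72 * D * ((w ^ 3 * N) * N * (τ ^ 2)⁻¹) := by field_simp; ring
    _ ≤ 100 * D * ((C * q * X) * (C * q * X) * (τ ^ 2)⁻¹) := by gcongr; norm_num
    _ = 100 * D * C ^ 2 * (q * q) * ((τ ^ 2)⁻¹ * X ^ 2) := by ring
    _ ≤ 100 * D * C ^ 2 * (q * 1) * ((τ ^ 2)⁻¹ * X ^ 5) := by
        gcongr
        norm_num
    _ = _ := by grind

section
variable {m₁ : ℝ} {G : Fin 2 → GF Ix}

set_option maxHeartbeats 400000 in
/-- Sharp decay of the solution and its first derivatives along rays. -/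
theorem ray_sharp (hm : 0 < m₁) (hb : ∀ j, (G j).Bdd) (hq : ∀ j, (G j).Quad) (b : Fin 2 → Ix → Ix → ℝ)
    (hG : ∃ C, 0 ≤ C ∧ ∀ j, ∀ x : Ix → ℝ, ‖x‖ ≤ 1 → |G j x - qf (b j) x| ≤ C * ‖x‖ ^ 3) {c : ℝ} (hc : 0 < c)
    (hres : ∀ ω : Fin 3 → ℝ, ω 0 ^ 2 - ω 1 ^ 2 - ω 2 ^ 2 = 1 → ((res m₁ (b 0) ω 1 = 0 ∧ res m₁ (b 1) ω 2 = 0) ∨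
      (c ≤ (res m₁ (b 0) ω 1 * res m₁ (b 1) ω 2).re ∧ (res m₁ (b 0) ω 1 * res m₁ (b 1) ω 2).im = 0))) (s0 : ℝ) :
    ∃ C, 0 ≤ C ∧ ∃ K1, 0 < K1 ∧ ∀ {s1 A K w}, BS (mm m₁) G (1 / 4000) s0 s1 A K w → K ≤ K1 →
    ∀ y τ, τ ∈ Icc (exp s0) (exp s1) → τ * w0 y * nn Z (UU w) 0 (ry y τ) ≤ C * K := by
  obtain ⟨Cg, hCg, hG⟩ := hG
  have hmm := fun k => mm_pos hm k
  obtain ⟨C1, hC1, h1⟩ := ray_decay hmm hb hq 11 1 (by norm_num)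
  obtain ⟨C2, hC2, h2⟩ := ray_Cas_le hmm hb hq 10 0 (by norm_num)
  obtain ⟨C3, hC3, h3⟩ := ray_init_le hmm hb hq 10 0 (by norm_num) s0
  obtain ⟨C4, hC4, h4⟩ := hs_ray_le hmm hb hq 0 (by norm_num)
  obtain ⟨C5, hC5, h5⟩ := nn_UU_le 0
  obtain ⟨C6, hC6, h6⟩ := RayODE.sharp hm b hc
  set Bq := ∑ j, ∑ c, ∑ e, |b j c e| with hBq
  have hBq0 : 0 ≤ Bq := by positivity
  set Cb := 1 + 5 * C1 + C2 + C3 + 100 * Bq * C1 ^ 2 + 1000 * Cg * C1 ^ 3 with hCb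
  have hCb1 : 0 < Cb := by positivity
  refine ⟨C5 * (2 * (4 * (C6 * Cb) + 8 * C4)), by positivity, min 1 Cb⁻¹, by positivity, fun {s1 A K w} B hK y τ hτ => ?_⟩
  have hK1 : K ≤ 1 := by grind
  have hKC : Cb * K ≤ 1 := by
    rw [← mul_inv_cancel₀ hCb1.ne']; exact mul_le_mul_of_nonneg_left (hK.trans (min_le_right _ _)) hCb1.le
  have hK0 := B.K_nonneg
  have hw := w0_pos y
  have hw1 := one_le_w0 y
  set q := K / w0 y ^ 20 with hqd
  have hq0 : 0 ≤ q := by positivity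
  have hq1 : q ≤ 1 := (div_le_one (by positivity)).2 (hK1.trans (one_le_pow₀ hw1))
  have hqK : w0 y ^ 20 * q = K := mul_div_cancel₀ _ (by positivity)
  have hdiv : ∀ {a D : ℝ}, w0 y ^ 20 * a ≤ D * K → a ≤ D * q := fun {a D} h => by
    rw [hqd, ← mul_div_assoc, le_div_iff₀ (by positivity)]; linarith
  have hs01 : s0 ≤ s1 := exp_le_exp.1 (hτ.1.trans hτ.2)
  set r : Fin 2 → ℝ → ℝ := fun k τ => τ * (box (w k) + (mm m₁ k ^ 2) • w k) (ry y τ) + Cas (w k) (ry y τ) / τ -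
    τ⁻¹ * qf (b k) (prof (oy y) (fun k => vr (w k) y τ) (fun k => vr' (w k) y τ)) with hr
  have hN : ∀ τ ∈ Icc (exp s0) (exp s1), w0 y ^ 3 * (τ * hs w 1 (ry y τ)) ≤ C1 * q * τ ^ (1 / 10 : ℝ) := fun τ hτ => by
    have i := h1 B y τ hτ
    rw [mul_right_comm]
    grind
  have hrb : ∀ k, ∀ τ ∈ Icc (exp s0) (exp s1), |r k τ| ≤ Cb * q * τ ^ (-3 / 2 : ℝ) := by
    intro k τ hτ
    have hτ1 := one_le_ray B hτ.1
    have h0 : 0 < τ := by linarith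
    have hH := hs_nonneg w 1 (ry y τ)
    have hn := hN τ hτ
    set N := τ * hs w 1 (ry y τ) with hNd
    have hN0 : 0 ≤ N := by positivity
    set X := τ ^ (1 / 10 : ℝ) with hX
    have hX1 : 1 ≤ X := one_le_rpow hτ1 (by norm_num)
    have hXY : (τ ^ 2)⁻¹ * X ^ 5 = τ ^ (-3 / 2 : ℝ) := by
      have i1 : (τ ^ 2)⁻¹ = τ ^ (-2 : ℝ) := by simp
      have i2 : X ^ 5 = τ ^ (1 / 2 : ℝ) := by
        rw [hX, ← rpow_natCast, ← rpow_mul h0.le]; norm_num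
      rw [i1, i2, ← rpow_add h0]; norm_num
    have hv : ∀ k, |vr (w k) y τ| + |vr' (w k) y τ| ≤ 5 * w0 y * N := fun k => ray_init w hτ1 (I := []) (k := 0) (by simp) k
    have hpr := abs_prof_le y hv
    set pr := prof (oy y) (fun k => vr (w k) y τ) (fun k => vr' (w k) y τ) with hprd
    have hrp : ∀ c, |τ * UU w c (ry y τ) - pr c| ≤ 4 * w0 y * N / τ := fun c =>
      (ray_prof w h0 c).trans (le_of_eq (by rw [hNd]; field_simp))
    have hNt : 4 * w0 y * N / τ ≤ 4 * w0 y ^ 2 * N := by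
      rw [div_le_iff₀ h0]
      have i1 : w0 y * N ≤ w0 y ^ 2 * N * τ := by
        have : w0 y * N ≤ w0 y ^ 2 * N := mul_le_mul_of_nonneg_right (by nlinarith) hN0
        exact this.trans (le_mul_of_one_le_right (by positivity) hτ1)
      linarith
    have hpr2 : ∀ c, |pr c| ≤ 9 * w0 y ^ 2 * N := by grind
    have hU : ∀ c, |τ * UU w c (ry y τ)| ≤ 9 * w0 y ^ 2 * N := by grind
    have hUn : ‖fun c => UU w c (ry y τ)‖ ≤ 9 * w0 y ^ 2 * N / τ := by
      refine (pi_norm_le_iff_of_nonneg (by positivity)).2 fun c => ?_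
      have := hU c
      rw [abs_mul, abs_of_pos h0] at this
      rw [norm_eq_abs, le_div_iff₀ h0]; linarith
    have hU1 : ‖fun c => UU w c (ry y τ)‖ ≤ 1 :=
      (norm_le_nn (D := Z) _ _).trans ((nn_mono (D := Z) (UU w) (ry y τ) (Nat.zero_le 15)).trans (ray_small B (by norm_num) y hτ))
    have hsrc := ray_src B [] k y hτ
    have g1 := hG k _ hU1
    rw [← comp_apply] at g1
    have hsrc' : (box (w k) + (mm m₁ k ^ 2) • w k) (ry y τ) = comp (G k) (UU w) (ry y τ) := hsrc
    have hCas := h2 B [] (by simp) k y τ hτ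
    have hCas' : |Cas (w k) (ry y τ) / τ| ≤ C2 * q * τ ^ (-3 / 2 : ℝ) := by
      have := hdiv (a := |Cas (w k) (ry y τ) / τ|) (D := C2 * τ ^ (-3 / 2 : ℝ)) (by
        refine le_trans (le_of_eq ?_) (hCas.trans (le_of_eq ?_))
        · rfl
        · ring)
      grind
    have hqd2 := qf_sub_le (b k) hU hpr2 hrp
    rw [qf_smul] at hqd2
    have hdec : r k τ = τ * (comp (G k) (UU w) (ry y τ) - qf (b k) fun c => UU w c (ry y τ)) +
        τ⁻¹ * (τ ^ 2 * qf (b k) (fun c => UU w c (ry y τ)) - qf (b k) pr) + Cas (w k) (ry y τ) / τ := by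
      grind
    have hbk : ∑ c, ∑ e, |b k c e| ≤ Bq := single_le_sum (f := fun j => ∑ c, ∑ e, |b j c e|)
      (fun j _ => by positivity) (Finset.mem_univ k)
    have hw23 : w0 y ^ 2 * N ≤ C1 * q * X := by
      refine le_trans (mul_le_mul_of_nonneg_right (pow_le_pow_right₀ hw1 (by norm_num)) hN0) hn
    have e1 : |τ * (comp (G k) (UU w) (ry y τ) - qf (b k) fun c => UU w c (ry y τ))| ≤ 1000 * Cg * C1 ^ 3 * q * τ ^ (-3 / 2 : ℝ) := by
      rw [abs_mul, abs_of_pos h0]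
      refine le_trans (mul_le_mul_of_nonneg_left (g1.trans ?_) h0.le) (cubic_est h0 hX1 hq0 hq1 hC1 hCg (M := w0 y ^ 2 * N) (by positivity) hw23 hXY)
      rw [← mul_assoc]
      gcongr
    have e2 : |τ⁻¹ * (τ ^ 2 * qf (b k) (fun c => UU w c (ry y τ)) - qf (b k) pr)| ≤ 100 * Bq * C1 ^ 2 * q * τ ^ (-3 / 2 : ℝ) := by
      rw [abs_mul, abs_of_pos (inv_pos.2 h0)]
      refine le_trans (mul_le_mul_of_nonneg_left (hqd2.trans ?_) (inv_nonneg.2 h0.le)) (quadratic_est h0 hX1 hq0 hq1 hC1 hBq0 hN0 hw1 hn hXY)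
      gcongr
    rw [hdec]
    refine (abs_add_three _ _ _).trans ?_
    have e3 : Cb * q * τ ^ (-3 / 2 : ℝ) = 1000 * Cg * C1 ^ 3 * q * τ ^ (-3 / 2 : ℝ) + 100 * Bq * C1 ^ 2 * q * τ ^ (-3 / 2 : ℝ) +
      C2 * q * τ ^ (-3 / 2 : ℝ) + (1 + 5 * C1 + C3) * (q * τ ^ (-3 / 2 : ℝ)) := by rw [hCb]; ring
    have e4 : 0 ≤ (1 + 5 * C1 + C3) * (q * τ ^ (-3 / 2 : ℝ)) := by positivity
    linarith
  have key : ∀ k, |vr (w k) y τ| + |vr' (w k) y τ| ≤ C6 * w0 y ^ 4 * (Cb * q) := by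
    intro k
    refine h6 (W := w0 y) (κ := Cb * q) (t0 := exp s0) (t1 := exp s1)
      (v := fun k => vr (w k) y) (v' := fun k => vr' (w k) y) (r := r) ?_ (fun k => ?_) (hres (oy y) (oy_hyp y)) τ hτ k
    · refine ⟨one_le_exp B.s0_nonneg, hw1, abs_oy_le y, by positivity, ?_, ?_, ?_, ?_, hrb⟩
      · nlinarith
      · exact fun k τ hτ => hasDerivAt_vr _ y ((exp_pos _).trans_le hτ.1)
      · intro k τ hτ
        refine (hasDerivAt_vr' (mm m₁ k) (w k) y ((exp_pos _).trans_le hτ.1)).congr_deriv ?_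
        grind
      · intro k τ hτ
        have hτ1 := one_le_ray B hτ.1
        have hH := hs_nonneg w 1 (ry y τ)
        have i1 : |vr (w k) y τ| + |vr' (w k) y τ| ≤ 5 * w0 y * (τ * hs w 1 (ry y τ)) :=
          ray_init w hτ1 (I := []) (k := 0) (by simp) k
        have i2 := hN τ hτ
        have i3 : w0 y * (τ * hs w 1 (ry y τ)) ≤ w0 y ^ 3 * (τ * hs w 1 (ry y τ)) :=
          mul_le_mul_of_nonneg_right (le_self_pow₀ hw1 (by norm_num)) (by positivity)
        have i4 : Cb * q * τ ^ (1 / 10 : ℝ) = 5 * (C1 * q * τ ^ (1 / 10 : ℝ)) +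
          (1 + C2 + C3 + 100 * Bq * C1 ^ 2 + 1000 * Cg * C1 ^ 3) * (q * τ ^ (1 / 10 : ℝ)) := by rw [hCb]; ring
        have i5 : 0 ≤ (1 + C2 + C3 + 100 * Bq * C1 ^ 2 + 1000 * Cg * C1 ^ 3) * (q * τ ^ (1 / 10 : ℝ)) := by positivity
        grind
    · have i := h3 B hs01 [] (by simp) k y
      refine (hdiv (D := C3) i).trans (mul_le_mul_of_nonneg_right ?_ hq0)
      have : 0 ≤ 1 + 5 * C1 + C2 + 100 * Bq * C1 ^ 2 + 1000 * Cg * C1 ^ 3 := by positivity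
      grind
  have hτ1 := one_le_ray B hτ.1
  have fin : ∀ k, τ * w0 y * (|word Z [] (w k) (ry y τ)| + ∑ b, |dd b (word Z [] (w k)) (ry y τ)|) ≤
      4 * (C6 * Cb * K) + 8 * (C4 * K) := fun k => by
    refine ray_recover w hτ1 (k := 0) (by simp) k ?_ (h4 B y τ hτ)
    change w0 y ^ 2 * (|vr (w k) y τ| + |vr' (w k) y τ|) ≤ _
    calc _ ≤ w0 y ^ 2 * (C6 * w0 y ^ 4 * (Cb * q)) := mul_le_mul_of_nonneg_left (key k) (by positivity)
      _ = C6 * Cb * (w0 y ^ 6 * q) := by ring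
      _ ≤ C6 * Cb * (w0 y ^ 20 * q) := by
        gcongr
        · norm_num
      _ = _ := by rw [hqK]
  refine (mul_le_mul_of_nonneg_left (h5 w (ry y τ)) (by positivity)).trans ?_
  have e0 : words (Fin 5) 0 = {[]} := rfl
  simp only [e0, Finset.sum_singleton, Fin.sum_univ_two (fun j => |word Z [] (w j) _| + _)]
  have f0 := fin 0
  have f1 := fin 1
  calc _ = C5 * (τ * w0 y * (|word Z [] (w 0) (ry y τ)| + ∑ b, |dd b (word Z [] (w 0)) (ry y τ)|) +
      τ * w0 y * (|word Z [] (w 1) (ry y τ)| + ∑ b, |dd b (word Z [] (w 1)) (ry y τ)|)) := by ring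
    _ ≤ C5 * ((4 * (C6 * Cb * K) + 8 * (C4 * K)) + (4 * (C6 * Cb * K) + 8 * (C4 * K))) :=
      mul_le_mul_of_nonneg_left (add_le_add f0 f1) hC5
    _ = _ := by ring
end

theorem closure_of_bootstrap {φ : Pt → ℝ} (hφ : OK φ) {s0 A : ℝ} (hA : 0 < A) (h0 : ∀ z, φ (s0, z) < A)
    (h : ∀ s1, (∀ p : Pt, p.1 ∈ Icc s0 s1 → φ p ≤ A) → ∀ p : Pt, p.1 ∈ Icc s0 s1 → φ p ≤ A / 2) (p : Pt)
    (hp : s0 ≤ p.1) : φ p ≤ A := by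
  by_contra! hc
  obtain ⟨R, hR⟩ := hφ.1 (|s0| + |p.1|)
  have hcl : IsClosed {q : Pt | A ≤ φ q} := isClosed_le continuous_const hφ.2
  have hcomp : IsCompact ((Icc s0 p.1 ×ˢ Icc (-R) R ×ˢ Icc (-R) R) ∩ {q : Pt | A ≤ φ q}) :=
    (isCompact_Icc.prod (isCompact_Icc.prod isCompact_Icc)).inter_right hcl
  have hmem : ∀ q : Pt, q.1 ∈ Icc s0 p.1 → A ≤ φ q → q ∈ (Icc s0 p.1 ×ˢ Icc (-R) R ×ˢ Icc (-R) R) ∩ {q : Pt | A ≤ φ q} := by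
    intro q hq hAq
    by_contra hcon
    have : φ q = 0 := by
      refine hR q ?_ ?_
      · grind
      · by_contra! h'
        exact hcon ⟨⟨hq, abs_le.1 h'.1, abs_le.1 h'.2⟩, hAq⟩
    linarith
  obtain ⟨q, hq, hmin⟩ := hcomp.exists_isMinOn ⟨p, hmem p ⟨hp, le_rfl⟩ hc.le⟩ continuous_fst.continuousOn
  have hqA : A ≤ φ q := hq.2
  have hq1 : q.1 ∈ Icc s0 p.1 := hq.1.1
  have hlt : s0 < q.1 := by
    refine lt_of_le_of_ne hq1.1 fun hs => ?_
    have := h0 q.2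
    rw [hs] at this; linarith
  have hA2 : ∀ s ∈ Ico s0 q.1, φ (s, q.2) ≤ A / 2 := fun s hs => by
    refine h s (fun q' hq' => ?_) _ ⟨hs.1, le_rfl⟩
    by_contra! hcc
    have := hmin (hmem q' ⟨hq'.1, by linarith [hq'.2, hs.2, hq1.2]⟩ hcc.le)
    have : q.1 ≤ q'.1 := this
    linarith [hq'.2, hs.2]
  have ht : Tendsto (fun s => φ (s, q.2)) (nhdsWithin q.1 (Iio q.1)) (nhds (φ q)) :=
    ((hφ.2.comp (by fun_prop : Continuous fun s : ℝ => ((s, q.2) : Pt))).tendsto q.1).mono_left nhdsWithin_le_nhds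
  have := le_of_tendsto ht (by
    filter_upwards [Ioo_mem_nhdsLT hlt] with s hs using hA2 s ⟨hs.1.le, hs.2⟩)
  linarith

/-- Global sharp decay in hyperboloidal coordinates for small initial energies. -/
theorem hyperboloidal_decay {m₁ : ℝ} {G : Fin 2 → GF Ix} (hm : 0 < m₁) (hb : ∀ j, (G j).Bdd) (hq : ∀ j, (G j).Quad)
    (b : Fin 2 → Ix → Ix → ℝ)
    (hG : ∃ C, 0 ≤ C ∧ ∀ j, ∀ x : Ix → ℝ, ‖x‖ ≤ 1 → |G j x - qf (b j) x| ≤ C * ‖x‖ ^ 3) {c : ℝ} (hc : 0 < c)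
    (hres : ∀ ω : Fin 3 → ℝ, ω 0 ^ 2 - ω 1 ^ 2 - ω 2 ^ 2 = 1 → ((res m₁ (b 0) ω 1 = 0 ∧ res m₁ (b 1) ω 2 = 0) ∨
      (c ≤ (res m₁ (b 0) ω 1 * res m₁ (b 1) ω 2).re ∧ (res m₁ (b 0) ω 1 * res m₁ (b 1) ω 2).im = 0)))
    {s0 : ℝ} (hs0 : 0 ≤ s0) :
    ∃ C > 0, ∃ K1 > 0, ∀ {K w}, 0 < K → K ≤ K1 → Sol (mm m₁) G s0 w → En (mm m₁) w 30 s0 ≤ K ^ 2 →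
    (∀ z, ∀ a ≤ 15, hy (s0, z) * nn Z (UU w) a (hp (s0, z)) ≤ K) →
    ∀ p : Pt, s0 ≤ p.1 → hy p * nn Z (UU w) 0 (hp p) ≤ C * K := by
  have hmm := fun k => mm_pos hm k
  obtain ⟨A0, hA0, he⟩ := energy_growth (G := G) hmm hb hq (δ := 1 / 4000) (by norm_num) (by norm_num)
  obtain ⟨D0, hD0, K0, hK0, h0⟩ := ray_sharp hm hb hq b hG hc hres s0
  choose! D hD hw using fun k (hk : 1 ≤ k ∧ k ≤ 15) => ray_weak hmm hb hq k hk.1 hk.2 s0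
  set S := D0 + ∑ a ∈ Finset.range 16, |D a| with hS
  have hS0 : 0 ≤ S := by positivity
  set M := 64 * S + 17 with hM
  have hM0 : 0 < M := by positivity
  have key : ∀ {s1 A K w}, BS (mm m₁) G (1 / 4000) s0 s1 A K w → K ≤ K0 → ∀ p : Pt, p.1 ∈ Icc s0 s1 → ∀ a < 16,
      hy p * nn Z (UU w) a (hp p) * exp (-(a * (1 / 4000) * p.1)) ≤ S * (K + A ^ 2) := by
    intro s1 A K w B hK p hp a ha
    have hKA : 0 ≤ K + A ^ 2 := by have := B.K_nonneg; positivity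
    obtain ⟨y, hy'⟩ := exists_rpt p
    have hτ : exp p.1 ∈ Icc (exp s0) (exp s1) := ⟨exp_le_exp.2 hp.1, exp_le_exp.2 hp.2⟩
    have h1 : hy p = exp p.1 * w0 y := by rw [hy', hy_rpt y (exp_pos _), ← hy']
    have h2 : KG.hp p = ry y (exp p.1) := by rw [hy', hp_rpt y (exp_pos _), ← hy']
    rw [h1, h2]
    rcases Nat.eq_zero_or_pos a with rfl | ha0
    · have := h0 B hK y _ hτ
      simp
      refine this.trans (mul_le_mul ?_ (by nlinarith) B.K_nonneg hS0)
      rw [hS]; have : 0 ≤ ∑ a ∈ Finset.range 16, |D a| := by positivity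
      linarith
    · have := hw a ⟨ha0, by omega⟩ B y _ hτ
      rw [← exp_mul] at this
      rw [exp_neg, ← div_eq_mul_inv, div_le_iff₀ (exp_pos _), mul_comm (a * (1 / 4000) : ℝ)]
      refine this.trans (mul_le_mul_of_nonneg_right (mul_le_mul_of_nonneg_right ?_ hKA) (exp_pos _).le)
      have := single_le_sum (f := fun a => |D a|) (fun _ _ => abs_nonneg _) (Finset.mem_range.2 ha)
      have h3 := le_abs_self (D a)
      linarith
  refine ⟨M, hM0, min (min K0 (A0 / M)) (min (1 / M) (1 / M ^ 2)), by positivity, fun {K w} hK hKK hsol hen hin => ?_⟩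
  have k1 : K ≤ K0 := hKK.trans ((min_le_left _ _).trans (min_le_left _ _))
  have k2 : M * K ≤ A0 := by
    have := hKK.trans ((min_le_left _ _).trans (min_le_right _ _)); rw [le_div_iff₀ hM0] at this; linarith
  have k3 : M * K ≤ 1 := by
    have := hKK.trans ((min_le_right _ _).trans (min_le_left _ _)); rw [le_div_iff₀ hM0] at this; linarith
  have k4 : M ^ 2 * K ≤ 1 := by
    have := hKK.trans ((min_le_right _ _).trans (min_le_right _ _)); rw [le_div_iff₀ (by positivity)] at this; linarith
  set φ : Pt → ℝ := fun p => ∑ a ∈ Finset.range 16, hy p * nn Z (UU w) a (hp p) * exp (-(a * (1 / 4000) * p.1)) with hφ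
  have hφ0 : ∀ p, ∀ a ∈ Finset.range 16, 0 ≤ hy p * nn Z (UU w) a (hp p) * exp (-(a * (1 / 4000) * p.1)) := fun p a _ => by
    have := hy_pos p; have := nn_nonneg Z (UU w) a (hp p); positivity
  have hle : ∀ p, ∀ a < 16, hy p * nn Z (UU w) a (hp p) * exp (-(a * (1 / 4000) * p.1)) ≤ φ p := fun p a ha =>
    single_le_sum (f := fun a : ℕ => hy p * nn Z (UU w) a (hp p) * exp (-(a * (1 / 4000) * p.1))) (hφ0 p) (Finset.mem_range.2 ha)
  have hok : OK φ := by
    refine OK.sum _ _ fun a _ => ?_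
    have h1 := ((hsol.okn a).mul_left (SF.cont hy)).mul_left
      (g := fun p : Pt => exp (-(a * (1 / 4000) * p.1))) (by fun_prop)
    refine h1.of_le ?_ fun p => le_of_eq (by rw [mul_comm])
    exact (h1.2).congr fun p => mul_comm _ _
  have hfin := closure_of_bootstrap hok (s0 := s0) (A := M * K) (by positivity) (fun z => ?_) fun s1 hs1 p hp => ?_
  · intro p hp
    have := (hle p 0 (by norm_num)).trans (hfin p hp)
    simpa using this
  · calc φ (s0, z) ≤ ∑ a ∈ Finset.range 16, K := sum_le_sum fun a ha => by
          have i1 := hin z a (by have := Finset.mem_range.1 ha; omega)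
          have i2 : exp (-(a * (1 / 4000) * s0)) ≤ 1 := exp_le_one_iff.2 (by
            have : 0 ≤ a * (1 / 4000) * s0 := by positivity
            linarith)
          refine le_trans (mul_le_of_le_one_right ?_ i2) i1
          have := hy_pos (s0, z); have := nn_nonneg Z (UU w) a (hp (s0, z)); positivity
      _ = 16 * K := by simp
      _ < M * K := by rw [hM]; nlinarith
  · have hB : BS (mm m₁) G (1 / 4000) s0 s1 (M * K) K w := by
      have hboot : Boot w (M * K) (1 / 4000) s0 s1 := fun p hp a ha => by
        have := (hle p a (by omega)).trans (hs1 p hp)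
        rwa [exp_neg, ← div_eq_mul_inv, div_le_iff₀ (exp_pos _)] at this
      refine ⟨hs0, hsol, by positivity, k3, hK.le, hboot, fun k hk s hs => ?_⟩
      rw [sqrt_le_left (by positivity)]
      exact he hs0 hsol s1 _ K (by positivity) k2 hK hboot hen k hk s hs
    calc φ p ≤ ∑ a ∈ Finset.range 16, S * (K + (M * K) ^ 2) := sum_le_sum fun a ha => key hB k1 p hp a (Finset.mem_range.1 ha)
      _ = 16 * S * (K + M ^ 2 * K * K) := by simp; ring
      _ ≤ 16 * S * (K + 1 * K) := by gcongr
      _ ≤ M * K / 2 := by rw [hM]; nlinarith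

/-- The parameter box of the spherical means. -/
def bx : Set Pt := Icc 0 1 ×ˢ (Icc 0 (π / 2) ×ˢ Icc 0 (2 * π))

theorem isCompact_bx : IsCompact bx := isCompact_Icc.prod (isCompact_Icc.prod isCompact_Icc)

/-- Lebesgue measure on the parameter box. -/
def mu : Measure Pt := (volume.restrict (Icc 0 1)).prod
  ((volume.restrict (Icc 0 (π / 2))).prod (volume.restrict (Icc 0 (2 * π))))

instance : IsFiniteMeasure mu := by unfold mu; infer_instance

theorem ae_mem_bx : ∀ᵐ q ∂mu, q ∈ bx := by
  rw [mu, Measure.prod_restrict, Measure.prod_restrict]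
  exact ae_restrict_mem isCompact_bx.measurableSet

theorem int_mu {E : Type} [NormedAddCommGroup E] {g : Pt → E} (hg : Continuous g) :
    Integrable g mu := by
  obtain ⟨B, hB⟩ := isCompact_bx.exists_bound_of_continuousOn hg.continuousOn
  exact Integrable.of_bound hg.aestronglyMeasurable B (ae_mem_bx.mono fun q hq => hB q hq)

theorem hasFDerivAt_param {E : Type} [NormedAddCommGroup E] [NormedSpace ℝ E]
    {Ψ : Pt × Pt → E} (h : ContDiff ℝ (⊤ : ℕ∞) Ψ) (p : Pt) :
    HasFDerivAt (fun p => ∫ q, Ψ (q, p) ∂mu)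
      (∫ q, (fderiv ℝ Ψ (q, p)).comp (.inr ℝ Pt Pt) ∂mu) p := by
  have hc : Continuous fun r => (fderiv ℝ Ψ r).comp (.inr ℝ Pt Pt) :=
    (h.continuous_fderiv (by simp)).clm_comp continuous_const
  obtain ⟨B, hB⟩ := (isCompact_bx.prod (isCompact_closedBall p 1)).exists_bound_of_continuousOn
    hc.continuousOn
  refine (hasFDerivAt_integral_of_dominated_of_fderiv_le (F := fun p q => Ψ (q, p))
    (F' := fun p q => (fderiv ℝ Ψ (q, p)).comp (.inr ℝ Pt Pt)) (bound := fun _ => B)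
    (Metric.ball_mem_nhds p one_pos) ?_ ?_ ?_ ?_ (integrable_const B) ?_)
  · exact Eventually.of_forall fun p => (int_mu (h.continuous.comp (by fun_prop))).1
  · exact int_mu (h.continuous.comp (by fun_prop))
  · exact (int_mu (hc.comp (by fun_prop : Continuous fun q : Pt => (q, p)))).1
  · exact ae_mem_bx.mono fun q hq x hx => hB (q, x) ⟨hq, Metric.ball_subset_closedBall hx⟩
  · refine Eventually.of_forall fun q x _ => ?_
    exact ((h.differentiable (by simp)) (q, x)).hasFDerivAt.comp x (hasFDerivAt_prodMk_right q x)

theorem contDiff_param (n : ℕ) : ∀ {E : Type} [NormedAddCommGroup E] [NormedSpace ℝ E]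
    {Ψ : Pt × Pt → E} (_ : ContDiff ℝ (⊤ : ℕ∞) Ψ), ContDiff ℝ n fun p => ∫ q, Ψ (q, p) ∂mu := by
  induction n with
  | zero =>
    intro E _ _ Ψ h
    exact contDiff_zero.2
      (continuous_iff_continuousAt.2 fun p => (hasFDerivAt_param h p).continuousAt)
  | succ n ih =>
    intro E _ _ Ψ h
    rw [Nat.cast_succ]
    refine contDiff_succ_iff_fderiv.2 ⟨fun p => (hasFDerivAt_param h p).differentiableAt,
      fun e => absurd e (by simp), ?_⟩
    rw [funext fun p => (hasFDerivAt_param h p).fderiv]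
    exact ih (Ψ := fun r => (fderiv ℝ Ψ r).comp (.inr ℝ Pt Pt))
      ((h.fderiv_right (m := (⊤ : ℕ∞)) (by simp)).clm_comp contDiff_const)

def sθ : SF := .mk (fun q => sin q.2.1) (by fun_prop)
def cθ : SF := .mk (fun q => cos q.2.1) (by fun_prop)
def sφ : SF := .mk (fun q => sin q.2.2) (by fun_prop)
def cφ : SF := .mk (fun q => cos q.2.2) (by fun_prop)

theorem d_trig : (T sθ = 0 ∧ T sφ = 0 ∧ T cφ = 0) ∧
    (X sθ = cθ ∧ X cθ = -sθ ∧ X sφ = 0 ∧ X cφ = 0) ∧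
    Y sφ = cφ ∧ Y cφ = -sφ := by
  refine ⟨⟨?_, ?_, ?_⟩, ⟨?_, ?_, ?_, ?_⟩, ?_, ?_⟩ <;> ext ⟨s, x, y⟩
  · exact (hasDerivAt_t _ s x y).unique (hasDerivAt_const s (sin x))
  · exact (hasDerivAt_t _ s x y).unique (hasDerivAt_const s (sin y))
  · exact (hasDerivAt_t _ s x y).unique (hasDerivAt_const s (cos y))
  · exact (hasDerivAt_x _ s x y).unique (hasDerivAt_sin x)
  · exact (hasDerivAt_x _ s x y).unique (hasDerivAt_cos x)
  · exact (hasDerivAt_x _ s x y).unique (hasDerivAt_const x (sin y))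
  · exact (hasDerivAt_x _ s x y).unique (hasDerivAt_const x (cos y))
  · exact (hasDerivAt_y _ s x y).unique (hasDerivAt_sin y)
  · exact (hasDerivAt_y _ s x y).unique (hasDerivAt_cos y)

/-- Points of the backward cone. -/
def lam (q p : Pt) : Pt := (q.1 * p.1, p.2.1 + (1 - q.1) * p.1 * (sin q.2.1 * cos q.2.2),
  p.2.2 + (1 - q.1) * p.1 * (sin q.2.1 * sin q.2.2))

theorem contDiff_lam : ContDiff ℝ (⊤ : ℕ∞) fun r : Pt × Pt => lam r.1 r.2 := by
  unfold lam; fun_prop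

/-- Pullback to the parameters. -/
def PB (p : Pt) (h : SF) : SF :=
  .mk (fun q => h (lam q p)) (h.smooth.comp (contDiff_lam.comp (contDiff_id.prodMk contDiff_const)))

theorem T_PB (p : Pt) (h : SF) : T (PB p h) =
    p.1 • (PB p (T h) - sθ * cφ * PB p (X h) - sθ * sφ * PB p (Y h)) := by
  ext ⟨s, x, y⟩
  refine (hasDerivAt_t (PB p h) s x y).unique ?_
  have h2 : HasDerivAt (fun s => lam (s, x, y) p)
      (p.1, -p.1 * (sin x * cos y), -p.1 * (sin x * sin y)) s := by
    exact .prodMk (by simpa using (hasDerivAt_id s).mul_const p.1) (.prodMk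
      (by simpa using ((((hasDerivAt_id s).const_sub 1).mul_const p.1).mul_const _).const_add p.2.1)
      (by simpa using ((((hasDerivAt_id s).const_sub 1).mul_const p.1).mul_const _).const_add p.2.2))
  refine ((h.diff _).hasFDerivAt.comp_hasDerivAt s h2).congr_deriv ?_
  rw [fderiv_eq]; simp [PB, sθ, cφ, sφ]; ring

theorem X_PB (p : Pt) (h : SF) : X (PB p h) =
    p.1 • ((1 - ct) * cθ * (cφ * PB p (X h) + sφ * PB p (Y h))) := by
  ext ⟨s, x, y⟩
  refine (hasDerivAt_x (PB p h) s x y).unique ?_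
  have h2 : HasDerivAt (fun x => lam (s, x, y) p)
      (0, (1 - s) * p.1 * (cos x * cos y), (1 - s) * p.1 * (cos x * sin y)) x := by
    simp only [lam]
    exact .prodMk (hasDerivAt_const x _) (.prodMk
      ((((hasDerivAt_sin x).mul_const _).const_mul _).const_add p.2.1)
      ((((hasDerivAt_sin x).mul_const _).const_mul _).const_add p.2.2))
  refine ((h.diff _).hasFDerivAt.comp_hasDerivAt x h2).congr_deriv ?_
  rw [fderiv_eq]; simp [PB, cθ, cφ, sφ]; ring

theorem Y_PB (p : Pt) (h : SF) : Y (PB p h) =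
    p.1 • ((1 - ct) * sθ * (cφ * PB p (Y h) - sφ * PB p (X h))) := by
  ext ⟨s, x, y⟩
  refine (hasDerivAt_y (PB p h) s x y).unique ?_
  have h2 : HasDerivAt (fun y => lam (s, x, y) p)
      (0, (1 - s) * p.1 * (sin x * -sin y), (1 - s) * p.1 * (sin x * cos y)) y := by
    simp only [lam]
    exact .prodMk (hasDerivAt_const y _) (.prodMk
      ((((hasDerivAt_cos y).const_mul _).const_mul _).const_add p.2.1)
      ((((hasDerivAt_sin y).const_mul _).const_mul _).const_add p.2.2))
  refine ((h.diff _).hasFDerivAt.comp_hasDerivAt y h2).congr_deriv ?_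
  rw [fderiv_eq]; simp [PB, sθ, cφ, sφ]; ring

/-- Weighted mean over the backward cone. -/
def MM (a h : SF) : SF :=
  .mk (fun p => ∫ q, a q * h (lam q p) ∂mu) (contDiff_infty.2 fun n =>
    contDiff_param n (Ψ := fun r => a r.1 * h (lam r.1 r.2))
      ((a.smooth.comp contDiff_fst).mul (h.smooth.comp contDiff_lam)))

/-- Integration over the parameter box. -/
def J : SF →ₗ[ℝ] ℝ where
  toFun g := ∫ q, g q ∂mu
  map_add' f g := integral_add (int_mu f.cont) (int_mu g.cont)
  map_smul' c f := integral_const_mul c _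

theorem MM_apply (a h : SF) (p : Pt) : MM a h p = J (a * PB p h) := rfl

theorem dir_MM (a h : SF) (w p : Pt) : dir w (MM a h) p = J (a * (ct * PB p (w.1 • T h)
    + PB p (w.2.1 • X h + w.2.2 • Y h) + (1 - ct) * (sθ * cφ * PB p (w.1 • X h)
      + sθ * sφ * PB p (w.1 • Y h)))) := by
  have h0 : ContDiff ℝ (⊤ : ℕ∞) fun r : Pt × Pt => a r.1 * h (lam r.1 r.2) :=
    (a.smooth.comp contDiff_fst).mul (h.smooth.comp contDiff_lam)
  have h1 := hasFDerivAt_param h0 p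
  have hc : Continuous fun r => (fderiv ℝ (fun r : Pt × Pt => a r.1 * h (lam r.1 r.2)) r).comp
      (.inr ℝ Pt Pt) := (h0.continuous_fderiv (by simp)).clm_comp continuous_const
  rw [dir_apply]
  have h2 : fderiv ℝ (MM a h) p = _ := h1.fderiv
  have hi := int_mu (hc.comp (by fun_prop : Continuous fun q : Pt => (q, p)))
  rw [h2, ContinuousLinearMap.integral_apply (by exact hi)]
  refine integral_congr_ae (Eventually.of_forall fun q => ?_)
  have h3 : HasDerivAt (fun s : ℝ => lam q (p + s • w)) (q.1 * w.1, w.2.1 + (1 - q.1) * w.1 *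
      (sin q.2.1 * cos q.2.2), w.2.2 + (1 - q.1) * w.1 * (sin q.2.1 * sin q.2.2)) 0 := by
    have e : (fun s : ℝ => lam q (p + s • w)) = fun s => lam q p + s • lam q w := by
      ext s <;> simp [lam] <;> ring
    rw [e]
    simpa [lam] using ((hasDerivAt_id (0 : ℝ)).smul_const (lam q w)).const_add (lam q p)
  have h4 : HasDerivAt (fun s : ℝ => p + s • w) w 0 := by
    simpa using ((hasDerivAt_id (0 : ℝ)).smul_const w).const_add p
  have h5 : HasDerivAt (fun s : ℝ => (q, p + s • w)) ((0 : Pt), w) 0 := (hasDerivAt_const 0 q).prodMk h4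
  have e0 : p + (0 : ℝ) • w = p := by simp
  have h6 := ((h0.differentiable (by simp)) (q, p + (0 : ℝ) • w)).hasFDerivAt.comp_hasDerivAt 0 h5
  have h7 := ((h.diff (lam q (p + (0 : ℝ) • w))).hasFDerivAt.comp_hasDerivAt 0 h3).const_mul (a q)
  have h8 := h6.unique h7
  rw [e0] at h8
  change fderiv ℝ _ (q, p) (0, w) = _
  rw [h8, fderiv_eq]
  simp [PB, sθ, cφ, sφ]; left; ring

theorem dMM (a h : SF) : T (MM a h) = MM (a * ct) (T h) + MM (a * ((1 - ct) * (sθ * cφ))) (X h)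
      + MM (a * ((1 - ct) * (sθ * sφ))) (Y h) ∧ X (MM a h) = MM a (X h) ∧ Y (MM a h) = MM a (Y h) := by
  have z : ∀ p (f g : SF), PB p (f + g) = PB p f + PB p g ∧ PB p ((1 : ℝ) • f) = PB p f ∧
      PB p ((0 : ℝ) • f) = 0 := fun p f g => ⟨rfl, by rw [one_smul], by rw [zero_smul]; rfl⟩
  have z0 : ∀ p, PB p 0 = 0 := fun _ => rfl
  refine ⟨?_, ?_, ?_⟩ <;> ext p
  · change KG.dir _ _ p = _; rw [dir_MM]
    rw [SF.add_apply, SF.add_apply, MM_apply, MM_apply, MM_apply, ← map_add, ← map_add]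
    congr 1; simp [z0]; ring
  · change KG.dir _ _ p = _; rw [dir_MM]
    rw [MM_apply]
    congr 1; simp [z0]
  · change KG.dir _ _ p = _; rw [dir_MM]
    rw [MM_apply]
    congr 1; simp [z0]

theorem ftc {φ φ' : ℝ → ℝ} (h : ∀ x, HasDerivAt φ (φ' x) x) (hc : Continuous φ') {a b : ℝ}
    (hab : a ≤ b) : ∫ x in Icc a b, φ' x = φ b - φ a := by
  rw [integral_Icc_eq_integral_Ioc, ← intervalIntegral.integral_of_le hab]
  exact intervalIntegral.integral_eq_sub_of_hasDerivAt (fun x _ => h x) (hc.intervalIntegrable _ _)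

theorem J_T {g : SF} {c : ℝ} (h0 : ∀ z, g (0, z) = 0) (h1 : ∀ z, g (1, z) = c * sin z.1) :
    J (T g) = 2 * π * c := by
  have hp := pi_pos
  change ∫ q, T g q ∂mu = _
  have hi := int_mu (T g).cont
  unfold mu at hi ⊢
  rw [integral_prod_symm _ hi]
  have e : ∀ z : ℝ × ℝ, ∫ σ in Icc (0:ℝ) 1, T g (σ, z) = c * sin z.1 * 1 := fun z => by
    rw [ftc (fun s => hasDerivAt_t g s z.1 z.2) (by fun_prop) zero_le_one, ← mul_one (c * _), ← h1]
    simp [h0]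
  simp only [e]
  rw [integral_prod_mul (fun x => c * sin x) (fun _ : ℝ => (1 : ℝ)), integral_const_mul,
    ftc (φ := fun x => - cos x) (fun x => by simpa using (hasDerivAt_cos x).fun_neg)
    continuous_sin (by positivity)]
  simp [hp.le]; ring

theorem J_X {g : SF} (h : ∀ s y, g (s, 0, y) = 0 ∧ g (s, π / 2, y) = 0) : J (X g) = 0 := by
  change ∫ q, X g q ∂mu = _
  have hi := int_mu (X g).cont
  unfold mu at hi ⊢
  rw [integral_prod _ hi]
  refine integral_eq_zero_of_ae ?_
  filter_upwards [hi.prod_right_ae] with s hs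
  rw [integral_prod_symm _ hs]
  have e : ∀ y, ∫ x in Icc (0:ℝ) (π / 2), X g (s, x, y) = 0 := fun y => by
    rw [ftc (fun x => hasDerivAt_x g s x y) (by fun_prop) (by positivity)]; simp [h]
  simp [e]

theorem J_Y {g : SF} (h : ∀ s x, g (s, x, 2 * π) = g (s, x, 0)) : J (Y g) = 0 := by
  change ∫ q, Y g q ∂mu = _
  have hi := int_mu (Y g).cont
  unfold mu at hi ⊢
  rw [integral_prod _ hi]
  refine integral_eq_zero_of_ae ?_
  filter_upwards [hi.prod_right_ae] with s hs
  rw [integral_prod _ hs]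
  have e : ∀ x, ∫ y in Icc (0:ℝ) (2 * π), Y g (s, x, y) = 0 := fun x => by
    rw [ftc (fun y => hasDerivAt_y g s x y) (by fun_prop) (by positivity)]; simp [h]
  simp [e]

/-- The solution operator of the inhomogeneous wave equation with zero data. -/
def W (h : SF) : SF := (1 / (2 * π)) • (ct ^ 2 * MM ((1 - ct) * sθ) h)

theorem box_W (h : SF) : box (W h) = h := by
  obtain ⟨⟨t1, t3, t4⟩, ⟨x1, x2, x3, x4⟩, y3, y4⟩ := d_trig
  ext p
  have n2 : ∀ p, (2 : SF) p = 2 := fun _ => rfl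
  have n4 : ∀ p, (4 : SF) p = 4 := fun _ => rfl
  suffices H : box (ct ^ 2 * MM ((1 - ct) * sθ) h) p = 2 * π * h p by
    rw [W, box_smul, SF.smul_apply, H]; field_simp
  have e1 : box (ct ^ 2 * MM ((1 - ct) * sθ) h) = 2 * MM ((1 - ct) * sθ) h
      + 4 * ct * T (MM ((1 - ct) * sθ) h) + ct ^ 2 * box (MM ((1 - ct) * sθ) h) := by
    simp only [box, pow_two, Derivation.leibniz, map_add, smul_eq_mul, T_ct, X_ct, Y_ct,
      Derivation.map_one_eq_zero, map_zero]
    ring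
  rw [e1]
  simp only [box, dMM, map_add]
  simp only [SF.add_apply, SF.mul_apply, SF.sub_apply, n2, n4, SF.pow_apply, ct_apply]
  simp only [MM_apply, XT, YT, YX]
  set S : SF := p.1 • ((1 - ct) * ct ^ 2 * (PB p (T h) - sθ * cφ * PB p (X h) - sθ * sφ * PB p (Y h)))
    + ((2 : ℝ) • ct - ct ^ 2) * PB p h + (2 * p.1) • (ct * (1 - ct) * (sθ * cφ * PB p (X h) + sθ * sφ * PB p (Y h)))
  set A : SF := p.1 • (sθ * cθ * (cφ * PB p (X h) + sφ * PB p (Y h)))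
  set B : SF := p.1 • (cφ * PB p (Y h) - sφ * PB p (X h))
  have k1 : J (T (sθ * S)) = 2 * π * h p := by
    refine J_T (fun z => ?_) fun z => ?_
    · simp [S]
    · simp [S, PB, sθ, lam]; ring_nf
  have k2 : J (X A) = 0 := J_X fun s y => by simp [A, sθ, cθ]
  have k3 : J (Y B) = 0 := J_Y fun s x => by simp [B, PB, lam, sφ, cφ]
  have k4 : J (T (sθ * S)) - J (X A) - J (Y B) = 2 * π * h p := by grind
  rw [← k4]
  simp only [← smul_eq_mul, ← map_smul, ← map_add, ← map_sub]
  congr 1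
  ext q
  simp only [S, A, B, Derivation.leibniz, map_add, map_sub, Derivation.map_smul, pow_two, T_PB, X_PB, Y_PB,
    t1, t3, t4, x1, x2, x3, x4, y3, y4, T_ct, XT, YT, YX, smul_eq_mul,
    Derivation.map_one_eq_zero]
  simp
  have h1 : cθ q ^ 2 = 1 - sθ q ^ 2 := by have := sin_sq_add_cos_sq q.2.1; simp only [cθ, sθ, SF.mk_apply]; linarith
  have h2 : cφ q ^ 2 = 1 - sφ q ^ 2 := by have := sin_sq_add_cos_sq q.2.2; simp only [cφ, sφ, SF.mk_apply]; linarith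
  ring_nf
  simp only [h1, h2]
  ring_nf

theorem X_W (h : SF) : X (W h) = W (X h) := by
  simp [W, dMM, pow_two]
theorem Y_W (h : SF) : Y (W h) = W (Y h) := by
  simp [W, dMM, pow_two]
theorem W_zero (h : SF) (z : ℝ × ℝ) : W h (0, z) = 0 ∧ T (W h) (0, z) = 0 := by
  simp [W, pow_two]

/-- Support in the cone `r ≤ R + |t|`, expressed by half planes. -/
def SR (R : ℝ) (h : Pt → ℝ) : Prop :=
  ∀ p : Pt, ∀ a b : ℝ, a ^ 2 + b ^ 2 ≤ 1 → R + |p.1| < a * p.2.1 + b * p.2.2 → h p = 0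

theorem SR.of_zero {R : ℝ} {f g : Pt → ℝ} (hf : SR R f) (h : ∀ p, f p = 0 → g p = 0) : SR R g :=
  fun p a b ha hp => h p (hf p a b ha hp)

theorem SR.add {R : ℝ} {f g : SF} (hf : SR R f) (hg : SR R g) : SR R (f + g : SF) :=
  fun p a b h hp => by rw [SF.add_apply, hf p a b h hp, hg p a b h hp, add_zero]

theorem SR.dir {R : ℝ} {f : SF} (hf : SR R f) (w : Pt) : SR R (dir w f) := fun p a b h hp => by
  have : (f : Pt → ℝ) =ᶠ[nhds p] fun _ => 0 :=
    (ContinuousAt.eventually_lt (f := fun q : Pt => R + |q.1|)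
      (g := fun q : Pt => a * q.2.1 + b * q.2.2) (by fun_prop) (by fun_prop) hp).mono
      fun q hq => hf q a b h hq
  rw [dir_apply, this.fderiv_eq]; simp

theorem SR.sc {R : ℝ} {f : Pt → ℝ} (hf : SR R f) : SC f := fun A => by
  refine ⟨R + A, fun p hp h => ?_⟩
  have e : ∀ x : ℝ, R + A < |x| → R + |p.1| < x ∨ R + |p.1| < -x := by grind
  rcases h with h | h <;> rcases e _ h with h | h
  · exact hf p 1 0 (by norm_num) (by linarith)
  · exact hf p (-1) 0 (by norm_num) (by linarith)
  · exact hf p 0 1 (by norm_num) (by linarith)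
  · exact hf p 0 (-1) (by norm_num) (by linarith)

theorem SR.W {R : ℝ} {h : SF} (hh : SR R h) : SR R (W h) := fun p a b hab hp => by
  have key : MM ((1 - ct) * sθ) h p = 0 := by
    rw [MM_apply]
    refine integral_eq_zero_of_ae (ae_mem_bx.mono fun q hq => ?_)
    rw [Pi.zero_apply, SF.mul_apply]
    refine mul_eq_zero_of_right _ (hh _ a b hab ?_)
    obtain ⟨⟨h0, h1⟩, _⟩ := hq
    have hz : |a * (sin q.2.1 * cos q.2.2) + b * (sin q.2.1 * sin q.2.2)| ≤ 1 := by
      refine abs_le_of_sq_le_sq ?_ zero_le_one |> fun h => h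
      have e1 := sin_sq_add_cos_sq q.2.2
      have e2 : (sin q.2.1 * cos q.2.2) ^ 2 + (sin q.2.1 * sin q.2.2) ^ 2 ≤ 1 := by
        have : (sin q.2.1 * cos q.2.2) ^ 2 + (sin q.2.1 * sin q.2.2) ^ 2 = sin q.2.1 ^ 2 := by
          linear_combination sin q.2.1 ^ 2 * e1
        rw [this]; exact sin_sq_le_one _
      generalize sin q.2.1 * cos q.2.2 = u at *
      generalize sin q.2.1 * sin q.2.2 = v at *
      have e3 : (a ^ 2 + b ^ 2) * (u ^ 2 + v ^ 2) ≤ 1 := by nlinarith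
      linarith [sq_nonneg (a * v - b * u)]
    have h2 : |(1 - q.1) * p.1 * (a * (sin q.2.1 * cos q.2.2) + b * (sin q.2.1 * sin q.2.2))|
        ≤ (1 - q.1) * |p.1| := by
      rw [abs_mul, abs_mul, abs_of_nonneg (sub_nonneg.2 h1)]
      exact mul_le_of_le_one_right (mul_nonneg (sub_nonneg.2 h1) (abs_nonneg _)) hz
    have h3 := (abs_le.1 h2).1
    simp only [lam, abs_mul, abs_of_nonneg h0]
    linarith
  simp [KG.W, key]

/-- The spatial derivatives. -/
def SS : Fin 2 → Derivation ℝ SF SF := ![X, Y]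

theorem SS_eq (i : Fin 2) : ∃ w, SS i = dir w := by
  fin_cases i
  exacts [⟨_, rfl⟩, ⟨_, rfl⟩]

theorem isChain_SS {ι : Type} [Fintype ι] [DecidableEq ι] (i : Fin 2) : IsChain (ι := ι) (SS i) := by
  obtain ⟨w, hw⟩ := SS_eq i
  rw [hw]; exact fun G U => dir_comp _ G U

theorem SC.SS {f : SF} (hf : SC f) (I : List (Fin 2)) : SC (word KG.SS I f) := by
  induction I with
  | nil => exact hf
  | cons i I ih => obtain ⟨w, hw⟩ := SS_eq i; rw [word_cons, hw]; exact ih.dir w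

theorem SC.ok {f : SF} (hf : SC f) : OK f := ⟨hf, f.cont⟩

theorem nrm_sq_le_of {f : Pt → ℝ} {s A : ℝ} (h : nrm f s ≤ A) : II (fun p => f p ^ 2) s ≤ A ^ 2 := by
  rw [← nrm_sq]; exact pow_le_pow_left₀ (nrm_nonneg _ _) h 2

section
variable {ι : Type} [Fintype ι] [DecidableEq ι]

/-- Sum of the `L²` norms of the spatial derivatives of order at most `k`. -/
def NN (U : ι → SF) (k : ℕ) (s : ℝ) : ℝ := ∑ c, ∑ I ∈ words (Fin 2) k, nrm (word SS I (U c)) s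

theorem NN_nonneg (U : ι → SF) (k : ℕ) (s : ℝ) : 0 ≤ NN U k s :=
  sum_nonneg fun _ _ => sum_nonneg fun _ _ => nrm_nonneg _ _

theorem NN_mono (U : ι → SF) (s : ℝ) {k l : ℕ} (h : k ≤ l) : NN U k s ≤ NN U l s :=
  sum_le_sum fun _ _ =>
    sum_le_sum_of_subset_of_nonneg (words_mono h) fun _ _ _ => nrm_nonneg _ _

theorem le_NN (U : ι → SF) {k : ℕ} {I : List (Fin 2)} (h : I.length ≤ k) (c : ι) (s : ℝ) :
    nrm (word SS I (U c)) s ≤ NN U k s :=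
  (single_le_sum (f := fun I => nrm (word SS I (U c)) s) (fun _ _ => nrm_nonneg _ _)
    (mem_words.2 h)).trans (single_le_sum
      (f := fun c => ∑ I ∈ words (Fin 2) k, nrm (word SS I (U c)) s)
      (fun _ _ => sum_nonneg fun _ _ => nrm_nonneg _ _) (Finset.mem_univ c))

theorem sobolev_nrm {f : SF} (hf : SC f) {A : ℝ} (p : Pt) (h0 : nrm f p.1 ≤ A)
    (h1 : nrm (X f) p.1 ≤ A) (h2 : nrm (Y f) p.1 ≤ A) (h3 : nrm (Y (X f)) p.1 ≤ A) :
    |f p| ≤ 2 * A := by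
  have h := sobolev hf p
  have o := hf.ok.sq
  have o1 := hf.X.ok.sq
  have o2 := hf.Y.ok.sq
  have o3 := hf.X.Y.ok.sq
  rw [II_add (o.add o1 |>.add o2).1 (o.add o1 |>.add o2).2 o3.1 o3.2,
    II_add (o.add o1).1 (o.add o1).2 o2.1 o2.2, II_add o.1 o.2 o1.1 o1.2] at h
  refine abs_le_of_sq_le_sq ?_ (by linarith [nrm_nonneg f p.1])
  linarith [nrm_sq_le_of h0, nrm_sq_le_of h1, nrm_sq_le_of h2, nrm_sq_le_of h3,
    (by ring : (2 * A) ^ 2 = 4 * A ^ 2)]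

theorem abs_le_NN {U : ι → SF} (hU : ∀ c, SC (U c)) {k : ℕ} {I : List (Fin 2)}
    (h : I.length + 2 ≤ k) (c : ι) (p : Pt) : |word SS I (U c) p| ≤ 2 * NN U k p.1 :=
  sobolev_nrm ((hU c).SS I) p (le_NN U (by omega) c _) (le_NN U (I := 0 :: I) (by simp; omega) c _)
    (le_NN U (I := 1 :: I) (by simp; omega) c _) (le_NN U (I := 1 :: 0 :: I) (by simp; omega) c _)

theorem SC.factors {U : ι → SF} (hU : ∀ c, SC (U c)) {t : List (List (Fin 2) × ι)} (ht : t ≠ []) :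
    SC (KG.factors KG.SS U t) := by
  obtain ⟨e, t, rfl⟩ := List.exists_cons_of_ne_nil ht
  exact ((hU _).SS _).mul_right _

theorem nrm_factors_le {U : ι → SF} (hU : ∀ c, SC (U c)) (s : ℝ) (t : List (List (Fin 2) × ι))
    (k : ℕ) (h1 : ∀ e ∈ t, e.1 ≠ []) (h2 : (t.map fun e => e.1.length).sum ≤ k) (ht : t ≠ []) :
    nrm (factors SS U t) s ≤ 2 ^ t.length * NN U k s * NN U (k - 1) s ^ (t.length - 1) := by
  induction t generalizing k with
  | nil => exact absurd rfl ht
  | cons e t ih =>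
    have hN := NN_nonneg U k s
    have hN' := NN_nonneg U (k - 1) s
    have he : 0 < e.1.length := by grind
    have h1' : ∀ e ∈ t, e.1 ≠ [] := by grind
    simp at h2
    have hf : factors SS U (e :: t) = word SS e.1 (U e.2) * factors SS U t := by
      simp [KG.factors]
    match t, ih, hf, h1', h2 with
    | [], _, hf, _, h2 =>
      rw [hf]
      simp only [KG.factors, List.map_nil, List.prod_nil, mul_one, List.length_cons, List.length_nil,
        zero_add, Nat.sub_self, pow_zero, pow_one]
      linarith [le_NN U (by simpa using h2 : e.1.length ≤ k) e.2 s]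
    | [e'], _, hf, h1', h2 =>
      have he' : 0 < e'.1.length := by grind
      simp at h2
      rw [hf]
      have hl := ladyzhenskaya ((hU e.2).SS e.1) ((hU e'.2).SS e'.1) s
      have e1 : factors SS U [e'] = word SS e'.1 (U e'.2) := by simp [KG.factors]
      rw [e1]
      refine nrm_le_of_II (by positivity) (hl.trans ?_)
      have a1 := le_NN U (by omega : e.1.length ≤ k - 1) e.2 s
      have a2 := le_NN U (by omega : e'.1.length ≤ k - 1) e'.2 s
      have a3 := le_NN U (by simp; omega : ((0 : Fin 2) :: e.1).length ≤ k) e.2 s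
      have a4 := le_NN U (by simp; omega : ((1 : Fin 2) :: e'.1).length ≤ k) e'.2 s
      have b := nrm_nonneg
      calc _ ≤ 2 * (NN U (k - 1) s * NN U k s) * (2 * (NN U (k - 1) s * NN U k s)) :=
            mul_le_mul (mul_le_mul_of_nonneg_left (mul_le_mul a1 a3 (b _ _) hN') zero_le_two)
              (mul_le_mul_of_nonneg_left (mul_le_mul a2 a4 (b _ _) hN') zero_le_two)
              (mul_nonneg zero_le_two (mul_nonneg (b _ _) (b _ _))) (by positivity)
        _ ≤ _ := by
          norm_num
          nlinarith
    | e' :: e'' :: t, ih, hf, h1', h2 =>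
      have he' : 0 < e'.1.length := by grind
      have he'' : 0 < e''.1.length := by grind
      have h3 := ih (k - 1) h1' (by omega) (by simp)
      simp at h2
      rw [hf]
      have h4 : ∀ z, |word SS e.1 (U e.2) (s, z)| ≤ 2 * NN U k s := fun z =>
        abs_le_NN hU (by omega) e.2 (s, z)
      refine (nrm_mul_le (by positivity) (SF.cont _) (SC.factors hU (by simp)).ok h4).trans ?_
      refine (mul_le_mul_of_nonneg_left h3 (by positivity)).trans ?_
      have h5 : NN U (k - 1 - 1) s ≤ NN U (k - 1) s := NN_mono U s (by omega)
      have h6 := pow_le_pow_left₀ (NN_nonneg U (k - 1 - 1) s) h5 (t.length + 1)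
      simp
      calc _ ≤ 2 * NN U k s * (2 ^ (t.length + 1 + 1) * NN U (k - 1) s * NN U (k - 1) s ^ (t.length + 1)) := by
            gcongr
        _ = _ := by ring

/-- Tame estimate for a composition. -/
theorem nrm_word_comp_le {G : GF ι} (hb : G.Bdd) (h0 : G 0 = 0) (k : ℕ) {M : ℝ} (hM : 0 ≤ M) :
    ∃ C, 0 ≤ C ∧ ∀ U : ι → SF, (∀ c, SC (U c)) → ∀ s, (0 < k → NN U (k - 1) s ≤ M) →
      ∀ I : List (Fin 2), I.length ≤ k → nrm (word SS I (comp G U)) s ≤ C * NN U k s := by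
  obtain ⟨L, hL0, hL⟩ := hb.lip
  choose B hB using hb
  refine ⟨L + ∑ I ∈ words (Fin 2) k, ((expand ι I).map fun t =>
    |B (t.map (·.2))| * (2 ^ t.length * M ^ (t.length - 1))).sum, add_nonneg hL0
    (sum_nonneg fun I _ => list_map_sum_nonneg _ _ fun e _ => by positivity),
    fun U hU s hs I hI => ?_⟩
  have hN := NN_nonneg U k s
  have hS : ∀ I : List (Fin 2), 0 ≤ ((expand ι I).map fun t =>
      |B (t.map (·.2))| * (2 ^ t.length * M ^ (t.length - 1))).sum := fun I =>
    list_map_sum_nonneg _ _ fun e _ => by positivity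
  rcases eq_or_ne I [] with rfl | hI0
  · have o : OK fun p => ∑ c, |U c p| := OK.sum _ _ fun c _ => (hU c).ok.abs
    have h1 : nrm (comp G U) s ≤ L * nrm (fun p => ∑ c, |U c p|) s := by
      rw [← abs_of_nonneg hL0, ← nrm_const_mul]
      have h2 : ∀ p, |comp G U p| ≤ L * ∑ c, |U c p| := fun p => by
        have := hL (fun c => U c p) 0
        rw [h0, sub_zero, sub_zero] at this
        refine this.trans (mul_le_mul_of_nonneg_left ?_ hL0)
        exact (pi_norm_le_iff_of_nonneg (sum_nonneg fun _ _ => abs_nonneg _)).2 fun c =>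
          single_le_sum (f := fun c => |U c p|) (fun _ _ => abs_nonneg _) (Finset.mem_univ c)
      have h3 : ∀ p, |comp G U p| ≤ |(L * ∑ c, |U c p|)| := by grind
      exact nrm_mono ((o.const_mul _).of_le (SF.cont _) h3) (o.const_mul _) fun z => h3 _
    have h2 : nrm (fun p => ∑ c, |U c p|) s ≤ NN U k s := by
      refine (nrm_sum _ _ (fun c _ => (hU c).ok.abs) s).trans (sum_le_sum fun c _ => ?_)
      refine le_trans (le_of_eq ?_) (single_le_sum (f := fun I => nrm (word SS I (U c)) s)
        (fun _ _ => nrm_nonneg _ _) (mem_words.2 hI))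
      simp [nrm]
    refine (h1.trans (mul_le_mul_of_nonneg_left h2 hL0)).trans (mul_le_mul_of_nonneg_right ?_ hN)
    linarith [sum_nonneg fun I (_ : I ∈ words (Fin 2) k) => hS I]
  · have hpos : 0 < I.length := List.length_pos_iff.2 hI0
    have hterm : ∀ t ∈ expand ι I, OK (term SS G U t) ∧ nrm (term SS G U t) s ≤
        |B (t.map (·.2))| * (2 ^ t.length * M ^ (t.length - 1)) * NN U k s := fun t ht => by
      obtain ⟨h3, h4⟩ := mem_expand I t ht
      have ht0 : t ≠ [] := by grind
      have o := (SC.factors hU ht0).ok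
      refine ⟨o.mul_left (SF.cont _), (nrm_mul_le (abs_nonneg (B (t.map (·.2))))
        (SF.cont (comp (G.pdw (t.map (·.2))) U)) o fun z => (hB _ _).trans (le_abs_self _)).trans ?_⟩
      rw [mul_assoc]
      refine mul_le_mul_of_nonneg_left ?_ (abs_nonneg _)
      refine (nrm_factors_le hU s t k h3 (h4.le.trans hI) ht0).trans ?_
      rw [mul_right_comm]
      have := pow_le_pow_left₀ (NN_nonneg U (k - 1) s) (hs (by omega)) (t.length - 1)
      gcongr
    have hl : ∀ l : List (List (List (Fin 2) × ι)), (∀ t ∈ l, OK (term SS G U t) ∧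
        nrm (term SS G U t) s ≤ |B (t.map (·.2))| * (2 ^ t.length * M ^ (t.length - 1)) * NN U k s) →
        OK ((l.map (term SS G U)).sum) ∧ nrm ((l.map (term SS G U)).sum) s ≤
          (l.map fun t => |B (t.map (·.2))| * (2 ^ t.length * M ^ (t.length - 1))).sum * NN U k s := by
      intro l hl
      induction l with
      | nil => exact ⟨⟨SC.zero, SF.cont _⟩, by simp [nrm, II]⟩
      | cons t l ih =>
        obtain ⟨a1, a2⟩ := hl t (by simp)
        obtain ⟨b1, b2⟩ := ih fun t ht => hl t (List.mem_cons_of_mem _ ht)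
        simp only [List.map_cons, List.sum_cons, add_mul]
        exact ⟨a1.add b1, (nrm_add a1 b1 s).trans (add_le_add a2 b2)⟩
    rw [word_comp SS isChain_SS]
    refine (hl _ hterm).2.trans (mul_le_mul_of_nonneg_right ?_ hN)
    have := single_le_sum (f := fun I => ((expand ι I).map fun t =>
      |B (t.map (·.2))| * (2 ^ t.length * M ^ (t.length - 1))).sum) (fun I _ => hS I) (mem_words.2 hI)
    linarith
end

theorem word_SS_comm (w : Pt) (I : List (Fin 2)) (f : SF) :
    word SS I (dir w f) = dir w (word SS I f) := by
  induction I with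
  | nil => rfl
  | cons i I ih => obtain ⟨v, hv⟩ := SS_eq i; rw [word_cons, word_cons, ih, hv, dir_comm]

theorem dd_eq (a : Fin 3) : ∃ w, dd a = dir w := by
  fin_cases a
  exacts [⟨_, rfl⟩, ⟨_, rfl⟩, ⟨_, rfl⟩]

theorem word_SS_dd (a : Fin 3) (I : List (Fin 2)) (f : SF) :
    word SS I (dd a f) = dd a (word SS I f) := by
  obtain ⟨w, hw⟩ := dd_eq a
  rw [hw, word_SS_comm]

theorem box_word_SS (I : List (Fin 2)) (f : SF) : box (word SS I f) = word SS I (box f) := by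
  simp only [box, map_sub, T, X, Y, word_SS_comm]

theorem word_SS_W (I : List (Fin 2)) (h : SF) : word SS I (W h) = W (word SS I h) := by
  induction I with
  | nil => rfl
  | cons i I ih =>
    rw [word_cons, word_cons, ih]
    fin_cases i
    exacts [X_W _, Y_W _]

theorem SC.UU {w : Fin 2 → SF} (hw : ∀ j, SC (w j)) (c : Ix) : SC (UU w c) := by
  obtain ⟨j, _ | a⟩ := c
  · exact hw j
  · obtain ⟨v, hv⟩ := dd_eq a
    change SC (dd a (w j)); rw [hv]; exact (hw j).dir v

theorem UU_lin (a : ℝ) (w w' : Fin 2 → SF) (c : Ix) :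
    UU (fun j => w j + a • w' j) c = UU w c + a • UU w' c := by
  obtain ⟨j, _ | b⟩ := c <;> simp [KG.UU]

/-- The flat energy of order `k`. -/
def EE (w : Fin 2 → SF) (k : ℕ) (s : ℝ) : ℝ :=
  ∑ j, ∑ I ∈ words (Fin 2) k, II (dens 1 (word SS I (w j))) s

theorem II_dens {f : SF} (hf : SC f) (s : ℝ) : II (dens 1 f) s =
    nrm (T f) s ^ 2 + nrm (X f) s ^ 2 + nrm (Y f) s ^ 2 + nrm f s ^ 2 := by
  have o := hf.T.ok.sq
  have o1 := hf.X.ok.sq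
  have o2 := hf.Y.ok.sq
  have o3 := hf.ok.sq
  have e : (dens 1 f : Pt → ℝ) = fun p => T f p ^ 2 + X f p ^ 2 + Y f p ^ 2 + f p ^ 2 := by
    ext p; rw [dens_apply]; ring
  rw [e, II_add (o.add o1 |>.add o2).1 (o.add o1 |>.add o2).2 o3.1 o3.2,
    II_add (o.add o1).1 (o.add o1).2 o2.1 o2.2, II_add o.1 o.2 o1.1 o1.2]
  simp only [nrm_sq]

theorem EE_eq {w : Fin 2 → SF} (hw : ∀ j, SC (w j)) (k : ℕ) (s : ℝ) :
    EE w k s = ∑ c, ∑ I ∈ words (Fin 2) k, nrm (word SS I (UU w c)) s ^ 2 := by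
  rw [EE, Fintype.sum_prod_type]
  refine sum_congr rfl fun j _ => ?_
  rw [sum_comm]
  refine sum_congr rfl fun I _ => ?_
  rw [Fintype.sum_option, Fin.sum_univ_three, II_dens ((hw j).SS I)]
  simp only [KG.UU, Option.elim, word_SS_dd]
  simp only [dd, Matrix.cons_val_zero, Matrix.cons_val_one, Matrix.cons_val]
  ring

theorem nrm_le_of_EE {w : Fin 2 → SF} (hw : ∀ j, SC (w j)) {k : ℕ} {s A : ℝ} (hA : 0 ≤ A)
    (h : EE w k s ≤ A ^ 2) (c : Ix) {I : List (Fin 2)} (hI : I.length ≤ k) :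
    nrm (word SS I (UU w c)) s ≤ A := by
  rw [EE_eq hw] at h
  refine pow_le_pow_iff_left₀ (nrm_nonneg _ _) hA two_ne_zero |>.1 (le_trans ?_ h)
  exact (single_le_sum (f := fun I => nrm (word SS I (UU w c)) s ^ 2)
    (fun _ _ => sq_nonneg _) (mem_words.2 hI)).trans (single_le_sum
      (f := fun c => ∑ I ∈ words (Fin 2) k, nrm (word SS I (UU w c)) s ^ 2)
      (fun _ _ => sum_nonneg fun _ _ => sq_nonneg _) (Finset.mem_univ c))

/-- Number of terms in `NN`. -/
def cnt (k : ℕ) : ℝ := (Finset.univ : Finset Ix).card * (words (Fin 2) k).card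

theorem NN_le_of_EE {w : Fin 2 → SF} (hw : ∀ j, SC (w j)) {k : ℕ} {s A : ℝ} (hA : 0 ≤ A)
    (h : EE w k s ≤ A ^ 2) : NN (UU w) k s ≤ cnt k * A := by
  refine (sum_le_card_nsmul _ _ ((words (Fin 2) k).card * A) fun c _ => ?_).trans
    (le_of_eq (by rw [cnt, nsmul_eq_mul, mul_assoc]))
  refine (sum_le_card_nsmul _ _ A fun I hI => ?_).trans (le_of_eq (nsmul_eq_mul _ _))
  exact nrm_le_of_EE hw hA h c (mem_words.1 hI)

theorem hasDerivAt_EE {w : Fin 2 → SF} (hw : ∀ j, SC (w j)) (k : ℕ) (s : ℝ) :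
    HasDerivAt (EE w k) (∑ j, ∑ I ∈ words (Fin 2) k, II (fun p => 2 * (T (word SS I (w j)) p *
      (box (word SS I (w j)) p + 1 ^ 2 * word SS I (w j) p))) s) s :=
  HasDerivAt.fun_sum fun j _ => HasDerivAt.fun_sum fun I _ => hasDerivAt_energy 1 ((hw j).SS I) s

/-- Exponential growth of the energy in both time directions. -/
theorem EE_growth {w : Fin 2 → SF} (hw : ∀ j, SC (w j)) {k : ℕ} {K C l A : ℝ} (hK : 0 < K)
    (hC : 0 ≤ C) (hl : 2 * (words (Fin 2) k).card * (C + 1) < l) (h0 : EE w k 0 ≤ K ^ 2)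
    (h : ∀ j, ∀ I : List (Fin 2), I.length ≤ k → ∀ s, |s| ≤ A →
      nrm (word SS I (box (w j))) s ≤ C * (K * exp (l * |s|))) (s : ℝ) (hs : |s| ≤ A) :
    EE w k s ≤ (K * exp (l * |s|)) ^ 2 := by
  set c : ℝ := ((words (Fin 2) k).card : ℝ)
  set E' := fun s => ∑ j, ∑ I ∈ words (Fin 2) k, II (fun p => 2 * (T (word SS I (w j)) p *
      (box (word SS I (w j)) p + 1 ^ 2 * word SS I (w j) p))) s
  have hE' : ∀ s, |s| ≤ A → EE w k s ≤ (K * exp (l * |s|)) ^ 2 →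
      |E' s| < 2 * l * (K * exp (l * |s|)) ^ 2 := fun s hs hE => by
    set x := K * exp (l * |s|)
    have hx : 0 < x := by positivity
    have h1 : ∀ j, ∀ I ∈ words (Fin 2) k, |II (fun p => 2 * (T (word SS I (w j)) p *
        (box (word SS I (w j)) p + 1 ^ 2 * word SS I (w j) p))) s| ≤ 2 * (C + 1) * x ^ 2 :=
      fun j I hI => by
        have hI' := mem_words.1 hI
        have hf := (hw j).SS I
        have e1 : nrm (T (word SS I (w j))) s ≤ x := by
          have := nrm_le_of_EE hw hx.le hE (j, some 0) hI'
          change nrm (word SS I (dd 0 (w j))) s ≤ x at this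
          rwa [word_SS_dd] at this
        have e2 : nrm (word SS I (w j)) s ≤ x := nrm_le_of_EE hw hx.le hE (j, none) hI'
        have e3 : nrm (box (word SS I (w j))) s ≤ C * x := by rw [box_word_SS]; exact h j I hI' s hs
        have ob : OK (box (word SS I (w j))) := by
          rw [box_word_SS]
          exact SC.ok (SC.SS (((hw j).T.T.add ((hw j).X.X.mul_left fun _ => -1)).add
            ((hw j).Y.Y.mul_left fun _ => -1) |>.of_zero fun p hp => by
              simp only [box, SF.sub_apply]; linarith) I)
        have o : OK fun p => box (word SS I (w j)) p + 1 ^ 2 * word SS I (w j) p :=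
          ob.add (hf.ok.const_mul _)
        have e4 := (nrm_add ob (hf.ok.const_mul (1 ^ 2)) s)
        norm_num only [one_pow, abs_one, one_mul] at e4
        have key : ∀ f : Pt → ℝ, OK f → nrm f s = nrm (T (word SS I (w j))) s →
            II (fun p => f p * (box (word SS I (w j)) p + 1 ^ 2 * word SS I (w j) p)) s ≤
              (C + 1) * x ^ 2 := fun f hf' hn => by
          refine (II_mul_le_nrm hf' o s).trans ?_
          rw [hn]
          have : nrm (fun p => box (word SS I (w j)) p + 1 ^ 2 * word SS I (w j) p) s ≤ (C + 1) * x := by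
            norm_num only [one_pow, one_mul]; linarith
          calc _ ≤ x * ((C + 1) * x) := mul_le_mul e1 this (nrm_nonneg _ _) hx.le
            _ = _ := by ring
        have k1 := key _ hf.T.ok rfl
        have k2 := key _ (hf.T.ok.const_mul (-1)) (by rw [nrm_const_mul]; simp)
        rw [II_const_mul]
        have e5 : (fun p => -1 * T (word SS I (w j)) p *
            (box (word SS I (w j)) p + 1 ^ 2 * word SS I (w j) p)) = fun p => -1 *
            (T (word SS I (w j)) p * (box (word SS I (w j)) p + 1 ^ 2 * word SS I (w j) p)) := by
          ext p; ring
        rw [e5, II_const_mul] at k2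
        grind
    have h2 : |E' s| ≤ 2 * c * (2 * (C + 1) * x ^ 2) := by
      refine (abs_sum_le_sum_abs _ _).trans ((sum_le_card_nsmul _ _
        (c * (2 * (C + 1) * x ^ 2)) fun j _ => (abs_sum_le_sum_abs _ _).trans
          ((sum_le_card_nsmul _ _ _ (h1 j)).trans (le_of_eq (nsmul_eq_mul _ _)))).trans ?_)
      simp; linarith
    nlinarith [mul_lt_mul_of_pos_right hl (by positivity : 0 < x ^ 2)]
  have main : ∀ σ : ℝ, |σ| = 1 → ∀ r ∈ Icc 0 A, EE w k (σ * r) ≤ (K * exp (l * r)) ^ 2 :=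
    fun σ hσ => by
      have ha : ∀ r, 0 ≤ r → |σ * r| = r := fun r hr => by rw [abs_mul, hσ, one_mul, abs_of_nonneg hr]
      refine energy_le (e := fun r => EE w k (σ * r)) (e' := fun r => E' (σ * r) * σ)
        (fun r hr => ?_) (by simpa using h0) fun r hr he => ?_
      · have := (hasDerivAt_EE hw k (σ * r)).comp r ((hasDerivAt_id r).const_mul σ)
        rwa [mul_one] at this
      · have h3 := hE' (σ * r) (by grind) (by rw [ha r hr.1]; exact he.le)
        rw [ha r hr.1] at h3
        refine lt_of_le_of_lt ((le_abs_self _).trans ?_) h3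
        grind
  rcases le_total 0 s with h3 | h3
  · have := main 1 (by simp) |s| ⟨abs_nonneg _, hs⟩
    rw [one_mul, abs_of_nonneg h3] at this
    rwa [abs_of_nonneg h3]
  · have := main (-1) (by simp) |s| ⟨abs_nonneg _, hs⟩
    rw [abs_of_nonpos h3, neg_mul_neg, one_mul] at this
    rwa [abs_of_nonpos h3]

/-- Right-hand side of the system written as a wave equation. -/
def src (m : Fin 2 → ℝ) (G : Fin 2 → GF Ix) (w : Fin 2 → SF) (j : Fin 2) : SF :=
  comp (G j) (UU w) - (m j) ^ 2 • w j

/-- Picard iteration. -/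
def it (m : Fin 2 → ℝ) (G : Fin 2 → GF Ix) (q : Fin 2 → SF) : ℕ → Fin 2 → SF
  | 0 => q
  | n + 1 => fun j => q j + W (src m G (it m G q n) j - box (q j))

section
variable {m : Fin 2 → ℝ} {G : Fin 2 → GF Ix} (h0 : ∀ j, G j 0 = 0)

theorem box_it (q : Fin 2 → SF) (n : ℕ) (j : Fin 2) :
    box (it m G q (n + 1) j) = src m G (it m G q n) j := by
  rw [it, box_add, box_W]; ring

include h0 in
theorem comp_eq_zero {w : Fin 2 → SF} {p : Pt} (h : ∀ c, UU w c p = 0) (j : Fin 2) :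
    comp (G j) (UU w) p = 0 := by
  rw [comp_apply, funext h]; exact h0 j

theorem SR.UU {R : ℝ} {w : Fin 2 → SF} (hw : ∀ j, SR R (w j)) (c : Ix) : SR R (UU w c) := by
  obtain ⟨j, _ | a⟩ := c
  · exact hw j
  · obtain ⟨v, hv⟩ := dd_eq a
    change SR R (dd a (w j)); rw [hv]; exact (hw j).dir v

theorem SR.box {R : ℝ} {f : SF} (hf : SR R f) : SR R (box f) := fun p a b h hp => by
  have e : ∀ w, KG.dir w (KG.dir w f) p = 0 := fun w => (hf.dir w).dir w p a b h hp
  simp only [KG.box, SF.sub_apply, T, X, Y, e, sub_zero]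

include h0 in
theorem SR.src {R : ℝ} {w : Fin 2 → SF} (hw : ∀ j, SR R (w j)) (j : Fin 2) : SR R (src m G w j) :=
  fun p a b h hp => by
    rw [KG.src, SF.sub_apply, comp_eq_zero h0 (fun c => SR.UU hw c p a b h hp), SF.smul_apply,
      hw j p a b h hp]; simp

include h0 in
theorem SR.it {R : ℝ} {q : Fin 2 → SF} (hq : ∀ j, SR R (q j)) (n : ℕ) (j : Fin 2) :
    SR R (it m G q n j) := by
  induction n generalizing j with
  | zero => exact hq j
  | succ n ih =>
    refine (hq j).add (SR.W fun p a b h hp => ?_)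
    rw [SF.sub_apply, SR.src h0 ih j p a b h hp, (hq j).box p a b h hp, sub_zero]

theorem it_data (q : Fin 2 → SF) (n : ℕ) (c : Ix) (I : List (Fin 2)) (z : ℝ × ℝ) :
    word SS I (UU (it m G q n) c) (0, z) = word SS I (UU q c) (0, z) := by
  cases n with
  | zero => rfl
  | succ n =>
    obtain ⟨j, _ | a⟩ := c
    · change word SS I (it m G q (n + 1) j) (0, z) = word SS I (q j) (0, z)
      rw [it, map_add, word_SS_W, SF.add_apply, (W_zero _ z).1, add_zero]
    · change word SS I (dd a (it m G q (n + 1) j)) (0, z) = word SS I (dd a (q j)) (0, z)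
      rw [it, map_add, map_add, SF.add_apply, add_eq_left, word_SS_dd, word_SS_W]
      fin_cases a
      exacts [(W_zero _ z).2, by change X (W _) (0, z) = 0; rw [X_W, (W_zero _ z).1],
        by change Y (W _) (0, z) = 0; rw [Y_W, (W_zero _ z).1]]

theorem EE_zero_congr {w v : Fin 2 → SF} (hw : ∀ j, SC (w j)) (hv : ∀ j, SC (v j)) (k : ℕ)
    (h : ∀ c I z, word SS I (UU w c) (0, z) = word SS I (UU v c) (0, z)) : EE w k 0 = EE v k 0 := by
  rw [EE_eq hw, EE_eq hv]; simp only [nrm, II, h]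

theorem EE_bdd {w : Fin 2 → SF} (hw : ∀ j, SC (w j)) (k : ℕ) (A : ℝ) :
    ∃ K, 0 < K ∧ ∀ s, |s| ≤ A → EE w k s ≤ K ^ 2 := by
  obtain ⟨B, hB⟩ := (isCompact_Icc (a := -A) (b := A)).exists_bound_of_continuousOn
    (f := EE w k) fun s _ => (hasDerivAt_EE hw k s).continuousAt.continuousWithinAt
  refine ⟨1 + |B|, by positivity, fun s hs => ?_⟩
  nlinarith [(le_abs_self _).trans (hB s (abs_le.1 hs)), le_abs_self B]

theorem EE_smul {w : Fin 2 → SF} (hw : ∀ j, SC (w j)) (e : ℝ) (k : ℕ) (s : ℝ) :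
    EE (fun j => e • w j) k s = e ^ 2 * EE w k s := by
  rw [EE_eq hw, EE_eq (w := fun j => e • w j) fun j => (hw j).mul_left fun _ => e, mul_sum]
  refine sum_congr rfl fun c _ => ?_
  rw [mul_sum]
  refine sum_congr rfl fun I _ => ?_
  have : UU (fun j => e • w j) c = e • UU w c := by obtain ⟨j, _ | b⟩ := c <;> simp [KG.UU]
  rw [this, map_smul, ← sq_abs e, ← mul_pow, ← nrm_const_mul]; rfl

theorem cnt_nonneg (k : ℕ) : 0 ≤ cnt k := by unfold cnt; positivity

include h0 in
theorem nrm_src_le (hb : ∀ j, (G j).Bdd) (k : ℕ) {M : ℝ} (hM : 0 ≤ M) : ∃ C, 0 ≤ C ∧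
    ∀ w : Fin 2 → SF, (∀ j, SC (w j)) → ∀ s, (0 < k → NN (UU w) (k - 1) s ≤ M) →
      ∀ j, ∀ I : List (Fin 2), I.length ≤ k →
        nrm (word SS I (src m G w j)) s ≤ C * NN (UU w) k s := by
  choose C hC0 hC using fun j => nrm_word_comp_le (hb j) (h0 j) k hM
  refine ⟨∑ j, (C j + m j ^ 2), sum_nonneg fun j _ => by have := hC0 j; positivity,
    fun w hw s hs j I hI => ?_⟩
  have h1 := hC j (UU w) (SC.UU hw) s hs I hI
  have h2 : nrm (word SS I (w j)) s ≤ NN (UU w) k s := le_NN (UU w) hI (j, none) s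
  have h3 : SC (comp (G j) (UU w)) := (SC.sum Finset.univ _ fun c _ => ((SC.UU hw c).abs)).of_zero
    fun p hp => comp_eq_zero h0 (fun c => by
      simpa using (Finset.sum_eq_zero_iff_of_nonneg fun _ _ => abs_nonneg _).1 hp c) j
  have e : (word SS I (src m G w j) : Pt → ℝ) = fun p => word SS I (comp (G j) (UU w)) p +
      (-m j ^ 2) * word SS I (w j) p := by
    ext p; simp [src]; ring
  rw [e]
  refine (nrm_add (h3.SS I).ok (((hw j).SS I).ok.const_mul _) s).trans ?_
  rw [nrm_const_mul, abs_neg, abs_of_nonneg (sq_nonneg (m j))]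
  calc _ ≤ (C j + m j ^ 2) * NN (UU w) k s := by nlinarith
    _ ≤ _ := mul_le_mul_of_nonneg_right (single_le_sum (f := fun j => C j + m j ^ 2)
        (fun j _ => by have := hC0 j; positivity) (Finset.mem_univ j)) (NN_nonneg _ _ _)

include h0 in
/-- Energy bounds of all orders for the iterates, uniform in the size of the data. -/
theorem it_bound (hb : ∀ j, (G j).Bdd) {R : ℝ} {q : Fin 2 → SF} (hq : ∀ j, SR R (q j)) (A : ℝ)
    (k : ℕ) : ∃ M, 0 < M ∧ ∀ e : ℝ, 0 < e → e ≤ 1 → ∀ n s, |s| ≤ A →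
      NN (UU (it m G (fun j => e • q j) n)) k s ≤ M * e := by
  have hqe : ∀ (e : ℝ) j, SR R (e • q j : SF) := fun e j => (hq j).of_zero fun p h => by simp [h]
  have hsc : ∀ e n j, SC (it m G (fun j => e • q j) n j) := fun e n j =>
    (SR.it h0 (hqe e) n j).sc
  induction k using Nat.strong_induction_on with | _ k ih => ?_
  obtain ⟨M, hM, hM'⟩ : ∃ M : ℝ, 0 ≤ M ∧ ∀ e : ℝ, 0 < e → e ≤ 1 → ∀ n s, |s| ≤ A → 0 < k →
      NN (UU (it m G (fun j => e • q j) n)) (k - 1) s ≤ M := by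
    rcases Nat.eq_zero_or_pos k with rfl | hk
    · exact ⟨0, le_rfl, fun _ _ _ _ _ _ h => absurd h (lt_irrefl 0)⟩
    · obtain ⟨M, hM, h⟩ := ih (k - 1) (by omega)
      exact ⟨M, hM.le, fun e h1 h2 n s hs _ => (h e h1 h2 n s hs).trans (by nlinarith)⟩
  obtain ⟨C, hC0, hC⟩ := nrm_src_le (m := m) h0 hb k hM
  obtain ⟨K, hK0, hK⟩ := EE_bdd (fun j => (hq j).sc) k A
  have hc := cnt_nonneg k
  set l := 2 * ((words (Fin 2) k).card : ℝ) * (C * cnt k + 1) + 1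
  have hl : 0 ≤ l := by positivity
  have main : ∀ e : ℝ, 0 < e → e ≤ 1 → ∀ n s, |s| ≤ A →
      EE (it m G (fun j => e • q j) n) k s ≤ (K * e * exp (l * |s|)) ^ 2 := by
    intro e he he1 n
    have hK' : ∀ s, |s| ≤ A → EE (fun j => e • q j) k s ≤ (K * e) ^ 2 := fun s hs => by
      rw [EE_smul fun j => (hq j).sc, mul_pow, mul_comm]
      exact mul_le_mul_of_nonneg_right (hK s hs) (sq_nonneg e)
    induction n with
    | zero =>
      intro s hs
      refine (hK' s hs).trans (pow_le_pow_left₀ (by positivity) ?_ 2)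
      exact le_mul_of_one_le_right (by positivity) (one_le_exp (by positivity))
    | succ n ihn =>
      intro s hs
      refine EE_growth (hsc e (n + 1)) (by positivity) (by positivity : 0 ≤ C * cnt k)
        (by simp only [l]; linarith) ?_ (fun j I hI s hs => ?_) s hs
      · rw [EE_zero_congr (hsc e (n + 1)) (fun j => (hqe e j).sc) k (it_data _ _)]
        exact hK' 0 (by rw [abs_zero]; exact (abs_nonneg s).trans hs)
      · rw [box_it, mul_assoc]
        exact (hC _ (hsc e n) s (hM' e he he1 n s hs) j I hI).trans (mul_le_mul_of_nonneg_left
          (NN_le_of_EE (hsc e n) (by positivity) (ihn s hs)) hC0)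
  refine ⟨cnt k * (K * exp (l * A)) + 1, by positivity, fun e he he1 n s hs => ?_⟩
  have h1 := NN_le_of_EE (hsc e n) (by positivity) (main e he he1 n s hs)
  have h2 : exp (l * |s|) ≤ exp (l * A) := exp_le_exp.2 (by gcongr)
  calc _ ≤ cnt k * (K * e * exp (l * |s|)) := h1
    _ ≤ cnt k * (K * e * exp (l * A)) := by gcongr
    _ ≤ _ := by linarith
end

/-- Geometric decay, locally uniformly in time. -/
def Geo (g : ℕ → Pt → ℝ) : Prop :=
  ∀ A : ℝ, ∃ r M : ℝ, 0 < r ∧ r < 1 ∧ 0 ≤ M ∧ ∀ n p, |p.1| ≤ A → |g n p| ≤ M * r ^ n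

theorem sup_sq_le {f : SF} (hf : SC f) (p : Pt) : f p ^ 2 ≤
    2 * (nrm (Y f) p.1 * nrm (X f) p.1 + nrm f p.1 * nrm (Y (X f)) p.1) := by
  have hff : SC (f * f : SF) := hf.mul_left f
  have h := abs_le_II hff p
  have o := hf.ok.abs
  have o1 := hf.X.ok.abs
  have o2 := hf.Y.ok.abs
  have o3 := hf.X.Y.ok.abs
  have p1 := o2.mul_right o1.2
  have p2 := o.mul_right o3.2
  have na : ∀ g : Pt → ℝ, nrm (fun p => |g p|) p.1 = nrm g p.1 := fun g => by simp [nrm]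
  have q1 := II_mul_le_nrm o2 o1 p.1
  have q2 := II_mul_le_nrm o o3 p.1
  simp only [na] at q1 q2
  refine le_trans (le_of_eq ?_) (h.trans ((II_mono (g := fun p => 2 * (|Y f p| * |X f p| +
    |f p| * |Y (X f) p|)) hff.X.Y.abs (SF.cont _).abs ((p1.add p2).const_mul 2).1
    ((p1.add p2).const_mul 2).2 fun z => ?_).trans ?_))
  · rw [SF.mul_apply, ← pow_two, abs_of_nonneg (sq_nonneg _)]
  · simp
    generalize f (p.1, z) = a, X f (p.1, z) = b, Y f (p.1, z) = c, Y (X f) (p.1, z) = d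
    rw [← abs_mul, ← abs_mul]
    grind
  · rw [II_const_mul, II_add p1.1 p1.2 p2.1 p2.2]
    linarith

theorem hasDerivAt_line (f : SF) (p w : Pt) (t : ℝ) :
    HasDerivAt (fun t : ℝ => f (p + t • w)) (dir w f (p + t • w)) t := by
  have h1 : HasFDerivAt (f : Pt → ℝ) (fderiv ℝ f (p + t • w)) (p + t • w) := (f.diff _).hasFDerivAt
  have h2 : HasDerivAt (fun t : ℝ => p + t • w) w t := by
    simpa using ((hasDerivAt_id t).smul_const w).const_add p
  exact h1.comp_hasDerivAt t h2

/-- Landau's inequality. -/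
theorem landau (f : SF) (p w : Pt) {h M B : ℝ} (hh : 0 < h)
    (h0 : ∀ t ∈ Icc 0 h, |f (p + t • w)| ≤ M) (h2 : ∀ t ∈ Icc 0 h, |dir w (dir w f) (p + t • w)| ≤ B) :
    h * |dir w f p| ≤ 2 * M + B * h ^ 2 := by
  have hB : 0 ≤ B := (abs_nonneg _).trans (h2 0 ⟨le_rfl, hh.le⟩)
  have m1 : ∀ t ∈ Icc 0 h, |dir w f (p + t • w) - dir w f p| ≤ B * h := fun t ht => by
    have := Convex.norm_image_sub_le_of_norm_hasDerivWithin_le (f := fun t : ℝ => dir w f (p + t • w))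
      (s := Icc 0 h) (fun t ht => (hasDerivAt_line (dir w f) p w t).hasDerivWithinAt)
      (fun t ht => h2 t ht) (convex_Icc 0 h) ⟨le_rfl, hh.le⟩ ht
    simp at this
    rw [abs_of_nonneg ht.1] at this
    exact this.trans (mul_le_mul_of_nonneg_left ht.2 hB)
  have m2 := Convex.norm_image_sub_le_of_norm_hasDerivWithin_le
    (f := fun t : ℝ => f (p + t • w) - t * dir w f p) (s := Icc 0 h)
    (fun t ht => ((hasDerivAt_line f p w t).sub
      (by simpa using (hasDerivAt_id t).mul_const (dir w f p))).hasDerivWithinAt)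
    (fun t ht => m1 t ht) (convex_Icc 0 h) ⟨le_rfl, hh.le⟩ ⟨hh.le, le_rfl⟩
  have a0 := h0 0 ⟨le_rfl, hh.le⟩
  simp only [zero_smul, add_zero, sub_zero, norm_eq_abs, abs_of_pos hh, zero_mul] at m2 a0
  rw [← abs_of_pos hh, ← abs_mul, abs_of_pos hh]
  grind

theorem Geo.dd {g : ℕ → SF} (hg : Geo fun n => g n) (a : Fin 3)
    (hB : ∀ A : ℝ, ∃ B, ∀ n p, |p.1| ≤ A → |dd a (dd a (g n)) p| ≤ B) :
    Geo fun n => KG.dd a (g n) := by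
  obtain ⟨w, hw, hw1⟩ : ∃ w : Pt, KG.dd a = dir w ∧ |w.1| ≤ 1 := by
    fin_cases a
    exacts [⟨_, rfl, by norm_num⟩, ⟨_, rfl, by norm_num⟩, ⟨_, rfl, by norm_num⟩]
  rw [hw] at hB ⊢
  intro A
  obtain ⟨r, M, hr0, hr1, hM, h⟩ := hg (A + 1)
  obtain ⟨B, hB⟩ := hB (A + 1)
  refine ⟨√r, 2 * M + |B|, sqrt_pos.2 hr0, by
    rw [sqrt_lt' one_pos]; simpa using hr1, by positivity, fun n p hp => ?_⟩
  have hs : 0 < √r ^ n := by positivity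
  have hs2 : (√r ^ n) ^ 2 = r ^ n := by rw [← pow_mul, mul_comm, pow_mul, sq_sqrt hr0.le]
  have hs1 : √r ^ n ≤ 1 := pow_le_one₀ (sqrt_nonneg _) (sqrt_le_one.2 hr1.le)
  have hA : ∀ t ∈ Icc 0 (√r ^ n), |(p + t • w).1| ≤ A + 1 := fun t ht => by
    simp only [Prod.fst_add, Prod.smul_fst, smul_eq_mul]
    refine (abs_add_le _ _).trans (add_le_add hp ?_)
    rw [abs_mul, abs_of_nonneg ht.1]
    exact mul_le_one₀ (ht.2.trans hs1) (abs_nonneg _) hw1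
  have key := landau (g n) p w hs (fun t ht => h n _ (hA t ht)) (fun t ht => hB n _ (hA t ht))
  rw [← hs2] at key
  refine le_of_mul_le_mul_left (key.trans ?_) hs
  grind

theorem word_dd_perm {J J' : List (Fin 3)} (h : J.Perm J') (f : SF) : word dd J f = word dd J' f := by
  induction h with
  | nil => rfl
  | cons a _ ih => rw [word_cons, word_cons, ih]
  | swap a b l =>
    obtain ⟨v, hv⟩ := dd_eq a
    obtain ⟨w, hw⟩ := dd_eq b
    simp only [word_cons, hv, hw, dir_comm v w]
  | trans _ _ h1 h2 => rw [h1, h2]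

theorem word_SS_eq (I : List (Fin 2)) (f : SF) : word SS I f = word dd (I.map Fin.succ) f := by
  induction I with
  | nil => rfl
  | cons i I ih =>
    rw [List.map_cons, word_cons, word_cons, ih]
    fin_cases i <;> rfl

theorem exists_map_succ (J : List (Fin 3)) (h : (0 : Fin 3) ∉ J) : ∃ I : List (Fin 2),
    J = I.map Fin.succ := by
  induction J with
  | nil => exact ⟨[], rfl⟩
  | cons a J ih =>
    obtain ⟨I, rfl⟩ := ih fun h' => h (List.mem_cons_of_mem _ h')
    obtain ⟨i, rfl⟩ := Fin.exists_succ_eq.2 fun h' : a = 0 => h (by simp [h'])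
    exact ⟨i :: I, rfl⟩

theorem expand_sublist {ι κ : Type} [Fintype ι] (I : List κ) : ∀ t ∈ expand ι I, ∀ e ∈ t,
    e.1.Sublist I := by
  induction I with
  | nil => simp [expand]
  | cons i I ih =>
    have hm : ∀ t s : List (List κ × ι), s ∈ mods i t → (∀ e ∈ t, e.1.Sublist I) →
        ∀ e ∈ s, e.1.Sublist (i :: I) := by
      intro t
      induction t with
      | nil => simp [mods]
      | cons e t iht =>
        intro s hs h
        simp only [mods, List.mem_cons, List.mem_map] at hs
        grind
    intro t ht
    simp only [expand, List.mem_flatMap, List.mem_append, List.mem_map] at ht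
    grind

theorem word_dd_comp_le {ι : Type} [Fintype ι] [DecidableEq ι] {G : GF ι} (hb : G.Bdd) (h0 : G 0 = 0)
    (k : ℕ) {C : ℝ} (hC : 0 ≤ C) : ∃ C', 0 ≤ C' ∧ ∀ (U : ι → SF) (p : Pt) (e : ℝ) (i : ℕ), 0 ≤ e → e ≤ 1 →
      (∀ c, ∀ J : List (Fin 3), J.length ≤ k → J.count 0 ≤ i → |word dd J (U c) p| ≤ C * e) →
      ∀ I : List (Fin 3), I.length ≤ k → I.count 0 ≤ i → |word dd I (comp G U) p| ≤ C' * e := by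
  obtain ⟨L, hL0, hL⟩ := hb.lip
  choose B hB using hb
  have hS : ∀ I : List (Fin 3), 0 ≤ ((expand ι I).map fun t =>
      L * C + |B (t.map (·.2))| * C ^ t.length).sum :=
    fun I => list_map_sum_nonneg _ _ fun _ _ => by positivity
  refine ⟨∑ I ∈ words (Fin 3) k, ((expand ι I).map fun t =>
    L * C + |B (t.map (·.2))| * C ^ t.length).sum, sum_nonneg fun I _ => hS I,
    fun U p e i he he1 h I hI hi => ?_⟩
  rw [word_comp dd isChain_dd]
  refine (abs_list_sum_le _ _ _).trans ((list_sum_le_of_forall _ _ (fun t =>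
    L * C + |B (t.map (·.2))| * C ^ t.length) e fun t ht => ?_).trans
    (mul_le_mul_of_nonneg_right (single_le_sum (f := fun I => ((expand ι I).map fun t =>
      L * C + |B (t.map (·.2))| * C ^ t.length).sum) (fun I _ => hS I) (mem_words.2 hI)) he))
  rcases eq_or_ne t [] with rfl | ht0
  · have h1 := hL (fun c => U c p) 0
    rw [h0, sub_zero, sub_zero] at h1
    have h2 : ‖fun c => U c p‖ ≤ C * e := (pi_norm_le_iff_of_nonneg (by positivity)).2 fun c =>
      h c [] (by simp) (by simp)
    simp only [term, KG.factors, List.map_nil, List.prod_nil, mul_one, GF.pdw, comp_apply]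
    refine h1.trans ((mul_le_mul_of_nonneg_left h2 hL0).trans ?_)
    rw [← mul_assoc]
    exact mul_le_mul_of_nonneg_right (le_add_of_nonneg_right (by positivity)) he
  · have h1 : ((t.map fun e => |word dd e.1 (U e.2) p|)).prod ≤ C ^ t.length * e := by
      have h2 := list_prod_le_prod t (fun e => |word dd e.1 (U e.2) p|) (fun _ => C * e)
        (fun _ _ => abs_nonneg _) fun x hx => by
          have := expand_sublist I t ht x hx
          grind
      rw [List.map_const', List.prod_replicate, mul_pow] at h2
      exact h2.trans (mul_le_mul_of_nonneg_left (pow_le_of_le_one he he1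
        (List.length_pos_iff.2 ht0).ne') (by positivity))
    rw [term, SF.mul_apply, abs_mul, KG.factors, SF.list_prod_apply, abs_list_prod]
    calc _ ≤ |B (t.map (·.2))| * (C ^ t.length * e) :=
          mul_le_mul ((hB _ _).trans (le_abs_self _)) h1 (list_prod_nonneg _ _ fun _ _ => abs_nonneg _)
            (abs_nonneg _)
      _ ≤ _ := by rw [← mul_assoc]; exact mul_le_mul_of_nonneg_right
                    (le_add_of_nonneg_left (by positivity)) he

theorem SC.bdd {f : SF} (hf : SC f) (A : ℝ) : ∃ B, 0 ≤ B ∧ ∀ p : Pt, |p.1| ≤ A → |f p| ≤ B := by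
  obtain ⟨R, hR⟩ := hf A
  obtain ⟨B, hB⟩ := ((isCompact_Icc (a := -A) (b := A)).prod ((isCompact_Icc (a := -R) (b := R)).prod
    (isCompact_Icc (a := -R) (b := R)))).exists_bound_of_continuousOn f.cont.continuousOn
  refine ⟨|B|, abs_nonneg B, fun p hp => ?_⟩
  by_cases h : R < |p.2.1| ∨ R < |p.2.2|
  · grind
  · push Not at h
    exact (hB p ⟨abs_le.1 hp, abs_le.1 h.1, abs_le.1 h.2⟩).trans (le_abs_self B)

theorem SC.word_dd {f : SF} (hf : SC f) (J : List (Fin 3)) : SC (word KG.dd J f) := by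
  induction J with
  | nil => exact hf
  | cons i J ih => obtain ⟨w, hw⟩ := dd_eq i; rw [word_cons, hw]; exact ih.dir w

theorem SC.bdd_word {q : Fin 2 → SF} (hq : ∀ j, SC (q j)) (A : ℝ) (k : ℕ) : ∃ B, 0 ≤ B ∧
    ∀ j J p, |p.1| ≤ A → J.length ≤ k → |word KG.dd J (q j) p| ≤ B := by
  choose B hB0 hB using fun (j : Fin 2) (J : List (Fin 3)) => ((hq j).word_dd J).bdd A
  refine ⟨∑ j, ∑ J ∈ words (Fin 3) k, B j J,
    sum_nonneg fun j _ => sum_nonneg fun J _ => hB0 j J, fun j J p hp hJ => ?_⟩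
  exact (hB j J p hp).trans ((single_le_sum (f := fun J => B j J) (fun J _ => hB0 j J)
    (mem_words.2 hJ)).trans (single_le_sum (f := fun j => ∑ J ∈ words (Fin 3) k, B j J)
      (fun j _ => sum_nonneg fun J _ => hB0 j J) (Finset.mem_univ j)))

section
variable {m : Fin 2 → ℝ} {G : Fin 2 → GF Ix} (h0 : ∀ j, G j 0 = 0)
include h0

/-- Bounds for all derivatives of the iterates, uniform in the size of the data. -/
theorem it_word_bound (hb : ∀ j, (G j).Bdd) {R : ℝ} {q : Fin 2 → SF} (hq : ∀ j, SR R (q j)) (A : ℝ)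
    (i k : ℕ) : ∃ C, 0 ≤ C ∧ ∀ e : ℝ, 0 < e → e ≤ 1 → ∀ n j p, ∀ J : List (Fin 3), |p.1| ≤ A →
      J.length ≤ k → J.count 0 ≤ i + 1 → |word dd J (it m G (fun j => e • q j) n j) p| ≤ C * e := by
  have hsc : ∀ (e : ℝ) n j, SC (it m G (fun j => e • q j) n j) := fun e n j =>
    (SR.it h0 (fun j => (hq j).of_zero fun p h => by simp [h]) n j).sc
  induction i generalizing k with
  | zero =>
    obtain ⟨M, hM, h⟩ := it_bound (m := m) h0 hb hq A (k + 2)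
    refine ⟨2 * M, by positivity, fun e he he1 n j p J hp hJ hc => ?_⟩
    have key : ∀ c, ∀ I : List (Fin 2), I.length ≤ k →
        |word SS I (UU (it m G (fun j => e • q j) n) c) p| ≤ 2 * M * e := fun c I hI => by
      have := abs_le_NN (SC.UU (hsc e n)) (by omega : I.length + 2 ≤ k + 2) c p
      grind
    by_cases hJ0 : (0 : Fin 3) ∈ J
    · have h1 := (List.perm_cons_erase hJ0).trans (List.perm_append_singleton 0 (J.erase 0)).symm
      obtain ⟨I, hI⟩ := exists_map_succ (J.erase 0) fun h' => by grind
      have h2 := List.length_erase_of_mem hJ0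
      rw [word_dd_perm h1, word_append, hI, ← word_SS_eq]
      refine key (j, some 0) I ?_
      grind
    · obtain ⟨I, rfl⟩ := exists_map_succ J hJ0
      rw [← word_SS_eq]
      exact key (j, none) I (by grind)
  | succ i ih =>
    obtain ⟨C, hC0, hC⟩ := ih (k + 1)
    obtain ⟨B, hB0, hB⟩ := SC.bdd_word (fun j => (hq j).sc) A k
    choose D hD0 hD using fun j => word_dd_comp_le (hb j) (h0 j) k hC0
    refine ⟨B + (C + C + ∑ j, (D j + m j ^ 2 * C)), by
      have : 0 ≤ ∑ j, (D j + m j ^ 2 * C) := sum_nonneg fun j _ => by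
        have := hD0 j; positivity
      positivity, fun e he he1 n j p J hp hJ hc => ?_⟩
    have hnn : 0 ≤ C + C + ∑ j, (D j + m j ^ 2 * C) := by
      have : 0 ≤ ∑ j, (D j + m j ^ 2 * C) := sum_nonneg fun j _ => by
        have := hD0 j; positivity
      positivity
    by_cases hc2 : J.count 0 ≤ i + 1
    · refine (hC e he he1 n j p J hp (hJ.trans (Nat.le_succ k)) hc2).trans
        (mul_le_mul_of_nonneg_right ?_ he.le)
      have : 0 ≤ ∑ j, (D j + m j ^ 2 * C) := sum_nonneg fun j _ => by
        have := hD0 j; positivity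
      linarith
    cases n with
    | zero =>
      simp only [it, map_smul, SF.smul_apply, abs_mul, abs_of_pos he]
      rw [mul_comm]
      exact mul_le_mul_of_nonneg_right ((hB j J p hp hJ).trans (le_add_of_nonneg_right hnn)) he.le
    | succ n =>
      obtain ⟨L, hL⟩ : ∃ L, L = (J.erase 0).erase 0 := ⟨_, rfl⟩
      have hp1 : J.Perm (L ++ [0, 0]) := by grind
      have l1 : L.length + 2 ≤ k := by have := hp1.length_eq; simp at this; omega
      have l2 : L.count 0 ≤ i := by have := hp1.count_eq 0; simp at this; omega
      set w := it m G (fun j => e • q j) n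
      set v := it m G (fun j => e • q j) (n + 1)
      have e1 : dd 0 (dd 0 (v j)) = dd 1 (dd 1 (v j)) + dd 2 (dd 2 (v j)) + (comp (G j) (UU w) -
          (m j) ^ 2 • w j) := by
        have : box (v j) = _ := box_it (fun j => e • q j) n j
        rw [src] at this
        rw [← this]; change T (T (v j)) = X (X (v j)) + Y (Y (v j)) + _
        rw [box]; ring
      have e2 : word dd J (v j) p = word dd (L ++ [1, 1]) (v j) p + word dd (L ++ [2, 2]) (v j) p +
          (word dd L (comp (G j) (UU w)) p - m j ^ 2 * word dd L (w j) p) := by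
        rw [word_dd_perm hp1, word_append, word_append, word_append]
        change word dd L (dd 0 (dd 0 (v j))) p = word dd L (dd 1 (dd 1 (v j))) p +
          word dd L (dd 2 (dd 2 (v j))) p + _
        rw [e1]; simp
      have b1 := hC e he he1 (n + 1) j p (L ++ [1, 1]) hp (by simp; omega) (by simp; omega)
      have b2 := hC e he he1 (n + 1) j p (L ++ [2, 2]) hp (by simp; omega) (by simp; omega)
      have b3 := hC e he he1 n j p L hp (by omega) (by omega)
      have b4 := hD j (UU w) p e i he.le he1 (fun c J' hJ' hc' => by
        obtain ⟨j', _ | a⟩ := c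
        · exact hC e he he1 n j' p J' hp (by omega) (by omega)
        · have := hC e he he1 n j' p (J' ++ [a]) hp (by simp; omega) (by
            rw [List.count_append]
            exact add_le_add hc' (List.count_le_length.trans (by simp)))
          rwa [word_append] at this) L (by omega) l2
      have b5 := mul_le_mul_of_nonneg_right (single_le_sum (f := fun j => D j + m j ^ 2 * C)
        (fun j _ => by have := hD0 j; positivity) (Finset.mem_univ j)) he.le
      have b6 := mul_le_mul_of_nonneg_left b3 (sq_nonneg (m j))
      have b7 := mul_nonneg hB0 he.le
      rw [e2]
      refine (abs_add_le _ _).trans ((add_le_add (abs_add_le _ _) (abs_sub _ _)).trans ?_)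
      rw [abs_mul, abs_of_nonneg (sq_nonneg (m j))]
      linarith

end

section
variable {m : Fin 2 → ℝ} {G : Fin 2 → GF Ix} (h0 : ∀ j, G j 0 = 0)

/-- Increments of the Picard iteration. -/
def inc (m : Fin 2 → ℝ) (G : Fin 2 → GF Ix) (q : Fin 2 → SF) (n : ℕ) (j : Fin 2) : SF :=
  it m G q (n + 1) j + (-1 : ℝ) • it m G q n j

theorem nrm_abs (g : Pt → ℝ) (s : ℝ) : nrm (fun p => |g p|) s = nrm g s := by simp [nrm]

include h0 in
theorem SR.inc {R : ℝ} {q : Fin 2 → SF} (hq : ∀ j, SR R (q j)) (n : ℕ) (j : Fin 2) :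
    SR R (inc m G q n j) :=
  (SR.it h0 hq _ j).add ((SR.it (m := m) h0 hq n j).of_zero fun p h => by simp [h])

theorem nrm_src_sub_le (hb : ∀ j, (G j).Bdd) : ∃ C, 0 ≤ C ∧
    ∀ w v d : Fin 2 → SF, (d = fun j => w j + (-1 : ℝ) • v j) → (∀ j, SC (d j)) → ∀ s j,
      nrm (src m G w j - src m G v j : SF) s ≤ C * NN (UU d) 0 s := by
  choose L hL0 hL using fun j => (hb j).lip
  refine ⟨∑ j, (L j + m j ^ 2), sum_nonneg fun j _ => by have := hL0 j; positivity,
    fun w v d hd hsc s j => ?_⟩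
  have hpt : ∀ p, |(src m G w j - src m G v j) p| ≤ (∑ j, (L j + m j ^ 2)) * ∑ c, |UU d c p| := by
    intro p
    have hdc : ∀ c, UU d c p = UU w c p - UU v c p := fun c => by rw [hd, UU_lin]; simp; ring
    have hS : 0 ≤ ∑ c, |UU d c p| := by positivity
    have h1 : ‖(fun c => UU w c p) - fun c => UU v c p‖ ≤ ∑ c, |UU d c p| :=
      (pi_norm_le_iff_of_nonneg hS).2 fun c => by
        rw [Pi.sub_apply, ← hdc]
        exact single_le_sum (f := fun c => |UU d c p|) (fun _ _ => abs_nonneg _)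
          (Finset.mem_univ c)
    have h2 : |w j p - v j p| ≤ ∑ c, |UU d c p| := by
      have := hdc (j, none)
      change _ = w j p - v j p at this
      rw [← this]
      exact single_le_sum (f := fun c => |UU d c p|) (fun _ _ => abs_nonneg _)
        (Finset.mem_univ (j, none))
    have e : (src m G w j - src m G v j) p = (G j (fun c => UU w c p) - G j (fun c => UU v c p)) -
        m j ^ 2 * (w j p - v j p) := by simp [src]; ring
    rw [e]
    refine (abs_sub _ _).trans ?_
    rw [abs_mul, abs_of_nonneg (sq_nonneg (m j))]
    calc _ ≤ (L j + m j ^ 2) * ∑ c, |UU d c p| := by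
          rw [add_mul]
          exact add_le_add ((hL j _ _).trans (mul_le_mul_of_nonneg_left h1 (hL0 j)))
            (mul_le_mul_of_nonneg_left h2 (sq_nonneg _))
      _ ≤ _ := mul_le_mul_of_nonneg_right (single_le_sum (f := fun j => L j + m j ^ 2)
          (fun j _ => by have := hL0 j; positivity) (Finset.mem_univ j)) hS
  have ho : ∀ c, OK (fun p => |UU d c p|) := fun c => (SC.UU hsc c).ok.abs
  have ho2 : OK (fun p => (∑ j, (L j + m j ^ 2)) * ∑ c, |UU d c p|) :=
    (OK.sum Finset.univ _ fun c _ => ho c).const_mul _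
  have hn : nrm (fun p => (∑ j, (L j + m j ^ 2)) * ∑ c, |UU d c p|) s ≤
      (∑ j, (L j + m j ^ 2)) * NN (UU d) 0 s := by
    rw [nrm_const_mul, abs_of_nonneg (sum_nonneg fun j _ => by have := hL0 j; positivity)]
    refine mul_le_mul_of_nonneg_left ((nrm_sum _ _ (fun c _ => ho c) s).trans (le_of_eq ?_))
      (sum_nonneg fun j _ => by have := hL0 j; positivity)
    simp [NN, words, nrm_abs]
  refine le_trans (nrm_mono (OK.of_le ho2 (SF.cont _) fun p => (hpt p).trans (le_abs_self _)) ho2 fun z => (hpt _).trans (le_abs_self _)) hn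

include h0 in
theorem EE_inc (hb : ∀ j, (G j).Bdd) {R : ℝ} {q : Fin 2 → SF} (hq : ∀ j, SR R (q j)) (A : ℝ) :
    ∃ K, 0 < K ∧ ∀ n s, |s| ≤ A → EE (inc m G q n) 0 s ≤ (K * (1 / 2) ^ n) ^ 2 := by
  have hsc : ∀ n j, SC (inc m G q n j) := fun n j => (SR.inc h0 hq n j).sc
  obtain ⟨C, hC0, hC⟩ := nrm_src_sub_le (m := m) hb
  obtain ⟨K, hK0, hK⟩ := EE_bdd (hsc 0) 0 A
  have hc := cnt_nonneg 0
  set l := 2 * ((words (Fin 2) 0).card : ℝ) * (2 * (C * cnt 0) + 1) + 1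
  have hl : 0 ≤ l := by positivity
  have main : ∀ n s, |s| ≤ A → EE (inc m G q n) 0 s ≤
      (K * (1 / 2) ^ n * exp (l * |s|)) ^ 2 := by
    intro n
    induction n with
    | zero =>
      intro s hs
      refine (hK s hs).trans (pow_le_pow_left₀ hK0.le ?_ 2)
      rw [pow_zero, mul_one]
      exact le_mul_of_one_le_right hK0.le (one_le_exp (by positivity))
    | succ n ihn =>
      intro s hs
      refine EE_growth (hsc (n + 1)) (by positivity) (by positivity : 0 ≤ 2 * (C * cnt 0))
        (by grind) ?_ (fun j I hI s hs => ?_) s hs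
      · rw [EE_eq (hsc (n + 1))]
        refine le_trans (le_of_eq (sum_eq_zero fun c _ => sum_eq_zero fun I _ => ?_))
          (sq_nonneg _)
        have : ∀ z, word SS I (UU (inc m G q (n + 1)) c) (0, z) = 0 := fun z => by
          change word SS I (UU (fun j => it m G q (n + 2) j + (-1 : ℝ) • it m G q (n + 1) j) c) (0, z) = 0
          rw [UU_lin, map_add, map_smul, SF.add_apply, SF.smul_apply, it_data, it_data]; ring
        simp [nrm, II, this]
      · obtain rfl : I = [] := List.length_eq_zero_iff.1 (by omega)
        have e : box (inc m G q (n + 1) j) = src m G (it m G q (n + 1)) j - src m G (it m G q n) j := by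
          rw [inc, box_add, box_smul, box_it, box_it, neg_one_smul, sub_eq_add_neg]
        rw [word_nil, e]
        refine (hC _ _ (inc m G q n) rfl (hsc n) s j).trans ?_
        have := NN_le_of_EE (hsc n) (by positivity) (ihn s hs)
        refine (mul_le_mul_of_nonneg_left this hC0).trans (le_of_eq ?_)
        grind
  refine ⟨K * exp (l * |A|), by positivity, fun n s hs => (main n s hs).trans
    (pow_le_pow_left₀ (by positivity) ?_ 2)⟩
  rw [mul_right_comm]
  exact mul_le_mul_of_nonneg_right (mul_le_mul_of_nonneg_left (exp_le_exp.2
    (mul_le_mul_of_nonneg_left (hs.trans (le_abs_self A)) hl)) hK0.le) (by positivity)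

include h0 in
theorem Geo.inc (hb : ∀ j, (G j).Bdd) {R : ℝ} {q : Fin 2 → SF} (hq : ∀ j, SR R (q j)) (j : Fin 2) :
    Geo fun n => KG.inc m G q n j := by
  intro A
  have hsc : ∀ n j, SC (KG.inc m G q n j) := fun n j => (SR.inc h0 hq n j).sc
  obtain ⟨K, hK0, hK⟩ := EE_inc (m := m) h0 hb hq A
  obtain ⟨M, hM0, hM⟩ := it_bound (m := m) h0 hb hq A 2
  replace hM := fun n s hs => hM 1 one_pos le_rfl n s hs
  simp only [one_smul, mul_one] at hM
  refine ⟨√(1 / 2), √(2 * (K * K + K * (M + M))), by positivity, by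
    rw [sqrt_lt' one_pos]; norm_num, by positivity, fun n p hp => ?_⟩
  have hr : (0:ℝ) < (1 / 2) ^ n := by positivity
  have hr1 : ((1:ℝ) / 2) ^ n ≤ 1 := pow_le_one₀ (by norm_num) (by norm_num)
  have h := fun c => nrm_le_of_EE (hsc n) (by positivity) (hK n p.1 hp) c (I := []) (by simp)
  have n1 : nrm (Y (KG.inc m G q n j)) p.1 ≤ K * (1 / 2) ^ n := h (j, some 2)
  have n2 : nrm (X (KG.inc m G q n j)) p.1 ≤ K * (1 / 2) ^ n := h (j, some 1)
  have n3 : nrm (KG.inc m G q n j) p.1 ≤ K * (1 / 2) ^ n := h (j, none)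
  have n4 : nrm (Y (X (KG.inc m G q n j))) p.1 ≤ M + M := by
    have s1 := fun n => (SR.it (m := m) h0 hq n j).sc
    have b := fun n => (le_NN (UU (it m G q n)) (I := [1, 0]) (k := 2) (by simp) (j, none) p.1).trans
      (hM n p.1 hp)
    have e : (Y (X (KG.inc m G q n j)) : Pt → ℝ) = fun p => Y (X (it m G q (n + 1) j)) p +
      (-1) * Y (X (it m G q n j)) p := by ext p; simp [KG.inc]
    rw [e]
    refine (nrm_add (s1 _).X.Y.ok ((s1 n).X.Y.ok.const_mul _) _).trans ?_
    rw [nrm_const_mul, abs_neg, abs_one, one_mul]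
    exact add_le_add (b (n + 1)) (b n)
  have key : KG.inc m G q n j p ^ 2 ≤ 2 * (K * K + K * (M + M)) * (1 / 2) ^ n := by
    refine (sup_sq_le (hsc n j) p).trans ?_
    have p1 := mul_le_mul n1 n2 (nrm_nonneg _ _) (by positivity)
    have p2 := mul_le_mul n3 n4 (nrm_nonneg _ _) (by positivity)
    nlinarith
  refine abs_le_of_sq_le_sq ?_ (by positivity)
  rw [mul_pow, sq_sqrt (by positivity), ← pow_mul, mul_comm n 2, pow_mul, sq_sqrt (by norm_num)]
  exact key

include h0 in
theorem Geo.inc_word (hb : ∀ j, (G j).Bdd) {R : ℝ} {q : Fin 2 → SF} (hq : ∀ j, SR R (q j))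
    (J : List (Fin 3)) (j : Fin 2) : Geo fun n => word KG.dd J (KG.inc m G q n j) := by
  induction J with
  | nil => exact Geo.inc h0 hb hq j
  | cons a J ih =>
    refine Geo.dd ih a fun A => ?_
    obtain ⟨C, hC0, hC⟩ := it_word_bound (m := m) h0 hb hq A (J.length + 2) (J.length + 2)
    refine ⟨C + C, fun n p hp => ?_⟩
    have b := fun n => hC 1 one_pos le_rfl n j p (a :: a :: J) hp (by simp)
      (List.count_le_length.trans (by simp))
    simp only [one_smul, mul_one] at b
    have e : KG.dd a (KG.dd a (word KG.dd J (KG.inc m G q n j))) p =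
      word KG.dd (a :: a :: J) (it m G q (n + 1) j) p - word KG.dd (a :: a :: J) (it m G q n j) p := by
      simp [KG.inc]; ring
    grind

end

/-- The covector with given components. -/
def cov : Pt →L[ℝ] Pt →L[ℝ] ℝ :=
  (ContinuousLinearMap.fst ℝ ℝ (ℝ × ℝ)).smulRight (ContinuousLinearMap.fst ℝ ℝ (ℝ × ℝ)) +
  ((ContinuousLinearMap.fst ℝ ℝ ℝ).comp (ContinuousLinearMap.snd ℝ ℝ (ℝ × ℝ))).smulRight
    ((ContinuousLinearMap.fst ℝ ℝ ℝ).comp (ContinuousLinearMap.snd ℝ ℝ (ℝ × ℝ))) +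
  ((ContinuousLinearMap.snd ℝ ℝ ℝ).comp (ContinuousLinearMap.snd ℝ ℝ (ℝ × ℝ))).smulRight
    ((ContinuousLinearMap.snd ℝ ℝ ℝ).comp (ContinuousLinearMap.snd ℝ ℝ (ℝ × ℝ)))

@[simp] theorem cov_apply (a w : Pt) : cov a w = a.1 * w.1 + a.2.1 * w.2.1 + a.2.2 * w.2.2 := by
  simp [cov]

theorem Geo.lim {f : ℕ → Pt → ℝ} (h : Geo fun n p => f (n + 1) p - f n p) :
    ∃ v : Pt → ℝ, (∀ p, Tendsto (fun n => f n p) atTop (nhds (v p))) ∧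
      ∀ A : ℝ, TendstoUniformlyOn f v atTop {p | |p.1| < A} := by
  have h1 : ∀ A : ℝ, ∃ r M : ℝ, 0 ≤ r ∧ r < 1 ∧ ∀ p : Pt, |p.1| ≤ A → ∀ n,
      dist (f n p) (f (n + 1) p) ≤ M * r ^ n := fun A => by
    obtain ⟨r, M, h0, h1, _, h2⟩ := h A
    exact ⟨r, M, h0.le, h1, fun p hp n => by rw [dist_comm, dist_eq]; exact h2 n p hp⟩
  have h2 : ∀ p, ∃ v, Tendsto (fun n => f n p) atTop (nhds v) := fun p => by
    obtain ⟨r, M, _, hr, hp⟩ := h1 |p.1|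
    exact cauchySeq_tendsto_of_complete (cauchySeq_of_le_geometric r M hr (hp p le_rfl))
  choose v hv using h2
  refine ⟨v, hv, fun A => Metric.tendstoUniformlyOn_iff.2 fun ε hε => ?_⟩
  obtain ⟨r, M, hr0, hr, hp⟩ := h1 A
  have h3 : Tendsto (fun n : ℕ => M * r ^ n / (1 - r)) atTop (nhds 0) := by
    simpa using ((tendsto_pow_atTop_nhds_zero_of_lt_one hr0 hr).const_mul M).div_const (1 - r)
  filter_upwards [h3.eventually_lt_const hε] with n hn p hpA
  rw [dist_comm]
  exact (dist_le_of_le_geometric_of_tendsto r M hr (hp p (le_of_lt hpA)) (hv p) n).trans_lt hn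

theorem contDiff_family {ι : Type} {F : ι → Pt → ℝ} (d : Fin 3 → ι → ι)
    (h : ∀ i p, HasFDerivAt (F i) (cov (F (d 0 i) p, F (d 1 i) p, F (d 2 i) p)) p) (i : ι) :
    ContDiff ℝ (⊤ : ℕ∞) (F i) := by
  refine contDiff_infty.2 fun n => ?_
  induction n generalizing i with
  | zero => exact contDiff_zero.2 (continuous_iff_continuousAt.2 fun p => (h i p).continuousAt)
  | succ n ih =>
    rw [Nat.cast_succ, contDiff_succ_iff_fderiv]
    refine ⟨fun p => (h i p).differentiableAt, fun e => absurd e (by simp), ?_⟩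
    rw [show fderiv ℝ (F i) = fun p => cov (F (d 0 i) p, F (d 1 i) p, F (d 2 i) p) from
      funext fun p => (h i p).fderiv]
    exact cov.contDiff.comp ((ih _).prodMk ((ih _).prodMk (ih _)))

theorem SF.hasFDerivAt_cov (f : SF) (p : Pt) :
    HasFDerivAt (f : Pt → ℝ) (cov (dd 0 f p, dd 1 f p, dd 2 f p)) p := by
  refine (f.diff p).hasFDerivAt.congr_fderiv (ContinuousLinearMap.ext fun w => ?_)
  rw [fderiv_eq, cov_apply]
  change _ = T f p * w.1 + X f p * w.2.1 + Y f p * w.2.2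
  ring

theorem exists_limit {f : ℕ → SF}
    (h : ∀ J, Geo fun n => word dd J (f (n + 1) + (-1 : ℝ) • f n)) : ∃ u : SF, ∀ J p,
      Tendsto (fun n => word dd J (f n) p) atTop (nhds (word dd J u p)) := by
  have h1 := fun J => Geo.lim (f := fun n => word dd J (f n)) (by
    convert h J using 3 with n p; simp; ring)
  choose v hv hu using h1
  have hd : ∀ J p, HasFDerivAt (v J) (cov (v (0 :: J) p, v (1 :: J) p, v (2 :: J) p)) p := by
    intro J p
    refine hasFDerivAt_of_tendstoUniformlyOn (l := atTop) (s := {q : Pt | |q.1| < |p.1| + 1})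
      (f := fun n => word dd J (f n)) (f' := fun n q => cov (word dd (0 :: J) (f n) q,
        word dd (1 :: J) (f n) q, word dd (2 :: J) (f n) q))
      (g' := fun p => cov (v (0 :: J) p, v (1 :: J) p, v (2 :: J) p))
      (isOpen_lt (by fun_prop) continuous_const) ?_
      (fun n q _ => (word dd J (f n)).hasFDerivAt_cov q) (fun q _ => hv J q) (lt_add_one |p.1|)
    have hB := ((hu (0 :: J) (|p.1| + 1)).prodMk ((hu (1 :: J) (|p.1| + 1)).prodMk
      (hu (2 :: J) (|p.1| + 1))))
    have := cov.uniformContinuous.comp_tendstoUniformlyOn hB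
    exact fun s hs => (tendsto_id.prodMk (tendsto_id.prodMk tendsto_id)).eventually (this s hs)
  have hs := contDiff_family (fun a J => a :: J) hd
  have hw : ∀ J p, word dd J (SF.mk (v []) (hs [])) p = v J p := by
    intro J
    induction J with
    | nil => exact fun p => rfl
    | cons a J ih =>
      intro p
      have e : word dd J (SF.mk (v []) (hs [])) = SF.mk (v J) (hs J) := SF.ext ih
      rw [word_cons, e]
      have e2 : ∀ w, dir w (SF.mk (v J) (hs J)) p = cov (v (0 :: J) p, v (1 :: J) p, v (2 :: J) p) w :=
        fun w => by rw [dir_apply]; exact congrArg (fun l => l w) (hd J p).fderiv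
      fin_cases a
      exacts [(e2 (1, 0, 0)).trans (by simp), (e2 (0, 1, 0)).trans (by simp),
        (e2 (0, 0, 1)).trans (by simp)]
  exact ⟨SF.mk (v []) (hs []), fun J p => by rw [hw]; exact hv J p⟩

/-- Global solutions of the system with globally bounded nonlinearity. -/
theorem flat_existence {m : Fin 2 → ℝ} {G : Fin 2 → GF Ix} (h0 : ∀ j, G j 0 = 0)
    (hb : ∀ j, (G j).Bdd) {R : ℝ} {q : Fin 2 → SF} (hq : ∀ j, SR R (q j)) :
    ∃ C : ℝ → ℕ → ℝ, ∀ e : ℝ, 0 < e → e ≤ 1 → ∃ u : Fin 2 → SF,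
      (∀ j, box (u j) + (m j) ^ 2 • u j = comp (G j) (UU u)) ∧
      (∀ j z, u j (0, z) = e * q j (0, z) ∧ T (u j) (0, z) = e * T (q j) (0, z)) ∧
      (∀ j, SR R (u j)) ∧
      ∀ A k j J p, |p.1| ≤ A → J.length ≤ k → |word dd J (u j) p| ≤ C A k * e := by
  choose C hC0 hC using fun A k => it_word_bound (m := m) h0 hb hq A k k
  refine ⟨C, fun e he he1 => ?_⟩
  have hqe : ∀ j, SR R (e • q j : SF) := fun j => (hq j).of_zero fun p h => by simp [h]
  choose u hu using fun j => exists_limit (f := fun n => it m G (fun j => e • q j) n j) fun J =>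
    Geo.inc_word (m := m) h0 hb hqe J j
  have hU : ∀ c p, Tendsto (fun n => UU (it m G (fun j => e • q j) n) c p) atTop
      (nhds (UU u c p)) := fun c p => by
    obtain ⟨j, _ | a⟩ := c
    exacts [hu j [] p, hu j [a] p]
  refine ⟨u, fun j => SF.ext fun p => ?_, fun j z => ?_, fun j p a b h hp => ?_, fun A k j J p hp hJ => ?_⟩
  · have t1 : Tendsto (fun n => box (it m G (fun j => e • q j) (n + 1) j) p) atTop
        (nhds (box (u j) p)) :=
      (((hu j [0, 0] p).sub (hu j [1, 1] p)).sub (hu j [2, 2] p)).comp (tendsto_add_atTop_nat 1)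
    have t2 : Tendsto (fun n => box (it m G (fun j => e • q j) (n + 1) j) p) atTop
        (nhds (comp (G j) (UU u) p - m j ^ 2 * u j p)) := by
      simp only [box_it, src, SF.sub_apply, SF.smul_apply, comp_apply]
      exact (((G j).smooth.continuous.tendsto _).comp (tendsto_pi_nhds.2 fun c => hU c p)).sub
        ((hu j [] p).const_mul _)
    simp [tendsto_nhds_unique t1 t2]
  · have d := fun c n => it_data (m := m) (G := G) (fun j => e • q j) n c [] z
    constructor
    · refine tendsto_nhds_unique (hu j [] (0, z)) ?_
      exact tendsto_const_nhds.congr fun n => (d (j, none) n).symm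
    · refine tendsto_nhds_unique (hu j [0] (0, z)) ?_
      have : e * T (q j) (0, z) = T (e • q j) (0, z) := by simp
      rw [this]
      exact tendsto_const_nhds.congr fun n => (d (j, some 0) n).symm
  · exact tendsto_nhds_unique (hu j [] p) (tendsto_const_nhds.congr fun n =>
      (SR.it (m := m) h0 hqe n j p a b h hp).symm)
  · exact le_of_tendsto (hu j J p).abs (Eventually.of_forall fun n =>
      hC A k e he he1 n j p J hp hJ (List.count_le_length.trans (hJ.trans (Nat.le_succ k))))

theorem contDiff_Dd {v : Pt → ℝ} (hv : ContDiff ℝ 2 v) (w : Pt) : ContDiff ℝ 1 (Dd w v) :=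
  (hv.fderiv_right (m := 1) (by norm_num)).clm_apply contDiff_const

theorem Dd_comm {v : Pt → ℝ} (hv : ContDiff ℝ 2 v) (a b p : Pt) :
    Dd a (Dd b v) p = Dd b (Dd a v) p := by
  have h2 : ∀ a b : Pt, Dd a (Dd b v) p = fderiv ℝ (fderiv ℝ v) p a b := fun a b => by
    have hd : DifferentiableAt ℝ (fderiv ℝ v) p :=
      ((hv.fderiv_right (m := 1) (by norm_num)).differentiable (by simp)) p
    have : Dd b v = fun q => fderiv ℝ v q b := rfl
    rw [Dd, this, fderiv_clm_apply hd (by fun_prop)]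
    simp
  rw [h2, h2]
  exact hv.contDiffAt.isSymmSndFDerivAt (by simp) _ _

/-- Weight supported in a backward truncated cone. -/
def wt (A : ℝ) : SF := .mk (fun p => expNegInvGlue (A - p.1 - √(1 + p.2.1 ^ 2 + p.2.2 ^ 2))) <| by
  refine expNegInvGlue.contDiff.comp ((contDiff_const.sub contDiff_fst).sub
    (ContDiff.sqrt (by fun_prop) fun p => by positivity))

theorem wt_nonneg (A : ℝ) (p : Pt) : 0 ≤ wt A p := expNegInvGlue.nonneg _

theorem SC_wt (A : ℝ) : SC (wt A) := fun B => by
  refine ⟨A + B, fun p hp h => expNegInvGlue.zero_of_nonpos ?_⟩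
  have h2 : |p.2.1| ≤ √(1 + p.2.1 ^ 2 + p.2.2 ^ 2) :=
    abs_le_sqrt (by nlinarith)
  have h3 : |p.2.2| ≤ √(1 + p.2.1 ^ 2 + p.2.2 ^ 2) :=
    abs_le_sqrt (by nlinarith)
  grind

theorem wt_deriv (A : ℝ) (p : Pt) : ∃ k a b : ℝ, 0 ≤ k ∧ a ^ 2 + b ^ 2 ≤ 1 ∧
    T (wt A) p = -k ∧ X (wt A) p = -(k * a) ∧ Y (wt A) p = -(k * b) := by
  obtain ⟨t, x, y⟩ := p
  have hp : 0 < 1 + x ^ 2 + y ^ 2 := by positivity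
  have hh := sq_sqrt hp.le
  have hd : ∀ {φ : ℝ → ℝ} {φ' s : ℝ}, HasDerivAt φ φ' s → HasDerivAt (fun s => expNegInvGlue (φ s))
      (deriv expNegInvGlue (φ s) * φ') s := fun {φ φ' s} h =>
    ((expNegInvGlue.contDiff (n := 1)).differentiable (by simp) (φ s)).hasDerivAt.comp s h
  refine ⟨deriv expNegInvGlue (A - t - √(1 + x ^ 2 + y ^ 2)), x / √(1 + x ^ 2 + y ^ 2),
    y / √(1 + x ^ 2 + y ^ 2), expNegInvGlue.monotone.deriv_nonneg, ?_, ?_, ?_, ?_⟩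
  · rw [div_pow, div_pow, ← add_div, div_le_one (by positivity)]; linarith
  · refine (hasDerivAt_t (wt A) t x y).unique (HasDerivAt.congr_deriv
      (hd (((hasDerivAt_id' t).const_sub A).sub_const √(1 + x ^ 2 + y ^ 2))) ?_)
    ring
  · refine (hasDerivAt_x (wt A) t x y).unique (HasDerivAt.congr_deriv (hd
      (((((hasDerivAt_pow 2 x).const_add 1).add_const (y ^ 2)).sqrt hp.ne').const_sub (A - t))) ?_)
    grind
  · refine (hasDerivAt_y (wt A) t x y).unique (HasDerivAt.congr_deriv (hd
      ((((hasDerivAt_pow 2 y).const_add (1 + x ^ 2)).sqrt hp.ne').const_sub (A - t))) ?_)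
    grind

/-- Value and first derivatives. -/
def Vo (v : Pt → ℝ) (o : Option (Fin 3)) : Pt → ℝ :=
  o.elim v fun a => Dd ((![(1, 0, 0), (0, 1, 0), (0, 0, 1)] : Fin 3 → Pt) a) v

/-- D'Alembertian. -/
def Bx (v : Pt → ℝ) (p : Pt) : ℝ := Dd (1, 0, 0) (Dd (1, 0, 0) v) p
  - Dd (0, 1, 0) (Dd (0, 1, 0) v) p - Dd (0, 0, 1) (Dd (0, 0, 1) v) p

theorem slice_energy (A : ℝ) {v : Pt → ℝ} (hv : ContDiff ℝ 2 v) : ∃ e : ℝ → ℝ,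
    (∀ s, HasDerivAt (II fun p => wt A p * ∑ o, Vo v o p ^ 2) (e s) s) ∧
    ∀ s, e s ≤ II (fun p => wt A p * (2 * Dd (1, 0, 0) v p * (Bx v p + v p))) s := by
  have C1 := contDiff_Dd hv
  have c2 : ∀ w w', Continuous (Dd w (Dd w' v)) := fun w w' =>
    ((C1 w').continuous_fderiv (by simp)).clm_apply continuous_const
  have d0 : Differentiable ℝ v := hv.differentiable (by simp)
  have d1 : ∀ w, Differentiable ℝ (Dd w v) := by fun_prop
  have w0 := SC_wt A
  have wT := w0.T
  have es : ∀ p, ∑ o, Vo v o p ^ 2 = v p ^ 2 + (Dd (1, 0, 0) v p ^ 2 + Dd (0, 1, 0) v p ^ 2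
      + Dd (0, 0, 1) v p ^ 2) := fun p => by
    rw [Fintype.sum_option, Fin.sum_univ_three]; rfl
  simp only [es]
  set g' : Pt → ℝ := fun p => T (wt A) p * (v p ^ 2 + (Dd (1, 0, 0) v p ^ 2 + Dd (0, 1, 0) v p ^ 2
      + Dd (0, 0, 1) v p ^ 2)) + wt A p * (2 * (v p * Dd (1, 0, 0) v p
      + Dd (1, 0, 0) v p * Dd (1, 0, 0) (Dd (1, 0, 0) v) p
      + Dd (0, 1, 0) v p * Dd (1, 0, 0) (Dd (0, 1, 0) v) p
      + Dd (0, 0, 1) v p * Dd (1, 0, 0) (Dd (0, 0, 1) v) p)) with hg'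
  set q : Pt → Pt → ℝ := fun w p => dir w (wt A) p * (2 * (Dd (1, 0, 0) v p * Dd w v p))
    + wt A p * (2 * (Dd w (Dd (1, 0, 0) v) p * Dd w v p
      + Dd (1, 0, 0) v p * Dd w (Dd w v) p)) with hq
  have sg : SC g' := (wT.mul_right _).add (w0.mul_right _)
  have cg : Continuous g' := by fun_prop
  have sq : ∀ w, SC (q w) := fun w => ((w0.dir w).mul_right _).add (w0.mul_right _)
  have cq : ∀ w, Continuous (q w) := by fun_prop
  have i1 : ∀ s, II (q (0, 1, 0)) s = 0 :=
    II_Dx (g := fun p => wt A p * (2 * (Dd (1, 0, 0) v p * Dd (0, 1, 0) v p))) (w0.mul_right _)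
      (by fun_prop) (sq _) (cq _) fun s x y => ((hasDerivAt_x _ s x y).mul
        (((hasDerivAt_Dd_x s x y (d1 _ _)).mul (hasDerivAt_Dd_x s x y (d1 _ _))).const_mul 2))
  have i2 : ∀ s, II (q (0, 0, 1)) s = 0 :=
    II_Dy (g := fun p => wt A p * (2 * (Dd (1, 0, 0) v p * Dd (0, 0, 1) v p))) (w0.mul_right _)
      (by fun_prop) (sq _) (cq _) fun s x y => ((hasDerivAt_y _ s x y).mul
        (((hasDerivAt_Dd_y s x y (d1 _ _)).mul (hasDerivAt_Dd_y s x y (d1 _ _))).const_mul 2))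
  refine ⟨II g', hasDerivAt_II_of (w0.mul_right _) (by fun_prop) sg cg fun s z => ?_, fun s => ?_⟩
  · refine HasDerivAt.congr_deriv ((hasDerivAt_t (wt A) s z.1 z.2).mul
      (((hasDerivAt_Dd_t s z (d0 _)).pow 2).add ((((hasDerivAt_Dd_t s z (d1 _ _)).pow 2).add
        ((hasDerivAt_Dd_t s z (d1 _ _)).pow 2)).add ((hasDerivAt_Dd_t s z (d1 _ _)).pow 2)))) ?_
    grind
  · have h1 : II (fun p => wt A p * (2 * Dd (1, 0, 0) v p * (Bx v p + v p))
        + (q (0, 1, 0) p + q (0, 0, 1) p)) s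
        = II (fun p => wt A p * (2 * Dd (1, 0, 0) v p * (Bx v p + v p))) s := by
      have cB : Continuous (Bx v) := ((c2 _ _).sub (c2 _ _)).sub (c2 _ _)
      rw [II_add (w0.mul_right _) (by fun_prop) ((sq _).add (sq _)) (by fun_prop),
        II_add (sq _) (cq _) (sq _) (cq _), i1, i2]; ring
    have cB : Continuous (Bx v) := ((c2 _ _).sub (c2 _ _)).sub (c2 _ _)
    rw [← h1]
    refine II_mono sg cg ((w0.mul_right _).add ((sq _).add (sq _))) (by fun_prop) fun z => ?_
    obtain ⟨k, a, b, hk, hab, e1, e2, e3⟩ := wt_deriv A (s, z)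
    have e2' : dir (0, 1, 0) (wt A) (s, z) = -(k * a) := e2
    have e3' : dir (0, 0, 1) (wt A) (s, z) = -(k * b) := e3
    simp only [hg', hq, Bx, e1, e2', e3', Dd_comm hv (0, 1, 0) (1, 0, 0),
      Dd_comm hv (0, 0, 1) (1, 0, 0)]
    generalize Dd (1, 0, 0) v (s, z) = A'
    generalize Dd (0, 1, 0) v (s, z) = B'
    generalize Dd (0, 0, 1) v (s, z) = C'
    have h2 : (a * B' + b * C') ^ 2 ≤ B' ^ 2 + C' ^ 2 := by
      nlinarith [sq_nonneg (a * C' - b * B'), mul_nonneg (sub_nonneg.2 hab) (add_nonneg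
        (sq_nonneg B') (sq_nonneg C'))]
    have h3 : 0 ≤ k * (v (s, z) ^ 2 + (A' - (a * B' + b * C')) ^ 2 + (B' ^ 2 + C' ^ 2
      - (a * B' + b * C') ^ 2)) := mul_nonneg hk (add_nonneg (by positivity)
        (sub_nonneg.2 h2))
    linarith

theorem Vo_sub {u v : Pt → ℝ} (hu : Differentiable ℝ u) (hv : Differentiable ℝ v) (o p) :
    Vo (fun p => u p - v p) o p = Vo u o p - Vo v o p := by
  rcases o with _ | a
  · rfl
  · change fderiv ℝ (fun p => u p - v p) p _ = _
    rw [fderiv_fun_sub (hu p) (hv p)]; rfl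

theorem continuous_Vo {v : Pt → ℝ} (hv : ContDiff ℝ 2 v) (o) : Continuous (Vo v o) := by
  rcases o with _ | a
  exacts [hv.continuous, (contDiff_Dd hv _).continuous]

theorem eq_of_eq_zero {m : Fin 2 → ℝ} (G : Fin 2 → GF Ix) {u v : Fin 2 → Pt → ℝ}
    (hu : ∀ j, ContDiff ℝ 2 (u j)) (hv : ∀ j, ContDiff ℝ 2 (v j))
    (eu : ∀ j p, Bx (u j) p + m j ^ 2 * u j p = G j fun c => Vo (u c.1) c.2 p)
    (ev : ∀ j p, Bx (v j) p + m j ^ 2 * v j p = G j fun c => Vo (v c.1) c.2 p)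
    (h0 : ∀ j z, u j (0, z) = v j (0, z) ∧
      Dd (1, 0, 0) (u j) (0, z) = Dd (1, 0, 0) (v j) (0, z)) (j₀ : Fin 2) (p₀ : Pt)
    (hp₀ : 0 ≤ p₀.1) : u j₀ p₀ = v j₀ p₀ := by
  set w : Fin 2 → Pt → ℝ := fun j p => u j p - v j p with hw
  have dU := fun j => (hu j).differentiable (by simp)
  have dV := fun j => (hv j).differentiable (by simp)
  have hws : ∀ j, ContDiff ℝ 2 (w j) := by fun_prop
  have dW := fun j => (hws j).differentiable (by simp)
  have cw := fun j o => continuous_Vo (hws j) o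
  have eV : ∀ j o p, Vo (w j) o p = Vo (u j) o p - Vo (v j) o p := fun j o p =>
    Vo_sub (dU j) (dV j) o p
  have eD : ∀ j a, Dd a (w j) = fun p => Dd a (u j) p - Dd a (v j) p := fun j a => by
    funext p
    change fderiv ℝ (fun p => u j p - v j p) p _ = _
    rw [fderiv_fun_sub (dU j p) (dV j p)]; rfl
  have eB : ∀ j p, Bx (w j) p = Bx (u j) p - Bx (v j) p := fun j p => by
    have : ∀ a b, Dd b (Dd a (w j)) p = Dd b (Dd a (u j)) p - Dd b (Dd a (v j)) p := fun a b => by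
      rw [eD]
      change fderiv ℝ (fun p => _ - _) p _ = _
      rw [fderiv_fun_sub ((contDiff_Dd (hu j) a).differentiable (by simp) p)
        ((contDiff_Dd (hv j) a).differentiable (by simp) p)]; rfl
    simp only [Bx, this]; ring
  set A := p₀.1 + √(1 + p₀.2.1 ^ 2 + p₀.2.2 ^ 2) + 1 with hA
  obtain ⟨R, hR⟩ := SC_wt A p₀.1
  have hK : IsCompact (Icc (-p₀.1) p₀.1 ×ˢ (Icc (-R) R ×ˢ Icc (-R) R) : Set Pt) :=
    isCompact_Icc.prod (isCompact_Icc.prod isCompact_Icc)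
  set N : Pt → ℝ := fun p => ∑ j, ∑ o, Vo (w j) o p ^ 2 with hN
  have hNle : ∀ p j o, |Vo (w j) o p| ≤ √(N p) := fun p j o => abs_le_sqrt <|
    (single_le_sum (f := fun o => Vo (w j) o p ^ 2) (fun _ _ => sq_nonneg _)
      (Finset.mem_univ o)).trans (single_le_sum (f := fun j => ∑ o, Vo (w j) o p ^ 2)
      (fun _ _ => sum_nonneg fun _ _ => sq_nonneg _) (Finset.mem_univ j))
  have hN0 : ∀ p, 0 ≤ N p := fun p =>
    sum_nonneg fun _ _ => sum_nonneg fun _ _ => sq_nonneg _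
  obtain ⟨r1, hr1⟩ := hK.exists_bound_of_continuousOn (f := fun p (c : Ix) => Vo (u c.1) c.2 p)
    (continuous_pi fun c : Ix => continuous_Vo (hu c.1) c.2).continuousOn
  obtain ⟨r2, hr2⟩ := hK.exists_bound_of_continuousOn (f := fun p (c : Ix) => Vo (v c.1) c.2 p)
    (continuous_pi fun c : Ix => continuous_Vo (hv c.1) c.2).continuousOn
  have hB : ∃ B, ∀ y ∈ Metric.closedBall (0 : Ix → ℝ) (max r1 r2),
      ‖(fun (i : Fin 2 × Ix) => (G i.1).pd i.2 y)‖ ≤ B :=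
    (isCompact_closedBall _ _).exists_bound_of_continuousOn
      (continuous_pi fun i : Fin 2 × Ix => ((G i.1).pd i.2).smooth.continuous).continuousOn
  obtain ⟨B, hB⟩ := hB
  set L : ℝ := Fintype.card Ix * |B| + ∑ j, m j ^ 2 + 1 with hL
  have key : ∀ s z j, |s| ≤ p₀.1 →
      wt A (s, z) * (2 * Dd (1, 0, 0) (w j) (s, z) * (Bx (w j) (s, z) + w j (s, z)))
        ≤ 2 * L * (wt A (s, z) * N (s, z)) := by
    intro s z j hs
    by_cases hz : (s, z) ∈ (Icc (-p₀.1) p₀.1 ×ˢ (Icc (-R) R ×ˢ Icc (-R) R) : Set Pt)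
    swap
    · rw [hR (s, z) hs (by
        by_contra! h
        exact hz ⟨abs_le.1 hs, abs_le.1 h.1, abs_le.1 h.2⟩)]
      simp
    have h1 : |Bx (w j) (s, z) + m j ^ 2 * w j (s, z)| ≤ Fintype.card Ix * |B| * √(N (s, z)) := by
      have e : Bx (w j) (s, z) + m j ^ 2 * w j (s, z)
          = (Bx (u j) (s, z) + m j ^ 2 * u j (s, z))
            - (Bx (v j) (s, z) + m j ^ 2 * v j (s, z)) := by rw [eB]; simp only [hw]; ring
      rw [e, eu, ev]
      refine (GF.abs_sub_le (G j) (r := max r1 r2) (B := |B|) (fun y hy c => ?_)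
        ((hr1 _ hz).trans (le_max_left _ _)) ((hr2 _ hz).trans (le_max_right _ _))).trans
        (mul_le_mul_of_nonneg_left ?_ (by positivity))
      · exact ((norm_le_pi_norm (fun i : Fin 2 × Ix => (G i.1).pd i.2 y) (j, c)).trans
          (hB y (by simpa using hy))).trans (le_abs_self B)
      · refine (pi_norm_le_iff_of_nonneg (sqrt_nonneg _)).2 fun c => ?_
        rw [Pi.sub_apply, ← eV]; exact hNle _ _ _
    have h2 : |Bx (w j) (s, z) + w j (s, z)| ≤ L * √(N (s, z)) := by
      have e : Bx (w j) (s, z) + w j (s, z) = (Bx (w j) (s, z) + m j ^ 2 * w j (s, z))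
        + w j (s, z) - m j ^ 2 * w j (s, z) := by ring
      have h3 : |w j (s, z)| ≤ √(N (s, z)) := hNle _ j none
      have h4 : |m j ^ 2 * w j (s, z)| ≤ (∑ j, m j ^ 2) * √(N (s, z)) := by
        rw [abs_mul, abs_of_nonneg (sq_nonneg (m j))]
        exact mul_le_mul (single_le_sum (f := fun j => m j ^ 2)
          (fun _ _ => sq_nonneg _) (Finset.mem_univ j)) h3 (abs_nonneg _)
          (sum_nonneg fun _ _ => sq_nonneg _)
      rw [e, hL, add_mul, add_mul, one_mul]
      linarith [abs_sub (Bx (w j) (s, z) + m j ^ 2 * w j (s, z) + w j (s, z))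
        (m j ^ 2 * w j (s, z)), abs_add_le (Bx (w j) (s, z) + m j ^ 2 * w j (s, z)) (w j (s, z))]
    have h5 : Dd (1, 0, 0) (w j) (s, z) * (Bx (w j) (s, z) + w j (s, z))
        ≤ √(N (s, z)) * (L * √(N (s, z))) :=
      (le_abs_self _).trans ((abs_mul _ _).le.trans (mul_le_mul (hNle _ j (some 0)) h2
        (abs_nonneg _) (sqrt_nonneg _)))
    rw [mul_left_comm, mul_self_sqrt (hN0 _)] at h5
    linarith [mul_le_mul_of_nonneg_left h5 (wt_nonneg A (s, z))]
  choose e he1 he2 using fun j => slice_energy A (hws j)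
  have sN : ∀ g : Pt → ℝ, SC fun p => wt A p * g p := fun g => (SC_wt A).mul_right g
  have cB : ∀ j, Continuous (Bx (w j)) := fun j => by
    have c2 : ∀ a b, Continuous (Dd b (Dd a (w j))) := fun a b =>
      ((contDiff_Dd (hws j) a).continuous_fderiv (by simp)).clm_apply continuous_const
    exact ((c2 _ _).sub (c2 _ _)).sub (c2 _ _)
  have hE : ∀ s, II (fun p => wt A p * N p) s
      = ∑ j, II (fun p => wt A p * ∑ o, Vo (w j) o p ^ 2) s := fun s => by
    simp only [hN, Fin.sum_univ_two, mul_add]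
    exact II_add (sN _) (by fun_prop) (sN _) (by fun_prop)
  have hdE : ∀ s, HasDerivAt (II fun p => wt A p * N p) (∑ j, e j s) s := fun s => by
    rw [show (II fun p => wt A p * N p) = _ from funext hE]
    exact HasDerivAt.fun_sum fun j _ => he1 j s
  have hle : ∀ s, |s| ≤ p₀.1 → ∑ j, e j s ≤ 4 * L * II (fun p => wt A p * N p) s := fun s hs => by
    have h : ∀ j, e j s ≤ 2 * L * II (fun p => wt A p * N p) s := fun j => by
      refine (he2 j s).trans ?_
      rw [← II_const_mul]
      have := (contDiff_Dd (hws j) (1, 0, 0)).continuous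
      exact II_mono (sN _) (by fun_prop) ((sN _).mul_left _) (by fun_prop) fun z => key s z j hs
    rw [Fin.sum_univ_two]; linarith [h 0, h 1]
  have hd : ∀ s, HasDerivAt (fun s => II (fun p => wt A p * N p) s * exp (-(4 * L) * s)) _ s :=
    fun s => (hdE s).mul (((hasDerivAt_id s).const_mul (-(4 * L))).exp)
  have hanti := antitoneOn_of_deriv_nonpos (convex_Icc 0 p₀.1)
    (fun s _ => (hd s).continuousAt.continuousWithinAt)
    (fun s _ => (hd s).differentiableAt.differentiableWithinAt) fun s hs => by
      rw [interior_Icc] at hs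
      rw [(hd s).deriv]
      have := hle s (by rw [abs_of_pos hs.1]; exact hs.2.le)
      have h2 := mul_nonneg (sub_nonneg.2 this) (exp_pos (-(4 * L) * s)).le
      simp only [id]; linarith
  have h1 := hanti (left_mem_Icc.2 hp₀) (right_mem_Icc.2 hp₀) hp₀
  have h00 : II (fun p => wt A p * N p) 0 = 0 := by
    have hz : ∀ j x y, w j (0, x, y) = 0 := fun j x y => sub_eq_zero.2 (h0 j (x, y)).1
    have : ∀ z, wt A (0, z) * N (0, z) = 0 := fun z => by
      refine mul_eq_zero_of_right _ (sum_eq_zero fun j _ => sum_eq_zero fun o _ => ?_)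
      rw [sq_eq_zero_iff]
      rcases o with _ | a
      · exact hz j z.1 z.2
      fin_cases a
      · exact (congrFun (eD j _) _).trans (sub_eq_zero.2 (h0 j z).2)
      · exact (hasDerivAt_Dd_x 0 z.1 z.2 (dW j _)).unique
          (by simp only [hz]; exact hasDerivAt_const _ _)
      · exact (hasDerivAt_Dd_y 0 z.1 z.2 (dW j _)).unique
          (by simp only [hz]; exact hasDerivAt_const _ _)
    simp [II, this]
  simp only [h00, zero_mul] at h1
  by_contra hne
  have hc : Continuous fun p => wt A p * N p := by fun_prop
  have h2 : 0 < ∫ z : ℝ × ℝ, wt A (p₀.1, z) * N (p₀.1, z) :=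
    Continuous.integral_pos_of_hasCompactSupport_nonneg_nonzero (x := p₀.2)
      (hc.comp (f := fun z : ℝ × ℝ => (p₀.1, z)) (by fun_prop)) ((sN N).hcs p₀.1)
      (fun z => mul_nonneg (wt_nonneg _ _) (hN0 _))
      (mul_ne_zero (expNegInvGlue.pos_of_pos (by rw [hA]; ring_nf; norm_num)).ne' fun h => hne <| by
        have := hNle p₀ j₀ none
        rw [show N p₀ = 0 from h, sqrt_zero] at this
        exact sub_eq_zero.1 (abs_eq_zero.1 (this.antisymm (abs_nonneg _))))
  exact absurd h1 (not_le.2 (mul_pos h2 (exp_pos _)))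

/-- Time reversal. -/
def rev : Pt →L[ℝ] Pt := (-ContinuousLinearMap.fst ℝ ℝ (ℝ × ℝ)).prod (.snd ℝ ℝ (ℝ × ℝ))

theorem rev_apply (p : Pt) : rev p = (-p.1, p.2) := rfl
theorem rev_rev (p : Pt) : rev (rev p) = p := by simp [rev_apply]

/-- Parity of a jet component under time reversal. -/
def sgn (o : Option (Fin 3)) : ℝ := if o = some 0 then -1 else 1

theorem abs_sgn (o) : |sgn o| = 1 := by unfold sgn; split_ifs <;> simp

/-- The nonlinearity seen after time reversal. -/
def GF.flip (G : GF Ix) : GF Ix :=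
  ⟨fun x => G fun c => sgn c.2 * x c, G.smooth.comp (by fun_prop)⟩

theorem GF.flip_apply (G : GF Ix) (x) : G.flip x = G fun c => sgn c.2 * x c := rfl

theorem Dd_rev {v : Pt → ℝ} (hv : Differentiable ℝ v) (w p : Pt) :
    Dd w (fun q => v (rev q)) p = Dd (rev w) v (rev p) := by
  have := ((hv (rev p)).hasFDerivAt.comp p rev.hasFDerivAt).fderiv
  exact DFunLike.congr_fun this w

theorem Dd_neg_left (v : Pt → ℝ) (w : Pt) : Dd (-w) v = fun p => -Dd w v p := by
  ext p; simp [Dd]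

theorem rev_e0 : rev (1, 0, 0) = -(1, 0, 0) := by simp [rev_apply]

theorem Vo_rev {v : Pt → ℝ} (hv : Differentiable ℝ v) (o p) :
    Vo (fun q => v (rev q)) o p = sgn o * Vo v o (rev p) := by
  rcases o with _ | a
  · simp [Vo, sgn]
  · refine (Dd_rev hv _ p).trans ?_
    fin_cases a
    · change Dd (rev (1, 0, 0)) v _ = _
      rw [rev_e0, Dd_neg_left]; simp [Vo, sgn]
    all_goals simp [Vo, sgn, rev_apply]

theorem Bx_rev {v : Pt → ℝ} (hv : ContDiff ℝ 2 v) (p) :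
    Bx (fun q => v (rev q)) p = Bx v (rev p) := by
  have h : ∀ w, Dd w (Dd w fun q => v (rev q)) p = Dd (rev w) (Dd (rev w) v) (rev p) := fun w => by
    rw [← Dd_rev ((contDiff_Dd hv _).differentiable (by simp))]
    congr 1
    exact funext (Dd_rev (hv.differentiable (by simp)) w)
  have e1 : Dd (-(1, 0, 0)) (Dd (-(1, 0, 0)) v) (rev p) = Dd (1, 0, 0) (Dd (1, 0, 0) v) (rev p) := by
    simp only [Dd_neg_left]; simp [Dd.eq_1 _ (fun _ => _)]
  rw [Bx, h, h, h, rev_e0, e1]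
  simp [rev_apply, Bx]

/-- `C²` solutions of the system. -/
structure Sys (m : Fin 2 → ℝ) (G : Fin 2 → GF Ix) (u : Fin 2 → Pt → ℝ) : Prop where
  reg : ∀ j, ContDiff ℝ 2 (u j)
  eqn : ∀ j p, Bx (u j) p + m j ^ 2 * u j p = G j fun c => Vo (u c.1) c.2 p

theorem Sys.rev {m G u} (h : Sys m G u) : Sys m (fun j => (G j).flip) fun j p => u j (rev p) where
  reg j := (h.reg j).comp KG.rev.contDiff
  eqn j p := by
    simp only [GF.flip_apply, Bx_rev (h.reg j), h.eqn, Vo_rev ((h.reg _).differentiable (by simp)),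
      ← mul_assoc]
    refine congrArg (G j).fn (funext fun c => ?_)
    rw [← abs_mul_abs_self, abs_sgn]; ring

theorem Sys.unique {m G u v} (hu : Sys m G u) (hv : Sys m G v)
    (h0 : ∀ j z, u j (0, z) = v j (0, z) ∧ Dd (1, 0, 0) (u j) (0, z) = Dd (1, 0, 0) (v j) (0, z)) :
    u = v := by
  ext j p
  rcases le_total 0 p.1 with hp | hp
  · exact eq_of_eq_zero G hu.reg hv.reg hu.eqn hv.eqn h0 j p hp
  · have := eq_of_eq_zero _ hu.rev.reg hv.rev.reg hu.rev.eqn hv.rev.eqn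
      (fun j z => by
        rw [Dd_rev ((hu.reg _).differentiable (by simp)), Dd_rev ((hv.reg _).differentiable (by simp)),
          rev_e0, Dd_neg_left, Dd_neg_left]
        simp [rev_apply, h0]) j
      (KG.rev p) (by simpa [rev_apply] using hp)
    simpa only [rev_rev] using this

section
variable {ι : Type} [Fintype ι] [DecidableEq ι]

theorem GF.bdd_of_hasCompactSupport {G : GF ι} (h : HasCompactSupport G.fn) : G.Bdd := by
  intro cs
  have : HasCompactSupport (G.pdw cs).fn := by
    induction cs with
    | nil => exact h
    | cons c cs ih => exact ih.fderiv_apply (𝕜 := ℝ) _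
  exact this.exists_bound_of_continuous (G.pdw cs).smooth.continuous

/-- Smooth truncation. -/
def GF.trunc (G : GF ι) : GF ι :=
  ⟨fun x => smoothTransition (2 - ∑ c, x c ^ 2) * G x,
    (smoothTransition.contDiff.comp (by fun_prop)).mul G.smooth⟩

theorem GF.trunc_eq (G : GF ι) {x : ι → ℝ} (h : ∑ c, x c ^ 2 ≤ 1) : G.trunc x = G x := by
  change smoothTransition _ * _ = _
  rw [smoothTransition.one_of_one_le (by linarith), one_mul]

theorem GF.trunc_bdd (G : GF ι) : G.trunc.Bdd := by
  refine bdd_of_hasCompactSupport (.intro (isCompact_closedBall 0 2) fun x hx => ?_)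
  change smoothTransition _ * _ = 0
  rw [smoothTransition.zero_of_nonpos, zero_mul]
  by_contra! h
  refine hx (mem_closedBall_zero_iff.2 <| (pi_norm_le_iff_of_nonneg zero_le_two).2 fun c => ?_)
  have : x c ^ 2 ≤ ∑ c, x c ^ 2 :=
    single_le_sum (f := fun c => x c ^ 2) (fun c _ => sq_nonneg _) (Finset.mem_univ c)
  exact abs_le_of_sq_le_sq (by linarith) zero_le_two

theorem GF.trunc_eventuallyEq (G : GF ι) : G.trunc.fn =ᶠ[nhds 0] G.fn := by
  have : Continuous fun x : ι → ℝ => ∑ c, x c ^ 2 := by fun_prop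
  filter_upwards [this.continuousAt.eventually_lt continuousAt_const (by simp : _ < (1 : ℝ))]
    with x hx using G.trunc_eq hx.le

theorem GF.taylor (G : GF ι) (h0 : G 0 = 0) (h1 : fderiv ℝ G.fn 0 = 0) :
    ∃ b : ι → ι → ℝ, ∃ C, 0 ≤ C ∧ ∀ x, ‖x‖ ≤ 1 →
      |G x - ∑ c, ∑ d, b c d * x c * x d| ≤ C * ‖x‖ ^ 3 := by
  have hs : ContDiff ℝ 3 G.fn := G.smooth.of_le (WithTop.coe_le_coe.2 (le_top : (3 : ℕ∞) ≤ ⊤))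
  obtain ⟨C, hC⟩ := (isCompact_closedBall (0 : ι → ℝ) 1).exists_bound_of_continuousOn
    (hs.continuous_iteratedFDeriv (m := 3) le_rfl).continuousOn
  refine ⟨fun c d => 2⁻¹ * fderiv ℝ (fderiv ℝ G.fn) 0 (Pi.single c 1) (Pi.single d 1), |C|,
    abs_nonneg _, fun x hx => ?_⟩
  have ht := map_add_eq_sum_add_integral_iteratedFDeriv (n := 2) (f := G.fn) (x := 0) (y := x)
    fun t _ => by fun_prop
  have e2 : fderiv ℝ (fderiv ℝ G.fn) 0 x x =
      ∑ c, ∑ d, x c * x d * fderiv ℝ (fderiv ℝ G.fn) 0 (Pi.single c 1) (Pi.single d 1) := by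
    conv_lhs => rw [pi_eq_sum_univ' x]
    simp only [map_sum, map_smul, ContinuousLinearMap.sum_apply, ContinuousLinearMap.smul_apply,
      smul_eq_mul, mul_sum, mul_assoc]
    rw [sum_comm]
    grind
  set I := ∫ t in (0:ℝ)..1, (1 - t) ^ 2 • iteratedFDeriv ℝ (2 + 1) G.fn (0 + t • x) fun _ => x
  have hI : ‖I‖ ≤ |C| * ‖x‖ ^ 3 * |1 - 0| := by
    refine intervalIntegral.norm_integral_le_of_norm_le_const fun t ht => ?_
    rw [uIoc_of_le zero_le_one] at ht
    have hb : t • x ∈ Metric.closedBall (0 : ι → ℝ) 1 := by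
      rw [mem_closedBall_zero_iff, norm_smul, norm_of_nonneg ht.1.le]
      exact mul_le_one₀ ht.2 (norm_nonneg _) hx
    have h3 := (iteratedFDeriv ℝ (2 + 1) G.fn (t • x)).le_opNorm fun _ => x
    rw [norm_smul, zero_add, norm_of_nonneg (sq_nonneg (1 - t))]
    refine (mul_le_of_le_one_left (norm_nonneg _) (pow_le_one₀ (by grind) (by linarith [ht.1]))).trans
      (h3.trans ?_)
    simp
    gcongr
    grind
  simp only [Finset.sum_range_succ, Finset.sum_range_zero, iteratedFDeriv_zero_apply,
    iteratedFDeriv_one_apply, iteratedFDeriv_two_apply, h0, h1, e2, zero_add] at ht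
  have e3 : ∑ c, ∑ d, (fun c d => 2⁻¹ * fderiv ℝ (fderiv ℝ G.fn) 0 (Pi.single c 1) (Pi.single d 1))
      c d * x c * x d = 2⁻¹ * fderiv ℝ (fderiv ℝ G.fn) 0 x x := by
    simp only [e2, mul_sum]
    exact sum_congr rfl fun c _ => sum_congr rfl fun d _ => by ring
  rw [ht, e3, e2]
  norm_num at hI ⊢
  grind
end

theorem eq_qf_of_tendsto {G : (Ix → ℝ) → ℝ} {b C} (h : ∀ x, ‖x‖ ≤ 1 → |G x - qf b x| ≤ C * ‖x‖ ^ 3)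
    {x q} (hq : Tendsto (fun l : ℝ => l⁻¹ ^ 2 * G (l • x)) (nhdsWithin 0 (Ioi 0)) (nhds q)) :
    q = qf b x := by
  refine tendsto_nhds_unique hq (tendsto_iff_norm_sub_tendsto_zero.2 ?_)
  have hl : Tendsto (fun l : ℝ => l * (C * ‖x‖ ^ 3)) (nhdsWithin 0 (Ioi 0)) (nhds 0) := by
    simpa using (tendsto_nhdsWithin_of_tendsto_nhds (tendsto_id (α := ℝ) (x := nhds 0))).mul_const
      (b := C * ‖x‖ ^ 3)
  refine squeeze_zero' (.of_forall fun _ => norm_nonneg _) ?_ hl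
  have hs : ∀ᶠ l : ℝ in nhdsWithin 0 (Ioi 0), l * ‖x‖ < 1 := nhdsWithin_le_nhds <|
    (continuous_id.mul continuous_const).continuousAt.eventually_lt continuousAt_const (by simp)
  filter_upwards [hs, self_mem_nhdsWithin] with l h1 (h2 : 0 < l)
  have hn : ‖l • x‖ = l * ‖x‖ := by rw [norm_smul, norm_of_nonneg h2.le]
  have := h (l • x) (hn ▸ h1.le)
  rw [show qf b (l • x) = _ from qf_smul b l x, hn] at this
  have e : l⁻¹ ^ 2 * G (l • x) - qf b x = l⁻¹ ^ 2 * (G (l • x) - l ^ 2 * qf b x) := by field_simp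
  rw [norm_eq_abs, e, abs_mul, abs_of_nonneg (by positivity)]
  refine (mul_le_mul_of_nonneg_left this (by positivity)).trans (le_of_eq ?_)
  field_simp

/-- Parity action of time reversal on jets. -/
def flipL : (Ix → ℝ) →L[ℝ] (Ix → ℝ) := .pi fun c => sgn c.2 • .proj c

theorem flipL_apply (x) : flipL x = fun c => sgn c.2 * x c := rfl

theorem sgn_sq (o) : sgn o * sgn o = 1 := by rw [← abs_mul_abs_self, abs_sgn, one_mul]

theorem norm_flipL (x) : ‖flipL x‖ = ‖x‖ := by
  have h : ∀ x, ‖flipL x‖ ≤ ‖x‖ := fun x => (pi_norm_le_iff_of_nonneg (norm_nonneg x)).2 fun c => by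
    rw [flipL_apply, norm_eq_abs, abs_mul, abs_sgn, one_mul]; exact norm_le_pi_norm x c
  refine (h x).antisymm ?_
  have := h (flipL x)
  simpa only [flipL_apply, ← mul_assoc, sgn_sq, one_mul] using this

theorem trunc_flip (H : GF Ix) : H.trunc.flip = H.flip.trunc := by
  refine Subtype.ext (funext fun x => ?_)
  change smoothTransition (2 - ∑ c, (sgn c.2 * x c) ^ 2) * _ = smoothTransition _ * _
  simp only [mul_pow, pow_two (sgn _), sgn_sq, one_mul]; rfl

/-- Admissible nonlinearities. -/
structure NL (m₁ : ℝ) (H : Fin 2 → GF Ix) : Prop where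
  zero : ∀ j, H j 0 = 0
  fd : ∀ j, fderiv ℝ (H j).fn 0 = 0
  tay : ∃ b : Fin 2 → Ix → Ix → ℝ,
    (∃ C, 0 ≤ C ∧ ∀ j x, ‖x‖ ≤ 1 → |(H j).trunc x - qf (b j) x| ≤ C * ‖x‖ ^ 3) ∧
    ∃ c > 0, ∀ ω : Fin 3 → ℝ, ω 0 ^ 2 - ω 1 ^ 2 - ω 2 ^ 2 = 1 →
      (res m₁ (b 0) ω 1 = 0 ∧ res m₁ (b 1) ω 2 = 0) ∨
      (c ≤ (res m₁ (b 0) ω 1 * res m₁ (b 1) ω 2).re ∧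
        (res m₁ (b 0) ω 1 * res m₁ (b 1) ω 2).im = 0)

theorem NL.flip {m₁ H} (hm : 0 < m₁) (h : NL m₁ H) : NL m₁ fun j => (H j).flip where
  zero j := by
    rw [GF.flip_apply, ← h.zero j]; simp; rfl
  fd j := by
    have := ((H j).smooth.differentiable (by simp) (flipL 0)).hasFDerivAt.comp 0 flipL.hasFDerivAt
    rw [map_zero, h.fd] at this
    exact this.fderiv.trans (by simp)
  tay := by
    obtain ⟨b, ⟨C, hC, hb⟩, c, hc, hr⟩ := h.tay
    have hq : ∀ j x, qf (fun c d => sgn c.2 * sgn d.2 * b j c d) x = qf (b j) (flipL x) :=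
      fun j x => sum_congr rfl fun c _ => sum_congr rfl fun d _ => by
        rw [flipL_apply]; ring
    have hres : ∀ (j) (i : ℤ) ω, res m₁ (fun c d => sgn c.2 * sgn d.2 * b j c d) ω i =
        res m₁ (b j) (fun a => sgn (some a) * ω a) i := fun j i ω => by
      rw [← phi_eq_res hm, ← phi_eq_res hm]
      have : ∀ v v', flipL (prof ω v v') = prof (fun a => sgn (some a) * ω a) v v' := fun v v' => by
        funext ⟨k, o⟩
        rcases o with _ | a
        · simp [flipL_apply, sgn, prof]
        · simp [flipL_apply, prof, mul_assoc]
      grind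
    refine ⟨fun j c d => sgn c.2 * sgn d.2 * b j c d, ⟨C, hC, fun j x hx => ?_⟩, c, hc, fun ω hω => ?_⟩
    · rw [← trunc_flip, hq, ← norm_flipL x]
      exact hb j (flipL x) (by rwa [norm_flipL])
    · simp only [hres]
      exact hr _ (by simpa [sgn] using hω)

theorem NL.trunc {m₁ H} (h : NL m₁ H) (j) : (H j).trunc.Quad := by
  have e := (H j).trunc_eventuallyEq
  refine ⟨e.eq_of_nhds.trans (h.zero j), fun c => ?_⟩
  change fderiv ℝ (H j).trunc.fn 0 _ = 0
  rw [e.fderiv_eq, h.fd]; rfl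

/-- Translation. -/
def sh (a : Pt) (f : SF) : SF := .mk (fun p => f (p + a)) (f.smooth.comp (by fun_prop))

theorem dir_sh (w a f) : dir w (sh a f) = sh a (dir w f) := by
  ext p
  change fderiv ℝ (fun p => f (p + a)) p w = fderiv ℝ f (p + a) w
  rw [fderiv_comp_add_right]

theorem word_sh (a f) (J : List (Fin 3)) : word dd J (sh a f) = sh a (word dd J f) := by
  induction J with
  | nil => rfl
  | cons i J ih =>
    obtain ⟨w, hw⟩ := dd_eq i
    rw [word_cons, ih, hw, dir_sh, ← hw]; rfl

theorem dir_congr {f g : SF} {L : ℝ} (h : ∀ p : Pt, L < p.1 → f p = g p) (w : Pt) {p : Pt}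
    (hp : L < p.1) : dir w f p = dir w g p := by
  refine congrFun (congrArg DFunLike.coe (EventuallyEq.fderiv_eq ?_)) w
  filter_upwards [continuousAt_const.eventually_lt continuousAt_fst hp] with q hq using h q hq

theorem hk_congr {f g : SF} {L : ℝ} (h : ∀ p : Pt, L < p.1 → f p = g p) (k : ℕ) {p : Pt}
    (hp : L < p.1) : hk Z k f p = hk Z k g p := by
  refine sum_congr rfl fun I _ => congrArg _ ?_
  have := word_ne_zero (f := f - g) (isClosed_le continuous_fst continuous_const)
    (fun p hp => not_lt.1 fun hL => hp (sub_eq_zero.2 (h p hL))) I p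
  rw [map_sub] at this
  exact sub_eq_zero.1 (not_not.1 fun h0 => (this h0).not_gt hp)

theorem one_lt_hy {L : ℝ} (hL : 0 ≤ L) (z : ℝ × ℝ) : L + 1 ≤ hy (log (L + 1), z) :=
  (exp_log (by linarith)).ge.trans (exp_le_hy (log (L + 1), z))

theorem hk_data_le {L : ℝ} (hL : 0 ≤ L) (k : ℕ) : ∃ C, 0 ≤ C ∧ ∀ (f g : SF) (M : ℝ), CS f →
    (∀ p : Pt, L < p.1 → f p = g (p + (-L, 0, 0))) →
    (∀ p J, |p.1| ≤ ((L + 1) ^ 2 + 1) / 2 → J.length ≤ k → |word dd J g p| ≤ M) → ∀ z,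
    hk Z k f (hp (log (L + 1), z)) ≤ C * M ∧ (hk Z k f (hp (log (L + 1), z)) ≠ 0 →
      ‖hp (log (L + 1), z)‖ ≤ ((L + 1) ^ 2 + 1) / 2) := by
  obtain ⟨C, hC, h⟩ := hk_Z_le_flat (Metric.closedBall 0 (((L + 1) ^ 2 + 1) / 2))
    (isCompact_closedBall _ _) k
  refine ⟨C * (words (Fin 3) k).card, by positivity, fun f g M hf hfg hM z => ?_⟩
  have hy1 := one_lt_hy hL z
  have key : hk Z k f (hp (log (L + 1), z)) ≠ 0 →
      ‖hp (log (L + 1), z)‖ ≤ ((L + 1) ^ 2 + 1) / 2 := fun h0 => by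
    obtain ⟨h1, h2⟩ := CS_hk hf k _ h0
    have h3 := cone_bounds h1 h2 (s := (L + 1) ^ 2) (by
      refine (hy_sq' (log (L + 1), z)).trans ?_
      simp only [two_mul, exp_add, exp_log (by linarith : 0 < L + 1), hp]; ring)
    have h4 : ∀ x : ℝ, x ^ 2 ≤ ((hp (log (L + 1), z)).1 - 1) ^ 2 → |x| ≤ ((L + 1) ^ 2 + 1) / 2 :=
      fun x hx => (abs_le_of_sq_le_sq hx (by linarith)).trans (by linarith)
    exact norm_prod_le_iff.2 ⟨abs_le.2 ⟨by linarith, h3⟩, norm_prod_le_iff.2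
      ⟨h4 _ (by nlinarith),
      h4 _ (by nlinarith)⟩⟩
  refine ⟨?_, key⟩
  have hM0 : 0 ≤ M := (abs_nonneg _).trans (hM 0 [] (by simp; positivity) (by simp))
  by_cases h0 : hk Z k f (hp (log (L + 1), z)) = 0
  · rw [h0]; positivity
  have hn := key h0
  rw [hk_congr (L := L) (g := sh (-L, 0, 0) g) hfg k (by change L < hy _; linarith)]
  refine (h _ _ (mem_closedBall_zero_iff.2 hn)).trans ?_
  rw [mul_assoc]
  gcongr
  refine (sum_le_card_nsmul _ _ M fun J hJ => ?_).trans (by simp)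
  rw [word_sh]
  refine hM _ J ?_ (mem_words.1 hJ)
  have h5 := (norm_fst_le _).trans hn
  have h6 : (hp (log (L + 1), z)).1 = hy (log (L + 1), z) := rfl
  rw [norm_eq_abs, abs_le] at h5
  rw [Prod.fst_add, abs_le]
  grind

theorem En_data_le (m : Fin 2 → ℝ) (k : ℕ) (τ : ℝ) : ∃ C, 0 ≤ C ∧ ∀ (w : Fin 2 → SF) (M s : ℝ), 0 ≤ s →
    (∀ j z, hk Z (k + 1) (w j) (hp (s, z)) ≤ M ∧
      (hk Z (k + 1) (w j) (hp (s, z)) ≠ 0 → ‖hp (s, z)‖ ≤ τ)) → En m w k s ≤ C * M ^ 2 := by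
  refine ⟨∑ j, ∑ I ∈ words (Fin 5) k, (3 + m j ^ 2) * volume.real (Metric.closedBall (0 : ℝ × ℝ) τ),
    by positivity, fun w M s hs h => ?_⟩
  simp only [En, sum_mul]
  refine sum_le_sum fun j _ => sum_le_sum fun I hI => ?_
  have hd : ∀ z, hdens (m j) (word Z I (w j)) (s, z) ≤
      (3 + m j ^ 2) * hk Z (k + 1) (w j) (hp (s, z)) ^ 2 := fun z => by
    have hl : I.length ≤ k := mem_words.1 hI
    have h0 : ∀ i : Fin 5, |Z i (word Z I (w j)) (hp (s, z))| ≤ hk Z (k + 1) (w j) (hp (s, z)) :=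
      fun i => le_hk Z (J := i :: I) (by grind) (w j) _
    have h1 := le_hk Z (hl.trans k.le_succ) (w j) (hp (s, z))
    have ht : |tinv (s, z)| ≤ 1 := by
      rw [tinv_apply, abs_of_pos (inv_pos.2 (hy_pos _))]
      exact inv_le_one_of_one_le₀ ((one_le_exp hs).trans (exp_le_hy (s, z)))
    have hr : |rho (s, z)| ≤ 1 := by rw [abs_of_nonneg (rho_nonneg _)]; exact rho_le_one _
    have hsq : ∀ {a x B : ℝ}, |a| ≤ 1 → |x| ≤ B → (a * x) ^ 2 ≤ B ^ 2 := fun {a x B} ha hx => by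
      rw [← sq_abs, abs_mul]
      exact pow_le_pow_left₀ (by positivity)
        ((mul_le_of_le_one_left (abs_nonneg _) ha).trans hx) 2
    rw [hdens_apply]
    have e1 := hsq ht (h0 3)
    have e2 := hsq ht (h0 4)
    have e3 := hsq hr (h0 0)
    have e4 := mul_le_mul_of_nonneg_left (sq_le_sq' (abs_le.1 h1).1 (abs_le.1 h1).2) (sq_nonneg (m j))
    linarith! [e1, e2, e3, e4]
  have hi : ∫ z, (Metric.closedBall (0 : ℝ × ℝ) τ).indicator (fun _ => (3 + m j ^ 2) * M ^ 2) z =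
      (3 + m j ^ 2) * volume.real (Metric.closedBall (0 : ℝ × ℝ) τ) * M ^ 2 := by
    rw [integral_indicator_const _ measurableSet_closedBall, smul_eq_mul]; ring
  rw [← hi]
  refine integral_mono_of_nonneg (.of_forall fun z => hdens_nonneg _ _ _)
    ((integrable_indicator_iff measurableSet_closedBall).2
      (integrableOn_const measure_closedBall_lt_top.ne)) (.of_forall fun z => (hd z).trans ?_)
  by_cases h0 : hk Z (k + 1) (w j) (hp (s, z)) = 0
  · rw [h0]; simp; exact indicator_nonneg (fun _ _ => by positivity) _
  rw [indicator_of_mem (mem_closedBall_zero_iff.2 ((norm_snd_le (hp (s, z))).trans ((h j z).2 h0)) :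
    z ∈ Metric.closedBall 0 τ)]
  gcongr
  exacts [hk_nonneg _ _ _ _, (h j z).1]

theorem forward {m₁ H} (hm : 0 < m₁) (h : NL m₁ H) {R : ℝ} (hR : 0 ≤ R) {q : Fin 2 → SF}
    (hq : ∀ j, SR R (q j)) : ∃ C > 0, ∃ e1 > 0, ∀ e : ℝ, 0 < e → e ≤ e1 → ∃ u : Fin 2 → SF,
      (∀ j, box (u j) + mm m₁ j ^ 2 • u j = comp (H j).trunc (UU u)) ∧
      (∀ j z, u j (0, z) = e * q j (0, z) ∧ T (u j) (0, z) = e * T (q j) (0, z)) ∧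
      (∀ j, SR R (u j)) ∧ ∀ p c, 0 ≤ p.1 → (1 + p.1) * |UU u c p| ≤ C * e := by
  obtain ⟨b, hb, c, hc, hr⟩ := h.tay
  have hB := fun j => (H j).trunc_bdd
  obtain ⟨C0, hE⟩ := flat_existence (m := mm m₁) (fun j => (h.trunc j).1) hB hq
  set L := R + 3 with hL
  have hL0 : 0 ≤ L := by positivity
  have hs0 : 0 ≤ log (L + 1) := log_nonneg (by linarith)
  obtain ⟨C1, hC1, K1, hK1, hD⟩ := hyperboloidal_decay hm hB h.trunc b hb hc hr hs0
  obtain ⟨C2, hC2, h2⟩ := hk_data_le hL0 31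
  set τ := ((L + 1) ^ 2 + 1) / 2 with hτ
  obtain ⟨C3, hC3, h3⟩ := En_data_le (mm m₁) 30 τ
  obtain ⟨C4, hC4, h4⟩ : ∃ C, 0 ≤ C ∧ C0 τ 32 ≤ C := ⟨|C0 τ 32|, abs_nonneg _, le_abs_self _⟩
  have hτ0 : 0 ≤ τ := by positivity
  have k1 : 0 ≤ √C3 * (C2 * C4) := by positivity
  have k2 : 0 ≤ τ * (8 * (C2 * C4)) := by positivity
  obtain ⟨K, hK, hK2, hK3⟩ : ∃ K > 0, √C3 * (C2 * C4) ≤ K ∧ τ * (8 * (C2 * C4)) ≤ K :=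
    ⟨√C3 * (C2 * C4) + τ * (8 * (C2 * C4)) + 1, by linarith, by linarith, by linarith⟩
  refine ⟨C1 * K + (1 + τ) * C4, by positivity, min 1 (K1 / K), by positivity, fun e he he1 => ?_⟩
  obtain ⟨u, hu, hd, hS, hw⟩ := hE e he (he1.trans (min_le_left _ _))
  refine ⟨u, hu, hd, hS, ?_⟩
  set χ : SF := .mk (fun p => smoothTransition (p.1 - L + 1))
    (smoothTransition.contDiff.comp (by fun_prop))
  set w : Fin 2 → SF := fun j => χ * sh (-L, 0, 0) (u j) with hw_def
  have ew : ∀ j (p : Pt), L < p.1 → w j p = sh (-L, 0, 0) (u j) p := fun j p hp => by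
    change smoothTransition (p.1 - L + 1) * _ = _
    rw [smoothTransition.one_of_one_le (by linarith)]
    exact one_mul _
  have eU : ∀ c (p : Pt), L < p.1 → UU w c p = UU u c (p + (-L, 0, 0)) := fun ⟨j, o⟩ p hp => by
    rcases o with _ | a
    · exact ew j p hp
    · obtain ⟨v, hv⟩ := dd_eq a
      change dd a (w j) p = dd a (u j) _
      rw [hv, dir_congr (ew j) v hp, dir_sh]; rfl
  have eB : ∀ j (p : Pt), L < p.1 → box (w j) p = box (u j) (p + (-L, 0, 0)) := fun j p hp => by
    have : ∀ v, dir v (dir v (w j)) p = dir v (dir v (u j)) (p + (-L, 0, 0)) := fun v => by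
      rw [dir_congr (fun p hp => dir_congr (ew j) v hp) v hp, dir_sh, dir_sh]; rfl
    simp only [box, SF.sub_apply, T, X, Y, this]
  have hcs : ∀ j, CS (w j) := fun j p hp => by
    have hp1 : L - 1 < p.1 := by
      by_contra! hle
      exact hp (by change smoothTransition (p.1 - L + 1) * _ = 0
                   rw [smoothTransition.zero_of_nonpos (by linarith), zero_mul])
    have hp2 : u j (p + (-L, 0, 0)) ≠ 0 := right_ne_zero_of_mul hp
    refine ⟨by linarith, ?_⟩
    by_contra! hlt
    refine hp2 ?_
    have hr0 := sqrt_nonneg (p.2.1 ^ 2 + p.2.2 ^ 2)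
    have hrs := sq_sqrt (by positivity : 0 ≤ p.2.1 ^ 2 + p.2.2 ^ 2)
    have hrl : p.1 - 1 < √(p.2.1 ^ 2 + p.2.2 ^ 2) := by nlinarith
    set r := √(p.2.1 ^ 2 + p.2.2 ^ 2)
    have hr1 : 0 < r := by linarith
    refine hS j _ (p.2.1 / r) (p.2.2 / r) (by rw [div_pow, div_pow, ← add_div, hrs, div_self]; rw [← hrs]; positivity) ?_
    have e1 : p.2.1 / r * p.2.1 + p.2.2 / r * p.2.2 = r := by grind
    have e2 : |p.1 + -L| ≤ p.1 - 1 - R := abs_le.2 ⟨by linarith, by linarith⟩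
    simp
    linarith
  have hsol : Sol (mm m₁) (fun j => (H j).trunc) (log (L + 1)) w := ⟨hcs, fun j p hp => by
    rw [exp_log (by linarith), add_sub_cancel_right] at hp
    have := congrArg (fun f : SF => f (p + (-L, 0, 0))) (hu j)
    simp at this ⊢
    rw [eB j p hp, ew j p hp, show (fun c => UU w c p) = _ from funext fun c => eU c p hp]
    exact this⟩
  have hflat : ∀ c (p : Pt) J, |p.1| ≤ τ → J.length ≤ 31 → |word dd J (UU u c) p| ≤ C4 * e :=
    fun ⟨j, o⟩ p J hp hJ => by
      refine le_trans ?_ (mul_le_mul_of_nonneg_right h4 he.le)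
      rcases o with _ | a
      · exact hw τ 32 j J p hp (by omega)
      · rw [show UU u (j, some a) = word dd [a] (u j) from rfl, ← word_append]
        grind
  have hKe : K * e ≤ K1 := by
    rw [mul_comm, ← le_div_iff₀ hK]; exact he1.trans (min_le_right _ _)
  have hdata := fun c => h2 (UU w c) (UU u c) (C4 * e) (hsol.csU c) (eU c) (hflat c)
  have hdec := hD (by positivity) hKe hsol ?_ ?_
  · intro p c hp
    by_cases hpt : p.1 ≤ τ
    · have := hflat c p [] (by rwa [abs_of_nonneg hp]) (by simp)
      rw [word_nil] at this
      have := mul_le_mul (by linarith : 1 + p.1 ≤ 1 + τ) this (abs_nonneg _) (by linarith)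
      have : 0 ≤ C1 * K * e := by positivity
      linarith
    set p' : Pt := p + (L, 0, 0) with hp'
    have hpe : p' + (-L, 0, 0) = p := by ext <;> simp [p']
    have hp1 : p'.1 = p.1 + L := rfl
    rw [← hpe, ← eU c p' (by linarith), hpe]
    by_cases h0 : UU w c p' = 0
    · rw [h0, abs_zero, mul_zero]; positivity
    obtain ⟨-, h7⟩ := hsol.csU c p' h0
    have hD0 : (L + 1) ^ 2 ≤ p'.1 ^ 2 - p'.2.1 ^ 2 - p'.2.2 ^ 2 := by grind
    set D := p'.1 ^ 2 - p'.2.1 ^ 2 - p'.2.2 ^ 2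
    have hDp : 0 < D := by grind
    have hyp : hy (log D / 2, p'.2) = p'.1 := by
      rw [← sq_eq_sq₀ (hy_pos _).le (by linarith), hy_sq', mul_div_cancel₀ _ two_ne_zero, exp_log hDp]
      ring
    have h8 := hdec (log D / 2, p'.2) (by
      have := log_le_log (by positivity) hD0
      rw [log_pow] at this
      push_cast at this
      linarith)
    rw [show KG.hp (log D / 2, p'.2) = p' from Prod.ext hyp rfl, hyp] at h8
    have h9 := mul_le_mul_of_nonneg_left (le_nn Z (J := []) (k := 0) (by simp) (UU w) c p') (by linarith : 0 ≤ p'.1)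
    rw [word_nil] at h9
    have h10 := mul_le_mul_of_nonneg_right (by linarith : 1 + p.1 ≤ p'.1) (abs_nonneg (UU w c p'))
    have : 0 ≤ (1 + τ) * C4 * e := by positivity
    linarith
  · refine (h3 w _ _ hs0 fun j z => hdata (j, none) z).trans ?_
    calc _ = (√C3 * (C2 * C4) * e) ^ 2 := by rw [mul_assoc, mul_pow (√C3), sq_sqrt hC3]; ring
      _ ≤ _ := by gcongr
  · intro z a ha
    have h5 : ∀ c, hy (log (L + 1), z) * hk Z a (UU w c) (hp (log (L + 1), z)) ≤
        τ * (C2 * (C4 * e)) := fun c => by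
      obtain ⟨h6, h7⟩ := hdata c z
      have hk1 := hk_mono Z (by omega : a ≤ 31) (UU w c) (KG.hp (log (L + 1), z))
      have hk0 := hk_nonneg Z a (UU w c) (KG.hp (log (L + 1), z))
      have hn : hy (log (L + 1), z) ≤ ‖KG.hp (log (L + 1), z)‖ := (le_abs_self _).trans (norm_fst_le (KG.hp (log (L + 1), z)))
      generalize hk Z 31 (UU w c) (KG.hp (log (L + 1), z)) = x at *
      generalize hk Z a (UU w c) (KG.hp (log (L + 1), z)) = y at *
      by_cases h0 : x = 0
      · rw [le_antisymm (hk1.trans_eq h0) hk0, mul_zero]; positivity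
      · exact mul_le_mul (hn.trans (h7 h0)) (hk1.trans h6) hk0 hτ0
    refine (mul_sum _ _ _).trans_le ((sum_le_sum fun c _ => h5 c).trans ?_)
    rw [Finset.sum_const, show (Finset.univ : Finset Ix).card = 8 from rfl]
    have : τ * (8 * (C2 * C4)) * e ≤ K * e := by gcongr
    refine le_trans (le_of_eq ?_) this
    rw [nsmul_eq_mul]; push_cast; ring

theorem jet_vanish {R : ℝ} {u : Fin 2 → SF} (h : ∀ j, SR R (u j)) (c : Ix) (p : Pt)
    (hp : R + |p.1| < |p.2.1| ∨ R + |p.1| < |p.2.2|) : UU u c p = 0 := by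
  rcases hp with hp | hp <;> rcases lt_abs.1 hp with hp | hp
  · exact SR.UU h c p 1 0 (by norm_num) (by linarith)
  · exact SR.UU h c p (-1) 0 (by norm_num) (by linarith)
  · exact SR.UU h c p 0 1 (by norm_num) (by linarith)
  · exact SR.UU h c p 0 (-1) (by norm_num) (by linarith)

theorem global_small {m₁ H} (hm : 0 < m₁) (h : NL m₁ H) {R : ℝ} (hR : 0 ≤ R) {q : Fin 2 → SF}
    (hq : ∀ j, SR R (q j)) : ∃ C > 0, ∃ e1 > 0, ∀ e : ℝ, 0 < e → e ≤ e1 → ∃ u : Fin 2 → Pt → ℝ,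
      Sys (mm m₁) H u ∧
      (∀ j z, u j (0, z) = e * q j (0, z) ∧ Dd (1, 0, 0) (u j) (0, z) = e * T (q j) (0, z)) ∧
      ∀ p (c : Ix), (1 + |p.1|) * |Vo (u c.1) c.2 p| ≤ C * e ∧
        (R + |p.1| < |p.2.1| ∨ R + |p.1| < |p.2.2| → Vo (u c.1) c.2 p = 0) := by
  set q' : Fin 2 → SF := fun j => .mk (fun p => q j (rev p)) ((q j).smooth.comp rev.contDiff)
  have hq' : ∀ j, SR R (q' j) := fun j p a b hab hp => hq j (rev p) a b hab (by
    simpa [rev_apply] using hp)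
  obtain ⟨C, hC, e1, he1, hf⟩ := forward hm h hR hq
  obtain ⟨C', hC', e2, he2, hb⟩ := forward hm (h.flip hm) hR hq'
  refine ⟨C + C', by positivity, min (min e1 e2) (1 / (3 * (C + C'))), by positivity, fun e he hle => ?_⟩
  obtain ⟨⟨hl1, hl2⟩, hl3⟩ := (le_min_iff.1 hle).imp_left le_min_iff.1
  obtain ⟨u, hu, hd, hS, hw⟩ := hf e he hl1
  obtain ⟨v, hv, hvd, -, hvw⟩ := hb e he hl2
  have hVo : ∀ (u : Fin 2 → SF) (c : Ix) p, UU u c p = Vo (u c.1) c.2 p := fun u ⟨j, o⟩ p => by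
    rcases o with _ | a
    · rfl
    · fin_cases a <;> rfl
  have mk : ∀ {G : Fin 2 → GF Ix} {u : Fin 2 → SF},
      (∀ j, box (u j) + mm m₁ j ^ 2 • u j = comp (G j) (UU u)) → Sys (mm m₁) G fun j => u j := fun hu =>
    ⟨fun j => (SF.smooth _).of_le (WithTop.coe_le_coe.2 le_top), fun j p => by
      simp only [← hVo]; exact congrArg (fun f : SF => f p) (hu j)⟩
  have hus := mk hu
  have ht := hus.rev
  simp only [trunc_flip] at ht
  have hdf : ∀ f : SF, Differentiable ℝ f := fun f p => f.diff p
  have key := ht.unique (mk hv) fun j z => by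
    have hz : rev (0, z) = (0, z) := by simp [rev_apply]
    refine ⟨by rw [hz, (hd j z).1, (hvd j z).1]; change _ = e * q j (rev (0, z)); rw [hz], ?_⟩
    refine Eq.trans ?_ (hvd j z).2.symm
    change _ = e * Dd (1, 0, 0) (fun p => q j (rev p)) (0, z)
    rw [Dd_rev (hdf _), Dd_rev (hdf _), rev_e0, Dd_neg_left, Dd_neg_left, hz]
    have := (hd j z).2
    change Dd (1, 0, 0) (u j) (0, z) = e * Dd (1, 0, 0) (q j) (0, z) at this
    grind
  have bd : ∀ p (c : Ix), (1 + |p.1|) * |Vo (u c.1) c.2 p| ≤ (C + C') * e := fun p c => by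
    rcases le_total 0 p.1 with hp | hp
    · rw [abs_of_nonneg hp, ← hVo]
      have := hw p c hp
      nlinarith
    · have h1 := Vo_rev (hdf (u c.1)) c.2 (rev p)
      have h2 := hvw (rev p) c (neg_nonneg.2 hp)
      rw [hVo, ← congrFun key c.1, h1, rev_rev, abs_mul, abs_sgn, one_mul] at h2
      rw [abs_of_nonpos hp]
      have := mul_pos hC he
      exact h2.trans (by linarith)
  refine ⟨fun j => u j, ⟨hus.reg, fun j p => (hus.eqn j p).trans ((H j).trunc_eq ?_)⟩, hd, fun p c =>
    ⟨bd p c, fun hp => (hVo u c p).symm.trans (jet_vanish hS c p hp)⟩⟩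
  have h3 : ∀ c : Ix, Vo (u c.1) c.2 p ^ 2 ≤ (1 / 3) ^ 2 := fun c => by
    rw [← sq_abs]
    refine pow_le_pow_left₀ (abs_nonneg _) ?_ 2
    have h4 := bd p c
    have h5 : (C + C') * e ≤ 1 / 3 := by
      rw [le_div_iff₀ (by positivity)] at hl3; linarith
    have := mul_nonneg (abs_nonneg p.1) (abs_nonneg (Vo (u c.1) c.2 p))
    linarith
  refine (sum_le_card_nsmul _ _ _ fun c _ => h3 c).trans ?_
  norm_num

/-- A flat jet, in the form in which the nonlinearities take it. -/
def jet : (Ix → ℝ) →L[ℝ] (Fin 2 → ℝ) × (Fin 2 → Fin 3 → ℝ) :=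
  (ContinuousLinearMap.pi fun k => .proj (k, none)).prod (.pi fun k => .pi fun a => .proj (k, some a))

theorem jet_apply (x) : jet x = (fun k => x (k, none), fun k a => x (k, some a)) := rfl

theorem NL.of_phi {m₁ : ℝ} (hm : 0 < m₁) {F Q : Fin 2 → (Fin 2 → ℝ) × (Fin 2 → Fin 3 → ℝ) → ℝ}
    (hF : ∀ j, ContDiff ℝ (⊤ : ℕ∞) (F j)) (hF0 : ∀ j, F j 0 = 0) (hF1 : ∀ j, fderiv ℝ (F j) 0 = 0)
    (hQ : ∀ j : Fin 2, ∀ vw : (Fin 2 → ℝ) × (Fin 2 → Fin 3 → ℝ),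
      Tendsto (fun lam : ℝ => lam⁻¹ ^ 2 * F j (lam • vw.1, lam • vw.2))
        (nhdsWithin 0 (Ioi 0)) (nhds (Q j vw)))
    (hcond :
      (∀ ω ∈ Hyp, Phi m₁ (Q 0) 1 ω = 0 ∧ Phi m₁ (Q 1) 2 ω = 0)
      ∨ (∃ c > (0:ℝ), ∀ ω ∈ Hyp,
          c ≤ (Phi m₁ (Q 0) 1 ω * Phi m₁ (Q 1) 2 ω).re
          ∧ (Phi m₁ (Q 0) 1 ω * Phi m₁ (Q 1) 2 ω).im = 0)) :
    NL m₁ fun j => ⟨fun x => F j (jet x), (hF j).comp jet.contDiff⟩ := by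
  set H : Fin 2 → GF Ix := fun j => ⟨fun x => F j (jet x), (hF j).comp jet.contDiff⟩
  have z : ∀ j, H j 0 = 0 := fun j => (congrArg (F j) (map_zero jet)).trans (hF0 j)
  have fd : ∀ j, fderiv ℝ (H j).fn 0 = 0 := fun j => by
    change fderiv ℝ (F j ∘ jet) 0 = 0
    rw [fderiv_comp _ ((hF j).differentiable (by simp) _) jet.differentiableAt, map_zero, hF1,
      ContinuousLinearMap.zero_comp]
  have ev := fun j => (H j).trunc_eventuallyEq
  choose b C hC hb using fun j => (H j).trunc.taylor ((ev j).eq_of_nhds.trans (z j))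
    ((ev j).fderiv_eq.trans (fd j))
  refine ⟨z, fd, b, ⟨C 0 + C 1, add_nonneg (hC 0) (hC 1), fun j x hx => (hb j x hx).trans ?_⟩, ?_⟩
  · refine mul_le_mul_of_nonneg_right ?_ (by positivity)
    have := hC 0; have := hC 1
    fin_cases j <;> simpa
  have hq : ∀ j x, Q j (jet x) = qf (b j) x := fun j x => by
    refine eq_qf_of_tendsto (hb j) ((hQ j (jet x)).congr' ?_)
    have h0 : Tendsto (fun l : ℝ => l • x) (nhdsWithin 0 (Ioi 0)) (nhds 0) :=
      tendsto_nhdsWithin_of_tendsto_nhds ((by fun_prop : Continuous fun l : ℝ => l • x).tendsto' 0 0 (zero_smul ℝ x))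
    filter_upwards [h0.eventually (ev j)] with l hl
    rw [hl]; rfl
  have hφ : ∀ j (n : ℕ) ω, Phi m₁ (Q j) n ω = res m₁ (b j) ω n := fun j n ω => by
    rw [← phi_eq_res hm]
    refine intervalIntegral.integral_congr fun θ _ => ?_
    simp only [← hq, jet_apply]
    congr 3
    refine (Prod.ext rfl (funext fun k => funext fun a => ?_))
    simp only [Wprof, prof, Option.elim]; ring
  have h1 := fun ω => hφ 0 1 ω
  have h2 := fun ω => hφ 1 2 ω
  simp only [h1, h2] at hcond
  rcases hcond with h | ⟨c, hc, h⟩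
  · exact ⟨1, one_pos, fun ω hω => .inl (h ω hω)⟩
  · exact ⟨c, hc, fun ω hω => .inr (h ω hω)⟩

theorem deriv_eq_Dd {v : Pt → ℝ} (hv : Differentiable ℝ v) (t : ℝ) (x : Fin 2 → ℝ) :
    deriv (fun s => v (s, x 0, x 1)) t = Dd (1, 0, 0) v (t, x 0, x 1) :=
  ((hv _).hasFDerivAt.comp_hasDerivAt t ((hasDerivAt_id t).prodMk (hasDerivAt_const t (x 0, x 1)))).deriv

theorem pd_eq_Dd {v : Pt → ℝ} (hv : Differentiable ℝ v) (t : ℝ) (x : Fin 2 → ℝ)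
    (k : Fin 2) : pd k (fun x => v (t, x 0, x 1)) x =
    Dd (0, (Pi.single k 1 : Fin 2 → ℝ) 0, (Pi.single k 1 : Fin 2 → ℝ) 1) v (t, x 0, x 1) := by
  have h : HasFDerivAt (fun x : Fin 2 → ℝ => (t, x 0, x 1))
      ((0 : (Fin 2 → ℝ) →L[ℝ] ℝ).prod ((ContinuousLinearMap.proj 0).prod (.proj 1))) x :=
    (hasFDerivAt_const t x).prodMk ((hasFDerivAt_apply 0 x).prodMk (hasFDerivAt_apply 1 x))
  exact DFunLike.congr_fun ((hv _).hasFDerivAt.comp x h).fderiv _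

theorem exists_data {f g : (Fin 2 → ℝ) → ℝ} (hf : ContDiff ℝ (⊤ : ℕ∞) f ∧ HasCompactSupport f)
    (hg : ContDiff ℝ (⊤ : ℕ∞) g ∧ HasCompactSupport g) : ∃ R, 0 ≤ R ∧ ∃ q : SF, SR R q ∧
    ∀ z, q (0, z) = f ![z.1, z.2] ∧ T q (0, z) = g ![z.1, z.2] := by
  obtain ⟨r, hr, hfr⟩ := hf.2.exists_pos_le_norm
  obtain ⟨s, hs, hgs⟩ := hg.2.exists_pos_le_norm
  have hA : ContDiff ℝ (⊤ : ℕ∞) fun p : Pt => ![p.2.1, p.2.2] := contDiff_pi.2 fun i => by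
    fin_cases i <;> simp <;> fun_prop
  refine ⟨2 * max r s, by positivity, .mk (fun p => f ![p.2.1, p.2.2] + p.1 * g ![p.2.1, p.2.2])
    ((hf.1.comp hA).add (contDiff_fst.mul (hg.1.comp hA))), fun p a b hab hp => ?_, fun z => ⟨?_, ?_⟩⟩
  · have h : max r s ≤ ‖![p.2.1, p.2.2]‖ := by
      have h1 := norm_le_pi_norm ![p.2.1, p.2.2] 0
      have h2 := norm_le_pi_norm ![p.2.1, p.2.2] 1
      set n := ‖![p.2.1, p.2.2]‖
      have ha : |a| ≤ 1 := abs_le_one_iff_mul_self_le_one.2 (by nlinarith)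
      have hb : |b| ≤ 1 := abs_le_one_iff_mul_self_le_one.2 (by nlinarith)
      have e1 := (le_abs_self _).trans ((abs_mul a p.2.1).trans_le (mul_le_mul ha h1 (abs_nonneg _) one_pos.le))
      have e2 := (le_abs_self _).trans ((abs_mul b p.2.2).trans_le (mul_le_mul hb h2 (abs_nonneg _) one_pos.le))
      grind
    change f _ + p.1 * g _ = 0
    grind
  · simp
  · refine (deriv_eq_Dd (fun p => SF.diff _ p) 0 ![z.1, z.2]).symm.trans ?_
    simp

theorem pd_zero_eq_Dd {v : Pt → ℝ} (hv : Differentiable ℝ v) (t : ℝ) (x : Fin 2 → ℝ) :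
    pd 0 (fun x => v (t, x 0, x 1)) x = Dd (0, 1, 0) v (t, x 0, x 1) := by simpa using pd_eq_Dd hv t x 0

theorem pd_one_eq_Dd {v : Pt → ℝ} (hv : Differentiable ℝ v) (t : ℝ) (x : Fin 2 → ℝ) :
    pd 1 (fun x => v (t, x 0, x 1)) x = Dd (0, 0, 1) v (t, x 0, x 1) := by simpa using pd_eq_Dd hv t x 1

theorem isSolution_iff {m₁ ε : ℝ} {F : Fin 2 → (Fin 2 → ℝ) × (Fin 2 → Fin 3 → ℝ) → ℝ}
    (hF : ∀ j, ContDiff ℝ (⊤ : ℕ∞) (F j)) {f g : Fin 2 → (Fin 2 → ℝ) → ℝ} {v : Fin 2 → Pt → ℝ} :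
    IsSolution m₁ ε F f g (fun j t x => v j (t, x 0, x 1)) ↔
      Sys (mm m₁) (fun j => ⟨fun x => F j (jet x), (hF j).comp jet.contDiff⟩) v ∧
      ∀ j z, v j (0, z) = ε * f j ![z.1, z.2] ∧ Dd (1, 0, 0) (v j) (0, z) = ε * g j ![z.1, z.2] := by
  have hreg : (∀ j, ContDiff ℝ 2 fun p : ℝ × (Fin 2 → ℝ) => v j (p.1, p.2 0, p.2 1)) ↔
      ∀ j, ContDiff ℝ 2 (v j) := by
    refine forall_congr' fun j => ⟨fun h => ?_, fun h => h.comp (by fun_prop)⟩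
    have hA : ContDiff ℝ 2 fun p : Pt => (p.1, ![p.2.1, p.2.2]) :=
      contDiff_fst.prodMk (contDiff_pi.2 fun i => by fin_cases i <;> simp <;> fun_prop)
    exact h.comp hA
  have hx : ∀ x : Fin 2 → ℝ, ![x 0, x 1] = x := fun x => by ext i; fin_cases i <;> rfl
  by_cases hv : ∀ j, ContDiff ℝ 2 (v j)
  swap
  · exact iff_of_false (fun h => hv (hreg.1 h.1)) fun h => hv h.1.reg
  have hd := fun j => (hv j).differentiable (by simp)
  have hdd := fun j w => (contDiff_Dd (hv j) w).differentiable (by simp)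
  have e : ∀ j t (x : Fin 2 → ℝ), (iteratedDeriv 2 (fun s => v j (s, x 0, x 1)) t
      - (pd 0 (pd 0 fun x => v j (t, x 0, x 1)) x + pd 1 (pd 1 fun x => v j (t, x 0, x 1)) x)) =
      Bx (v j) (t, x 0, x 1) := fun j t x => by
    rw [iteratedDeriv_succ, iteratedDeriv_one, funext fun s => deriv_eq_Dd (hd j) s x,
      deriv_eq_Dd (hdd j _), funext fun y => pd_zero_eq_Dd (hd j) t y, funext fun y => pd_one_eq_Dd (hd j) t y,
      pd_zero_eq_Dd (hdd j _), pd_one_eq_Dd (hdd j _), Bx]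
    ring
  have eF : ∀ t (x : Fin 2 → ℝ), ((fun k => v k (t, x 0, x 1), fun k a =>
      if a = 0 then deriv (fun s => v k (s, x 0, x 1)) t
      else if a = 1 then pd 0 (fun x => v k (t, x 0, x 1)) x
      else pd 1 (fun x => v k (t, x 0, x 1)) x) : (Fin 2 → ℝ) × (Fin 2 → Fin 3 → ℝ)) =
      jet fun c => Vo (v c.1) c.2 (t, x 0, x 1) := fun t x => by
    refine Prod.ext rfl (funext fun k => funext fun a => ?_)
    dsimp only
    rw [deriv_eq_Dd (hd k), pd_zero_eq_Dd (hd k), pd_one_eq_Dd (hd k)]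
    fin_cases a <;> rfl
  refine ⟨fun ⟨_, h1, h2⟩ => ⟨⟨hv, fun j p => ?_⟩, fun j z => ?_⟩, fun ⟨h1, h2⟩ => ⟨hreg.2 hv, fun j t x => ?_, fun j x => ?_⟩⟩
  · have := h1 j p.1 ![p.2.1, p.2.2]
    rw [e, eF] at this
    exact this
  · have := h2 j ![z.1, z.2]
    rw [deriv_eq_Dd (hd j)] at this
    exact this
  · rw [e, eF]; exact h1.eqn j _
  · have := h2 j (x 0, x 1)
    rw [hx] at this
    rwa [deriv_eq_Dd (hd j)]

theorem eLpNorm_le_of_bound {h : (Fin 2 → ℝ) → ℝ} {A R t : ℝ} (hA : 0 ≤ A) (hR : 0 ≤ R)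
    (h1 : ∀ x, (1 + |t|) * |h x| ≤ A) (h2 : ∀ x, R + |t| < |x 0| ∨ R + |t| < |x 1| → h x = 0)
    {p : ℝ≥0∞} (hp : 2 ≤ p) :
    eLpNorm h p volume ≤ ENNReal.ofReal ((2 * R + 2) * A * (1 + |t|) ^ (-(1 - 2 / p.toReal))) := by
  have ht : 0 < 1 + |t| := by positivity
  set a := 2 / p.toReal with ha
  have ha0 : 0 ≤ a := by positivity
  have ha1 : a ≤ 1 := by
    rcases eq_or_ne p ⊤ with rfl | hpt
    · simp [ha]
    · have := ENNReal.toReal_mono hpt hp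
      rw [ENNReal.toReal_ofNat] at this
      exact (div_le_one (by linarith)).2 this
  have hB : 0 ≤ R + |t| := by positivity
  refine (eLpNorm_mono (g := (Metric.closedBall 0 (R + |t|)).indicator fun _ => A / (1 + |t|))
    fun x => ?_).trans ((eLpNorm_indicator_const_le _ _).trans ?_)
  · by_cases hx : x ∈ Metric.closedBall 0 (R + |t|)
    · rw [indicator_of_mem hx, Real.norm_eq_abs, Real.norm_of_nonneg (by positivity), le_div_iff₀' ht]
      exact h1 x
    · rw [h2 x, norm_zero]
      · positivity
      by_contra! hc
      refine hx (mem_closedBall_zero_iff.2 ((pi_norm_le_iff_of_nonneg hB).2 fun i => ?_))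
      fin_cases i
      exacts [hc.1, hc.2]
  rw [Real.volume_pi_closedBall _ hB, Fintype.card_fin, ENNReal.ofReal_rpow_of_nonneg (by positivity) (by positivity),
    Real.enorm_of_nonneg (by positivity), ← ENNReal.ofReal_mul (by positivity)]
  refine ENNReal.ofReal_le_ofReal ?_
  have h3 : ((2 * (R + |t|)) ^ 2) ^ (1 / p.toReal) ≤ (2 * R + 2) * (1 + |t|) ^ a := by
    rw [← Real.rpow_natCast, ← Real.rpow_mul (by positivity), show ((2 : ℕ) : ℝ) * (1 / p.toReal) = a by
      rw [ha]; push_cast; ring]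
    refine (Real.rpow_le_rpow (by positivity) (?_ : _ ≤ (2 * R + 2) * (1 + |t|)) ha0).trans ?_
    · nlinarith [mul_nonneg hR (abs_nonneg t)]
    · rw [Real.mul_rpow (by positivity) ht.le]
      gcongr
      exact Real.rpow_le_self_of_one_le (by linarith) ha1
  refine (mul_le_mul_of_nonneg_left h3 (by positivity)).trans (le_of_eq ?_)
  rw [neg_sub, Real.rpow_sub_one ht.ne']
  ring

end KG

/-- global existence, uniqueness and `L^p` time-decay of small solutions of
two-dimensional quadratic Klein–Gordon systems with mass resonance `m₂ = 2m₁`, under the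
structural condition (a) or (b) on `Φ₁, Φ₂`. -/
theorem global_existence_and_decay (m₁ : ℝ) (hm₁ : 0 < m₁)
    (F Q : Fin 2 → (Fin 2 → ℝ) × (Fin 2 → Fin 3 → ℝ) → ℝ)
    (hFsmooth : ∀ j, ContDiff ℝ (⊤ : ℕ∞) (F j))
    (hF0 : ∀ j, F j 0 = 0)
    (hF1 : ∀ j, fderiv ℝ (F j) 0 = 0)
    (hQ : ∀ j : Fin 2, ∀ vw : (Fin 2 → ℝ) × (Fin 2 → Fin 3 → ℝ),
      Tendsto (fun lam : ℝ => lam⁻¹ ^ 2 * F j (lam • vw.1, lam • vw.2))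
        (nhdsWithin 0 (Ioi 0)) (nhds (Q j vw)))
    (hcond :
      (∀ ω ∈ Hyp, Phi m₁ (Q 0) 1 ω = 0 ∧ Phi m₁ (Q 1) 2 ω = 0)
      ∨ (∃ c > (0:ℝ), ∀ ω ∈ Hyp,
          c ≤ (Phi m₁ (Q 0) 1 ω * Phi m₁ (Q 1) 2 ω).re
          ∧ (Phi m₁ (Q 0) 1 ω * Phi m₁ (Q 1) 2 ω).im = 0))
    (f g : Fin 2 → (Fin 2 → ℝ) → ℝ)
    (hf : ∀ j, ContDiff ℝ (⊤ : ℕ∞) (f j) ∧ HasCompactSupport (f j))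
    (hg : ∀ j, ContDiff ℝ (⊤ : ℕ∞) (g j) ∧ HasCompactSupport (g j)) :
    ∃ ε₀ > (0:ℝ), ∃ C > (0:ℝ), ∀ ε : ℝ, 0 < ε → ε ≤ ε₀ →
      (∃! u : Fin 2 → ℝ → (Fin 2 → ℝ) → ℝ, IsSolution m₁ ε F f g u)
      ∧ ∀ u : Fin 2 → ℝ → (Fin 2 → ℝ) → ℝ, IsSolution m₁ ε F f g u →
          ∀ p : ℝ≥0∞, 2 ≤ p → ∀ t : ℝ,
            (∑ j : Fin 2,
              (eLpNorm (fun x => u j t x) p volume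
                + eLpNorm (fun x => deriv (fun s => u j s x) t) p volume
                + eLpNorm (fun x => pd 0 (u j t) x) p volume
                + eLpNorm (fun x => pd 1 (u j t) x) p volume))
              ≤ ENNReal.ofReal (C * ε * (1 + |t|) ^ (-(1 - 2 / p.toReal))) := by
  choose R hR q hq hqd using fun j => KG.exists_data (hf j) (hg j)
  have hq' : ∀ j, KG.SR (∑ i, R i) (q j) := fun j p a b hab hp => hq j p a b hab
    (lt_of_le_of_lt (by gcongr; exact Finset.single_le_sum (fun i _ => hR i) (Finset.mem_univ j)) hp)
  have hR' : 0 ≤ ∑ i, R i := Finset.sum_nonneg fun i _ => hR i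
  obtain ⟨C, hC, e1, he1, h⟩ := KG.global_small hm₁ (.of_phi hm₁ hFsmooth hF0 hF1 hQ hcond) hR' hq'
  set M := (2 * ∑ i, R i) + 2 with hM
  refine ⟨e1, he1, 8 * M * C, by positivity, fun ε hε hεe => ?_⟩
  obtain ⟨v, hv, hd, hb⟩ := h ε hε hεe
  simp only [hqd] at hd
  have hu : ∀ u, IsSolution m₁ ε F f g u ↔ u = fun j t x => v j (t, x 0, x 1) := fun u => by
    refine ⟨fun hu => ?_, fun e => e ▸ (KG.isSolution_iff hFsmooth).2 ⟨hv, hd⟩⟩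
    set w : Fin 2 → KG.Pt → ℝ := fun j p => u j p.1 ![p.2.1, p.2.2] with hw
    have eu : u = fun j t x => w j (t, x 0, x 1) := by
      ext j t x
      exact congrArg (u j t) (by ext i; fin_cases i <;> rfl)
    rw [eu, KG.isSolution_iff hFsmooth] at hu
    rw [eu, hu.1.unique hv fun j z => ⟨(hu.2 j z).1.trans (hd j z).1.symm, (hu.2 j z).2.trans (hd j z).2.symm⟩]
  refine ⟨⟨_, (hu _).2 rfl, fun u h => (hu u).1 h⟩, fun u h p hp t => ?_⟩
  rw [(hu u).1 h]
  have hdf := fun j => (hv.reg j).differentiable (by simp)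
  have key : ∀ j o, eLpNorm (fun x : Fin 2 → ℝ => KG.Vo (v j) o (t, x 0, x 1)) p volume ≤
      ENNReal.ofReal (M * (C * ε) * (1 + |t|) ^ (-(1 - 2 / p.toReal))) := fun j o =>
    KG.eLpNorm_le_of_bound (by positivity) hR' (fun x => (hb (t, x 0, x 1) (j, o)).1)
      (fun x => (hb (t, x 0, x 1) (j, o)).2) hp
  have e0 : ∀ j (x : Fin 2 → ℝ), deriv (fun s => v j (s, x 0, x 1)) t = KG.Vo (v j) (some 0) (t, x 0, x 1) :=
    fun j x => KG.deriv_eq_Dd (hdf j) t x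
  have e1 : ∀ j x, pd 0 (fun x => v j (t, x 0, x 1)) x = KG.Vo (v j) (some 1) (t, x 0, x 1) := fun j x =>
    KG.pd_zero_eq_Dd (hdf j) t x
  have e2 : ∀ j x, pd 1 (fun x => v j (t, x 0, x 1)) x = KG.Vo (v j) (some 2) (t, x 0, x 1) := fun j x =>
    KG.pd_one_eq_Dd (hdf j) t x
  simp only [e0, e1, e2]
  refine (Finset.sum_le_sum fun j _ => add_le_add (add_le_add (add_le_add (key j none) (key j _))
    (key j _)) (key j _)).trans (le_of_eq ?_)
  set X := M * (C * ε) * (1 + |t|) ^ (-(1 - 2 / p.toReal)) with hX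
  have hX0 : 0 ≤ X := by positivity
  rw [show 8 * M * C * ε * (1 + |t|) ^ (-(1 - 2 / p.toReal)) = (X + X + X + X) + (X + X + X + X) by
    rw [hX]; ring]
  simp only [Fin.sum_univ_two]
  repeat rw [ENNReal.ofReal_add (by positivity) (by positivity)]

end
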